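/- Let ω : ℝ → ℝ be any function with 1 ≤ ω(X) ≤ X for all X and ω(X) → ∞ as X → ∞. Then limsup_{x→∞} | E^{log}_{x/ω(x) ≤ n ≤ x} λ(n+1) λ(n+2) λ(n+4) λ(n+5) | < 1. -/

import Mathlib

open Filter
open scoped Classical

/-- `Ω(n)`, the number of prime factors of `n` counted with multiplicity. -/
def bigOmega (n : ℕ) : ℕ := n.primeFactorsList.length

/-- The Liouville function `λ(n) = (-1)^{Ω(n)}`. -/
def liouville (n : ℕ) : ℤ := (-1) ^ bigOmega n

/-- Logarithmic average of `f` over the finite set `s ⊆ ℕ`. -/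
noncomputable def logAvg (s : Finset ℕ) (f : ℕ → ℝ) : ℝ :=
  (∑ n ∈ s, f n / (n : ℝ)) / (∑ n ∈ s, (1 : ℝ) / (n : ℝ))

/-! ### Basic facts -/

lemma bigOmega_mul {a b : ℕ} (ha : a ≠ 0) (hb : b ≠ 0) :
    bigOmega (a * b) = bigOmega a + bigOmega b := by
  unfold bigOmega
  rw [(Nat.perm_primeFactorsList_mul ha hb).length_eq, List.length_append]

lemma liouville_mul {a b : ℕ} (ha : a ≠ 0) (hb : b ≠ 0) :
    liouville (a * b) = liouville a * liouville b := by
  unfold liouville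
  rw [bigOmega_mul ha hb, pow_add]

lemma liouville_prime {p : ℕ} (hp : p.Prime) : liouville p = -1 := by
  unfold liouville bigOmega
  rw [Nat.primeFactorsList_prime hp]; simp

lemma liouville_eq (n : ℕ) : liouville n = 1 ∨ liouville n = -1 :=
  neg_one_pow_eq_or ℤ _

lemma liouville_sq (n : ℕ) : liouville n * liouville n = 1 := by
  rcases liouville_eq n with h | h <;> simp [h]

/-- real valued Liouville function -/
noncomputable def lam (n : ℕ) : ℝ := (liouville n : ℝ)

lemma lam_mul {a b : ℕ} (ha : a ≠ 0) (hb : b ≠ 0) : lam (a * b) = lam a * lam b := by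
  unfold lam; rw [liouville_mul ha hb]; push_cast; rfl

lemma lam_prime {p : ℕ} (hp : p.Prime) : lam p = -1 := by
  unfold lam; rw [liouville_prime hp]; simp

lemma lam_eq (n : ℕ) : lam n = 1 ∨ lam n = -1 := by
  unfold lam; rcases liouville_eq n with h | h <;> simp [h]

lemma lam_sq (n : ℕ) : lam n * lam n = 1 := by
  rcases lam_eq n with h | h <;> simp [h]

lemma abs_lam (n : ℕ) : |lam n| = 1 := by
  rcases lam_eq n with h | h <;> simp [h]

lemma lam_prime_mul {p m : ℕ} (hp : p.Prime) (hm : m ≠ 0) : lam (p * m) = - lam m := by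
  rw [lam_mul hp.ne_zero hm, lam_prime hp]; ring

/-! ### Part A: from the core statement to the theorem -/

noncomputable def logS (Q : ℕ → Prop) (a b : ℕ) : ℝ :=
  ∑ n ∈ Finset.Icc a b, if Q n then (1 : ℝ) / n else 0

def PosLog (Q : ℕ → Prop) : Prop :=
  ∃ c > (0 : ℝ), ∃ C ≥ (0 : ℝ), ∀ a b : ℕ, 1 ≤ a → a ≤ b →
    c * Real.log ((b : ℝ) / a) - C ≤ logS Q a b

lemma logS_nonneg (Q : ℕ → Prop) (a b : ℕ) : 0 ≤ logS Q a b := by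
  unfold logS
  refine Finset.sum_nonneg fun n _ => ?_
  split_ifs <;> positivity

lemma logS_inj (Q : ℕ → Prop) (φ : ℕ → ℕ) (k : ℕ) (hk : 1 ≤ k)
    (hinj : ∀ m m', 1 ≤ m → 1 ≤ m' → φ m = φ m' → m = m')
    (h1 : ∀ m, 1 ≤ m → m ≤ φ m) (h2 : ∀ m, 1 ≤ m → φ m ≤ k * m) (a b : ℕ) (ha : 1 ≤ a) :
    logS (fun m => Q (φ m)) a (b / k) ≤ k * logS Q a b := by
  unfold logS
  rw [Finset.mul_sum]
  calc ∑ m ∈ Finset.Icc a (b / k), (if Q (φ m) then (1 : ℝ) / m else 0)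
      ≤ ∑ m ∈ Finset.Icc a (b / k), (k : ℝ) * (if Q (φ m) then (1 : ℝ) / (φ m : ℕ) else 0) := by
        refine Finset.sum_le_sum fun m hm => ?_
        rw [Finset.mem_Icc] at hm
        have hm1 : 1 ≤ m := ha.trans hm.1
        split_ifs
        · have : (φ m : ℝ) ≤ k * m := by exact_mod_cast h2 m hm1
          have h0 : (0 : ℝ) < φ m := by exact_mod_cast hm1.trans (h1 m hm1)
          have hm0 : (0 : ℝ) < m := by exact_mod_cast hm1
          rw [mul_one_div, div_le_div_iff₀ hm0 h0]
          linarith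
        · simp
    _ = ∑ n ∈ (Finset.Icc a (b / k)).image φ, (k : ℝ) * (if Q n then (1 : ℝ) / n else 0) := by
        rw [Finset.sum_image]
        intro x hx y hy hxy
        simp only [Finset.coe_Icc, Set.mem_Icc] at hx hy
        exact hinj x y (ha.trans hx.1) (ha.trans hy.1) hxy
    _ ≤ _ := by
        refine Finset.sum_le_sum_of_subset_of_nonneg ?_ ?_
        · intro n hn
          rw [Finset.mem_image] at hn
          obtain ⟨m, hm, rfl⟩ := hn
          rw [Finset.mem_Icc] at hm ⊢
          have hm1 : 1 ≤ m := ha.trans hm.1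
          refine ⟨hm.1.trans (h1 m hm1), (h2 m hm1).trans ?_⟩
          calc k * m ≤ k * (b / k) := by gcongr; exact hm.2
            _ ≤ b := Nat.mul_div_le b k
        · intro n _ _
          split_ifs <;> positivity

lemma PosLog.transfer {R Q : ℕ → Prop} (hR : PosLog R) (φ₁ φ₂ φ₃ : ℕ → ℕ) (k : ℕ) (hk : 1 ≤ k)
    (hinj₁ : ∀ m m', 1 ≤ m → 1 ≤ m' → φ₁ m = φ₁ m' → m = m')
    (hinj₂ : ∀ m m', 1 ≤ m → 1 ≤ m' → φ₂ m = φ₂ m' → m = m')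
    (hinj₃ : ∀ m m', 1 ≤ m → 1 ≤ m' → φ₃ m = φ₃ m' → m = m')
    (h1 : ∀ m, 1 ≤ m → (m ≤ φ₁ m ∧ φ₁ m ≤ k * m) ∧ (m ≤ φ₂ m ∧ φ₂ m ≤ k * m) ∧
      (m ≤ φ₃ m ∧ φ₃ m ≤ k * m))
    (himp : ∀ m, 1 ≤ m → R m → Q (φ₁ m) ∨ Q (φ₂ m) ∨ Q (φ₃ m)) : PosLog Q := by
  obtain ⟨c, hc, C, hC, h⟩ := hR
  have hk0 : (0 : ℝ) < k := by exact_mod_cast hk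
  refine ⟨c / (3 * k), by positivity, (C + c * Real.log (2 * k)) / (3 * k), ?_, ?_⟩
  · have : 0 ≤ Real.log (2 * k) := Real.log_nonneg (by
      have : (1 : ℝ) ≤ k := by exact_mod_cast hk
      linarith)
    positivity
  intro a b ha hab
  have key : logS R a (b / k) ≤ 3 * k * logS Q a b := by
    have e1 := logS_inj Q φ₁ k hk hinj₁ (fun m hm => (h1 m hm).1.1) (fun m hm => (h1 m hm).1.2) a b ha
    have e2 := logS_inj Q φ₂ k hk hinj₂ (fun m hm => (h1 m hm).2.1.1) (fun m hm => (h1 m hm).2.1.2) a b ha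
    have e3 := logS_inj Q φ₃ k hk hinj₃ (fun m hm => (h1 m hm).2.2.1) (fun m hm => (h1 m hm).2.2.2) a b ha
    have : logS R a (b / k) ≤ logS (fun m => Q (φ₁ m)) a (b / k) + logS (fun m => Q (φ₂ m)) a (b / k)
        + logS (fun m => Q (φ₃ m)) a (b / k) := by
      unfold logS
      rw [← Finset.sum_add_distrib, ← Finset.sum_add_distrib]
      refine Finset.sum_le_sum fun m hm => ?_
      rw [Finset.mem_Icc] at hm
      have hh := himp m (ha.trans hm.1)
      have hpos : (0 : ℝ) ≤ 1 / m := by positivity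
      by_cases hRm : R m
      · rcases hh hRm with h' | h' | h' <;> simp only [hRm, h', if_true] <;> split_ifs <;> linarith
      · simp only [hRm, if_false]; split_ifs <;> linarith
    linarith
  have ha0 : (0 : ℝ) < a := by exact_mod_cast ha
  have hb0 : (0 : ℝ) < b := by exact_mod_cast ha.trans hab
  rw [div_mul_eq_mul_div, ← sub_div, div_le_iff₀ (by positivity)]
  have e : logS Q a b * (3 * k) = 3 * k * logS Q a b := by ring
  rw [e]
  refine le_trans ?_ key
  have hlog : Real.log ((b : ℝ) / a) = Real.log ((b : ℝ) / (2 * k) / a) + Real.log (2 * k) := by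
    rw [← Real.log_mul (by positivity) (by positivity)]; congr 1; field_simp
  by_cases hc1 : a ≤ b / k
  · have h3 := h a (b / k) ha hc1
    have hbk : (b : ℝ) / (2 * k) ≤ ((b / k : ℕ) : ℝ) := by
      have h5 : b < k * (b / k + 1) := Nat.lt_mul_div_succ b (by omega)
      have h6 : k * (b / k + 1) ≤ 2 * k * (b / k) := by
        have : 1 ≤ b / k := ha.trans hc1
        nlinarith
      rw [div_le_iff₀ (by positivity)]
      have : (b : ℝ) ≤ 2 * k * (b / k : ℕ) := by exact_mod_cast (h5.le.trans h6)
      linarith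
    have : Real.log ((b : ℝ) / (2 * k) / a) ≤ Real.log (((b / k : ℕ) : ℝ) / a) := by
      apply Real.log_le_log (by positivity); gcongr
    nlinarith
  · have : (b : ℝ) / (2 * k) / a ≤ 1 := by
      push Not at hc1
      have : b < k * a := by rwa [Nat.div_lt_iff_lt_mul (by omega), mul_comm] at hc1
      have : (b : ℝ) < k * a := by exact_mod_cast this
      rw [div_div, div_le_one (by positivity)]
      nlinarith
    have h4 : Real.log ((b : ℝ) / (2 * k) / a) ≤ 0 := Real.log_nonpos (by positivity) this
    have := logS_nonneg R a (b / k)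
    nlinarith

lemma log_succ_div_le {n : ℕ} (hn : 1 ≤ n) :
    Real.log (((n + 1 : ℕ) : ℝ)) - Real.log n ≤ 1 / n := by
  have hn0 : (0 : ℝ) < n := by exact_mod_cast hn
  rw [← Real.log_div (by positivity) (by positivity)]
  have := Real.log_le_sub_one_of_pos (x := ((n + 1 : ℕ) : ℝ) / n) (by positivity)
  refine this.trans (le_of_eq ?_)
  push_cast; field_simp; ring

lemma le_log_succ_div {n : ℕ} (hn : 1 ≤ n) :
    1 / ((n + 1 : ℕ) : ℝ) ≤ Real.log (((n + 1 : ℕ) : ℝ)) - Real.log n := by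
  have hn0 : (0 : ℝ) < n := by exact_mod_cast hn
  rw [← Real.log_div (by positivity) (by positivity)]
  have := Real.one_sub_inv_le_log_of_pos (x := ((n + 1 : ℕ) : ℝ) / n) (by positivity)
  refine le_trans (le_of_eq ?_) this
  push_cast; field_simp; ring

lemma harm_lower {a b : ℕ} (ha : 1 ≤ a) (hab : a ≤ b) :
    Real.log ((b + 1 : ℕ) : ℝ) - Real.log a ≤ ∑ n ∈ Finset.Icc a b, (1 : ℝ) / n := by
  induction b, hab using Nat.le_induction with
  | base => simpa using log_succ_div_le ha
  | succ n hn ih =>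
    rw [← Finset.insert_Icc_right_eq_Icc_add_one (by omega), Finset.sum_insert (by simp)]
    have := log_succ_div_le (n := n + 1) (by omega)
    linarith

lemma harm_upper {a b : ℕ} (ha : 1 ≤ a) (hab : a ≤ b) :
    ∑ n ∈ Finset.Icc a b, (1 : ℝ) / n ≤ 1 / a + (Real.log b - Real.log a) := by
  induction b, hab using Nat.le_induction with
  | base => simp
  | succ n hn ih =>
    rw [← Finset.insert_Icc_right_eq_Icc_add_one (by omega), Finset.sum_insert (by simp)]
    have := le_log_succ_div (n := n) (by omega)
    linarith

lemma PosLog_true : PosLog (fun _ => True) := by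
  refine ⟨1, one_pos, 0, le_rfl, ?_⟩
  intro a b ha hab
  unfold logS
  simp only [if_true]
  have h := harm_lower ha hab
  have ha0 : (0 : ℝ) < a := by exact_mod_cast ha
  have hb0 : (0 : ℝ) < b := by exact_mod_cast ha.trans hab
  rw [Real.log_div hb0.ne' ha0.ne']
  have : Real.log b ≤ Real.log ((b + 1 : ℕ) : ℝ) := Real.log_le_log hb0 (by push_cast; linarith)
  linarith

def CoreStmt : Prop := ∃ δ > (0 : ℝ), ∃ B : ℕ, 1 ≤ B ∧ ∃ N0 : ℕ, ∀ N : ℕ, N0 ≤ N →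
  δ * N ≤ (((Finset.Icc N (B * N)).filter (fun n => lam n ≠ lam (n + 1))).card : ℝ)

lemma PosLog_of_core (h : CoreStmt) : PosLog (fun n => lam n ≠ lam (n + 1)) := by
  obtain ⟨δ, hδ, B, hB, N0, hN⟩ := h
  obtain ⟨Q, hQ⟩ : ∃ Q : ℕ → Prop, Q = fun n => lam n ≠ lam (n + 1) := ⟨_, rfl⟩
  have hN : ∀ N : ℕ, N0 ≤ N → δ * N ≤ (((Finset.Icc N (B * N)).filter Q).card : ℝ) := by
    intro N h0
    subst hQ
    convert hN N h0
  rw [← hQ]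
  clear hQ
  have hB0 : (0 : ℝ) < B := by exact_mod_cast hB
  have hq : (1 : ℝ) < B + 1 := by linarith
  have hlq : 0 < Real.log (B + 1) := Real.log_pos hq
  -- block estimate
  have hblock : ∀ N : ℕ, N0 ≤ N → 1 ≤ N → δ / B ≤ logS Q N (B * N) := by
    intro N h0 h1
    have h2 := hN N h0
    have hN0 : (0 : ℝ) < N := by exact_mod_cast h1
    unfold logS
    rw [← Finset.sum_filter]
    calc δ / B = δ * N * (1 / (B * N)) := by field_simp
      _ ≤ ((Finset.Icc N (B * N)).filter Q).card * (1 / (B * N)) := by gcongr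
      _ ≤ _ := by
        rw [← nsmul_eq_mul]
        refine Finset.card_nsmul_le_sum _ _ _ fun n hn => ?_
        rw [Finset.mem_filter, Finset.mem_Icc] at hn
        have : (n : ℝ) ≤ B * N := by exact_mod_cast hn.1.2
        have : (0 : ℝ) < n := by exact_mod_cast h1.trans hn.1.1
        gcongr
  have hchain : ∀ (N : ℕ), N0 ≤ N → 1 ≤ N → ∀ k : ℕ,
      k * (δ / B) ≤ ∑ n ∈ Finset.Ico N (N * (B + 1) ^ k), if Q n then (1 : ℝ) / n else 0 := by
    intro N h0 h1 k
    induction k with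
    | zero => simp
    | succ k ih =>
      have hle : N ≤ N * (B + 1) ^ k := Nat.le_mul_of_pos_right _ (by positivity)
      have hle2 : N * (B + 1) ^ k ≤ N * (B + 1) ^ (k + 1) := by gcongr <;> omega
      rw [← Finset.sum_Ico_consecutive _ hle hle2]
      have hb := hblock (N * (B + 1) ^ k) (h0.trans hle) (h1.trans hle)
      have : logS Q (N * (B + 1) ^ k) (B * (N * (B + 1) ^ k)) ≤
          ∑ n ∈ Finset.Ico (N * (B + 1) ^ k) (N * (B + 1) ^ (k + 1)),
            if Q n then (1 : ℝ) / n else 0 := by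
        unfold logS
        refine Finset.sum_le_sum_of_subset_of_nonneg ?_ ?_
        · intro n hn
          rw [Finset.mem_Icc] at hn
          rw [Finset.mem_Ico]
          refine ⟨hn.1, lt_of_le_of_lt hn.2 ?_⟩
          have : 0 < N * (B + 1) ^ k := by positivity
          rw [pow_succ]; nlinarith
        · intro n _ _
          split_ifs <;> positivity
      push_cast
      linarith
  refine ⟨δ / B / Real.log (B + 1), by positivity,
    δ / B / Real.log (B + 1) * Real.log (N0 + 1) + δ / B, ?_, ?_⟩
  · have : 0 ≤ Real.log ((N0 : ℝ) + 1) := Real.log_nonneg (by linarith [(Nat.cast_nonneg N0 : (0:ℝ) ≤ N0)])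
    positivity
  intro a b ha hab
  have ha0 : (0 : ℝ) < a := by exact_mod_cast ha
  have ha1 : (1 : ℝ) ≤ a := by exact_mod_cast ha
  have hb0 : (0 : ℝ) < b := by exact_mod_cast ha.trans hab
  set A : ℕ := a * (N0 + 1) with hA
  have hAa : a ≤ A := Nat.le_mul_of_pos_right _ (by omega)
  have hAN : N0 ≤ A := by nlinarith
  set t : ℝ := Real.log ((b : ℝ) / A) / Real.log (B + 1) with ht
  have hA0 : (0 : ℝ) < A := by exact_mod_cast (by omega : 0 < A)
  have hlogA : Real.log ((b : ℝ) / a) = Real.log ((b : ℝ) / A) + Real.log (N0 + 1) := by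
    rw [← Real.log_mul (by positivity) (by positivity)]
    congr 1
    rw [hA]; push_cast; field_simp
  have goal1 : t * (δ / B) - δ / B ≤ logS Q a b := by
    by_cases ht0 : t < 0
    · have := logS_nonneg Q a b
      have : 0 < δ / B := by positivity
      nlinarith
    push Not at ht0
    have h1 := hchain A hAN (ha.trans hAa) ⌊t⌋₊
    have h2 : t - 1 ≤ (⌊t⌋₊ : ℝ) := (Nat.sub_one_lt_floor t).le
    have h3 : ((⌊t⌋₊ : ℕ) : ℝ) ≤ t := Nat.floor_le ht0
    have hsub : (A * (B + 1) ^ ⌊t⌋₊ : ℕ) ≤ b := by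
      have : (A : ℝ) * ((B : ℝ) + 1) ^ ⌊t⌋₊ ≤ b := by
        rw [← le_div_iff₀' hA0, ← Real.log_le_log_iff (by positivity) (by positivity), Real.log_pow,
          ← le_div_iff₀ hlq]
        exact h3
      exact_mod_cast this
    have h4 : (∑ n ∈ Finset.Ico A (A * (B + 1) ^ ⌊t⌋₊), if Q n then (1 : ℝ) / n else 0) ≤ logS Q a b := by
      unfold logS
      refine Finset.sum_le_sum_of_subset_of_nonneg ?_ ?_
      · intro n hn
        rw [Finset.mem_Ico] at hn
        rw [Finset.mem_Icc]
        omega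
      · intro n _ _
        split_ifs <;> positivity
    have : 0 < δ / B := by positivity
    nlinarith
  refine le_trans (le_of_eq ?_) goal1
  rw [hlogA, ht]
  ring

noncomputable def ff (n : ℕ) : ℝ := (lam (n + 1) * lam (n + 2)) * (lam (n + 4) * lam (n + 5))

lemma ff_eq (n : ℕ) : ff n = 1 ∨ ff n = -1 := by
  unfold ff
  rcases lam_eq (n + 1) with h1 | h1 <;> rcases lam_eq (n + 2) with h2 | h2 <;>
  rcases lam_eq (n + 4) with h3 | h3 <;> rcases lam_eq (n + 5) with h4 | h4 <;>
  simp [h1, h2, h3, h4]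

lemma ff_triple (m : ℕ) (hm : 1 ≤ m) :
    ff (6 * m - 1) * ff (6 * m) * ff (6 * m + 1) = lam m * lam (m + 1) := by
  unfold ff
  have e1 : 6 * m - 1 + 1 = 6 * m := by omega
  have e2 : 6 * m - 1 + 2 = 6 * m + 1 := by omega
  have e4 : 6 * m - 1 + 4 = 6 * m + 3 := by omega
  have e5 : 6 * m - 1 + 5 = 6 * m + 4 := by omega
  have e6 : 6 * m + 1 + 5 = 6 * (m + 1) := by omega
  rw [e1, e2, e4, e5, e6, lam_mul (by norm_num) (by omega), lam_mul (by norm_num) (by omega)]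
  simp only [add_assoc]
  norm_num
  have s6 := lam_sq 6
  have s1 := lam_sq (6 * m + 1)
  have s2 := lam_sq (6 * m + 2)
  have s3 := lam_sq (6 * m + 3)
  have s4 := lam_sq (6 * m + 4)
  have s5 := lam_sq (6 * m + 5)
  calc _ = (lam 6 * lam 6) * (lam (6*m+1) * lam (6*m+1)) * (lam (6*m+2) * lam (6*m+2))
      * (lam (6*m+3) * lam (6*m+3)) * (lam (6*m+4) * lam (6*m+4))
      * (lam (6*m+5) * lam (6*m+5)) * (lam m * lam (m+1)) := by ring
    _ = _ := by rw [s6, s1, s2, s3, s4, s5]; ring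

lemma PosLog_ff_neg (h : CoreStmt) : PosLog (fun n => ff n = -1) := by
  refine (PosLog_of_core h).transfer (fun m => 6 * m - 1) (fun m => 6 * m) (fun m => 6 * m + 1) 7
    (by norm_num) (by intros; omega) (by intros; omega) (by intros; omega) (by intros; omega) ?_
  intro m hm hne
  have ht := ff_triple m hm
  by_contra hcon
  push Not at hcon
  have h1 := (ff_eq (6 * m - 1)).resolve_right hcon.1
  have h2 := (ff_eq (6 * m)).resolve_right hcon.2.1
  have h3 := (ff_eq (6 * m + 1)).resolve_right hcon.2.2
  rw [h1, h2, h3] at ht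
  apply hne
  rcases lam_eq m with a | a <;> rcases lam_eq (m + 1) with b | b <;> rw [a, b] at ht ⊢ <;> norm_num at ht

lemma PosLog_ff_pos : PosLog (fun n => ff n = 1) := by
  have h0 : PosLog (fun n => lam n = lam (n + 1)) := by
    refine PosLog_true.transfer (fun m => m) (fun m => 2 * m) (fun m => 2 * m + 1) 3
      (by norm_num) (by intros; omega) (by intros; omega) (by intros; omega) (by intros; omega) ?_
    intro m hm _
    have e1 : lam (2 * m) = - lam m := lam_prime_mul Nat.prime_two (by omega)
    have e2 : lam (2 * m + 1 + 1) = - lam (m + 1) := by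
      rw [show 2 * m + 1 + 1 = 2 * (m + 1) by ring]; exact lam_prime_mul Nat.prime_two (by omega)
    simp only [e1, e2]
    rcases lam_eq m with a | a <;> rcases lam_eq (m + 1) with b | b <;>
      rcases lam_eq (2 * m + 1) with c | c <;> simp [a, b, c]
  refine h0.transfer (fun m => 6 * m - 1) (fun m => 6 * m) (fun m => 6 * m + 1) 7
    (by norm_num) (by intros; omega) (by intros; omega) (by intros; omega) (by intros; omega) ?_
  intro m hm heq
  have ht := ff_triple m hm
  rw [heq, lam_sq] at ht
  by_contra hcon
  push Not at hcon
  have h1 := (ff_eq (6 * m - 1)).resolve_left hcon.1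
  have h2 := (ff_eq (6 * m)).resolve_left hcon.2.1
  have h3 := (ff_eq (6 * m + 1)).resolve_left hcon.2.2
  rw [h1, h2, h3] at ht
  norm_num at ht

lemma sum_ff (a b : ℕ) : ∑ n ∈ Finset.Icc a b, ff n / n =
    logS (fun n => ff n = 1) a b - logS (fun n => ff n = -1) a b := by
  unfold logS
  rw [← Finset.sum_sub_distrib]
  refine Finset.sum_congr rfl fun n _ => ?_
  rcases ff_eq n with h | h
  · rw [if_pos h, if_neg (by show ¬ _ = _; rw [h]; norm_num), h]; ring
  · rw [if_neg (by show ¬ _ = _; rw [h]; norm_num), if_pos h, h]; ring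

lemma sum_one (a b : ℕ) : ∑ n ∈ Finset.Icc a b, (1 : ℝ) / n =
    logS (fun n => ff n = 1) a b + logS (fun n => ff n = -1) a b := by
  unfold logS
  rw [← Finset.sum_add_distrib]
  refine Finset.sum_congr rfl fun n _ => ?_
  rcases ff_eq n with h | h
  · rw [if_pos h, if_neg (by show ¬ _ = _; rw [h]; norm_num)]; ring
  · rw [if_neg (by show ¬ _ = _; rw [h]; norm_num), if_pos h]; ring

theorem final_of_core (hcore : CoreStmt) (ω : ℝ → ℝ)
    (hω : ∀ X : ℝ, 1 ≤ X → 1 ≤ ω X ∧ ω X ≤ X)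
    (hωtop : Filter.Tendsto ω Filter.atTop Filter.atTop) :
    Filter.limsup (fun x : ℝ =>
      |logAvg (Finset.Icc ⌈x / ω x⌉₊ ⌊x⌋₊)
        (fun n => ((liouville (n + 1) : ℝ) * (liouville (n + 2) : ℝ)) *
          ((liouville (n + 4) : ℝ) * (liouville (n + 5) : ℝ)))|)
      Filter.atTop < 1 := by
  obtain ⟨c₁, hc₁, C₁, hC₁, h₁⟩ := PosLog_ff_neg hcore
  obtain ⟨c₂, hc₂, C₂, hC₂, h₂⟩ := PosLog_ff_pos
  set c := min (min c₁ c₂) 1 with hc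
  have hc0 : 0 < c := by positivity
  have hcc1 : c ≤ c₁ := (min_le_left _ _).trans (min_le_left _ _)
  have hcc2 : c ≤ c₂ := (min_le_left _ _).trans (min_le_right _ _)
  have hcc3 : c ≤ 1 := min_le_right _ _
  set C := max C₁ C₂ with hC
  have hC0 : 0 ≤ C := le_max_of_le_left hC₁
  have hev : ∀ᶠ x in Filter.atTop, |logAvg (Finset.Icc ⌈x / ω x⌉₊ ⌊x⌋₊)
        (fun n => ((liouville (n + 1) : ℝ) * (liouville (n + 2) : ℝ)) *
          ((liouville (n + 4) : ℝ) * (liouville (n + 5) : ℝ)))| ≤ 1 - c / 2 := by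
    have hw := hωtop.eventually_ge_atTop (4 * Real.exp (4 * (C + c + 1) / c))
    filter_upwards [hw, Filter.eventually_ge_atTop (2 : ℝ)] with x hx hx2
    obtain ⟨hw1, hw2⟩ := hω x (by linarith)
    set a := ⌈x / ω x⌉₊ with ha
    set b := ⌊x⌋₊ with hb
    have hexp : 1 ≤ Real.exp (4 * (C + c + 1) / c) := Real.one_le_exp (by positivity)
    have hω0 : 0 < ω x := by linarith
    have hdiv : 0 < x / ω x := by positivity
    have ha1 : 1 ≤ a := Nat.one_le_iff_ne_zero.mpr (by rw [ha]; exact (Nat.ceil_pos.mpr hdiv).ne')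
    have ha0 : (0 : ℝ) < a := by exact_mod_cast ha1
    have ha2 : (a : ℝ) ≤ 2 * (x / ω x) := by
      have := (Nat.ceil_lt_add_one hdiv.le).le
      have h1 : 1 ≤ x / ω x := by rw [one_le_div hω0]; exact hw2
      rw [ha]; linarith
    have hb2 : x / 2 ≤ (b : ℝ) := by
      have := Nat.sub_one_lt_floor x
      rw [hb]; linarith
    have hb0 : (0 : ℝ) < b := by linarith
    have hratio : ω x / 4 ≤ (b : ℝ) / a := by
      rw [le_div_iff₀ ha0]
      calc ω x / 4 * a ≤ ω x / 4 * (2 * (x / ω x)) := by gcongr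
        _ = x / 2 := by field_simp; ring
        _ ≤ b := hb2
    have hratio2 : Real.exp (4 * (C + c + 1) / c) ≤ (b : ℝ) / a := by linarith
    have hab : a ≤ b := by
      have : (1 : ℝ) ≤ (b : ℝ) / a := by linarith
      rw [one_le_div ha0] at this
      exact_mod_cast this
    have hlog : 4 * (C + c + 1) / c ≤ Real.log ((b : ℝ) / a) := by
      rw [Real.le_log_iff_exp_le (by positivity)]; exact hratio2
    set ℓ := Real.log ((b : ℝ) / a) with hℓ
    have hℓ0 : 0 ≤ ℓ := le_trans (by positivity) hlog
    have g1 := h₁ a b ha1 hab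
    have g2 := h₂ a b ha1 hab
    have gs := sum_one a b
    have gu := harm_upper ha1 hab
    rw [← Real.log_div hb0.ne' ha0.ne'] at gu
    set p := logS (fun n => ff n = 1) a b
    set q := logS (fun n => ff n = -1) a b
    set L := ∑ n ∈ Finset.Icc a b, (1 : ℝ) / n with hL
    have hL2 : L ≤ 1 + ℓ := by
      have : 1 / (a : ℝ) ≤ 1 := by rw [div_le_one ha0]; exact_mod_cast ha1
      linarith
    have hbig : 4 * (C + c + 1) ≤ ℓ * c := by rwa [div_le_iff₀ hc0] at hlog
    have hCC1 : C₁ ≤ C := le_max_left _ _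
    have hCC2 : C₂ ≤ C := le_max_right _ _
    have hq : c * L / 4 ≤ q := by nlinarith
    have hp : c * L / 4 ≤ p := by nlinarith
    have hLpos : 0 < L := by nlinarith
    have hrew : logAvg (Finset.Icc a b) (fun n => ((liouville (n + 1) : ℝ) * (liouville (n + 2) : ℝ)) *
          ((liouville (n + 4) : ℝ) * (liouville (n + 5) : ℝ))) = (p - q) / L := by
      unfold logAvg
      rw [← sum_ff a b]; rfl
    rw [hrew, abs_div, abs_of_pos hLpos, div_le_iff₀ hLpos, abs_le]
    constructor <;> nlinarith
  have hbdd : Filter.limsup (fun x : ℝ =>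
      |logAvg (Finset.Icc ⌈x / ω x⌉₊ ⌊x⌋₊)
        (fun n => ((liouville (n + 1) : ℝ) * (liouville (n + 2) : ℝ)) *
          ((liouville (n + 4) : ℝ) * (liouville (n + 5) : ℝ)))|)
      Filter.atTop ≤ 1 - c / 2 := by
    refine Filter.limsup_le_of_le ?_ hev
    exact Filter.isCoboundedUnder_le_of_le _ (x := 0) (fun x => abs_nonneg _)
  linarith

/-! ### Poisson weights and the mean value theorem -/

noncomputable def cis (x : ℝ) : ℂ := Complex.exp (x * Complex.I)

lemma norm_cis (x : ℝ) : ‖cis x‖ = 1 := Complex.norm_exp_ofReal_mul_I x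

lemma cis_add (x y : ℝ) : cis (x + y) = cis x * cis y := by
  unfold cis; rw [← Complex.exp_add]; push_cast; ring_nf

lemma cis_zero : cis 0 = 1 := by simp [cis]

lemma conj_cis (x : ℝ) : (starRingEnd ℂ) (cis x) = cis (-x) := by
  unfold cis; rw [← Complex.exp_conj]; simp

@[fun_prop]
lemma continuous_cis : Continuous cis := by unfold cis; fun_prop

lemma cis_sub_le (x y : ℝ) : ‖cis x - cis y‖ ≤ |x - y| := by
  have : cis x - cis y = cis y * (cis (x - y) - 1) := by
    rw [mul_sub, ← cis_add]; ring_nf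
  rw [this, norm_mul, norm_cis, one_mul]
  unfold cis
  have := Real.norm_exp_I_mul_ofReal_sub_one_le (x := x - y)
  rw [mul_comm]; simpa using this

open MeasureTheory

/-- the weight -/
noncomputable def wt (T ξ : ℝ) : ℝ := Real.exp (-(|ξ| / T)) / (2 * Real.pi)

lemma wt_pos (T ξ : ℝ) : 0 < wt T ξ := by unfold wt; positivity

lemma wt_le {T : ℝ} (hT : 0 < T) (ξ : ℝ) : wt T ξ ≤ 1 / (2 * Real.pi) := by
  unfold wt
  gcongr
  rw [Real.exp_le_one_iff]
  have : 0 ≤ |ξ| / T := by positivity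
  linarith

@[fun_prop]
lemma continuous_wt (T : ℝ) : Continuous (wt T) := by unfold wt; fun_prop

lemma laplace_integrable {T : ℝ} (hT : 0 < T) (x : ℝ) :
    Integrable (fun ξ : ℝ => (Real.exp (-(|ξ| / T)) : ℂ) * cis (ξ * x)) ∧
    ∫ ξ : ℝ, (Real.exp (-(|ξ| / T)) : ℂ) * cis (ξ * x) = ((2 * T / (1 + (T * x) ^ 2) : ℝ) : ℂ) := by
  set a : ℂ := -(1 / T : ℝ) + x * Complex.I with ha
  set b : ℂ := (1 / T : ℝ) + x * Complex.I with hb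
  have hare : a.re < 0 := by simp [ha, hT]
  have hbre : 0 < b.re := by simp [hb, hT]
  have e1 : Set.EqOn (fun ξ : ℝ => (Real.exp (-(|ξ| / T)) : ℂ) * cis (ξ * x))
      (fun ξ : ℝ => Complex.exp (a * ξ)) (Set.Ioi 0) := by
    intro ξ hξ
    simp only [cis, Complex.ofReal_exp]
    rw [← Complex.exp_add, abs_of_pos hξ]
    congr 1; rw [ha]; push_cast; ring
  have e2 : Set.EqOn (fun ξ : ℝ => (Real.exp (-(|ξ| / T)) : ℂ) * cis (ξ * x))
      (fun ξ : ℝ => Complex.exp (b * ξ)) (Set.Iic 0) := by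
    intro ξ hξ
    simp only [cis, Complex.ofReal_exp]
    rw [← Complex.exp_add, abs_of_nonpos hξ]
    congr 1; rw [hb]; push_cast; ring
  have i1 : IntegrableOn (fun ξ : ℝ => (Real.exp (-(|ξ| / T)) : ℂ) * cis (ξ * x)) (Set.Ioi 0) :=
    (integrableOn_congr_fun e1 measurableSet_Ioi).mpr (integrableOn_exp_mul_complex_Ioi hare 0)
  have i2 : IntegrableOn (fun ξ : ℝ => (Real.exp (-(|ξ| / T)) : ℂ) * cis (ξ * x)) (Set.Iic 0) :=
    (integrableOn_congr_fun e2 measurableSet_Iic).mpr (integrableOn_exp_mul_complex_Iic hbre 0)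
  have hIntg := i2.union i1
  rw [Set.Iic_union_Ioi, integrableOn_univ] at hIntg
  refine ⟨hIntg, ?_⟩
  rw [← intervalIntegral.integral_Iic_add_Ioi i2 i1, setIntegral_congr_fun measurableSet_Ioi e1,
    setIntegral_congr_fun measurableSet_Iic e2, integral_exp_mul_complex_Ioi hare,
    integral_exp_mul_complex_Iic hbre]
  have ha0 : a ≠ 0 := by intro h; rw [h] at hare; simp at hare
  have hb0 : b ≠ 0 := by intro h; rw [h] at hbre; simp at hbre
  simp only [Complex.ofReal_zero, mul_zero, Complex.exp_zero]
  have hab : a * b = ((-(1 + (T * x) ^ 2) / T ^ 2 : ℝ) : ℂ) := by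
    rw [ha, hb]
    have hTc : (T : ℂ) ≠ 0 := by exact_mod_cast hT.ne'
    push_cast
    field_simp
    ring_nf
    simp only [Complex.I_sq]
    ring
  have hba : a - b = ((-2 / T : ℝ) : ℂ) := by
    rw [ha, hb]; push_cast; ring
  have : (1 : ℂ) / b + -1 / a = (a - b) / (a * b) := by field_simp; ring
  rw [this, hab, hba, ← Complex.ofReal_div]
  congr 1
  have : 1 + (T * x) ^ 2 ≠ 0 := by positivity
  field_simp

/-- the measure -/
noncomputable def muT (T : ℝ) : Measure ℝ :=
  volume.withDensity (fun ξ => ENNReal.ofReal (wt T ξ))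

lemma wt_integrable {T : ℝ} (hT : 0 < T) : Integrable (wt T) := by
  have := (laplace_integrable hT 0).1.norm
  simp only [norm_mul, norm_cis, mul_one, Complex.norm_real, Real.norm_eq_abs, Real.abs_exp] at this
  unfold wt
  exact this.div_const _

lemma muT_finite {T : ℝ} (hT : 0 < T) : IsFiniteMeasure (muT T) :=
  isFiniteMeasure_withDensity_ofReal (wt_integrable hT).2

lemma muT_le {T : ℝ} (hT : 0 < T) : muT T ≤ ENNReal.ofReal (1 / (2 * Real.pi)) • volume := by
  unfold muT
  rw [← withDensity_const]
  exact withDensity_mono (Eventually.of_forall fun ξ => ENNReal.ofReal_le_ofReal (wt_le hT ξ))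

lemma muT_integral (T : ℝ) {E : Type*} [NormedAddCommGroup E] [NormedSpace ℝ E] (f : ℝ → E) :
    ∫ ξ, f ξ ∂(muT T) = ∫ ξ, wt T ξ • f ξ := by
  unfold muT
  rw [integral_withDensity_eq_integral_toReal_smul (by fun_prop) (by simp)]
  refine integral_congr_ae (Eventually.of_forall fun ξ => ?_)
  simp only [ENNReal.toReal_ofReal (wt_pos T ξ).le]

/-- the Poisson kernel -/
noncomputable def KT (T x : ℝ) : ℝ := T / Real.pi / (1 + (T * x) ^ 2)

lemma muT_cis {T : ℝ} (hT : 0 < T) (x : ℝ) : ∫ ξ, cis (ξ * x) ∂(muT T) = (KT T x : ℂ) := by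
  rw [muT_integral]
  have h : ∀ ξ : ℝ, wt T ξ • cis (ξ * x) =
      (1 / (2 * Real.pi) : ℂ) * ((Real.exp (-(|ξ| / T)) : ℂ) * cis (ξ * x)) := by
    intro ξ
    rw [Complex.real_smul]; unfold wt; push_cast; ring
  simp_rw [h]
  rw [integral_const_mul, (laplace_integrable hT x).2]
  unfold KT
  have : (1 : ℝ) + (T * x) ^ 2 ≠ 0 := by positivity
  rw [show (1 / (2 * Real.pi) : ℂ) = ((1 / (2 * Real.pi) : ℝ) : ℂ) by push_cast; ring,
    ← Complex.ofReal_mul]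
  congr 1
  field_simp

lemma KT_even (T x : ℝ) : KT T (-x) = KT T x := by unfold KT; ring_nf

lemma KT_nonneg {T : ℝ} (hT : 0 < T) (x : ℝ) : 0 ≤ KT T x := by
  unfold KT; positivity

lemma KT_le {T : ℝ} (hT : 0 < T) (x : ℝ) : KT T x ≤ T / Real.pi := by
  unfold KT
  exact div_le_self (by positivity) (by nlinarith [sq_nonneg (T * x)])

/-- Dirichlet polynomials -/
noncomputable def dp (S : Finset ℕ) (a : ℕ → ℂ) (ξ : ℝ) : ℂ :=
  ∑ n ∈ S, a n / n * cis (-(ξ * Real.log n))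

@[fun_prop]
lemma continuous_dp (S : Finset ℕ) (a : ℕ → ℂ) : Continuous (dp S a) := by
  unfold dp
  refine continuous_finsetSum _ fun n _ => ?_
  exact continuous_const.mul (continuous_cis.comp (by fun_prop))

lemma norm_dp_le (S : Finset ℕ) (a : ℕ → ℂ) (ξ : ℝ) : ‖dp S a ξ‖ ≤ ∑ n ∈ S, ‖a n‖ / n := by
  unfold dp
  refine (norm_sum_le _ _).trans (Finset.sum_le_sum fun n _ => ?_)
  rw [norm_mul, norm_cis, mul_one, norm_div, Complex.norm_natCast]

lemma integrable_of_cont_bdd {E : Type*} [NormedAddCommGroup E] [SecondCountableTopology E]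
    {μ : Measure ℝ} [IsFiniteMeasure μ]
    {f : ℝ → E} (hf : Continuous f) {C : ℝ} (hC : ∀ x, ‖f x‖ ≤ C) : Integrable f μ :=
  Integrable.of_bound hf.aestronglyMeasurable C (Eventually.of_forall hC)

lemma dp_normSq (S : Finset ℕ) (a : ℕ → ℂ) (ξ : ℝ) : ((‖dp S a ξ‖ ^ 2 : ℝ) : ℂ) =
    ∑ m ∈ S, ∑ n ∈ S, a m / m * (starRingEnd ℂ (a n) / n) * cis (ξ * (Real.log n - Real.log m)) := by
  rw [← Complex.normSq_eq_norm_sq, Complex.normSq_eq_conj_mul_self, mul_comm]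
  unfold dp
  rw [map_sum, Finset.sum_mul_sum]
  refine Finset.sum_congr rfl fun m _ => Finset.sum_congr rfl fun n _ => ?_
  rw [map_mul, conj_cis, map_div₀, Complex.conj_natCast, mul_mul_mul_comm, ← cis_add]
  congr 2; ring

lemma dp_sq {T : ℝ} (hT : 0 < T) (S : Finset ℕ) (a : ℕ → ℂ) :
    ∫ ξ, ‖dp S a ξ‖ ^ 2 ∂(muT T) = ∑ m ∈ S, ∑ n ∈ S,
      (a m * starRingEnd ℂ (a n)).re / (m * n) * KT T (Real.log n - Real.log m) := by
  have := muT_finite hT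
  have h : ((∫ ξ, ‖dp S a ξ‖ ^ 2 ∂(muT T) : ℝ) : ℂ) = ∑ m ∈ S, ∑ n ∈ S,
      a m / m * (starRingEnd ℂ (a n) / n) * (KT T (Real.log n - Real.log m) : ℂ) := by
    rw [← integral_complex_ofReal]
    simp_rw [dp_normSq]
    have hi : ∀ m n : ℕ, Integrable (fun ξ : ℝ => a m / m * (starRingEnd ℂ (a n) / n) *
        cis (ξ * (Real.log n - Real.log m))) (muT T) := by
      intro m n
      refine Integrable.const_mul ?_ _
      exact integrable_of_cont_bdd (continuous_cis.comp (by fun_prop)) (C := 1)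
        (fun x => (norm_cis _).le)
    rw [integral_finsetSum _ (fun m _ => integrable_finsetSum _ fun n _ => hi m n)]
    refine Finset.sum_congr rfl fun m _ => ?_
    rw [integral_finsetSum _ (fun n _ => hi m n)]
    refine Finset.sum_congr rfl fun n _ => ?_
    rw [integral_const_mul, muT_cis hT]
  have h2 := congrArg Complex.re h
  rw [Complex.ofReal_re, Complex.re_sum] at h2
  rw [h2]
  refine Finset.sum_congr rfl fun m _ => ?_
  rw [Complex.re_sum]
  refine Finset.sum_congr rfl fun n _ => ?_
  rw [Complex.re_mul_ofReal]
  congr 1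
  rw [div_mul_div_comm, show ((m : ℂ) * n) = ((m * n : ℝ) : ℂ) by push_cast; ring,
    Complex.div_ofReal_re]

/-! arctan telescoping -/

noncomputable def ThT (T x : ℝ) : ℝ := Real.arctan (T * x) / Real.pi

lemma ThT_mono {T : ℝ} (hT : 0 < T) : Monotone (ThT T) := by
  intro x y hxy
  unfold ThT
  gcongr

lemma ThT_lt {T : ℝ} (x : ℝ) : ThT T x < 1 / 2 := by
  unfold ThT
  rw [div_lt_iff₀ Real.pi_pos]
  linarith [Real.arctan_lt_pi_div_two (T * x)]

lemma ThT_neg (T x : ℝ) : ThT T (-x) = - ThT T x := by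
  unfold ThT; rw [mul_neg, Real.arctan_neg]; ring

lemma ThT_zero (T : ℝ) : ThT T 0 = 0 := by simp [ThT]

lemma ThT_bounds {T : ℝ} (hT : 0 < T) {x y : ℝ} (hx : 0 ≤ x) (hxy : x ≤ y) :
    KT T y * (y - x) ≤ ThT T y - ThT T x ∧ ThT T y - ThT T x ≤ KT T x * (y - x) := by
  rcases hxy.eq_or_lt with rfl | hlt
  · simp
  have hd : ∀ z, HasDerivAt (ThT T) (KT T z) z := by
    intro z
    unfold ThT KT
    have := (((hasDerivAt_id z).const_mul T).arctan).div_const Real.pi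
    refine HasDerivAt.congr_deriv this ?_
    simp only [id]
    ring
  obtain ⟨c, ⟨hc1, hc2⟩, hc⟩ := exists_hasDerivAt_eq_slope (ThT T) (KT T) hlt
    (fun z _ => (hd z).continuousAt.continuousWithinAt) (fun z _ => hd z)
  have hyx : 0 < y - x := by linarith
  rw [eq_div_iff hyx.ne'] at hc
  rw [← hc]
  constructor
  · have h0 : 0 ≤ T * c := mul_nonneg hT.le (by linarith)
    gcongr
    unfold KT
    gcongr
  · have h0 : 0 ≤ T * c := mul_nonneg hT.le (by linarith)
    gcongr
    unfold KT
    gcongr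

lemma ThT_ge {T : ℝ} (hT : 0 < T) {x : ℝ} (hx : 0 < x) : 1 / 2 - 1 / (T * x) ≤ ThT T x := by
  unfold ThT
  have h0 : 0 < T * x := by positivity
  rw [le_div_iff₀ Real.pi_pos]
  have h1 := Real.arctan_inv_of_pos h0
  have h2 : Real.arctan (T * x)⁻¹ ≤ (T * x)⁻¹ := by
    have h3 := Real.le_tan (Real.arctan_nonneg.mpr (inv_pos.mpr h0).le)
      (Real.arctan_lt_pi_div_two (T * x)⁻¹)
    rwa [Real.tan_arctan] at h3
  have : (T * x)⁻¹ ≤ Real.pi * (1 / (T * x)) := by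
    rw [one_div]; nlinarith [Real.pi_gt_three, inv_pos.mpr h0]
  nlinarith

lemma sum_Ico_telescope (F : ℕ → ℝ) {a b : ℕ} (h : a ≤ b) :
    ∑ n ∈ Finset.Ico a b, (F (n + 1) - F n) = F b - F a := by
  induction b, h using Nat.le_induction with
  | base => simp
  | succ n hn ih => rw [Finset.sum_Ico_succ_top hn, ih]; ring

lemma log_nat_mono {a b : ℕ} (ha : 1 ≤ a) (h : a ≤ b) : Real.log a ≤ Real.log b :=
  Real.log_le_log (by exact_mod_cast ha) (by exact_mod_cast h)

lemma row_up {T : ℝ} (hT : 0 < T) {m c X : ℕ} (hm : 1 ≤ m) (hc : m ≤ c) :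
    ∑ n ∈ Finset.Ico c X, KT T (Real.log (n + 1 : ℕ) - Real.log m) / (n + 1 : ℕ) ≤
      1 / 2 - ThT T (Real.log c - Real.log m) := by
  rcases le_total X c with h | h
  · rw [Finset.Ico_eq_empty (by omega), Finset.sum_empty]
    linarith [ThT_lt (T := T) (Real.log c - Real.log m)]
  calc _ ≤ ∑ n ∈ Finset.Ico c X, (ThT T (Real.log (n + 1 : ℕ) - Real.log m) -
        ThT T (Real.log n - Real.log m)) := by
        refine Finset.sum_le_sum fun n hn => ?_
        rw [Finset.mem_Ico] at hn
        have h1 : 0 ≤ Real.log n - Real.log m := sub_nonneg.mpr (log_nat_mono hm (hc.trans hn.1))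
        have h2 : Real.log n ≤ Real.log (n + 1 : ℕ) := log_nat_mono (by omega) (by omega)
        have h3 := (ThT_bounds hT h1 (by linarith :
          Real.log n - Real.log m ≤ Real.log (n + 1 : ℕ) - Real.log m)).1
        refine le_trans ?_ h3
        have h4 := le_log_succ_div (n := n) (by omega)
        rw [div_eq_mul_one_div]
        exact mul_le_mul_of_nonneg_left (by linarith) (KT_nonneg hT _)
    _ = ThT T (Real.log X - Real.log m) - ThT T (Real.log c - Real.log m) :=
        sum_Ico_telescope (fun n => ThT T (Real.log n - Real.log m)) h
    _ ≤ _ := by linarith [ThT_lt (T := T) (Real.log X - Real.log m)]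

lemma row_up_lower {T : ℝ} (hT : 0 < T) {m X : ℕ} (hm : 1 ≤ m) (h : m ≤ X) :
    ThT T (Real.log X - Real.log m) ≤
    ∑ n ∈ Finset.Ico m X, KT T (Real.log n - Real.log m) / n := by
  calc ThT T (Real.log X - Real.log m) = ∑ n ∈ Finset.Ico m X,
        (ThT T (Real.log (n + 1 : ℕ) - Real.log m) - ThT T (Real.log n - Real.log m)) := by
        rw [sum_Ico_telescope (fun n => ThT T (Real.log n - Real.log m)) h]; simp [ThT_zero]
    _ ≤ _ := by
        refine Finset.sum_le_sum fun n hn => ?_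
        rw [Finset.mem_Ico] at hn
        have h1 : 0 ≤ Real.log n - Real.log m := sub_nonneg.mpr (log_nat_mono hm hn.1)
        have h2 : Real.log n ≤ Real.log (n + 1 : ℕ) := log_nat_mono (by omega) (by omega)
        have h3 := (ThT_bounds hT h1 (by linarith :
          Real.log n - Real.log m ≤ Real.log (n + 1 : ℕ) - Real.log m)).2
        refine h3.trans ?_
        have h4 := log_succ_div_le (n := n) (by omega)
        rw [div_eq_mul_one_div]
        exact mul_le_mul_of_nonneg_left (by linarith) (KT_nonneg hT _)

lemma row_down {T : ℝ} (hT : 0 < T) {m c a : ℕ} (ha : 1 ≤ a) (hc : c ≤ m) :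
    ∑ n ∈ Finset.Ico a c, KT T (Real.log n - Real.log m) / n ≤
      2 * (1 / 2 - ThT T (Real.log m - Real.log c)) := by
  rcases le_total c a with h | h
  · rw [Finset.Ico_eq_empty (by omega), Finset.sum_empty]
    linarith [ThT_lt (T := T) (Real.log m - Real.log c)]
  calc _ ≤ ∑ n ∈ Finset.Ico a c, ((-2 * ThT T (Real.log m - Real.log (n + 1 : ℕ))) -
        (-2 * ThT T (Real.log m - Real.log n))) := by
        refine Finset.sum_le_sum fun n hn => ?_
        rw [Finset.mem_Ico] at hn
        have h1 : 0 ≤ Real.log m - Real.log (n + 1 : ℕ) :=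
          sub_nonneg.mpr (log_nat_mono (by omega) (by omega))
        have h2 : Real.log n ≤ Real.log (n + 1 : ℕ) := log_nat_mono (by omega) (by omega)
        have h3 := (ThT_bounds hT h1 (by linarith :
          Real.log m - Real.log (n + 1 : ℕ) ≤ Real.log m - Real.log n)).1
        have h4 := le_log_succ_div (n := n) (by omega)
        have hn0 : (0 : ℝ) < n := by exact_mod_cast (by omega : 0 < n)
        have h5 : (1 : ℝ) / n ≤ 2 * (1 / ((n + 1 : ℕ) : ℝ)) := by
          push_cast
          rw [mul_one_div, div_le_div_iff₀ hn0 (by linarith)]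
          have : (1 : ℝ) ≤ n := by exact_mod_cast (by omega : 1 ≤ n)
          linarith
        rw [← KT_even, neg_sub, div_eq_mul_one_div]
        have h6 : KT T (Real.log m - Real.log n) * (1 / n) ≤
          KT T (Real.log m - Real.log n) * (2 * (Real.log (n + 1 : ℕ) - Real.log n)) :=
          mul_le_mul_of_nonneg_left (by linarith) (KT_nonneg hT _)
        linarith
    _ = -2 * ThT T (Real.log m - Real.log c) - (-2 * ThT T (Real.log m - Real.log a)) :=
        sum_Ico_telescope (fun n => -2 * ThT T (Real.log m - Real.log n)) h
    _ ≤ _ := by linarith [ThT_lt (T := T) (Real.log m - Real.log a)]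

lemma row_total {T : ℝ} (hT : 0 < T) (S : Finset ℕ) (hS : ∀ n ∈ S, 1 ≤ n) {m : ℕ} (hm : 1 ≤ m) :
    ∑ n ∈ S, KT T (Real.log n - Real.log m) / n ≤ 3 / 2 + T / m := by
  set X := S.sup id + m + 1 with hX
  have hsub : S ⊆ Finset.Ico 1 X := by
    intro n hn
    rw [Finset.mem_Ico]
    have : n ≤ S.sup id := Finset.le_sup (f := id) hn
    exact ⟨hS n hn, by omega⟩
  have hnn : ∀ n : ℕ, 0 ≤ KT T (Real.log n - Real.log m) / n := fun n =>
    div_nonneg (KT_nonneg hT _) (Nat.cast_nonneg n)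
  refine (Finset.sum_le_sum_of_subset_of_nonneg hsub fun n _ _ => hnn n).trans ?_
  rw [← Finset.sum_Ico_consecutive _ hm (by omega : m ≤ X),
    Finset.sum_eq_sum_Ico_succ_bot (by omega : m < X)]
  have h1 := row_down hT (m := m) (c := m) (a := 1) le_rfl le_rfl
  have h2 := row_up hT (m := m) (c := m) (X := X - 1) hm le_rfl
  rw [Finset.sum_Ico_add' (fun n : ℕ => KT T (Real.log n - Real.log m) / n) m (X - 1) 1,
    show X - 1 + 1 = X by omega] at h2
  simp only [sub_self, ThT_zero] at h1 h2
  have h3 : KT T (Real.log m - Real.log m) / m ≤ T / m := by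
    gcongr
    refine (KT_le hT _).trans (div_le_self hT.le (by linarith [Real.pi_gt_three]))
  linarith

/-- Mean value theorem for Dirichlet polynomials. -/
lemma dp_mv {T : ℝ} (hT : 0 < T) (S : Finset ℕ) (a : ℕ → ℂ) (hS1 : ∀ n ∈ S, 1 ≤ n)
    (hS : ∀ n ∈ S, T ≤ n) :
    ∫ ξ, ‖dp S a ξ‖ ^ 2 ∂(muT T) ≤ 3 * ∑ n ∈ S, ‖a n‖ ^ 2 / n := by
  rw [dp_sq hT]
  have hle : ∀ m ∈ S, ∀ n ∈ S, (a m * starRingEnd ℂ (a n)).re / (m * n) * KT T (Real.log n - Real.log m) ≤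
      1 / 2 * (‖a m‖ ^ 2 / m * (KT T (Real.log n - Real.log m) / n)) +
      1 / 2 * (‖a n‖ ^ 2 / n * (KT T (Real.log m - Real.log n) / m)) := by
    intro m hm n hn
    have h1 : (a m * starRingEnd ℂ (a n)).re ≤ ‖a m‖ * ‖a n‖ := by
      refine (Complex.re_le_norm _).trans ?_
      rw [norm_mul, Complex.norm_conj]
    have h2 : KT T (Real.log m - Real.log n) = KT T (Real.log n - Real.log m) := by
      rw [← KT_even, neg_sub]
    rw [h2]
    have hm0 : (0 : ℝ) < m := by exact_mod_cast hS1 m hm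
    have hn0 : (0 : ℝ) < n := by exact_mod_cast hS1 n hn
    have hK := KT_nonneg hT (Real.log n - Real.log m)
    have h3 : (a m * starRingEnd ℂ (a n)).re ≤ 1 / 2 * (‖a m‖ ^ 2 + ‖a n‖ ^ 2) := by
      nlinarith [sq_nonneg (‖a m‖ - ‖a n‖)]
    calc _ ≤ 1 / 2 * (‖a m‖ ^ 2 + ‖a n‖ ^ 2) / (m * n) * KT T (Real.log n - Real.log m) := by gcongr
      _ = _ := by field_simp
  refine (Finset.sum_le_sum fun m hm => Finset.sum_le_sum fun n hn => hle m hm n hn).trans ?_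
  simp_rw [Finset.sum_add_distrib]
  have hrow : ∀ m ∈ S, ∑ n ∈ S, ‖a m‖ ^ 2 / m * (KT T (Real.log n - Real.log m) / n) ≤
      3 * (‖a m‖ ^ 2 / m) := by
    intro m hm
    rw [← Finset.mul_sum]
    have := row_total hT S hS1 (hS1 m hm)
    have hm0 : (0 : ℝ) < m := by exact_mod_cast hS1 m hm
    have h2 : T / m ≤ 1 := by rw [div_le_one hm0]; exact hS m hm
    rw [mul_comm 3]
    gcongr
    linarith
  have e1 : ∑ m ∈ S, ∑ n ∈ S, 1 / 2 * (‖a m‖ ^ 2 / m * (KT T (Real.log n - Real.log m) / n)) ≤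
      1 / 2 * (3 * ∑ n ∈ S, ‖a n‖ ^ 2 / n) := by
    simp_rw [← Finset.mul_sum (s := S) (a := (1 / 2 : ℝ))]
    gcongr
    rw [Finset.mul_sum]
    exact Finset.sum_le_sum hrow
  have e2 : ∑ m ∈ S, ∑ n ∈ S, 1 / 2 * (‖a n‖ ^ 2 / n * (KT T (Real.log m - Real.log n) / m)) ≤
      1 / 2 * (3 * ∑ n ∈ S, ‖a n‖ ^ 2 / n) := by
    rw [Finset.sum_comm]
    exact e1
  linarith

/-! ### Lower bound for the mean square under few sign changes -/

lemma exists_change {m n : ℕ} (hmn : m ≤ n) (h : lam m ≠ lam n) :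
    ∃ c, m ≤ c ∧ c < n ∧ lam c ≠ lam (c + 1) := by
  by_contra hcon
  push Not at hcon
  apply h
  induction n, hmn using Nat.le_induction with
  | base => rfl
  | succ n hn ih =>
    by_cases hne : lam m = lam n
    · rw [hne]; exact hcon n hn (by omega)
    · exact absurd (ih hne (fun c h1 h2 => hcon c h1 (by omega))) hne

lemma near_bad_card (S : Finset ℕ) (a b L : ℕ) (hS : S = Finset.Icc a b) :
    ((S ×ˢ S).filter (fun q : ℕ × ℕ => lam q.1 ≠ lam q.2 ∧ q.1 ≤ q.2 + L ∧ q.2 ≤ q.1 + L)).card ≤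
    (S.filter (fun n => lam n ≠ lam (n + 1))).card * (2 * L + 1) ^ 2 := by
  set D := S.filter (fun n => lam n ≠ lam (n + 1)) with hD
  have hsub : (S ×ˢ S).filter (fun q : ℕ × ℕ => lam q.1 ≠ lam q.2 ∧ q.1 ≤ q.2 + L ∧ q.2 ≤ q.1 + L) ⊆
      D.biUnion (fun c => Finset.Icc (c - L) (c + L) ×ˢ Finset.Icc (c - L) (c + L)) := by
    rintro ⟨m, n⟩ hq
    simp only [Finset.mem_filter, Finset.mem_product, hS, Finset.mem_Icc] at hq
    obtain ⟨⟨⟨h1, h2⟩, h3, h4⟩, h5, h6, h7⟩ := hq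
    rw [Finset.mem_biUnion]
    rcases le_total m n with h | h
    · obtain ⟨c, hc1, hc2, hc3⟩ := exists_change h h5
      refine ⟨c, ?_, ?_⟩
      · rw [hD, Finset.mem_filter, hS, Finset.mem_Icc]; exact ⟨⟨by omega, by omega⟩, hc3⟩
      · simp only [Finset.mem_product, Finset.mem_Icc]; omega
    · obtain ⟨c, hc1, hc2, hc3⟩ := exists_change h (Ne.symm h5)
      refine ⟨c, ?_, ?_⟩
      · rw [hD, Finset.mem_filter, hS, Finset.mem_Icc]; exact ⟨⟨by omega, by omega⟩, hc3⟩
      · simp only [Finset.mem_product, Finset.mem_Icc]; omega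
  refine (Finset.card_le_card hsub).trans ?_
  refine Finset.card_biUnion_le_card_mul _ _ _ fun c _ => ?_
  rw [Finset.card_product, Nat.card_Icc, sq]
  gcongr <;> omega

lemma far_row {T : ℝ} (hT : 0 < T) {N B L m : ℕ} (hN : 1 ≤ N) (hB : 1 ≤ B) (hL : 1 ≤ L) (hLN : L ≤ N)
    (hm : m ∈ Finset.Icc N (B * N)) :
    ∑ n ∈ (Finset.Icc N (B * N)).filter (fun n => ¬ (m ≤ n + L ∧ n ≤ m + L)),
      KT T (Real.log n - Real.log m) / n ≤ 4 * B * N / (T * L) := by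
  rw [Finset.mem_Icc] at hm
  have hm1 : 1 ≤ m := hN.trans hm.1
  have hm0 : (0 : ℝ) < m := by exact_mod_cast hm1
  have hL0 : (0 : ℝ) < L := by exact_mod_cast hL
  have hmB : (m : ℝ) ≤ B * N := by exact_mod_cast hm.2
  have hLB : (L : ℝ) ≤ B * N := by exact_mod_cast hLN.trans (Nat.le_mul_of_pos_left _ hB)
  have hnn : ∀ n : ℕ, 0 ≤ KT T (Real.log n - Real.log m) / n := fun n =>
    div_nonneg (KT_nonneg hT _) (Nat.cast_nonneg n)
  set f : ℕ → ℝ := fun n => KT T (Real.log n - Real.log m) / n with hf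
  have hsub : (Finset.Icc N (B * N)).filter (fun n => ¬ (m ≤ n + L ∧ n ≤ m + L)) ⊆
      Finset.Ico 1 (m - L) ∪ Finset.Ico (m + L + 1) (B * N + 1) := by
    intro n hn
    simp only [Finset.mem_filter, Finset.mem_Icc, Finset.mem_union, Finset.mem_Ico] at hn ⊢
    omega
  refine (Finset.sum_le_sum_of_subset_of_nonneg hsub fun n _ _ => hnn n).trans ?_
  rw [Finset.sum_union (Finset.disjoint_left.mpr fun n h1 h2 => by
    rw [Finset.mem_Ico] at h1 h2; omega)]
  have h1 : ∑ n ∈ Finset.Ico 1 (m - L), f n ≤ 2 * (m / (T * L)) := by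
    rcases Nat.eq_zero_or_pos (m - L) with h0 | h0
    · rw [h0]; simp; positivity
    refine (row_down hT (m := m) (c := m - L) (a := 1) le_rfl (Nat.sub_le _ _)).trans ?_
    have hc0 : (0 : ℝ) < ((m - L : ℕ) : ℝ) := by exact_mod_cast h0
    have hcast : ((m - L : ℕ) : ℝ) = m - L := by rw [Nat.cast_sub (by omega)]
    have hlog : (L : ℝ) / m ≤ Real.log m - Real.log (m - L : ℕ) := by
      rw [← Real.log_div hm0.ne' hc0.ne']
      refine le_trans (le_of_eq ?_) (Real.one_sub_inv_le_log_of_pos (by positivity))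
      rw [hcast]; rw [hcast] at hc0; field_simp; ring
    have hpos : 0 < (L : ℝ) / m := by positivity
    have h2 := ThT_ge hT (lt_of_lt_of_le hpos hlog)
    have h3 : 1 / (T * (Real.log m - Real.log (m - L : ℕ))) ≤ 1 / (T * (L / m)) := by gcongr
    have h4 : 1 / (T * (L / m)) = m / (T * L) := by field_simp
    linarith
  have h2 : ∑ n ∈ Finset.Ico (m + L + 1) (B * N + 1), f n ≤ (m + L) / (T * L) := by
    have e := row_up hT (m := m) (c := m + L) (X := B * N) hm1 (by omega)
    rw [Finset.sum_Ico_add' (fun n : ℕ => KT T (Real.log n - Real.log m) / n) (m + L) (B * N) 1] at e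
    refine e.trans ?_
    have hlog : (L : ℝ) / (m + L) ≤ Real.log (m + L : ℕ) - Real.log m := by
      have hc0 : (0 : ℝ) < ((m + L : ℕ) : ℝ) := by positivity
      rw [← Real.log_div hc0.ne' hm0.ne']
      refine le_trans (le_of_eq ?_) (Real.one_sub_inv_le_log_of_pos (by positivity))
      push_cast; field_simp; ring
    have hpos : 0 < (L : ℝ) / (m + L) := by positivity
    have h2 := ThT_ge hT (lt_of_lt_of_le hpos hlog)
    have h3 : 1 / (T * (Real.log (m + L : ℕ) - Real.log m)) ≤ 1 / (T * (L / (m + L))) := by gcongr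
    have h4 : 1 / (T * (L / (m + L))) = (m + L) / (T * L) := by field_simp
    linarith
  calc _ ≤ 2 * (m / (T * L)) + (m + L) / (T * L) := add_le_add h1 h2
    _ = (3 * m + L) / (T * L) := by field_simp; ring
    _ ≤ _ := by gcongr; linarith

lemma total_lower {T : ℝ} (hT : 0 < T) {N B : ℕ} (hN : 1 ≤ N) (hB : 1 ≤ B) {τ : ℝ} (hτ : 0 < τ) 
    (hτB : τ < Real.log B) (hTt : 2 / (T * τ) ≤ 1) :
    (Real.log B - τ) * (1 - 2 / (T * τ)) - T / N * (∑ m ∈ Finset.Icc N (B * N), (1 : ℝ) / m) ≤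
    ∑ m ∈ Finset.Icc N (B * N), ∑ n ∈ Finset.Icc N (B * N),
      KT T (Real.log n - Real.log m) / (m * n) := by
  set S := Finset.Icc N (B * N) with hS
  have hpos : ∀ m ∈ S, (0 : ℝ) < m := by
    intro m hm; rw [hS, Finset.mem_Icc] at hm; exact_mod_cast hN.trans hm.1
  have hN0 : (0 : ℝ) < N := by exact_mod_cast hN
  have hB0 : (0 : ℝ) < B := by exact_mod_cast hB
  set f : ℕ → ℕ → ℝ := fun m n => KT T (Real.log n - Real.log m) / (m * n) with hf
  have hsymm : ∀ m n, f m n = f n m := by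
    intro m n; simp only [hf]; rw [← KT_even, neg_sub, mul_comm]
  have hsplit : ∑ m ∈ S, ∑ n ∈ S, f m n = 2 * (∑ m ∈ S, ∑ n ∈ S.filter (fun n => m ≤ n), f m n)
      - ∑ m ∈ S, f m m := by
    have h1 : ∀ m ∈ S, ∑ n ∈ S, f m n = ∑ n ∈ S.filter (fun n => m ≤ n), f m n +
        ∑ n ∈ S.filter (fun n => ¬ m ≤ n), f m n := fun m _ =>
      (Finset.sum_filter_add_sum_filter_not S _ _).symm
    rw [Finset.sum_congr rfl h1, Finset.sum_add_distrib]
    have h2 : ∑ m ∈ S, ∑ n ∈ S.filter (fun n => ¬ m ≤ n), f m n =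
        ∑ n ∈ S, ∑ m ∈ S.filter (fun m => n < m), f n m := by
      rw [Finset.sum_comm' (t' := S) (s' := fun n => S.filter (fun m => n < m))]
      · exact Finset.sum_congr rfl fun n _ => Finset.sum_congr rfl fun m _ => hsymm m n
      · intro x y; simp only [Finset.mem_filter, not_le]; tauto
    have h3 : ∀ n ∈ S, ∑ m ∈ S.filter (fun m => n < m), f n m =
        ∑ m ∈ S.filter (fun m => n ≤ m), f n m - f n n := by
      intro n hn
      have : S.filter (fun m => n ≤ m) = insert n (S.filter (fun m => n < m)) := by
        ext x; simp only [Finset.mem_filter, Finset.mem_insert]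
        constructor
        · rintro ⟨h, h'⟩; rcases h'.eq_or_lt with rfl | h''
          · left; rfl
          · right; exact ⟨h, h''⟩
        · rintro (rfl | ⟨h, h'⟩)
          · exact ⟨hn, le_rfl⟩
          · exact ⟨h, h'.le⟩
      rw [this, Finset.sum_insert (by simp)]; ring
    rw [h2, Finset.sum_congr rfl h3, Finset.sum_sub_distrib]; ring
  have hdiag : ∑ m ∈ S, f m m ≤ T / N * (∑ m ∈ S, (1 : ℝ) / m) := by
    rw [Finset.mul_sum]
    refine Finset.sum_le_sum fun m hm => ?_
    have hm0 := hpos m hm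
    have hNm : (N : ℝ) ≤ m := by rw [hS, Finset.mem_Icc] at hm; exact_mod_cast hm.1
    have hK : KT T (Real.log m - Real.log m) ≤ T :=
      (KT_le hT _).trans (div_le_self hT.le (by linarith [Real.pi_gt_three]))
    simp only [hf]
    calc _ ≤ T / (m * m) := by gcongr
      _ = T / m * (1 / m) := by field_simp
      _ ≤ T / N * (1 / m) := by gcongr
  have hrow : ∀ m ∈ S, ThT T (Real.log (B * N + 1 : ℕ) - Real.log m) * (1 / m) ≤
      ∑ n ∈ S.filter (fun n => m ≤ n), f m n := by
    intro m hm
    have hm0 := hpos m hm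
    have hm' := hm
    rw [hS, Finset.mem_Icc] at hm'
    have e := row_up_lower hT (m := m) (X := B * N + 1) (hN.trans hm'.1) (by omega)
    have e2 : S.filter (fun n => m ≤ n) = Finset.Ico m (B * N + 1) := by
      ext x; simp only [hS, Finset.mem_filter, Finset.mem_Icc, Finset.mem_Ico]; omega
    rw [e2]
    calc _ ≤ (∑ n ∈ Finset.Ico m (B * N + 1), KT T (Real.log n - Real.log m) / n) * (1 / m) := by gcongr
      _ = _ := by
        rw [Finset.sum_mul]
        refine Finset.sum_congr rfl fun n _ => ?_
        simp only [hf]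
        rw [div_mul_div_comm, mul_one, mul_comm (n : ℝ)]
  have hmain : (Real.log B - τ) * (1 - 2 / (T * τ)) ≤
      2 * ∑ m ∈ S, ThT T (Real.log (B * N + 1 : ℕ) - Real.log m) * (1 / m) := by
    set M := ⌊(B : ℝ) * N * Real.exp (-τ)⌋₊ with hM
    have hMle : (M : ℝ) ≤ B * N * Real.exp (-τ) := Nat.floor_le (by positivity)
    have hexp : Real.exp (-τ) ≤ 1 := by rw [Real.exp_le_one_iff]; linarith
    have hMB : M ≤ B * N := by
      have : (M : ℝ) ≤ B * N := hMle.trans (mul_le_of_le_one_right (by positivity) hexp)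
      exact_mod_cast this
    have hNM : N ≤ M := by
      apply Nat.le_floor
      have : Real.exp (-Real.log B) ≤ Real.exp (-τ) := Real.exp_le_exp.mpr (by linarith)
      rw [Real.exp_neg, Real.exp_log hB0] at this
      calc (N : ℝ) = B * N * (B : ℝ)⁻¹ := by field_simp
        _ ≤ _ := by gcongr
    have hsub : Finset.Icc N M ⊆ S := by
      intro x hx; rw [hS]; rw [Finset.mem_Icc] at hx ⊢; omega
    have hnn : ∀ m ∈ S, 0 ≤ ThT T (Real.log (B * N + 1 : ℕ) - Real.log m) * (1 / m) := by
      intro m hm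
      have hm' := hm
      rw [hS, Finset.mem_Icc] at hm'
      have := log_nat_mono (hN.trans hm'.1) (by omega : m ≤ B * N + 1)
      have h2 := ThT_mono hT (sub_nonneg.mpr this)
      rw [ThT_zero] at h2
      positivity
    have h1 : (1 / 2 - 1 / (T * τ)) * ∑ m ∈ Finset.Icc N M, (1 : ℝ) / m ≤
        ∑ m ∈ S, ThT T (Real.log (B * N + 1 : ℕ) - Real.log m) * (1 / m) := by
      refine le_trans ?_ (Finset.sum_le_sum_of_subset_of_nonneg hsub fun m hm _ => hnn m hm)
      rw [Finset.mul_sum]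
      refine Finset.sum_le_sum fun m hm => ?_
      have hm0 := hpos m (hsub hm)
      rw [Finset.mem_Icc] at hm
      gcongr
      have hτle : τ ≤ Real.log (B * N + 1 : ℕ) - Real.log m := by
        have a1 : Real.log m ≤ Real.log (B * N * Real.exp (-τ)) :=
          Real.log_le_log hm0 (le_trans (by exact_mod_cast hm.2) hMle)
        rw [Real.log_mul (by positivity) (by positivity), Real.log_exp] at a1
        have a2 : Real.log ((B : ℝ) * N) ≤ Real.log (B * N + 1 : ℕ) :=
          Real.log_le_log (by positivity) (by push_cast; linarith)
        linarith
      exact (ThT_ge hT hτ).trans (ThT_mono hT hτle)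
    have h2 := harm_lower hN hNM
    have h3 : Real.log B - τ ≤ Real.log (M + 1 : ℕ) - Real.log N := by
      have : Real.log (B * N * Real.exp (-τ)) ≤ Real.log (M + 1 : ℕ) :=
        Real.log_le_log (by positivity) (by push_cast; exact (Nat.lt_floor_add_one _).le)
      rw [Real.log_mul (by positivity) (by positivity), Real.log_exp,
        Real.log_mul (by positivity) (by positivity)] at this
      linarith
    have h4 : 1 / (T * τ) = 2 / (T * τ) / 2 := by ring
    rw [h4] at h1
    nlinarith
  rw [hsplit]
  have := Finset.sum_le_sum hrow
  linarith

lemma meanSq_lower (B : ℕ) (hB : 2 ≤ B) (H : ℝ) (hH : 1 ≤ H) (ε : ℝ) (hε : 0 < ε) :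
    ∃ δ > (0 : ℝ), ∃ N0 : ℕ, ∀ N : ℕ, N0 ≤ N →
      (((Finset.Icc N (B * N)).filter (fun n => lam n ≠ lam (n + 1))).card : ℝ) ≤ δ * N →
      Real.log B - ε - (Real.log B + 1) / H ≤
        ∫ ξ, ‖dp (Finset.Icc N (B * N)) (fun n => (lam n : ℂ)) ξ‖ ^ 2 ∂(muT (N / H)) := by
  have hB0 : (0 : ℝ) < B := by positivity
  have hlB : 0 < Real.log B := Real.log_pos (by exact_mod_cast hB)
  set τ := min (ε / 4) (Real.log B / 2) with hτ
  have hτ0 : 0 < τ := by positivity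
  have hτ1 : τ ≤ ε / 4 := min_le_left _ _
  have hτ2 : τ < Real.log B := lt_of_le_of_lt (min_le_right _ _) (by linarith)
  set L := ⌈32 * B * H * (Real.log B + 1) / ε⌉₊ + 1 with hL
  have hL1 : 1 ≤ L := by omega
  have hL0 : (0 : ℝ) < L := by exact_mod_cast hL1
  have hLge : 32 * B * H * (Real.log B + 1) / ε ≤ L := by
    rw [hL]; push_cast; linarith [Nat.le_ceil (32 * B * H * (Real.log B + 1) / ε)]
  refine ⟨ε / (8 * (2 * L + 1) ^ 2), by positivity,
    max L (⌈8 * H * (Real.log B + 1) / (ε * τ) + 2 * H / τ⌉₊ + 1), ?_⟩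
  intro N hN hch
  have hLN : L ≤ N := (le_max_left _ _).trans hN
  have hN1 : 1 ≤ N := hL1.trans hLN
  have hN0 : (0 : ℝ) < N := by exact_mod_cast hN1
  have hNge : 8 * H * (Real.log B + 1) / (ε * τ) + 2 * H / τ ≤ N := by
    have h1 : (⌈8 * H * (Real.log B + 1) / (ε * τ) + 2 * H / τ⌉₊ + 1) ≤ N := (le_max_right _ _).trans hN
    have h2 : ((⌈8 * H * (Real.log B + 1) / (ε * τ) + 2 * H / τ⌉₊ : ℕ) : ℝ) ≤ N := by
      exact_mod_cast (by omega : _ ≤ N)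
    exact (Nat.le_ceil _).trans h2
  set T : ℝ := N / H with hTdef
  have hH0 : 0 < H := by linarith
  have hT : 0 < T := by positivity
  set S := Finset.Icc N (B * N) with hS
  have hpos : ∀ m ∈ S, (0 : ℝ) < m := by
    intro m hm; rw [hS, Finset.mem_Icc] at hm; exact_mod_cast hN1.trans hm.1
  have hNle : ∀ m ∈ S, (N : ℝ) ≤ m := by
    intro m hm; rw [hS, Finset.mem_Icc] at hm; exact_mod_cast hm.1
  have hTt : 2 / (T * τ) ≤ 1 := by
    rw [div_le_one (by positivity), hTdef]
    have : 2 * H / τ ≤ N := le_trans (by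
      have : 0 ≤ 8 * H * (Real.log B + 1) / (ε * τ) := by positivity
      linarith) hNge
    rw [div_le_iff₀ hτ0] at this
    rw [div_mul_eq_mul_div, le_div_iff₀ hH0]; linarith
  have hTt2 : Real.log B * (2 / (T * τ)) ≤ ε / 4 := by
    have : 8 * H * (Real.log B + 1) / (ε * τ) ≤ N := le_trans (by
      have : 0 ≤ 2 * H / τ := by positivity
      linarith) hNge
    rw [div_le_iff₀ (by positivity)] at this
    rw [hTdef, show Real.log B * (2 / (N / H * τ)) = 2 * H * Real.log B / (N * τ) by field_simp,
      div_le_iff₀ (by positivity)]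
    nlinarith
  have htot := total_lower hT hN1 (by omega : 1 ≤ B) hτ0 hτ2 hTt
  rw [← hS] at htot
  have hharm : ∑ m ∈ S, (1 : ℝ) / m ≤ Real.log B + 1 := by
    have := harm_upper hN1 (by nlinarith : N ≤ B * N)
    push_cast at this
    rw [Real.log_mul (by positivity) (by positivity)] at this
    have h2 : 1 / (N : ℝ) ≤ 1 := by rw [div_le_one hN0]; exact_mod_cast hN1
    rw [hS]; linarith
  have hTN : T / N = 1 / H := by rw [hTdef]; field_simp
  -- main expansion
  rw [dp_sq hT]
  have hterm : ∀ m ∈ S, ∀ n ∈ S, KT T (Real.log n - Real.log m) / (m * n) -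
      2 * ((if ¬ (m ≤ n + L ∧ n ≤ m + L) then KT T (Real.log n - Real.log m) / (m * n) else 0) +
        (if (lam m ≠ lam n ∧ m ≤ n + L ∧ n ≤ m + L) then T / (N * N) else 0)) ≤
      (((lam m : ℝ) : ℂ) * starRingEnd ℂ ((lam n : ℝ) : ℂ)).re / (m * n) * KT T (Real.log n - Real.log m) := by
    intro m hm n hn
    have hm0 := hpos m hm
    have hn0 := hpos n hn
    have hK := KT_nonneg hT (Real.log n - Real.log m)
    have hK2 : KT T (Real.log n - Real.log m) ≤ T :=
      (KT_le hT _).trans (div_le_self hT.le (by linarith [Real.pi_gt_three]))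
    have hq : 0 ≤ KT T (Real.log n - Real.log m) / (m * n) := by positivity
    have hq2 : KT T (Real.log n - Real.log m) / (m * n) ≤ T / (N * N) := by
      have := hNle m hm
      have := hNle n hn
      gcongr
    have hq3 : 0 ≤ T / ((N : ℝ) * N) := by positivity
    rw [Complex.conj_ofReal, ← Complex.ofReal_mul, Complex.ofReal_re, div_mul_eq_mul_div, mul_div_assoc]
    by_cases heq : lam m = lam n
    · rw [heq, lam_sq, one_mul]
      simp only [ne_eq, not_true_eq_false, false_and, if_false]
      split_ifs <;> linarith
    · have : lam m * lam n = -1 := by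
        rcases lam_eq m with a | a <;> rcases lam_eq n with b | b <;> rw [a, b] at heq ⊢ <;> first | exact absurd rfl heq | norm_num
      rw [this]
      by_cases hnear : m ≤ n + L ∧ n ≤ m + L
      · rw [if_neg (not_not.mpr hnear), if_pos ⟨heq, hnear⟩]; linarith
      · rw [if_pos hnear, if_neg (fun h => hnear h.2)]; linarith
  refine le_trans ?_ (Finset.sum_le_sum fun m hm => Finset.sum_le_sum fun n hn => hterm m hm n hn)
  simp_rw [Finset.sum_sub_distrib, ← Finset.mul_sum, Finset.sum_add_distrib]
  have hfar : ∑ m ∈ S, ∑ n ∈ S, (if ¬ (m ≤ n + L ∧ n ≤ m + L) then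
      KT T (Real.log n - Real.log m) / (m * n) else 0) ≤ ε / 8 := by
    calc _ ≤ ∑ m ∈ S, (4 * B * N / (T * L)) * (1 / m) := by
          refine Finset.sum_le_sum fun m hm => ?_
          rw [← Finset.sum_filter]
          have hm0 := hpos m hm
          have := far_row hT hN1 (by omega : 1 ≤ B) hL1 hLN hm
          calc _ = (∑ n ∈ S.filter (fun n => ¬ (m ≤ n + L ∧ n ≤ m + L)),
                KT T (Real.log n - Real.log m) / n) * (1 / m) := by
                rw [Finset.sum_mul]
                refine Finset.sum_congr rfl fun n _ => ?_
                rw [div_mul_div_comm, mul_one, mul_comm (n : ℝ)]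
            _ ≤ _ := by gcongr
      _ = (4 * B * N / (T * L)) * ∑ m ∈ S, (1 : ℝ) / m := by rw [Finset.mul_sum]
      _ ≤ (4 * B * N / (T * L)) * (Real.log B + 1) := by gcongr
      _ ≤ ε / 8 := by
          rw [div_le_iff₀ hε] at hLge
          rw [hTdef, show 4 * (B : ℝ) * N / (N / H * L) * (Real.log B + 1) =
            4 * B * H * (Real.log B + 1) / L by field_simp, div_le_iff₀ hL0]
          linarith
  have hnear : ∑ m ∈ S, ∑ n ∈ S, (if (lam m ≠ lam n ∧ m ≤ n + L ∧ n ≤ m + L) then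
      T / ((N : ℝ) * N) else 0) ≤ ε / 8 := by
    rw [← Finset.sum_product' (f := fun m n : ℕ => (if (lam m ≠ lam n ∧ m ≤ n + L ∧ n ≤ m + L) then
      T / ((N : ℝ) * N) else 0)), ← Finset.sum_filter, Finset.sum_const, nsmul_eq_mul]
    have hcard := near_bad_card S N (B * N) L hS
    have hcard' : (((S ×ˢ S).filter (fun q : ℕ × ℕ => lam q.1 ≠ lam q.2 ∧ q.1 ≤ q.2 + L ∧ q.2 ≤ q.1 + L)).card : ℝ)
      ≤ (S.filter (fun n => lam n ≠ lam (n + 1))).card * (2 * L + 1) ^ 2 := by exact_mod_cast hcard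
    calc _ ≤ ((S.filter (fun n => lam n ≠ lam (n + 1))).card * (2 * L + 1) ^ 2 : ℝ) * (T / (N * N)) := by
          gcongr
      _ ≤ (ε / (8 * (2 * L + 1) ^ 2) * N * (2 * L + 1) ^ 2) * (T / (N * N)) := by gcongr
      _ = ε / 8 * (1 / H) := by rw [hTdef]; field_simp
      _ ≤ ε / 8 * 1 := by
          gcongr
          rw [div_le_one hH0]; exact hH
      _ = _ := by ring
  have e1 : (Real.log B + 1) / H = 1 / H * (Real.log B + 1) := by ring
  have e2 : 1 / H * ∑ m ∈ S, (1 : ℝ) / m ≤ 1 / H * (Real.log B + 1) := by gcongr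
  have e3 : 0 ≤ 2 / (T * τ) := by positivity
  rw [hTN] at htot
  nlinarith

/-! ### Bessel inequality -/

noncomputable def hat (ν : Measure ℝ) (φ : ℝ → ℂ) (u : ℝ) : ℂ := ∫ ξ, φ ξ * cis (u * ξ) ∂ν

@[fun_prop]
lemma continuous_KT (T : ℝ) : Continuous (KT T) := by
  unfold KT
  refine Continuous.div (by fun_prop) (by fun_prop) fun x => ?_
  positivity

lemma KT_integral {T : ℝ} (hT : 0 < T) : Integrable (KT T) ∧ ∫ x, KT T x = 1 := by
  have h : KT T = fun x => T / Real.pi * (fun y : ℝ => (1 + y ^ 2)⁻¹) (T * x) := by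
    funext x; unfold KT; simp [div_eq_mul_inv]
  constructor
  · rw [h]
    exact (integrable_inv_one_add_sq.comp_mul_left' hT.ne').const_mul _
  · rw [h, integral_const_mul, Measure.integral_comp_mul_left (fun y : ℝ => (1 + y ^ 2)⁻¹), integral_univ_inv_one_add_sq,
      abs_of_pos (inv_pos.mpr hT), smul_eq_mul]
    have := Real.pi_pos
    field_simp

lemma KT_shift {T : ℝ} (hT : 0 < T) {ν : Measure ℝ}
    (hν : ν ≤ ENNReal.ofReal (1 / (2 * Real.pi)) • volume) (y : ℝ) :
    ∫ x, KT T (y - x) ∂ν ≤ 1 / (2 * Real.pi) := by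
  have hi : Integrable (fun x => KT T (y - x)) := (KT_integral hT).1.comp_sub_left y
  have h1 : ∫ x, KT T (y - x) ∂ν ≤
      ∫ x, KT T (y - x) ∂(ENNReal.ofReal (1 / (2 * Real.pi)) • volume) :=
    integral_mono_measure hν (Eventually.of_forall fun x => KT_nonneg hT _)
      (hi.smul_measure (by simp))
  rw [integral_smul_measure, integral_sub_left_eq_self (KT T) volume y, (KT_integral hT).2,
    ENNReal.toReal_ofReal (by positivity)] at h1
  simpa using h1

lemma hat_norm_sq (ν : Measure ℝ) [IsFiniteMeasure ν] (φ : ℝ → ℂ) (u : ℝ) :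
    ((‖hat ν φ u‖ ^ 2 : ℝ) : ℂ) =
      ∫ z : ℝ × ℝ, φ z.1 * starRingEnd ℂ (φ z.2) * cis (u * (z.1 - z.2)) ∂(ν.prod ν) := by
  rw [← Complex.normSq_eq_norm_sq, Complex.normSq_eq_conj_mul_self, mul_comm]
  unfold hat
  rw [← integral_conj, ← integral_prod_mul]
  refine integral_congr_ae (Eventually.of_forall fun z => ?_)
  simp only [map_mul, conj_cis]
  rw [mul_mul_mul_comm, ← cis_add]
  congr 2; ring

lemma continuous_hat (ν : Measure ℝ) [IsFiniteMeasure ν] {φ : ℝ → ℂ} (hφ : Continuous φ) {C : ℝ}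
    (hC : ∀ x, ‖φ x‖ ≤ C) : Continuous (hat ν φ) := by
  unfold hat
  refine continuous_of_dominated (bound := fun _ => C) (fun u => ?_) (fun u => ?_) (integrable_const _) ?_
  · exact (hφ.mul (by fun_prop)).aestronglyMeasurable
  · exact Eventually.of_forall fun x => by rw [norm_mul, norm_cis, mul_one]; exact hC x
  · exact Eventually.of_forall fun x => continuous_const.mul (continuous_cis.comp (by fun_prop))

lemma hat_bound (ν : Measure ℝ) [IsFiniteMeasure ν] {φ : ℝ → ℂ} {C : ℝ}
    (hC : ∀ x, ‖φ x‖ ≤ C) (u : ℝ) : ‖hat ν φ u‖ ≤ C * ν.real Set.univ := by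
  unfold hat
  refine norm_integral_le_of_norm_le_const (Eventually.of_forall fun x => ?_)
  rw [norm_mul, norm_cis, mul_one]; exact hC x

lemma cont_prod_int (ν : Measure ℝ) [IsFiniteMeasure ν] {E : Type*} [NormedAddCommGroup E]
    [SecondCountableTopology E] {f : ℝ × ℝ → E} (hf : Continuous f) {C : ℝ} (hC : ∀ x, ‖f x‖ ≤ C) :
    Integrable f (ν.prod ν) :=
  Integrable.of_bound hf.aestronglyMeasurable C (Eventually.of_forall hC)

lemma hat_poisson {T : ℝ} (hT : 0 < T) (ν : Measure ℝ) [IsFiniteMeasure ν]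
    (hν : ν ≤ ENNReal.ofReal (1 / (2 * Real.pi)) • volume)
    {φ : ℝ → ℂ} (hφ : Continuous φ) {C : ℝ} (hC : ∀ x, ‖φ x‖ ≤ C) :
    ∫ u, ‖hat ν φ u‖ ^ 2 ∂(muT T) ≤ 1 / (2 * Real.pi) * ∫ ξ, ‖φ ξ‖ ^ 2 ∂ν := by
  have := muT_finite hT
  have hC0 : 0 ≤ C := (norm_nonneg _).trans (hC 0)
  have hsq : ∀ x, ‖φ x‖ ^ 2 ≤ C ^ 2 := fun x => by gcongr; exact hC x
  have e1 : ((∫ u, ‖hat ν φ u‖ ^ 2 ∂(muT T) : ℝ) : ℂ) =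
      ∫ z : ℝ × ℝ, φ z.1 * starRingEnd ℂ (φ z.2) * (KT T (z.1 - z.2) : ℂ) ∂(ν.prod ν) := by
    rw [← integral_complex_ofReal]
    simp_rw [hat_norm_sq]
    rw [integral_integral_swap]
    · refine integral_congr_ae (Eventually.of_forall fun z => ?_)
      simp only
      rw [integral_const_mul, muT_cis hT]
    · refine Integrable.of_bound (C := C * C) (Continuous.aestronglyMeasurable ?_)
        (Eventually.of_forall fun z => ?_)
      · unfold Function.uncurry
        have := Complex.continuous_conj
        exact ((hφ.comp (by fun_prop)).mul (this.comp (hφ.comp (by fun_prop)))).mul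
          (continuous_cis.comp (by fun_prop))
      · simp only [Function.uncurry, norm_mul, norm_cis, mul_one, RCLike.norm_conj]
        exact mul_le_mul (hC _) (hC _) (norm_nonneg _) hC0
  have e2 : ∫ u, ‖hat ν φ u‖ ^ 2 ∂(muT T) ≤
      ∫ z : ℝ × ℝ, ‖φ z.1 * starRingEnd ℂ (φ z.2) * (KT T (z.1 - z.2) : ℂ)‖ ∂(ν.prod ν) := by
    have h0 : 0 ≤ ∫ u, ‖hat ν φ u‖ ^ 2 ∂(muT T) := integral_nonneg fun u => by positivity
    have := norm_integral_le_integral_norm (μ := ν.prod ν)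
      (fun z : ℝ × ℝ => φ z.1 * starRingEnd ℂ (φ z.2) * (KT T (z.1 - z.2) : ℂ))
    rw [← e1, Complex.norm_real, Real.norm_eq_abs, abs_of_nonneg h0] at this
    exact this
  have hKb : ∀ x, |KT T x| ≤ T / Real.pi := fun x => by
    rw [abs_of_nonneg (KT_nonneg hT x)]; exact KT_le hT x
  have i1 : Integrable (fun z : ℝ × ℝ => ‖φ z.1‖ ^ 2 * KT T (z.1 - z.2)) (ν.prod ν) := by
    refine cont_prod_int ν (C := C ^ 2 * (T / Real.pi)) ?_ fun z => ?_
    · exact ((hφ.comp continuous_fst).norm.pow 2).mul ((continuous_KT T).comp (by fun_prop))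
    · rw [norm_mul, norm_pow, norm_norm, Real.norm_eq_abs]
      exact mul_le_mul (hsq _) (hKb _) (abs_nonneg _) (by positivity)
  have i2 : Integrable (fun z : ℝ × ℝ => ‖φ z.2‖ ^ 2 * KT T (z.1 - z.2)) (ν.prod ν) := by
    refine cont_prod_int ν (C := C ^ 2 * (T / Real.pi)) ?_ fun z => ?_
    · exact ((hφ.comp continuous_snd).norm.pow 2).mul ((continuous_KT T).comp (by fun_prop))
    · rw [norm_mul, norm_pow, norm_norm, Real.norm_eq_abs]
      exact mul_le_mul (hsq _) (hKb _) (abs_nonneg _) (by positivity)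
  have e3 : ∫ z : ℝ × ℝ, ‖φ z.1 * starRingEnd ℂ (φ z.2) * (KT T (z.1 - z.2) : ℂ)‖ ∂(ν.prod ν) ≤
      ∫ z : ℝ × ℝ, (1 / 2 * (‖φ z.1‖ ^ 2 * KT T (z.1 - z.2)) +
        1 / 2 * (‖φ z.2‖ ^ 2 * KT T (z.1 - z.2))) ∂(ν.prod ν) := by
    refine integral_mono_of_nonneg (Eventually.of_forall fun z => norm_nonneg _)
      ((i1.const_mul _).add (i2.const_mul _)) (Eventually.of_forall fun z => ?_)
    simp only [norm_mul, RCLike.norm_conj, Complex.norm_real, Real.norm_eq_abs,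
      abs_of_nonneg (KT_nonneg hT _)]
    have := KT_nonneg hT (z.1 - z.2)
    nlinarith [sq_nonneg (‖φ z.1‖ - ‖φ z.2‖), mul_nonneg this (sq_nonneg (‖φ z.1‖ - ‖φ z.2‖))]
  rw [integral_add (i1.const_mul _) (i2.const_mul _), integral_const_mul, integral_const_mul,
    integral_prod _ i1, integral_prod_symm _ i2] at e3
  have isq : Integrable (fun x => ‖φ x‖ ^ 2) ν :=
    integrable_of_cont_bdd (hφ.norm.pow 2) (C := C ^ 2) fun x => by
      rw [norm_pow, norm_norm]; exact hsq x
  have e4 : ∫ x, ∫ y, ‖φ x‖ ^ 2 * KT T (x - y) ∂ν ∂ν ≤ 1 / (2 * Real.pi) * ∫ ξ, ‖φ ξ‖ ^ 2 ∂ν := by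
    rw [← integral_const_mul]
    refine integral_mono i1.integral_prod_left (isq.const_mul _) fun x => ?_
    simp only
    rw [integral_const_mul, mul_comm]
    gcongr
    exact KT_shift hT hν x
  have e5 : ∫ y, ∫ x, ‖φ y‖ ^ 2 * KT T (x - y) ∂ν ∂ν ≤ 1 / (2 * Real.pi) * ∫ ξ, ‖φ ξ‖ ^ 2 ∂ν := by
    rw [← integral_const_mul]
    refine integral_mono i2.integral_prod_right (isq.const_mul _) fun x => ?_
    simp only
    rw [integral_const_mul, mul_comm]
    gcongr
    have := KT_shift hT hν x
    simp_rw [← KT_even T (x - _), neg_sub] at this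
    exact this
  simp only at e3
  linarith

lemma hat_plancherel (ν : Measure ℝ) [IsFiniteMeasure ν]
    (hν : ν ≤ ENNReal.ofReal (1 / (2 * Real.pi)) • volume)
    {φ : ℝ → ℂ} (hφ : Continuous φ) {C : ℝ} (hC : ∀ x, ‖φ x‖ ≤ C) (a b : ℝ) (hab : a ≤ b) :
    ∫ u in a..b, ‖hat ν φ u‖ ^ 2 ≤ ∫ ξ, ‖φ ξ‖ ^ 2 ∂ν := by
  set R := |a| + |b| with hR
  set I := ∫ ξ, ‖φ ξ‖ ^ 2 ∂ν with hI
  have key : ∀ T : ℝ, 0 < T → ∫ u in a..b, ‖hat ν φ u‖ ^ 2 ≤ Real.exp (R / T) * I := by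
    intro T hT
    have := muT_finite hT
    have hp := hat_poisson hT ν hν hφ hC
    rw [muT_integral] at hp
    simp only [smul_eq_mul] at hp
    have hcont : Continuous fun u => ‖hat ν φ u‖ ^ 2 := (continuous_hat ν hφ hC).norm.pow 2
    have hIntg : Integrable (fun u => wt T u * ‖hat ν φ u‖ ^ 2) := by
      have h1 : Integrable (fun u => ‖hat ν φ u‖ ^ 2 * wt T u) :=
        (wt_integrable hT).bdd_mul (c := (C * ν.real Set.univ) ^ 2) hcont.aestronglyMeasurable
          (Eventually.of_forall fun u => by
            rw [norm_pow, norm_norm]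
            gcongr; exact hat_bound ν hC u)
      exact h1.congr (Eventually.of_forall fun u => mul_comm _ _)
    rw [intervalIntegral.integral_of_le hab]
    have hwc : Continuous fun u => Real.exp (R / T) * (2 * Real.pi) * (wt T u * ‖hat ν φ u‖ ^ 2) :=
      continuous_const.mul ((continuous_wt T).mul hcont)
    calc ∫ u in Set.Ioc a b, ‖hat ν φ u‖ ^ 2
        ≤ ∫ u in Set.Ioc a b, Real.exp (R / T) * (2 * Real.pi) * (wt T u * ‖hat ν φ u‖ ^ 2) := by
          refine setIntegral_mono_on (hcont.integrableOn_Ioc)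
            hwc.integrableOn_Ioc measurableSet_Ioc fun u hu => ?_
          have hu' : |u| ≤ R := by
            rw [abs_le, hR]
            constructor
            · linarith [neg_abs_le a, hu.1, abs_nonneg b]
            · linarith [le_abs_self b, hu.2, abs_nonneg a]
          have : 1 ≤ Real.exp (R / T) * (2 * Real.pi) * wt T u := by
            unfold wt
            have hpi := Real.pi_pos
            have e : Real.exp (R / T) * (2 * Real.pi) * (Real.exp (-(|u| / T)) / (2 * Real.pi))
              = Real.exp (R / T + -(|u| / T)) := by rw [Real.exp_add]; field_simp
            rw [e, Real.one_le_exp_iff]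
            have : |u| / T ≤ R / T := by gcongr
            linarith
          calc ‖hat ν φ u‖ ^ 2 = 1 * ‖hat ν φ u‖ ^ 2 := (one_mul _).symm
            _ ≤ (Real.exp (R / T) * (2 * Real.pi) * wt T u) * ‖hat ν φ u‖ ^ 2 := by gcongr
            _ = _ := by ring
      _ ≤ ∫ u, Real.exp (R / T) * (2 * Real.pi) * (wt T u * ‖hat ν φ u‖ ^ 2) := by
          refine setIntegral_le_integral (hIntg.const_mul _) (Eventually.of_forall fun u => ?_)
          have := wt_pos T u
          simp only [Pi.zero_apply]
          positivity
      _ ≤ Real.exp (R / T) * I := by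
          rw [integral_const_mul, mul_assoc]
          refine mul_le_mul_of_nonneg_left ?_ (Real.exp_pos _).le
          calc 2 * Real.pi * _ ≤ 2 * Real.pi * (1 / (2 * Real.pi) * I) := by gcongr
            _ = I := by have := Real.pi_pos; field_simp
  have hlim : Tendsto (fun T : ℝ => Real.exp (R / T) * I) atTop (nhds (Real.exp 0 * I)) := by
    refine Tendsto.mul_const _ ((Real.continuous_exp.tendsto 0).comp ?_)
    exact tendsto_const_nhds.div_atTop tendsto_id
  rw [Real.exp_zero, one_mul] at hlim
  refine ge_of_tendsto hlim ?_
  filter_upwards [eventually_gt_atTop 0] with T hT using key T hT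

lemma bessel (ν : Measure ℝ) [IsFiniteMeasure ν]
    (hν : ν ≤ ENNReal.ofReal (1 / (2 * Real.pi)) • volume)
    {φ : ℝ → ℂ} (hφ : Continuous φ) {C : ℝ} (hC : ∀ x, ‖φ x‖ ≤ C) (a b : ℝ) (hab : a ≤ b)
    (S : Finset ℕ) (X ρ : ℝ) (hsupp : ∀ᵐ ξ ∂ν, |ξ| ≤ X)
    (hES : ∀ s : ℝ, |s| ≤ 2 * X →
      ‖∑ m ∈ S, (1 / m : ℂ) * cis (s * Real.log m) - ∫ u in a..b, cis (u * s)‖ ≤ ρ) :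
    ∑ m ∈ S, ‖hat ν φ (Real.log m)‖ ^ 2 / m ≤ (1 + ρ * ν.real Set.univ) * ∫ ξ, ‖φ ξ‖ ^ 2 ∂ν := by
  have hC0 : 0 ≤ C := (norm_nonneg _).trans (hC 0)
  have hsq : ∀ x, ‖φ x‖ ^ 2 ≤ C ^ 2 := fun x => by gcongr; exact hC x
  have hconj := Complex.continuous_conj
  have hcontP : ∀ u : ℝ, Continuous fun z : ℝ × ℝ =>
      φ z.1 * starRingEnd ℂ (φ z.2) * cis (u * (z.1 - z.2)) := fun u =>
    ((hφ.comp (by fun_prop)).mul (hconj.comp (hφ.comp (by fun_prop)))).mul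
      (continuous_cis.comp (by fun_prop))
  have hbd : ∀ z : ℝ × ℝ, ‖φ z.1 * starRingEnd ℂ (φ z.2)‖ ≤ C * C := fun z => by
    rw [norm_mul, RCLike.norm_conj]
    exact mul_le_mul (hC _) (hC _) (norm_nonneg _) hC0
  have iP : ∀ u : ℝ, Integrable (fun z : ℝ × ℝ =>
      φ z.1 * starRingEnd ℂ (φ z.2) * cis (u * (z.1 - z.2))) (ν.prod ν) := fun u =>
    cont_prod_int ν (hcontP u) (C := C * C) fun z => by
      rw [norm_mul, norm_cis, mul_one]; exact hbd z
  have e1 : ((∑ m ∈ S, ‖hat ν φ (Real.log m)‖ ^ 2 / m : ℝ) : ℂ) =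
      ∫ z : ℝ × ℝ, φ z.1 * starRingEnd ℂ (φ z.2) *
        ∑ m ∈ S, (1 / m : ℂ) * cis ((z.1 - z.2) * Real.log m) ∂(ν.prod ν) := by
    rw [Complex.ofReal_sum]
    simp_rw [Finset.mul_sum]
    rw [integral_finsetSum]
    · refine Finset.sum_congr rfl fun m _ => ?_
      rw [Complex.ofReal_div, hat_norm_sq, Complex.ofReal_natCast, div_eq_mul_inv, mul_comm,
        ← integral_const_mul]
      refine integral_congr_ae (Eventually.of_forall fun z => ?_)
      simp only
      rw [mul_comm (Real.log m)]; ring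
    · intro m _
      refine ((iP (Real.log m)).const_mul (1 / m : ℂ)).congr (Eventually.of_forall fun z => ?_)
      simp only
      rw [mul_comm (Real.log m)]; ring
  have hjc : Continuous fun p : ℝ × (ℝ × ℝ) =>
      φ p.2.1 * starRingEnd ℂ (φ p.2.2) * cis (p.1 * (p.2.1 - p.2.2)) :=
    ((hφ.comp (by fun_prop)).mul (hconj.comp (hφ.comp (by fun_prop)))).mul
          (continuous_cis.comp (by fun_prop))
  have ij : Integrable (fun p : ℝ × (ℝ × ℝ) =>
      φ p.2.1 * starRingEnd ℂ (φ p.2.2) * cis (p.1 * (p.2.1 - p.2.2)))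
      ((volume.restrict (Set.Ioc a b)).prod (ν.prod ν)) := by
    refine Integrable.of_bound (C := C * C) hjc.aestronglyMeasurable
        (Eventually.of_forall fun z => ?_)
    rw [norm_mul, norm_cis, mul_one]; exact hbd _
  have e2 : ((∫ u in a..b, ‖hat ν φ u‖ ^ 2 : ℝ) : ℂ) =
      ∫ z : ℝ × ℝ, φ z.1 * starRingEnd ℂ (φ z.2) * (∫ u in a..b, cis (u * (z.1 - z.2))) ∂(ν.prod ν) := by
    rw [intervalIntegral.integral_of_le hab, ← integral_complex_ofReal]
    simp_rw [hat_norm_sq, intervalIntegral.integral_of_le hab]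
    rw [integral_integral_swap ij]
    refine integral_congr_ae (Eventually.of_forall fun z => ?_)
    simp only
    rw [integral_const_mul]
  have i2 : Integrable (fun z : ℝ × ℝ => φ z.1 * starRingEnd ℂ (φ z.2) *
      ∫ u in a..b, cis (u * (z.1 - z.2))) (ν.prod ν) := by
    have := ij.integral_prod_right
    refine this.congr (Eventually.of_forall fun z => ?_)
    simp only
    rw [integral_const_mul, intervalIntegral.integral_of_le hab]
  have i1 : Integrable (fun z : ℝ × ℝ => φ z.1 * starRingEnd ℂ (φ z.2) *
        ∑ m ∈ S, (1 / m : ℂ) * cis ((z.1 - z.2) * Real.log m)) (ν.prod ν) := by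
    simp_rw [Finset.mul_sum]
    refine integrable_finsetSum _ fun m _ => ?_
    refine ((iP (Real.log m)).const_mul (1 / m : ℂ)).congr (Eventually.of_forall fun z => ?_)
    simp only
    rw [mul_comm (Real.log m)]; ring
  have isq : Integrable (fun x => ‖φ x‖ ^ 2) ν :=
    integrable_of_cont_bdd (hφ.norm.pow 2) (C := C ^ 2) fun x => by
      rw [norm_pow, norm_norm]; exact hsq x
  have j1 : Integrable (fun z : ℝ × ℝ => ‖φ z.1‖ ^ 2) (ν.prod ν) := isq.comp_fst ν
  have j2 : Integrable (fun z : ℝ × ℝ => ‖φ z.2‖ ^ 2) (ν.prod ν) := isq.comp_snd ν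
  have hs1 : ∀ᵐ z ∂(ν.prod ν), |z.1| ≤ X := Measure.quasiMeasurePreserving_fst.ae hsupp
  have hs2 : ∀ᵐ z ∂(ν.prod ν), |z.2| ≤ X := Measure.quasiMeasurePreserving_snd.ae hsupp
  have hdiff : ∑ m ∈ S, ‖hat ν φ (Real.log m)‖ ^ 2 / m - ∫ u in a..b, ‖hat ν φ u‖ ^ 2 ≤
      ∫ z : ℝ × ℝ, (ρ / 2 * ‖φ z.1‖ ^ 2 + ρ / 2 * ‖φ z.2‖ ^ 2) ∂(ν.prod ν) := by
    have h1 : ((∑ m ∈ S, ‖hat ν φ (Real.log m)‖ ^ 2 / m - ∫ u in a..b, ‖hat ν φ u‖ ^ 2 : ℝ) : ℂ) =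
        ∫ z : ℝ × ℝ, φ z.1 * starRingEnd ℂ (φ z.2) *
        (∑ m ∈ S, (1 / m : ℂ) * cis ((z.1 - z.2) * Real.log m) -
          ∫ u in a..b, cis (u * (z.1 - z.2))) ∂(ν.prod ν) := by
      rw [Complex.ofReal_sub, e1, e2, ← integral_sub i1 i2]
      refine integral_congr_ae (Eventually.of_forall fun z => ?_)
      simp only
      ring
    refine (le_abs_self _).trans ?_
    rw [← Real.norm_eq_abs, ← Complex.norm_real, h1]
    refine norm_integral_le_of_norm_le ((j1.const_mul _).add (j2.const_mul _)) ?_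
    filter_upwards [hs1, hs2] with z h1 h2
    have h3 : |z.1 - z.2| ≤ 2 * X := by
      refine (abs_sub _ _).trans ?_; linarith
    have h4 := hES _ h3
    have hρ : 0 ≤ ρ := (norm_nonneg _).trans h4
    rw [norm_mul, norm_mul, RCLike.norm_conj]
    calc _ ≤ ‖φ z.1‖ * ‖φ z.2‖ * ρ := by gcongr
      _ ≤ _ := by nlinarith [mul_nonneg hρ (sq_nonneg (‖φ z.1‖ - ‖φ z.2‖))]
  rw [integral_add (j1.const_mul _) (j2.const_mul _), integral_const_mul, integral_const_mul,
    integral_fun_fst (fun x => ‖φ x‖ ^ 2), integral_fun_snd (fun x => ‖φ x‖ ^ 2)] at hdiff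
  have := hat_plancherel ν hν hφ hC a b hab
  simp only [smul_eq_mul] at hdiff
  linarith

/-- dual form -/
lemma bessel_dual (ν : Measure ℝ) [IsFiniteMeasure ν]
    (hν : ν ≤ ENNReal.ofReal (1 / (2 * Real.pi)) • volume) (a b : ℝ) (hab : a ≤ b)
    (S : Finset ℕ) (X ρ : ℝ) (hρ : 0 ≤ ρ) (hsupp : ∀ᵐ ξ ∂ν, |ξ| ≤ X)
    (hES : ∀ s : ℝ, |s| ≤ 2 * X →
      ‖∑ m ∈ S, (1 / m : ℂ) * cis (s * Real.log m) - ∫ u in a..b, cis (u * s)‖ ≤ ρ) (c : ℕ → ℂ) :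
    ∫ ξ, ‖dp S c ξ‖ ^ 2 ∂ν ≤ (1 + ρ * ν.real Set.univ) * ∑ m ∈ S, ‖c m‖ ^ 2 / m := by
  have hb := bessel ν hν (continuous_dp S c) (norm_dp_le S c) a b hab S X ρ hsupp hES
  set I := ∫ ξ, ‖dp S c ξ‖ ^ 2 ∂ν with hI
  have hI0 : 0 ≤ I := integral_nonneg fun _ => by positivity
  set K := 1 + ρ * ν.real Set.univ with hK
  have hK1 : 0 < K := by have : 0 ≤ ρ * ν.real Set.univ := by positivity
                         linarith
  have hIntg : ∀ u : ℝ, Integrable (fun ξ => dp S c ξ * cis (u * ξ)) ν := fun u =>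
    integrable_of_cont_bdd ((continuous_dp S c).mul (continuous_cis.comp (by fun_prop)))
      (C := ∑ n ∈ S, ‖c n‖ / n) fun ξ => by
        rw [norm_mul, norm_cis, mul_one]; exact norm_dp_le S c ξ
  have e : (I : ℂ) = ∑ m ∈ S, starRingEnd ℂ (c m) / m * hat ν (dp S c) (Real.log m) := by
    rw [hI, ← integral_complex_ofReal]
    unfold hat
    simp_rw [← integral_const_mul]
    rw [← integral_finsetSum _ fun m _ => (hIntg _).const_mul _]
    refine integral_congr_ae (Eventually.of_forall fun ξ => ?_)
    simp only
    rw [← Complex.normSq_eq_norm_sq, Complex.normSq_eq_conj_mul_self]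
    nth_rewrite 1 [dp]
    rw [map_sum, Finset.sum_mul]
    refine Finset.sum_congr rfl fun m _ => ?_
    rw [map_mul, map_div₀, Complex.conj_natCast, conj_cis, neg_neg, mul_comm ξ]; ring
  have e2 : I ≤ ∑ m ∈ S, (K / 2 * (‖c m‖ ^ 2 / m) + 1 / (2 * K) * (‖hat ν (dp S c) (Real.log m)‖ ^ 2 / m)) := by
    have : I = ‖(I : ℂ)‖ := by rw [Complex.norm_real, Real.norm_eq_abs, abs_of_nonneg hI0]
    rw [this, e]
    refine (norm_sum_le _ _).trans (Finset.sum_le_sum fun m _ => ?_)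
    rw [norm_mul, norm_div, RCLike.norm_conj, Complex.norm_natCast]
    set x := ‖c m‖
    set y := ‖hat ν (dp S c) (Real.log m)‖
    have hm : 0 ≤ 1 / (m : ℝ) := by positivity
    have : x * y ≤ K / 2 * x ^ 2 + 1 / (2 * K) * y ^ 2 := by
      have h := sq_nonneg (K * x - y)
      have : K / 2 * x ^ 2 + 1 / (2 * K) * y ^ 2 - x * y = (K * x - y) ^ 2 / (2 * K) := by
        field_simp; ring
      have h2 : 0 ≤ (K * x - y) ^ 2 / (2 * K) := by positivity
      linarith
    calc x / m * y = 1 / m * (x * y) := by ring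
      _ ≤ 1 / m * (K / 2 * x ^ 2 + 1 / (2 * K) * y ^ 2) := by gcongr
      _ = _ := by ring
  rw [Finset.sum_add_distrib, ← Finset.mul_sum, ← Finset.mul_sum] at e2
  have e3 : 1 / (2 * K) * ∑ m ∈ S, ‖hat ν (dp S c) (Real.log m)‖ ^ 2 / m ≤ I / 2 := by
    calc _ ≤ 1 / (2 * K) * (K * I) := by gcongr
      _ = I / 2 := by field_simp
  linarith

/-! ### Exponential sums -/

lemma cis_sub_one_ge {θ : ℝ} (h0 : 0 ≤ θ) (h1 : θ ≤ 1) : θ / 2 ≤ ‖cis θ - 1‖ := by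
  have h : |(cis θ - 1).im| ≤ ‖cis θ - 1‖ := Complex.abs_im_le_norm _
  have him : (cis θ - 1).im = Real.sin θ := by
    unfold cis; rw [Complex.sub_im, Complex.exp_ofReal_mul_I_im]; simp
  rw [him] at h
  refine le_trans ?_ ((le_abs_self _).trans h)
  rcases h0.eq_or_lt with rfl | h0
  · simp
  have := Real.sin_gt_sub_cube h0
  nlinarith [sq_nonneg θ, mul_pos h0 h0]

/-- Kusmin--Landau -/
lemma kusmin_landau (g : ℕ → ℝ) (l : ℝ) (hl : 0 < l)
    (L : ℕ) (h0 : ∀ n, 0 < g (n + 1) - g n)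
    (h1 : ∀ n ≤ L, l ≤ g (n + 1) - g n) (h2 : ∀ n, g (n + 1) - g n ≤ 1)
    (hanti : ∀ n, g (n + 2) - g (n + 1) ≤ g (n + 1) - g n) :
    ‖∑ n ∈ Finset.range L, cis (g n)‖ ≤ 8 / l := by
  set θ : ℕ → ℝ := fun n => g (n + 1) - g n with hθ
  have hθ0 : ∀ n, 0 < θ n := h0
  have hz : ∀ n, θ n / 2 ≤ ‖cis (θ n) - 1‖ := fun n => cis_sub_one_ge (hθ0 n).le (h2 n)
  have hz0 : ∀ n, 0 < ‖cis (θ n) - 1‖ := fun n => lt_of_lt_of_le (by have := hθ0 n; positivity) (hz n)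
  have hzn : ∀ n, cis (θ n) - 1 ≠ 0 := fun n => norm_pos_iff.mp (hz0 n)
  set c : ℕ → ℂ := fun n => (cis (θ n) - 1)⁻¹ with hc
  have hcb : ∀ n, ‖c n‖ ≤ 2 / θ n := fun n => by
    rw [hc]; simp only; rw [norm_inv, inv_eq_one_div, div_le_div_iff₀ (hz0 n) (hθ0 n)]
    linarith [hz n]
  have hcl : ∀ n ≤ L, ‖c n‖ ≤ 2 / l := fun n hn => (hcb n).trans (by gcongr; exact h1 n hn)
  have hcd : ∀ n, ‖c n - c (n + 1)‖ ≤ 4 * (1 / θ (n + 1) - 1 / θ n) := fun n => by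
    have e : c n - c (n + 1) = (cis (θ (n + 1)) - cis (θ n)) * (c n * c (n + 1)) := by
      simp only [hc]; have := hzn n; have := hzn (n + 1); field_simp; ring
    rw [e, norm_mul, norm_mul]
    have hle : θ (n + 1) ≤ θ n := hanti n
    have h3 : ‖cis (θ (n + 1)) - cis (θ n)‖ ≤ θ n - θ (n + 1) := by
      refine (cis_sub_le _ _).trans ?_
      rw [abs_of_nonpos (by linarith)]; linarith
    have p1 := hθ0 n
    have p2 := hθ0 (n + 1)
    calc _ ≤ (θ n - θ (n + 1)) * (2 / θ n * (2 / θ (n + 1))) := by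
          have q1 := hcb n; have q2 := hcb (n + 1)
          have : 0 ≤ θ n - θ (n + 1) := by linarith
          gcongr
      _ = _ := by field_simp; ring
  have hterm : ∀ n, cis (g n) = (cis (g (n + 1)) - cis (g n)) * c n := fun n => by
    have : cis (g (n + 1)) = cis (g n) * cis (θ n) := by rw [← cis_add]; congr 1; simp [hθ]
    rw [this]; simp only [hc]
    have := hzn n
    field_simp
  have key : ∀ L : ℕ, ∑ n ∈ Finset.range L, cis (g n) =
      cis (g L) * c L - cis (g 0) * c 0 + ∑ n ∈ Finset.range L, cis (g (n + 1)) * (c n - c (n + 1)) := by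
    intro L
    induction L with
    | zero => simp
    | succ L ih => rw [Finset.sum_range_succ, ih, Finset.sum_range_succ]; linear_combination hterm L
  rw [key]
  have hsum : ‖∑ n ∈ Finset.range L, cis (g (n + 1)) * (c n - c (n + 1))‖ ≤ 4 * (1 / θ L - 1 / θ 0) := by
    refine (norm_sum_le _ _).trans ?_
    rw [← Finset.sum_range_sub (fun n => 1 / θ n), Finset.mul_sum]
    refine Finset.sum_le_sum fun n _ => ?_
    rw [norm_mul, norm_cis, one_mul]; exact hcd n
  have a1 : ‖cis (g L) * c L‖ ≤ 2 / l := by rw [norm_mul, norm_cis, one_mul]; exact hcl L le_rfl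
  have a2 : ‖cis (g 0) * c 0‖ ≤ 2 / l := by rw [norm_mul, norm_cis, one_mul]; exact hcl 0 (Nat.zero_le _)
  have a3 : 1 / θ L ≤ 1 / l := by gcongr; exact h1 L le_rfl
  have a4 : 0 < 1 / θ 0 := by have := hθ0 0; positivity
  calc _ ≤ ‖cis (g L) * c L‖ + ‖cis (g 0) * c 0‖ + _ :=
        (norm_add_le _ _).trans (add_le_add_left (norm_sub_le _ _) _)
    _ ≤ 2 / l + 2 / l + 4 * (1 / l) := by gcongr; linarith
    _ = 8 / l := by ring


lemma shift_sum {E : Type*} [AddCommMonoid E] (F : ℕ → E) (L' H M j : ℕ) (hj : j ≤ H) (hM : M ≤ L')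
    (hF : ∀ i, ¬ (H ≤ i ∧ i < H + M) → F i = 0) :
    ∑ k ∈ Finset.range (L' + H), F (k + j) = ∑ n ∈ Finset.range M, F (H + n) := by
  rw [Finset.range_eq_Ico, Finset.sum_Ico_add' F 0 (L' + H) j]
  have h2 : ∑ n ∈ Finset.range M, F (H + n) = ∑ i ∈ Finset.Ico H (H + M), F i := by
    rw [Finset.sum_Ico_eq_sum_range]; simp
  rw [h2]
  symm
  refine Finset.sum_subset (fun i hi => ?_) fun i _ hi => hF i ?_
  · rw [Finset.mem_Ico] at hi ⊢; omega
  · rw [Finset.mem_Ico] at hi; exact hi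

/-- van der Corput -/
lemma vdc (z : ℕ → ℂ) (hz : ∀ n, ‖z n‖ ≤ 1) (L L' H : ℕ) (hL' : L' ≤ L) (hH : 1 ≤ H) (hHL : H ≤ L)
    (E : ℕ → ℝ) (hE : ∀ h ∈ Finset.Icc 1 H, ∀ M ≤ L,
      ‖∑ n ∈ Finset.range M, z (n + h) * starRingEnd ℂ (z n)‖ ≤ E h) :
    ‖∑ n ∈ Finset.range L', z n‖ ^ 2 ≤ 2 * L / H * (L + 2 * ∑ h ∈ Finset.Icc 1 H, E h) := by
  have hE0 : ∀ h ∈ Finset.Icc 1 H, 0 ≤ E h := fun h hh => by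
    have := hE h hh 0 (Nat.zero_le _); simpa using this
  have hH0 : (0 : ℝ) < H := by exact_mod_cast hH
  set y : ℕ → ℂ := fun i => if H ≤ i ∧ i < H + L' then z (i - H) else 0 with hy
  set S := ∑ n ∈ Finset.range L', z n with hS
  set sE := ∑ h ∈ Finset.Icc 1 H, E h with hsE
  have hS1 : ∀ j ∈ Finset.range H, ∑ k ∈ Finset.range (L' + H), y (k + j) = S := by
    intro j hj
    rw [shift_sum y L' H L' j (Finset.mem_range.mp hj).le le_rfl (fun i hi => if_neg hi), hS]
    refine Finset.sum_congr rfl fun n hn => ?_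
    rw [Finset.mem_range] at hn
    simp only [hy]; rw [if_pos (by omega)]; congr 1; omega
  have hcorr : ∀ j ∈ Finset.range H, ∀ h, 1 ≤ h → j + h < H →
      ‖∑ k ∈ Finset.range (L' + H), y (k + j + h) * starRingEnd ℂ (y (k + j))‖ ≤ E h := by
    intro j hj h h1 h2
    rw [shift_sum (fun i => y (i + h) * starRingEnd ℂ (y i)) L' H (L' - h) j (Finset.mem_range.mp hj).le
      (Nat.sub_le _ _)]
    · refine le_trans (le_of_eq ?_) (hE h (Finset.mem_Icc.mpr ⟨h1, by omega⟩) (L' - h) (by omega))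
      congr 1
      refine Finset.sum_congr rfl fun n hn => ?_
      rw [Finset.mem_range] at hn
      simp only [hy]
      rw [if_pos (by omega), if_pos (by omega)]
      congr 2
      · congr 1; omega
      · congr 1; omega
    · intro i hi
      simp only [hy]
      by_cases hc : H ≤ i
      · rw [if_neg (by omega), zero_mul]
      · rw [if_neg (c := H ≤ i ∧ i < H + L') (by omega), map_zero, mul_zero]
  have hdiag : ∀ j ∈ Finset.range H,
      ‖∑ k ∈ Finset.range (L' + H), y (k + j) * starRingEnd ℂ (y (k + j))‖ ≤ L := by
    intro j hj
    rw [shift_sum (fun i => y i * starRingEnd ℂ (y i)) L' H L' j (Finset.mem_range.mp hj).le le_rfl]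
    · refine (norm_sum_le _ _).trans ?_
      refine (Finset.sum_le_sum (g := fun _ => (1 : ℝ)) fun n hn => ?_).trans ?_
      · rw [Finset.mem_range] at hn
        rw [norm_mul, RCLike.norm_conj]
        simp only [hy]; rw [if_pos (by omega)]
        exact mul_le_one₀ (hz _) (norm_nonneg _) (hz _)
      · simp; exact hL'
    · intro i hi
      simp only [hy]; rw [if_neg hi, zero_mul]
  set T : ℕ → ℂ := fun k => ∑ j ∈ Finset.range H, y (k + j) with hT
  have h1 : ∑ k ∈ Finset.range (L' + H), T k = H * S := by
    rw [hT, Finset.sum_comm, Finset.sum_congr rfl hS1]; simp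
  have h2 : ‖∑ k ∈ Finset.range (L' + H), T k‖ ^ 2 ≤ (L' + H : ℕ) * ∑ k ∈ Finset.range (L' + H), ‖T k‖ ^ 2 := by
    have a := norm_sum_le (Finset.range (L' + H)) T
    have b := sq_sum_le_card_mul_sum_sq (s := Finset.range (L' + H)) (f := fun k => ‖T k‖)
    rw [Finset.card_range] at b
    refine le_trans ?_ b
    gcongr
  have h3 : ∑ k ∈ Finset.range (L' + H), ‖T k‖ ^ 2 ≤ H * (L + 2 * sE) := by
    have e : ((∑ k ∈ Finset.range (L' + H), ‖T k‖ ^ 2 : ℝ) : ℂ) =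
        ∑ j ∈ Finset.range H, ∑ j' ∈ Finset.range H,
          ∑ k ∈ Finset.range (L' + H), y (k + j') * starRingEnd ℂ (y (k + j)) := by
      rw [Complex.ofReal_sum, Finset.sum_congr rfl fun j _ => Finset.sum_comm, Finset.sum_comm]
      refine Finset.sum_congr rfl fun k _ => ?_
      rw [← Complex.normSq_eq_norm_sq, Complex.normSq_eq_conj_mul_self, hT]
      simp only
      rw [map_sum, Finset.sum_mul_sum]
      exact Finset.sum_congr rfl fun j _ => Finset.sum_congr rfl fun j' _ => mul_comm _ _
    have hnn : 0 ≤ ∑ k ∈ Finset.range (L' + H), ‖T k‖ ^ 2 := Finset.sum_nonneg fun _ _ => by positivity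
    rw [← abs_of_nonneg hnn, ← Real.norm_eq_abs, ← Complex.norm_real, e]
    refine (norm_sum_le _ _).trans ?_
    have hrow : ∀ j ∈ Finset.range H, ‖∑ j' ∈ Finset.range H,
          ∑ k ∈ Finset.range (L' + H), y (k + j') * starRingEnd ℂ (y (k + j))‖ ≤ L + 2 * sE := by
      intro j hj
      have hjH := Finset.mem_range.mp hj
      refine (norm_sum_le _ _).trans ?_
      have hsplit : Finset.range H = Finset.range j ∪ ({j} ∪ Finset.Ico (j + 1) H) := by
        ext i; simp only [Finset.mem_union, Finset.mem_range, Finset.mem_singleton, Finset.mem_Ico]; omega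
      nth_rewrite 1 [hsplit]
      rw [Finset.sum_union, Finset.sum_union, Finset.sum_singleton]
      · have b1 := hdiag j hj
        have b2 : ∑ j' ∈ Finset.range j, ‖∑ k ∈ Finset.range (L' + H), y (k + j') * starRingEnd ℂ (y (k + j))‖ ≤ sE := by
          calc _ ≤ ∑ j' ∈ Finset.range j, E (j - j') := by
                refine Finset.sum_le_sum fun j' hj' => ?_
                rw [Finset.mem_range] at hj'
                have := hcorr j' (Finset.mem_range.mpr (by omega)) (j - j') (by omega) (by omega)
                rw [← RCLike.norm_conj, map_sum]
                refine le_trans (le_of_eq ?_) this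
                congr 1
                refine Finset.sum_congr rfl fun k _ => ?_
                rw [map_mul, RCLike.conj_conj, mul_comm]
                congr 2; omega
            _ = ∑ h ∈ (Finset.range j).image (fun j' => j - j'), E h := by
                rw [Finset.sum_image]
                intro x hx y hy hxy
                simp only [Finset.coe_range, Set.mem_Iio] at hx hy hxy
                omega
            _ ≤ sE := by
                refine Finset.sum_le_sum_of_subset_of_nonneg (fun h hh => ?_) fun h hh _ => hE0 h hh
                rw [Finset.mem_image] at hh
                obtain ⟨j', hj', rfl⟩ := hh
                rw [Finset.mem_range] at hj'
                rw [Finset.mem_Icc]; omega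
        have b3 : ∑ j' ∈ Finset.Ico (j + 1) H, ‖∑ k ∈ Finset.range (L' + H), y (k + j') * starRingEnd ℂ (y (k + j))‖ ≤ sE := by
          calc _ ≤ ∑ j' ∈ Finset.Ico (j + 1) H, E (j' - j) := by
                refine Finset.sum_le_sum fun j' hj' => ?_
                rw [Finset.mem_Ico] at hj'
                have := hcorr j hj (j' - j) (by omega) (by omega)
                refine le_trans (le_of_eq ?_) this
                congr 1
                refine Finset.sum_congr rfl fun k _ => ?_
                congr 2; omega
            _ = ∑ h ∈ (Finset.Ico (j + 1) H).image (fun j' => j' - j), E h := by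
                rw [Finset.sum_image]
                intro x hx y hy hxy
                simp only [Finset.coe_Ico, Set.mem_Ico] at hx hy hxy
                omega
            _ ≤ sE := by
                refine Finset.sum_le_sum_of_subset_of_nonneg (fun h hh => ?_) fun h hh _ => hE0 h hh
                rw [Finset.mem_image] at hh
                obtain ⟨j', hj', rfl⟩ := hh
                rw [Finset.mem_Ico] at hj'
                rw [Finset.mem_Icc]; omega
        linarith
      · rw [Finset.disjoint_left]; intro i h1 h2
        rw [Finset.mem_singleton] at h1; rw [Finset.mem_Ico] at h2; omega
      · rw [Finset.disjoint_left]; intro i h1 h2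
        rw [Finset.mem_range] at h1; rw [Finset.mem_union, Finset.mem_singleton, Finset.mem_Ico] at h2; omega
    refine (Finset.sum_le_sum hrow).trans ?_
    rw [Finset.sum_const, Finset.card_range, nsmul_eq_mul]
  rw [h1, norm_mul, Complex.norm_natCast, mul_pow] at h2
  have hsE0 : 0 ≤ sE := Finset.sum_nonneg hE0
  have h4 : (H : ℝ) ^ 2 * ‖S‖ ^ 2 ≤ (2 * L) * (H * (L + 2 * sE)) := by
    refine h2.trans ?_
    have : ((L' + H : ℕ) : ℝ) ≤ 2 * L := by
      have : L' + H ≤ 2 * L := by omega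
      exact_mod_cast this
    gcongr
  have h5 : ‖S‖ ^ 2 ≤ (2 * L) * (H * (L + 2 * sE)) / H ^ 2 := by
    rw [le_div_iff₀ (by positivity)]; linarith
  refine h5.trans (le_of_eq ?_)
  field_simp

def Dn : List ℕ → (ℕ → ℝ) → (ℕ → ℝ)
  | [], F => F
  | h :: hs, F => Dn hs (fun n => F (n + h) - F n)

def Dr : List ℕ → (ℝ → ℝ) → (ℝ → ℝ)
  | [], F => F
  | h :: hs, F => Dr hs (fun x => F (x + h) - F x)

lemma Dn_eq_Dr (hs : List ℕ) (a : ℝ) : ∀ (F : ℝ → ℝ) (n : ℕ),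
    Dn hs (fun n => F (a + n)) n = Dr hs F (a + n) := by
  induction hs with
  | nil => intro F n; rfl
  | cons h hs ih =>
    intro F n
    rw [Dn, Dr, ← ih]
    congr 1
    funext m
    push_cast
    rw [add_assoc]

lemma Dr_sub (hs : List ℕ) (h : ℕ) : ∀ (F : ℝ → ℝ) (x : ℝ),
    Dr hs (fun x => F (x + h) - F x) x = Dr hs F (x + h) - Dr hs F x := by
  induction hs with
  | nil => intro F x; rfl
  | cons k hs ih =>
    intro F x
    rw [Dr, Dr]
    have : (fun x : ℝ => F (x + k + h) - F (x + k) - (F (x + h) - F x)) =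
      fun x : ℝ => (fun y => F (y + k) - F y) (x + h) - (fun y => F (y + k) - F y) x := by
      funext x; simp only; rw [add_right_comm]; ring
    rw [← ih, ← this]

lemma Dr_hasDeriv (hs : List ℕ) : ∀ (F F' : ℝ → ℝ) (x : ℝ), (∀ y, x ≤ y → HasDerivAt F (F' y) y) →
    HasDerivAt (Dr hs F) (Dr hs F' x) x := by
  induction hs with
  | nil => intro F F' x h; exact h x le_rfl
  | cons k hs ih =>
    intro F F' x h
    rw [Dr, Dr]
    refine ih _ _ x fun y hy => ?_
    have h1 : HasDerivAt F (F' (y + k)) (y + k) := h _ (by have : (0 : ℝ) ≤ k := Nat.cast_nonneg k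
                                                           linarith)
    exact (h1.comp_add_const y k).sub (h y hy)

lemma Dr_mvt (hs : List ℕ) : ∀ (G : ℕ → ℝ → ℝ) (x : ℝ), (∀ h ∈ hs, 1 ≤ h) →
    (∀ j y, x ≤ y → HasDerivAt (G j) (G (j + 1) y) y) → ∀ j,
    ∃ z, x ≤ z ∧ z ≤ x + (hs.sum : ℕ) ∧ Dr hs (G j) x = (hs.prod : ℕ) * G (j + hs.length) z := by
  induction hs with
  | nil => intro G x _ h j; exact ⟨x, le_rfl, by simp, by simp [Dr]⟩
  | cons k hs ih =>
    intro G x hpos h j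
    rw [Dr, Dr_sub]
    have hk : (0 : ℝ) < k := by exact_mod_cast hpos k (by simp)
    obtain ⟨y, hy, hy2⟩ := exists_hasDerivAt_eq_slope (Dr hs (G j)) (Dr hs (G (j + 1)))
      (show x < x + k by linarith)
      (fun y hy => (Dr_hasDeriv hs (G j) (G (j + 1)) y
        fun w hw => h j w (hy.1.trans hw)).continuousAt.continuousWithinAt)
      (fun y hy => Dr_hasDeriv hs (G j) (G (j + 1)) y fun w hw => h j w (hy.1.le.trans hw))
    obtain ⟨z, hz1, hz2, hz3⟩ := ih G y (fun a ha => hpos a (by simp [ha]))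
      (fun j w hw => h j w (hy.1.le.trans hw)) (j + 1)
    refine ⟨z, hy.1.le.trans hz1, ?_, ?_⟩
    · rw [List.sum_cons, Nat.cast_add]; linarith [hy.2]
    · rw [hz3, eq_div_iff (by linarith)] at hy2
      rw [List.prod_cons, List.length_cons, ← hy2, Nat.cast_mul]
      rw [show j + (hs.length + 1) = j + 1 + hs.length by ring]
      ring

lemma vdc_iter (r : ℕ) : ∃ C : ℝ, 0 ≤ C ∧ ∀ (L H : ℕ), 1 ≤ H → H ≤ L → ∀ (F : ℕ → ℝ) (K : ℝ), 0 ≤ K →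
    (∀ hs : List ℕ, hs.length = r → (∀ h ∈ hs, 1 ≤ h ∧ h ≤ H) → ∀ M ≤ L,
      ‖∑ n ∈ Finset.range M, cis (Dn hs F n)‖ ≤ K / (hs.prod : ℕ)) → ∀ L' ≤ L,
    (‖∑ n ∈ Finset.range L', cis (F n)‖ / L) ^ (2 ^ r) ≤
      C * (1 / H + K / L * ((1 + Real.log H) / H) ^ r) := by
  induction r with
  | zero =>
    refine ⟨1, zero_le_one, fun L H hH hHL F K hK h L' hL' => ?_⟩
    have := h [] rfl (by simp) L' hL'
    simp only [Dn, List.prod_nil, Nat.cast_one, div_one] at this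
    have hH0 : (0 : ℝ) ≤ 1 / H := by positivity
    have : ‖∑ n ∈ Finset.range L', cis (F n)‖ / L ≤ K / L := by gcongr
    simp only [pow_zero, pow_one, one_mul, mul_one]
    linarith
  | succ r ih =>
    obtain ⟨C, hC, ih⟩ := ih
    set q := 2 ^ r with hq
    have hq1 : 1 ≤ q := Nat.one_le_two_pow
    refine ⟨2 ^ q * (2 ^ q + 4 ^ q * C), by positivity, fun L H hH hHL F K hK h L' hL' => ?_⟩
    have hH0 : (0 : ℝ) < H := by exact_mod_cast hH
    have hL0 : (0 : ℝ) < L := by exact_mod_cast (hH.trans hHL)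
    have hlog : 0 ≤ Real.log H := Real.log_natCast_nonneg H
    set ℓ := (1 + Real.log H) / H with hℓ
    have hℓ0 : 0 ≤ ℓ := by positivity
    set E : ℕ → ℝ := fun k => (Finset.range (L + 1)).sup' ⟨0, by simp⟩
      (fun M => ‖∑ n ∈ Finset.range M, cis (F (n + k) - F n)‖) with hE
    have hEle : ∀ k, ∀ M ≤ L, ‖∑ n ∈ Finset.range M, cis (F (n + k) - F n)‖ ≤ E k := fun k M hM =>
      Finset.le_sup' (fun M => ‖∑ n ∈ Finset.range M, cis (F (n + k) - F n)‖)
        (Finset.mem_range.mpr (by omega))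
    have hE0 : ∀ k, 0 ≤ E k := fun k => (norm_nonneg _).trans (hEle k 0 (Nat.zero_le _))
    have hEb : ∀ k ∈ Finset.Icc 1 H, (E k / L) ^ q ≤ C * (1 / H + K / k / L * ℓ ^ r) := by
      intro k hk
      rw [Finset.mem_Icc] at hk
      obtain ⟨M, hM, hM2⟩ := Finset.exists_mem_eq_sup' (s := Finset.range (L + 1)) ⟨0, by simp⟩
        (fun M => ‖∑ n ∈ Finset.range M, cis (F (n + k) - F n)‖)
      have hEM : E k = ‖∑ n ∈ Finset.range M, cis (F (n + k) - F n)‖ := hM2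
      rw [hEM]
      refine ih L H hH hHL (fun n => F (n + k) - F n) (K / k) (by positivity) ?_ M
        (by rw [Finset.mem_range] at hM; omega)
      intro hs hlen hhs M hM
      have := h (k :: hs) (by simp [hlen]) (by
        intro a ha
        rw [List.mem_cons] at ha
        rcases ha with rfl | ha
        · exact hk
        · exact hhs a ha) M hM
      rw [Dn, List.prod_cons] at this
      refine this.trans (le_of_eq ?_)
      push_cast
      rw [div_div]
    have hv := vdc (fun n => cis (F n)) (fun n => (norm_cis _).le) L L' H hL' hH hHL E (by
      intro k hk M hM
      refine le_trans (le_of_eq ?_) (hEle k M hM)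
      congr 1
      refine Finset.sum_congr rfl fun n _ => ?_
      rw [conj_cis, ← cis_add, sub_eq_add_neg])
    set S := ‖∑ n ∈ Finset.range L', cis (F n)‖ with hS
    set av := (∑ k ∈ Finset.Icc 1 H, E k / L) / H with hav
    have hav0 : 0 ≤ av := div_nonneg (Finset.sum_nonneg fun k _ => div_nonneg (hE0 k) hL0.le) hH0.le
    have h1 : (S / L) ^ 2 ≤ 2 / H + 4 * av := by
      rw [hav, ← Finset.sum_div, div_pow, div_le_iff₀ (by positivity)]
      refine hv.trans (le_of_eq ?_)
      field_simp
      ring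
    have h2 : av ^ q ≤ (∑ k ∈ Finset.Icc 1 H, (E k / L) ^ q) / H := by
      have hj := Real.pow_arith_mean_le_arith_mean_pow (Finset.Icc 1 H) (fun _ => 1 / (H : ℝ))
        (fun k => E k / L) (fun _ _ => by positivity) (by simp; field_simp)
        (fun k _ => div_nonneg (hE0 k) hL0.le) q
      rw [← Finset.mul_sum, ← Finset.mul_sum] at hj
      rw [hav, div_eq_mul_one_div (∑ k ∈ Finset.Icc 1 H, E k / (L : ℝ)),
        div_eq_mul_one_div (∑ k ∈ Finset.Icc 1 H, (E k / (L : ℝ)) ^ q), mul_comm,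
        mul_comm _ (1 / (H : ℝ))]
      exact hj
    have h3 : (∑ k ∈ Finset.Icc 1 H, (E k / L) ^ q) / H ≤ C * (1 / H + K / L * ℓ ^ (r + 1)) := by
      rw [div_le_iff₀ hH0]
      refine (Finset.sum_le_sum hEb).trans ?_
      rw [← Finset.mul_sum, Finset.sum_add_distrib]
      have e1 : ∑ k ∈ Finset.Icc 1 H, (1 / (H : ℝ)) = 1 := by simp; field_simp
      have e2 : ∑ k ∈ Finset.Icc 1 H, K / (k : ℝ) / L * ℓ ^ r = K / L * ℓ ^ r * ∑ k ∈ Finset.Icc 1 H, 1 / (k : ℝ) := by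
        rw [Finset.mul_sum]; refine Finset.sum_congr rfl fun k _ => ?_; ring
      have e3 : ∑ k ∈ Finset.Icc 1 H, 1 / (k : ℝ) ≤ 1 + Real.log H := by
        have := harm_upper le_rfl hH
        simpa using this
      rw [e1, e2]
      have e4 : K / L * ℓ ^ r * ∑ k ∈ Finset.Icc 1 H, 1 / (k : ℝ) ≤ K / L * ℓ ^ r * (1 + Real.log H) := by gcongr
      have e5 : K / L * ℓ ^ (r + 1) * H = K / L * ℓ ^ r * (1 + Real.log H) := by
        rw [pow_succ, hℓ]; field_simp
      have e6 : C * (1 / H + K / L * ℓ ^ (r + 1)) * H = C * (1 + K / L * ℓ ^ r * (1 + Real.log H)) := by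
        rw [← e5]; field_simp
      rw [e6]
      gcongr
    have h4 : (2 / (H : ℝ)) ^ q ≤ 2 ^ q * (1 / H) := by
      rw [div_eq_mul_one_div, mul_pow]
      gcongr
      refine pow_le_of_le_one (by positivity) ?_ (by omega)
      rw [div_le_one hH0]; exact_mod_cast hH
    set R := K / L * ℓ ^ (r + 1) with hR
    have hR0 : 0 ≤ R := by positivity
    calc (S / L) ^ (2 ^ (r + 1)) = ((S / L) ^ 2) ^ q := by rw [← pow_mul, hq, pow_succ, mul_comm]
      _ ≤ (2 / H + 4 * av) ^ q := by gcongr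
      _ ≤ 2 ^ (q - 1) * ((2 / H) ^ q + (4 * av) ^ q) := add_pow_le (by positivity) (by positivity) q
      _ ≤ 2 ^ q * (2 ^ q * (1 / H) + 4 ^ q * (C * (1 / H + R))) := by
          rw [mul_pow 4]
          have := h2.trans h3
          gcongr
          · norm_num
          · omega
      _ ≤ 2 ^ q * (2 ^ q * (1 / H + R) + 4 ^ q * (C * (1 / H + R))) := by
          gcongr; linarith
      _ = _ := by ring

noncomputable def Glog (ξ : ℝ) : ℕ → ℝ → ℝ
  | 0, x => ξ * Real.log x
  | (j + 1), x => ξ * (-1) ^ j * (Nat.factorial j) / x ^ (j + 1)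

lemma Glog_deriv (ξ : ℝ) (j : ℕ) {x : ℝ} (hx : 0 < x) : HasDerivAt (Glog ξ j) (Glog ξ (j + 1) x) x := by
  cases j with
  | zero =>
    have := (Real.hasDerivAt_log hx.ne').const_mul ξ
    have e : Glog ξ 0 = fun x => ξ * Real.log x := rfl
    rw [e]
    refine this.congr_deriv ?_
    show _ = ξ * (-1) ^ 0 * (Nat.factorial 0) / x ^ (0 + 1)
    simp [div_eq_mul_inv]
  | succ j =>
    have e : Glog ξ (j + 1) = fun x => ξ * (-1) ^ j * (Nat.factorial j) / x ^ (j + 1) := rfl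
    rw [e]
    have := ((hasDerivAt_pow (j + 1) x).inv (by positivity)).const_mul (ξ * (-1) ^ j * (Nat.factorial j : ℝ))
    refine (this.congr_deriv ?_)
    show _ = ξ * (-1) ^ (j + 1) * (Nat.factorial (j + 1)) / x ^ (j + 1 + 1)
    rw [Nat.factorial_succ]
    push_cast
    have : x ≠ 0 := hx.ne'
    rw [pow_succ (-1 : ℝ) j]
    field_simp
    ring

lemma norm_sum_cis_neg (g : ℕ → ℝ) (M : ℕ) :
    ‖∑ n ∈ Finset.range M, cis (-g n)‖ = ‖∑ n ∈ Finset.range M, cis (g n)‖ := by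
  rw [← RCLike.norm_conj (∑ n ∈ Finset.range M, cis (g n)), map_sum]
  simp_rw [conj_cis]

/-- Bound for differenced sums -/
lemma diff_bound (r a L H : ℕ) (ha : 1 ≤ a) (hH : 1 ≤ H) (hHL : H ≤ L) (ξ κ : ℝ) (hξ : ξ ≠ 0)
    (hκ : (a : ℝ) + (r + 2) * L ≤ κ * a)
    (hup : (H : ℝ) ^ r * |ξ| * (Nat.factorial r) ≤ (a : ℝ) ^ (r + 1))
    (hs : List ℕ) (hlen : hs.length = r) (hhs : ∀ h ∈ hs, 1 ≤ h ∧ h ≤ H) (M : ℕ) (hM : M ≤ L) :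
    ‖∑ n ∈ Finset.range M, cis (Dn hs (fun n => Glog ξ 0 (a + n)) n)‖ ≤
      8 * (κ * a) ^ (r + 1) / (|ξ| * Nat.factorial r) / (hs.prod : ℕ) := by
  have ha0 : (0 : ℝ) < a := by exact_mod_cast ha
  have hξ0 : 0 < |ξ| := abs_pos.mpr hξ
  have hf0 : (0 : ℝ) < Nat.factorial r := by exact_mod_cast Nat.factorial_pos r
  have hL1 : 1 ≤ L := hH.trans hHL
  set P : ℝ := ((hs.prod : ℕ) : ℝ) with hP
  have hP0 : 0 < P := by
    rw [hP]; exact_mod_cast List.prod_pos (fun h hh => (hhs h hh).1)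
  have hPH : P ≤ (H : ℝ) ^ r := by
    rw [hP, ← hlen]; exact_mod_cast List.prod_le_pow_card hs H (fun h hh => (hhs h hh).2)
  have hsum : ((hs.sum : ℕ) : ℝ) ≤ r * H := by
    rw [← hlen]
    have := List.sum_le_card_nsmul hs H (fun h hh => (hhs h hh).2)
    rw [smul_eq_mul] at this
    exact_mod_cast this
  obtain ⟨σ, hσ, hσ2⟩ : ∃ σ : ℝ, (σ = 1 ∨ σ = -1) ∧ σ * (ξ * (-1) ^ r) = |ξ| := by
    have h1 : |ξ * (-1) ^ r| = |ξ| := by rw [abs_mul, abs_pow, abs_neg, abs_one, one_pow, mul_one]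
    rcases abs_choice (ξ * (-1) ^ r) with h | h
    · exact ⟨1, Or.inl rfl, by rw [one_mul, ← h, h1]⟩
    · exact ⟨-1, Or.inr rfl, by rw [neg_one_mul, ← h, h1]⟩
  set g : ℕ → ℝ := fun n => Dn hs (fun n => Glog ξ 0 (a + n)) n with hg
  have hgr : ∀ n, g n = Dr hs (Glog ξ 0) (a + n) := fun n => Dn_eq_Dr hs a (Glog ξ 0) n
  have hd1 : ∀ n : ℕ, ∃ z : ℝ, (a : ℝ) ≤ z ∧ z ≤ a + n + 1 + r * H ∧
      σ * g (n + 1) - σ * g n = P * (|ξ| * Nat.factorial r / z ^ (r + 1)) := by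
    intro n
    have hn : (0 : ℝ) ≤ n := Nat.cast_nonneg n
    obtain ⟨z, hz1, hz2, hz3⟩ := Dr_mvt (1 :: hs) (Glog ξ) (a + n) (by
      intro h hh; rw [List.mem_cons] at hh; rcases hh with rfl | hh
      · exact le_rfl
      · exact (hhs h hh).1) (fun j y hy => Glog_deriv ξ j (by linarith)) 0
    rw [List.sum_cons, Nat.cast_add, Nat.cast_one] at hz2
    refine ⟨z, by linarith, by linarith, ?_⟩
    rw [Dr, Dr_sub, Nat.cast_one] at hz3
    rw [← mul_sub, hgr, hgr]
    push_cast
    rw [← add_assoc, hz3, List.prod_cons, one_mul, List.length_cons, hlen, zero_add, ← hσ2]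
    simp only [Glog]
    ring
  have hd2 : ∀ n : ℕ, σ * g (n + 2) - σ * g (n + 1) ≤ σ * g (n + 1) - σ * g n := by
    intro n
    have hn : (0 : ℝ) ≤ n := Nat.cast_nonneg n
    obtain ⟨z, hz1, hz2, hz3⟩ := Dr_mvt (1 :: 1 :: hs) (Glog ξ) (a + n) (by
      intro h hh; rw [List.mem_cons, List.mem_cons] at hh; rcases hh with rfl | rfl | hh
      · exact le_rfl
      · exact le_rfl
      · exact (hhs h hh).1) (fun j y hy => Glog_deriv ξ j (by linarith)) 0
    have hz0 : 0 < z := by linarith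
    rw [Dr, Dr_sub, Dr, Dr_sub, Dr_sub, Nat.cast_one] at hz3
    have e : (σ * g (n + 2) - σ * g (n + 1)) - (σ * g (n + 1) - σ * g n) =
        - (P * (|ξ| * Nat.factorial (r + 1) / z ^ (r + 2))) := by
      rw [hgr, hgr, hgr]
      push_cast
      rw [show (a : ℝ) + (n + 2) = a + n + 1 + 1 by ring, ← add_assoc]
      have : σ * (Dr hs (Glog ξ 0) (↑a + ↑n + 1 + 1) - Dr hs (Glog ξ 0) (↑a + ↑n + 1) -
        (Dr hs (Glog ξ 0) (↑a + ↑n + 1) - Dr hs (Glog ξ 0) (↑a + ↑n))) = 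
        - (P * (|ξ| * Nat.factorial (r + 1) / z ^ (r + 2))) := by
        rw [hz3, List.prod_cons, List.prod_cons, one_mul, one_mul, List.length_cons, List.length_cons, hlen,
          zero_add, ← hσ2]
        simp only [Glog]
        ring
      rw [← this]; ring
    have : 0 ≤ P * (|ξ| * Nat.factorial (r + 1) / z ^ (r + 2)) := by positivity
    linarith
  set l := P * (|ξ| * Nat.factorial r / (κ * a) ^ (r + 1)) with hl
  have hκa : 0 < κ * a := lt_of_lt_of_le (by positivity) hκ
  have hkl := kusmin_landau (fun n => σ * g n) l (by positivity) M
    (fun n => by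
      obtain ⟨z, hz1, hz2, hz3⟩ := hd1 n
      have hz0 : 0 < z := by linarith
      rw [hz3]; positivity)
    (fun n hn => by
      obtain ⟨z, hz1, hz2, hz3⟩ := hd1 n
      have hz0 : 0 < z := by linarith
      rw [hz3, hl]
      have hnL : (n : ℝ) ≤ L := by exact_mod_cast hn.trans hM
      have hL1' : (1 : ℝ) ≤ L := by exact_mod_cast hL1
      have hHL' : (H : ℝ) ≤ L := by exact_mod_cast hHL
      have hrH : (r : ℝ) * H ≤ r * L := by gcongr
      have : z ≤ κ * a := by linarith
      gcongr)
    (fun n => by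
      obtain ⟨z, hz1, hz2, hz3⟩ := hd1 n
      have hz0 : 0 < z := by linarith
      rw [hz3, ← mul_div_assoc, div_le_one (by positivity)]
      calc P * (|ξ| * Nat.factorial r) ≤ (H : ℝ) ^ r * (|ξ| * Nat.factorial r) := by gcongr
        _ ≤ a ^ (r + 1) := by linarith
        _ ≤ z ^ (r + 1) := by gcongr)
    hd2
  have e8 : 8 / l = 8 * (κ * a) ^ (r + 1) / (|ξ| * Nat.factorial r) / P := by
    rw [hl]; field_simp
  rw [← e8]
  refine le_trans (le_of_eq ?_) hkl
  rcases hσ with rfl | rfl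
  · simp only [one_mul]; rfl
  · simp only [neg_one_mul]; rw [norm_sum_cis_neg]

lemma log_sum_bound (r B : ℕ) (hr : 1 ≤ r) (hB : 1 ≤ B) : ∃ c : ℝ, 0 < c ∧ ∃ C : ℝ, 0 ≤ C ∧ ∃ a0 : ℕ,
    1 ≤ a0 ∧ ∀ a : ℕ, a0 ≤ a → ∀ ξ : ℝ, (a : ℝ) ^ (1 / 2 : ℝ) ≤ |ξ| → |ξ| ≤ (a : ℝ) ^ r → ∀ L' ≤ B * a,
    ‖∑ n ∈ Finset.range L', cis (ξ * Real.log (a + n))‖ ≤ C * (a : ℝ) ^ (1 - c) := by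
  obtain ⟨C, hC, hv⟩ := vdc_iter r
  set f : ℝ := ((Nat.factorial r : ℕ) : ℝ) with hf
  have hf1 : 1 ≤ f := by rw [hf]; exact_mod_cast Nat.one_le_iff_ne_zero.mpr (Nat.factorial_ne_zero r)
  have hr0 : (0 : ℝ) < r := by exact_mod_cast hr
  set κ : ℝ := 1 + (r + 2) * B with hκ
  have hκ0 : 0 < κ := by positivity
  set e : ℝ := 3 / (8 * r) with he
  have he0 : 0 < e := by positivity
  set C2 : ℝ := C * (2 * f + 8 * κ ^ (r + 1) * 2 ^ r * (1 + 8 * r) ^ r) with hC2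
  have hC20 : 0 ≤ C2 := by positivity
  set q := 2 ^ r with hq
  have hq0 : (0 : ℝ) < q := by rw [hq]; positivity
  refine ⟨e / q, by positivity, B * max 1 C2, by positivity, Nat.factorial r ^ 2,
    Nat.one_le_iff_ne_zero.mpr (pow_ne_zero _ (Nat.factorial_ne_zero r)), ?_⟩
  intro a ha ξ hξ1 hξ2 L' hL'
  have haf : f ^ 2 ≤ a := by rw [hf]; exact_mod_cast ha
  have ha1 : (1 : ℝ) ≤ a := by nlinarith
  have ha1' : 1 ≤ a := by exact_mod_cast ha1
  have ha0 : (0 : ℝ) < a := by linarith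
  have hhalf : 0 < (a : ℝ) ^ (1 / 2 : ℝ) := by positivity
  have hξ0 : 0 < |ξ| := lt_of_lt_of_le hhalf hξ1
  have hsq : f ≤ (a : ℝ) ^ (1 / 2 : ℝ) := by
    rw [← Real.sqrt_eq_rpow]; exact Real.le_sqrt_of_sq_le haf
  set Y : ℝ := (a : ℝ) ^ r * (a : ℝ) ^ (1 / 2 : ℝ) / (|ξ| * f) with hY
  have hY1 : (a : ℝ) ^ (1 / 2 : ℝ) / f ≤ Y := by
    rw [hY, div_le_div_iff₀ (by positivity) (by positivity)]
    have : (a : ℝ) ^ (1 / 2 : ℝ) * f * |ξ| ≤ (a : ℝ) ^ (1 / 2 : ℝ) * f * (a : ℝ) ^ r := by gcongr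
    linarith
  have hY1' : 1 ≤ Y := le_trans (by rw [le_div_iff₀ (by positivity)]; linarith) hY1
  have hYa : Y ≤ (a : ℝ) ^ r := by
    rw [hY, div_le_iff₀ (by positivity)]
    have : (a : ℝ) ^ (1 / 2 : ℝ) ≤ |ξ| * f := by nlinarith
    gcongr
  set y : ℝ := Y ^ (1 / r : ℝ) with hy
  have hyr : y ^ r = Y := by
    rw [hy, ← Real.rpow_natCast, ← Real.rpow_mul (by linarith)]
    rw [one_div_mul_cancel hr0.ne', Real.rpow_one]
  have hy1 : 1 ≤ y := Real.one_le_rpow hY1' (by positivity)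
  have hya : y ≤ a := by
    refine le_of_pow_le_pow_left₀ (n := r) (by omega) ha0.le ?_
    rw [hyr]; exact hYa
  set H := ⌊y⌋₊ with hH
  have hHy : (H : ℝ) ≤ y := Nat.floor_le (by linarith)
  have hH1 : 1 ≤ H := Nat.le_floor (by simpa using hy1)
  have hH2 : y / 2 ≤ H := by
    have := Nat.lt_floor_add_one y
    have h1 : (1 : ℝ) ≤ H := by exact_mod_cast hH1
    rw [← hH] at this
    linarith
  have hH0 : (0 : ℝ) < H := by exact_mod_cast hH1
  have hHa : H ≤ a := by
    have : (H : ℝ) ≤ a := hHy.trans hya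
    exact_mod_cast this
  have hHL : H ≤ B * a := hHa.trans (Nat.le_mul_of_pos_left _ hB)
  set L := B * a with hL
  have hLr : (L : ℝ) = B * a := by rw [hL]; push_cast; ring
  have hL0 : (0 : ℝ) < L := by exact_mod_cast (hH1.trans hHL)
  have hHr : (H : ℝ) ^ r ≤ Y := by rw [← hyr]; gcongr
  have hmain := hv L H hH1 hHL (fun n => Glog ξ 0 (a + n)) (8 * (κ * a) ^ (r + 1) / (|ξ| * f)) (by positivity)
    (fun hs hlen hhs M hM => diff_bound r a L H ha1' hH1 hHL ξ κ (abs_pos.mp hξ0)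
      (by rw [hLr, hκ]; apply le_of_eq; ring) (by
        calc (H : ℝ) ^ r * |ξ| * Nat.factorial r ≤ Y * |ξ| * f := by gcongr
          _ = (a : ℝ) ^ r * (a : ℝ) ^ (1 / 2 : ℝ) := by rw [hY]; field_simp
          _ ≤ (a : ℝ) ^ r * (a : ℝ) ^ (1 : ℝ) := by
            have := Real.rpow_le_rpow_of_exponent_le ha1 (show (1/2:ℝ) ≤ 1 by norm_num)
            gcongr
          _ = (a : ℝ) ^ (r + 1) := by rw [Real.rpow_one, pow_succ]) hs hlen hhs M hM) L' hL'
  set S := ‖∑ n ∈ Finset.range L', cis (ξ * Real.log (a + n))‖ with hS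
  change (S / L) ^ q ≤ _ at hmain
  have hyinv : 1 / (H : ℝ) ≤ 2 * f * (a : ℝ) ^ (-e) := by
    have h1 : 1 / (H : ℝ) ≤ 2 / y := by
      rw [div_le_div_iff₀ hH0 (by linarith)]; linarith
    have h2 : (a : ℝ) ^ e / f ≤ y := by
      refine le_of_pow_le_pow_left₀ (n := r) (by omega) (by linarith) ?_
      rw [hyr, div_pow]
      refine le_trans ?_ hY1
      have e1 : ((a : ℝ) ^ e) ^ r = (a : ℝ) ^ (3 / 8 : ℝ) := by
        rw [← Real.rpow_natCast, ← Real.rpow_mul ha0.le]; congr 1; rw [he]; field_simp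
      rw [e1]
      have h38 := Real.rpow_le_rpow_of_exponent_le ha1 (show (3/8:ℝ) ≤ 1/2 by norm_num)
      gcongr
      · exact le_self_pow₀ hf1 (by omega)
    calc 1 / (H : ℝ) ≤ 2 / y := h1
      _ ≤ 2 / ((a : ℝ) ^ e / f) := by gcongr
      _ = _ := by rw [Real.rpow_neg ha0.le]; field_simp
  have hlogH : 1 + Real.log H ≤ (1 + 8 * r) * (a : ℝ) ^ (1 / (8 * r) : ℝ) := by
    have h1 : Real.log H ≤ Real.log a := Real.log_le_log hH0 (by exact_mod_cast hHa)
    have h2 := Real.log_le_rpow_div ha0.le (show (0 : ℝ) < 1 / (8 * r) by positivity)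
    have h3 : 1 ≤ (a : ℝ) ^ (1 / (8 * r) : ℝ) := Real.one_le_rpow ha1 (by positivity)
    rw [div_div_eq_mul_div, div_one] at h2
    linarith
  have hsecond : 8 * (κ * a) ^ (r + 1) / (|ξ| * f) / L * ((1 + Real.log H) / H) ^ r ≤
      8 * κ ^ (r + 1) * 2 ^ r * (1 + 8 * r) ^ r * (a : ℝ) ^ (-e) := by
    have hlog0 : 0 ≤ Real.log H := Real.log_natCast_nonneg H
    have h1 : (1 + Real.log H) ^ r ≤ (1 + 8 * r) ^ r * (a : ℝ) ^ (1 / 8 : ℝ) := by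
      calc _ ≤ ((1 + 8 * r) * (a : ℝ) ^ (1 / (8 * r) : ℝ)) ^ r := by gcongr
        _ = _ := by
          rw [mul_pow]; congr 1
          rw [← Real.rpow_natCast, ← Real.rpow_mul ha0.le]; congr 1; field_simp
    have h2 : 1 / (H : ℝ) ^ r ≤ 2 ^ r / Y := by
      rw [← hyr, ← div_pow, ← one_div_pow]
      have : 1 / (H : ℝ) ≤ 2 / y := by
        rw [div_le_div_iff₀ hH0 (by linarith)]; linarith
      gcongr
    have h3 : (a : ℝ) ≤ L := by
      rw [hLr]; exact le_mul_of_one_le_left ha0.le (by exact_mod_cast hB)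
    have h4 : (a : ℝ) ^ (1 / 8 : ℝ) / (a : ℝ) ^ (1 / 2 : ℝ) ≤ (a : ℝ) ^ (-e) := by
      rw [← Real.rpow_sub ha0]
      refine Real.rpow_le_rpow_of_exponent_le ha1 ?_
      have : e ≤ 3 / 8 := by
        rw [he, div_le_div_iff₀ (by positivity) (by norm_num)]
        have : (1 : ℝ) ≤ r := by exact_mod_cast hr
        linarith
      linarith
    calc 8 * (κ * a) ^ (r + 1) / (|ξ| * f) / L * ((1 + Real.log H) / H) ^ r
        = 8 * (κ * a) ^ (r + 1) / (|ξ| * f) / L * ((1 + Real.log H) ^ r * (1 / (H : ℝ) ^ r)) := by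
          rw [div_pow]; ring
      _ ≤ 8 * (κ * a) ^ (r + 1) / (|ξ| * f) / a *
          ((1 + 8 * r) ^ r * (a : ℝ) ^ (1 / 8 : ℝ) * (2 ^ r / Y)) := by gcongr
      _ = 8 * κ ^ (r + 1) * 2 ^ r * (1 + 8 * r) ^ r * ((a : ℝ) ^ (1 / 8 : ℝ) / (a : ℝ) ^ (1 / 2 : ℝ)) := by
          rw [hY, mul_pow, pow_succ (a : ℝ) r]; field_simp
      _ ≤ _ := by gcongr
  have hfin : (S / L) ^ q ≤ C2 * (a : ℝ) ^ (-e) := by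
    refine hmain.trans ?_
    calc _ ≤ C * (2 * f * (a : ℝ) ^ (-e) + 8 * κ ^ (r + 1) * 2 ^ r * (1 + 8 * r) ^ r * (a : ℝ) ^ (-e)) := by gcongr
      _ = _ := by rw [hC2]; ring
  have hroot : S / L ≤ max 1 C2 * (a : ℝ) ^ (-(e / q)) := by
    refine le_of_pow_le_pow_left₀ (n := q) (by positivity) (by positivity) (hfin.trans ?_)
    rw [mul_pow]
    have e1 : ((a : ℝ) ^ (-(e / q))) ^ q = (a : ℝ) ^ (-e) := by
      rw [← Real.rpow_natCast, ← Real.rpow_mul ha0.le]; congr 1; field_simp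
    rw [e1]
    gcongr
    exact (le_max_right 1 C2).trans (le_self_pow₀ (le_max_left _ _) (by positivity))
  rw [div_le_iff₀ hL0] at hroot
  refine hroot.trans (le_of_eq ?_)
  rw [hLr, sub_eq_add_neg, Real.rpow_add ha0, Real.rpow_one]; ring

lemma abel_bound (f : ℕ → ℝ) (z : ℕ → ℂ) (K : ℝ) (L : ℕ) (hf0 : ∀ n, 0 ≤ f n) (hf : ∀ n, f (n + 1) ≤ f n)
    (hK : ∀ l ≤ L, ‖∑ n ∈ Finset.range l, z n‖ ≤ K) :
    ‖∑ n ∈ Finset.range L, (f n : ℂ) * z n‖ ≤ f 0 * K := by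
  have hid : ∀ l, ∑ n ∈ Finset.range l, (f n : ℂ) * z n = (f l : ℂ) * ∑ n ∈ Finset.range l, z n +
      ∑ n ∈ Finset.range l, ((f n - f (n + 1) : ℝ) : ℂ) * ∑ k ∈ Finset.range (n + 1), z k := by
    intro l
    induction l with
    | zero => simp
    | succ l ih =>
      rw [Finset.sum_range_succ, ih, Finset.sum_range_succ (fun n => ((f n - f (n + 1) : ℝ) : ℂ) * _) l,
        Finset.sum_range_succ z l]
      push_cast; ring
  rw [hid L]
  have hK0 : 0 ≤ K := (norm_nonneg _).trans (hK 0 (Nat.zero_le _))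
  calc _ ≤ ‖(f L : ℂ) * ∑ n ∈ Finset.range L, z n‖ +
        ∑ n ∈ Finset.range L, ‖((f n - f (n + 1) : ℝ) : ℂ) * ∑ k ∈ Finset.range (n + 1), z k‖ :=
        (norm_add_le _ _).trans (by gcongr; exact norm_sum_le _ _)
    _ ≤ f L * K + ∑ n ∈ Finset.range L, (f n - f (n + 1)) * K := by
        gcongr with n hn
        · rw [norm_mul, Complex.norm_real, Real.norm_of_nonneg (hf0 L)]
          gcongr
          · exact hf0 L
          · exact hK L le_rfl
        · have : 0 ≤ f n - f (n + 1) := by linarith [hf n]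
          rw [norm_mul, Complex.norm_real, Real.norm_of_nonneg this]
          gcongr
          exact hK _ (Finset.mem_range.mp hn)
    _ = f 0 * K := by
        rw [← Finset.sum_mul, Finset.sum_range_sub']; ring

lemma int_cis_bound (a b ξ : ℝ) (hξ : ξ ≠ 0) : ‖∫ u in a..b, cis (u * ξ)‖ ≤ 2 / |ξ| := by
  have h : ∀ u, cis (u * ξ) = Complex.exp ((ξ * Complex.I) * u) := by
    intro u; unfold cis; congr 1; push_cast; ring
  simp_rw [h]
  have hne : (ξ * Complex.I : ℂ) ≠ 0 := mul_ne_zero (by exact_mod_cast hξ) Complex.I_ne_zero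
  rw [integral_exp_mul_complex hne, norm_div]
  have h1 : ‖(ξ * Complex.I : ℂ)‖ = |ξ| := by simp
  rw [h1]
  gcongr
  refine (norm_sub_le _ _).trans ?_
  rw [← h, ← h, norm_cis, norm_cis]; norm_num

lemma es_low_term (m : ℕ) (hm : 1 ≤ m) (ξ : ℝ) :
    ‖(1 / m : ℂ) * cis (ξ * Real.log m) - ∫ u in (Real.log m)..(Real.log (m + 1 : ℕ)), cis (u * ξ)‖ ≤
      (|ξ| + 1) / (m : ℝ) ^ 2 := by
  have hm0 : (0 : ℝ) < m := by exact_mod_cast hm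
  set p := Real.log m
  set q := Real.log (m + 1 : ℕ)
  have h1 : q - p ≤ 1 / m := log_succ_div_le hm
  have h2 : 1 / ((m : ℝ) + 1) ≤ q - p := by have := le_log_succ_div hm; push_cast at this; simpa [p, q] using this
  have h0 : p ≤ q := log_nat_mono hm (Nat.le_succ m)
  have e1 : ∫ u in p..q, cis (ξ * p) = ((q - p : ℝ) : ℂ) * cis (ξ * p) := by
    rw [intervalIntegral.integral_const]; simp
  have hc : Continuous fun u : ℝ => cis (u * ξ) := continuous_cis.comp (by fun_prop)
  have e2 : ‖(∫ u in p..q, cis (ξ * p)) - ∫ u in p..q, cis (u * ξ)‖ ≤ |ξ| / (m : ℝ) ^ 2 := by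
    rw [← intervalIntegral.integral_sub (by simp) (hc.intervalIntegrable _ _)]
    have := intervalIntegral.norm_integral_le_of_norm_le_const (a := p) (b := q)
      (f := fun u => cis (ξ * p) - cis (u * ξ)) (C := |ξ| * (1 / m)) (by
        intro u hu
        rw [Set.uIoc_of_le h0] at hu
        refine (cis_sub_le _ _).trans ?_
        rw [mul_comm u ξ, ← mul_sub, abs_mul]
        gcongr
        rw [abs_le]; constructor <;> linarith [hu.1, hu.2])
    refine this.trans ?_
    rw [abs_of_nonneg (show 0 ≤ q - p by linarith)]
    calc |ξ| * (1 / m) * (q - p) ≤ |ξ| * (1 / m) * (1 / m) := by gcongr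
      _ = _ := by field_simp
  have e3 : ‖(1 / m : ℂ) * cis (ξ * p) - ((q - p : ℝ) : ℂ) * cis (ξ * p)‖ ≤ 1 / (m : ℝ) ^ 2 := by
    rw [← sub_mul, norm_mul, norm_cis, mul_one]
    have : ((1 / m : ℂ) - ((q - p : ℝ) : ℂ)) = ((1 / m - (q - p) : ℝ) : ℂ) := by push_cast; ring
    rw [this, Complex.norm_real, Real.norm_of_nonneg (by linarith)]
    have : 1 / (m : ℝ) - 1 / (m + 1) ≤ 1 / (m : ℝ) ^ 2 := by
      rw [div_sub_div _ _ hm0.ne' (by positivity), div_le_div_iff₀ (by positivity) (by positivity)]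
      nlinarith
    linarith
  calc _ = ‖((1 / m : ℂ) * cis (ξ * p) - ((q - p : ℝ) : ℂ) * cis (ξ * p)) +
        ((∫ u in p..q, cis (ξ * p)) - ∫ u in p..q, cis (u * ξ))‖ := by rw [e1]; congr 1; ring
    _ ≤ _ := (norm_add_le _ _).trans (by rw [add_div]; linarith)

lemma sum_inv_sq_le (a : ℕ) (ha : 1 ≤ a) (k : ℕ) :
    ∑ m ∈ Finset.Ico a (a + k), 1 / (m : ℝ) ^ 2 ≤ 2 / a - 2 / ((a + k : ℕ) : ℝ) := by
  have ha0 : (1 : ℝ) ≤ a := by exact_mod_cast ha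
  induction k with
  | zero => simp
  | succ k ih =>
    rw [← add_assoc, Finset.sum_Ico_succ_top (by omega)]
    set M : ℝ := ((a + k : ℕ) : ℝ) with hM
    have hM1 : 1 ≤ M := by rw [hM]; exact_mod_cast (by omega : 1 ≤ a + k)
    have hM2 : (((a + k + 1 : ℕ)) : ℝ) = M + 1 := by push_cast [hM]; ring
    rw [hM2]
    have : 1 / M ^ 2 ≤ 2 / M - 2 / (M + 1) := by
      rw [div_sub_div _ _ (by positivity) (by positivity), div_le_div_iff₀ (by positivity) (by positivity)]
      nlinarith [mul_nonneg (by linarith : 0 ≤ M) (by linarith : 0 ≤ M - 1), sq_nonneg M]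
    linarith

lemma es_low (a k : ℕ) (ha : 1 ≤ a) (ξ : ℝ) :
    ‖∑ m ∈ Finset.Ico a (a + k), (1 / m : ℂ) * cis (ξ * Real.log m) -
      ∫ u in (Real.log a)..(Real.log (a + k : ℕ)), cis (u * ξ)‖ ≤
    (|ξ| + 1) * ∑ m ∈ Finset.Ico a (a + k), 1 / (m : ℝ) ^ 2 := by
  have hc : Continuous fun u : ℝ => cis (u * ξ) := continuous_cis.comp (by fun_prop)
  induction k with
  | zero => simp
  | succ k ih =>
    rw [← add_assoc, Finset.sum_Ico_succ_top (by omega), Finset.sum_Ico_succ_top (by omega),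
      ← intervalIntegral.integral_add_adjacent_intervals (hc.intervalIntegrable _ (Real.log (a + k : ℕ)))
        (hc.intervalIntegrable _ _), mul_add]
    have := es_low_term (a + k) (by omega) ξ
    rw [div_eq_mul_one_div (|ξ| + 1)] at this
    rw [add_sub_add_comm]
    exact (norm_add_le _ _).trans (add_le_add ih this)

theorem ES (r B : ℕ) (hr : 1 ≤ r) (hB : 1 ≤ B) : ∃ c : ℝ, 0 < c ∧ ∃ C : ℝ, 0 ≤ C ∧ ∃ a0 : ℕ, 1 ≤ a0 ∧
    ∀ a : ℕ, a0 ≤ a → ∀ b, a ≤ b → b ≤ B * a → ∀ ξ : ℝ, |ξ| ≤ (a : ℝ) ^ r →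
    ‖∑ m ∈ Finset.Icc a b, (1 / m : ℂ) * cis (ξ * Real.log m) -
      ∫ u in (Real.log a)..(Real.log b), cis (u * ξ)‖ ≤ C * (a : ℝ) ^ (-c) := by
  obtain ⟨c, hc, C, hC, a0, ha0, h⟩ := log_sum_bound r B hr hB
  refine ⟨min c (1 / 2), by positivity, C + 5, by positivity, a0, ha0, ?_⟩
  intro a ha b hab hbB ξ hξ
  have ha1 : 1 ≤ a := ha0.trans ha
  have ha1' : (1 : ℝ) ≤ a := by exact_mod_cast ha1
  have ha0' : (0 : ℝ) < a := by linarith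
  have hp1 : (a : ℝ) ^ (-(1 / 2) : ℝ) ≤ (a : ℝ) ^ (-(min c (1 / 2))) :=
    Real.rpow_le_rpow_of_exponent_le ha1' (neg_le_neg (min_le_right _ _))
  have hp2 : (a : ℝ) ^ (-c) ≤ (a : ℝ) ^ (-(min c (1 / 2))) :=
    Real.rpow_le_rpow_of_exponent_le ha1' (neg_le_neg (min_le_left _ _))
  have hpp : 0 < (a : ℝ) ^ (-(min c (1 / 2))) := by positivity
  obtain ⟨k, rfl⟩ := Nat.exists_eq_add_of_le hab
  rcases le_total (|ξ|) ((a : ℝ) ^ (1 / 2 : ℝ)) with hlow | hhigh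
  · have h1 := es_low a k ha1 ξ
    have h2 := sum_inv_sq_le a ha1 k
    rw [← Finset.Ico_add_one_right_eq_Icc, Finset.sum_Ico_succ_top (by omega), add_sub_right_comm]
    have hsq1 : 1 ≤ (a : ℝ) ^ (1 / 2 : ℝ) := Real.one_le_rpow ha1' (by norm_num)
    have hsq : (a : ℝ) ^ (1 / 2 : ℝ) / a = (a : ℝ) ^ (-(1 / 2) : ℝ) := by
      nth_rewrite 2 [← Real.rpow_one (a : ℝ)]
      rw [← Real.rpow_sub ha0']; norm_num
    have h3 : ‖(1 / ((a + k : ℕ) : ℂ)) * cis (ξ * Real.log (a + k : ℕ))‖ ≤ 1 / a := by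
      rw [norm_mul, norm_cis, mul_one, norm_div, norm_one, Complex.norm_natCast]
      gcongr
    have h4 : (|ξ| + 1) * ∑ m ∈ Finset.Ico a (a + k), 1 / (m : ℝ) ^ 2 ≤ 4 * (a : ℝ) ^ (-(1 / 2) : ℝ) := by
      calc _ ≤ ((a : ℝ) ^ (1 / 2 : ℝ) + (a : ℝ) ^ (1 / 2 : ℝ)) * (2 / a) := by
            gcongr
            refine h2.trans ?_
            have : 0 ≤ 2 / ((a + k : ℕ) : ℝ) := by positivity
            linarith
        _ = _ := by rw [← hsq]; ring
    have h5 : 1 / (a : ℝ) ≤ (a : ℝ) ^ (-(1 / 2) : ℝ) := by rw [← hsq]; gcongr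
    refine (norm_add_le _ _).trans ?_
    nlinarith
  · have hξ0 : 0 < |ξ| := lt_of_lt_of_le (by positivity) hhigh
    have hk : k + 1 ≤ B * a := by omega
    have h1 := abel_bound (fun n => 1 / ((a : ℝ) + n)) (fun n => cis (ξ * Real.log (a + n))) (C * (a : ℝ) ^ (1 - c))
      (k + 1) (fun n => by positivity) (fun n => by
        push_cast
        gcongr
        linarith) (fun l hl => h a ha ξ hhigh hξ l (hl.trans hk))
    have e1 : ∑ n ∈ Finset.range (k + 1), ((1 / ((a : ℝ) + n) : ℝ) : ℂ) * cis (ξ * Real.log (a + n)) =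
        ∑ m ∈ Finset.Icc a (a + k), (1 / m : ℂ) * cis (ξ * Real.log m) := by
      rw [← Finset.Ico_add_one_right_eq_Icc, Finset.sum_Ico_eq_sum_range]
      rw [show a + k + 1 - a = k + 1 by omega]
      refine Finset.sum_congr rfl fun n _ => ?_
      push_cast; rfl
    rw [e1] at h1
    have h2 := int_cis_bound (Real.log a) (Real.log (a + k : ℕ)) ξ (abs_pos.mp hξ0)
    have h3 : 2 / |ξ| ≤ 2 * (a : ℝ) ^ (-(1 / 2) : ℝ) := by
      rw [Real.rpow_neg ha0'.le, ← div_eq_mul_inv]; gcongr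
    have h4 : 1 / ((a : ℝ) + (0 : ℕ)) * (C * (a : ℝ) ^ (1 - c)) = C * (a : ℝ) ^ (-c) := by
      rw [sub_eq_add_neg, Real.rpow_add ha0', Real.rpow_one]; field_simp; simp
    rw [h4] at h1
    refine (norm_sub_le _ _).trans ?_
    have := mul_le_mul_of_nonneg_left hp2 hC
    nlinarith

lemma sqfree_sum_lower (R : ℕ) (hR : 1 ≤ R) :
    Real.log R / 2 ≤ ∑ m ∈ (Finset.Icc 1 R).filter Squarefree, 1 / (m : ℝ) := by
  set L := ∑ m ∈ (Finset.Icc 1 R).filter Squarefree, 1 / (m : ℝ) with hL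
  have hL0 : 0 ≤ L := Finset.sum_nonneg fun _ _ => by positivity
  have h1 : Real.log R ≤ ∑ n ∈ Finset.Icc 1 R, 1 / (n : ℝ) := by
    have := harm_lower (a := 1) (b := R) le_rfl hR
    have h2 := log_nat_mono hR (Nat.le_succ R)
    simp only [Nat.cast_one, Real.log_one, sub_zero] at this
    linarith
  have h2 : ∑ n ∈ Finset.Icc 1 R, 1 / (n : ℝ) ≤
      ∑ x ∈ ((Finset.Icc 1 R).filter Squarefree) ×ˢ (Finset.Ico 1 (1 + R)), 1 / ((x.1 * x.2 ^ 2 : ℕ) : ℝ) := by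
    have hch : ∀ n : ℕ, ∃ x : ℕ × ℕ, 1 ≤ n → x.1 * x.2 ^ 2 = n ∧ Squarefree x.1 := by
      intro n
      obtain ⟨a, b, h, h'⟩ := Nat.sq_mul_squarefree n
      exact ⟨(a, b), fun _ => ⟨by rw [← h]; ring, h'⟩⟩
    choose g hg using hch
    calc ∑ n ∈ Finset.Icc 1 R, 1 / (n : ℝ) = ∑ x ∈ (Finset.Icc 1 R).image g, 1 / ((x.1 * x.2 ^ 2 : ℕ) : ℝ) := by
          rw [Finset.sum_image]
          · refine Finset.sum_congr rfl fun n hn => ?_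
            rw [(hg n (Finset.mem_Icc.mp hn).1).1]
          · intro x hx y hy hxy
            have h1 := (hg x (Finset.mem_Icc.mp hx).1).1
            have h2 := (hg y (Finset.mem_Icc.mp hy).1).1
            rw [← h1, ← h2, hxy]
      _ ≤ _ := by
          refine Finset.sum_le_sum_of_subset_of_nonneg ?_ fun _ _ _ => by positivity
          intro x hx
          rw [Finset.mem_image] at hx
          obtain ⟨n, hn, rfl⟩ := hx
          rw [Finset.mem_Icc] at hn
          obtain ⟨h1, h2⟩ := hg n hn.1
          have hb0 : (g n).2 ≠ 0 := by rintro h; rw [h] at h1; simp at h1; omega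
          have ha0 : (g n).1 ≠ 0 := by rintro h; rw [h] at h1; simp at h1; omega
          rw [Finset.mem_product, Finset.mem_filter, Finset.mem_Icc, Finset.mem_Ico]
          have h3 : (g n).1 ≤ n := by
            nth_rewrite 2 [← h1]; exact Nat.le_mul_of_pos_right _ (by positivity)
          have h4 : (g n).2 ≤ n := by
            nth_rewrite 2 [← h1]
            calc (g n).2 ≤ (g n).2 ^ 2 := Nat.le_self_pow (by norm_num) _
              _ ≤ _ := Nat.le_mul_of_pos_left _ (Nat.pos_of_ne_zero ha0)
          refine ⟨⟨⟨?_, ?_⟩, h2⟩, ?_, ?_⟩ <;> omega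
  have h3 : ∑ x ∈ ((Finset.Icc 1 R).filter Squarefree) ×ˢ (Finset.Ico 1 (1 + R)), 1 / ((x.1 * x.2 ^ 2 : ℕ) : ℝ) =
      L * ∑ m ∈ Finset.Ico 1 (1 + R), 1 / (m : ℝ) ^ 2 := by
    rw [Finset.sum_product, hL, Finset.sum_mul_sum]
    refine Finset.sum_congr rfl fun a _ => Finset.sum_congr rfl fun b _ => ?_
    push_cast; rw [div_mul_div_comm, one_mul]
  have h4 := sum_inv_sq_le 1 le_rfl R
  have h5 : ∑ m ∈ Finset.Ico 1 (1 + R), 1 / (m : ℝ) ^ 2 ≤ 2 := by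
    refine h4.trans ?_
    have : 0 ≤ 2 / ((1 + R : ℕ) : ℝ) := by positivity
    norm_num at this ⊢
    exact this
  rw [h3] at h2
  have := mul_le_mul_of_nonneg_left h5 hL0
  linarith

/-- Selberg weights -/
theorem selberg_weights (R : ℕ) (hR : 2 ≤ R) : ∃ ρ : ℕ → ℝ, ρ 1 = 1 ∧ (∀ d, |ρ d| ≤ d) ∧
    0 ≤ ∑ d ∈ Finset.Icc 1 R, ∑ e ∈ Finset.Icc 1 R, ρ d * ρ e / (Nat.lcm d e : ℝ) ∧
    ∑ d ∈ Finset.Icc 1 R, ∑ e ∈ Finset.Icc 1 R, ρ d * ρ e / (Nat.lcm d e : ℝ) ≤ 2 / Real.log R := by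
  set L := ∑ m ∈ (Finset.Icc 1 R).filter Squarefree, 1 / (m : ℝ) with hL
  have hlogR : 0 < Real.log R := Real.log_pos (by exact_mod_cast hR)
  have hLl := sqfree_sum_lower R (by omega)
  have hL0 : 0 < L := by rw [← hL] at hLl; linarith
  let mu : ℕ → ℝ := fun n => (ArithmeticFunction.moebius n : ℝ)
  have hmu : ∀ n, |mu n| ≤ 1 := fun n => by
    have := ArithmeticFunction.abs_moebius_le_one (n := n)
    show |((ArithmeticFunction.moebius n : ℤ) : ℝ)| ≤ 1
    exact_mod_cast this
  have hmusq : ∀ n, mu n ^ 2 = if Squarefree n then 1 else 0 := fun n => by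
    have := ArithmeticFunction.moebius_sq (n := n)
    show ((ArithmeticFunction.moebius n : ℤ) : ℝ) ^ 2 = _
    split_ifs with h
    · rw [if_pos h] at this; exact_mod_cast this
    · rw [if_neg h] at this; exact_mod_cast this
  let y : ℕ → ℝ := fun m => mu m / (m * L)
  let ρ : ℕ → ℝ := fun d => d * ∑ m ∈ (Finset.Icc 1 R).filter (d ∣ ·), mu (m / d) * y m
  have hLmu : ∑ m ∈ Finset.Icc 1 R, mu m ^ 2 / (m : ℝ) = L := by
    rw [hL, Finset.sum_filter]
    refine Finset.sum_congr rfl fun m _ => ?_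
    rw [hmusq]; split_ifs <;> simp
  -- inversion
  have hinv : ∀ m ∈ Finset.Icc 1 R, ∑ d ∈ (Finset.Icc 1 R).filter (m ∣ ·), ρ d / d = y m := by
    intro m hm
    have hm' := Finset.mem_Icc.mp hm
    have h1 : ∀ d ∈ (Finset.Icc 1 R).filter (m ∣ ·), ρ d / d =
        ∑ n ∈ Finset.Icc 1 R, if d ∣ n then mu (n / d) * y n else 0 := by
      intro d hd
      have hd' := Finset.mem_Icc.mp (Finset.mem_filter.mp hd).1
      have : (d : ℝ) ≠ 0 := by exact_mod_cast (by omega : d ≠ 0)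
      rw [← Finset.sum_filter]
      simp only [ρ]; field_simp
    rw [Finset.sum_congr rfl h1, Finset.sum_comm]
    have h2 : ∀ n ∈ Finset.Icc 1 R, ∑ d ∈ (Finset.Icc 1 R).filter (m ∣ ·),
        (if d ∣ n then mu (n / d) * y n else 0) = if n = m then y n else 0 := by
      intro n hn
      have hn' := Finset.mem_Icc.mp hn
      rw [← Finset.sum_filter, Finset.filter_filter]
      by_cases hmn : m ∣ n
      · obtain ⟨s, rfl⟩ := hmn
        have hs : s ≠ 0 := by rintro rfl; simp at hn'
        have h3 : ∑ d ∈ (Finset.Icc 1 R).filter (fun a => m ∣ a ∧ a ∣ m * s), mu (m * s / d) * y (m * s) =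
            ∑ t ∈ s.divisors, mu (s / t) * y (m * s) := by
          symm
          refine Finset.sum_bij (fun t _ => m * t) ?_ ?_ ?_ ?_
          · intro t ht
            have ht' := Nat.dvd_of_mem_divisors ht
            have := Nat.mul_dvd_mul_left m ht'
            have h5 := Nat.le_of_dvd (by omega) this
            have h6 : t ≠ 0 := by rintro rfl; simp at ht
            have h7 : 0 < m * t := Nat.mul_pos (by omega) (by omega)
            rw [Finset.mem_filter, Finset.mem_Icc]
            exact ⟨⟨h7, by omega⟩, dvd_mul_right _ _, this⟩
          · intro a _ b _ hab
            exact Nat.eq_of_mul_eq_mul_left (by omega) hab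
          · intro d hd
            rw [Finset.mem_filter] at hd
            obtain ⟨t, rfl⟩ := hd.2.1
            exact ⟨t, Nat.mem_divisors.mpr ⟨Nat.dvd_of_mul_dvd_mul_left (by omega) hd.2.2, hs⟩, rfl⟩
          · intro t _
            rw [Nat.mul_div_mul_left _ _ (by omega)]
        rw [h3, ← Finset.sum_mul, Nat.sum_div_divisors s mu]
        have h4 : ∑ d ∈ s.divisors, mu d = if s = 1 then 1 else 0 := by
          have h9 := congrArg (fun F : ArithmeticFunction ℤ => F s) ArithmeticFunction.coe_zeta_mul_moebius
          simp only [ArithmeticFunction.coe_zeta_mul_apply, ArithmeticFunction.one_apply] at h9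
          have h10 : ∑ d ∈ s.divisors, mu d = ((∑ d ∈ s.divisors, ArithmeticFunction.moebius d : ℤ) : ℝ) := by
            push_cast; rfl
          rw [h10, h9]; split_ifs <;> simp
        rw [h4]
        by_cases hs1 : s = 1
        · simp [hs1]
        · have : m * s ≠ m := by
            intro h; apply hs1
            exact Nat.eq_of_mul_eq_mul_left (by omega : 0 < m) (by rw [h, mul_one])
          simp [hs1, this]
      · have : n ≠ m := by rintro rfl; exact hmn dvd_rfl
        rw [if_neg this]
        apply Finset.sum_eq_zero
        intro d hd
        exact absurd ((Finset.mem_filter.mp hd).2.1.trans (Finset.mem_filter.mp hd).2.2) hmn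
    rw [Finset.sum_congr rfl h2, Finset.sum_ite_eq' , if_pos hm]
  have hdiag : ∑ d ∈ Finset.Icc 1 R, ∑ e ∈ Finset.Icc 1 R, ρ d * ρ e / (Nat.lcm d e : ℝ) =
      ∑ m ∈ Finset.Icc 1 R, (Nat.totient m : ℝ) * y m ^ 2 := by
    have h1 : ∀ d ∈ Finset.Icc 1 R, ∀ e ∈ Finset.Icc 1 R, ρ d * ρ e / (Nat.lcm d e : ℝ) =
        ∑ m ∈ Finset.Icc 1 R, (if m ∣ d then ρ d / d else 0) * (if m ∣ e then ρ e / e else 0) * Nat.totient m := by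
      intro d hd e he
      have hd' := Finset.mem_Icc.mp hd
      have he' := Finset.mem_Icc.mp he
      have hd0 : (d : ℝ) ≠ 0 := by exact_mod_cast (by omega : d ≠ 0)
      have he0 : (e : ℝ) ≠ 0 := by exact_mod_cast (by omega : e ≠ 0)
      have hg : (Nat.gcd d e : ℝ) * Nat.lcm d e = d * e := by exact_mod_cast Nat.gcd_mul_lcm d e
      have hl0 : (Nat.lcm d e : ℝ) ≠ 0 := by
        intro h; rw [h, mul_zero] at hg; exact mul_ne_zero hd0 he0 hg.symm
      have hgt : (Nat.gcd d e : ℝ) = ∑ m ∈ (Nat.gcd d e).divisors, (Nat.totient m : ℝ) := by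
        exact_mod_cast (Nat.sum_totient (Nat.gcd d e)).symm
      have hset : (Nat.gcd d e).divisors = (Finset.Icc 1 R).filter (fun m => m ∣ d ∧ m ∣ e) := by
        ext m
        rw [Nat.mem_divisors, Finset.mem_filter, Finset.mem_Icc, Nat.dvd_gcd_iff]
        constructor
        · rintro ⟨h, _⟩
          exact ⟨⟨Nat.pos_of_dvd_of_pos h.1 (by omega), (Nat.le_of_dvd (by omega) h.1).trans hd'.2⟩, h⟩
        · rintro ⟨_, h⟩
          exact ⟨h, (Nat.gcd_pos_of_pos_left _ (by omega)).ne'⟩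
      have : ρ d * ρ e / (Nat.lcm d e : ℝ) = (ρ d / d) * (ρ e / e) * Nat.gcd d e := by
        field_simp
        linear_combination (-(ρ d * ρ e)) * hg
      rw [this, hgt, hset, Finset.mul_sum, Finset.sum_filter]
      refine Finset.sum_congr rfl fun m _ => ?_
      by_cases h1 : m ∣ d <;> by_cases h2 : m ∣ e <;> simp [h1, h2]
    rw [Finset.sum_congr rfl fun d hd => Finset.sum_congr rfl fun e he => h1 d hd e he]
    rw [Finset.sum_congr rfl fun d _ => Finset.sum_comm, Finset.sum_comm]
    refine Finset.sum_congr rfl fun m hm => ?_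
    rw [← hinv m hm, sq, Finset.sum_filter, Finset.sum_mul_sum, Finset.mul_sum]
    refine Finset.sum_congr rfl fun d _ => ?_
    rw [Finset.mul_sum]
    refine Finset.sum_congr rfl fun e _ => ?_
    ring
  refine ⟨ρ, ?_, ?_, ?_, ?_⟩
  · simp only [ρ, y, one_dvd, Finset.filter_true, Nat.div_one, Nat.cast_one, one_mul]
    have : ∀ m ∈ Finset.Icc 1 R, mu m * (mu m / (m * L)) = mu m ^ 2 / (m : ℝ) / L := by
      intro m _; rw [div_div, sq]; ring
    rw [Finset.sum_congr rfl this, ← Finset.sum_div, hLmu, div_self hL0.ne']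
  · intro d
    simp only [ρ]
    rw [abs_mul, Nat.abs_cast]
    apply mul_le_of_le_one_right (Nat.cast_nonneg d)
    calc _ ≤ ∑ m ∈ (Finset.Icc 1 R).filter (d ∣ ·), |mu (m / d) * y m| := Finset.abs_sum_le_sum_abs _ _
      _ ≤ ∑ m ∈ (Finset.Icc 1 R).filter (d ∣ ·), |y m| := by
          refine Finset.sum_le_sum fun m _ => ?_
          rw [abs_mul]; exact mul_le_of_le_one_left (abs_nonneg _) (hmu _)
      _ ≤ ∑ m ∈ Finset.Icc 1 R, |y m| :=
          Finset.sum_le_sum_of_subset_of_nonneg (Finset.filter_subset _ _) fun _ _ _ => abs_nonneg _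
      _ = ∑ m ∈ Finset.Icc 1 R, mu m ^ 2 / (m : ℝ) / L := by
          refine Finset.sum_congr rfl fun m _ => ?_
          simp only [y]
          rw [abs_div, abs_of_nonneg (by positivity : 0 ≤ (m : ℝ) * L), div_div]
          congr 1
          rw [← sq_abs]
          have := hmusq m
          rw [← sq_abs] at this
          split_ifs at this with h
          · have : |mu m| = 1 := by
              nlinarith [abs_nonneg (mu m)]
            rw [this]; norm_num
          · have : |mu m| = 0 := by simpa using this
            rw [this]; norm_num
      _ = 1 := by rw [← Finset.sum_div, hLmu, div_self hL0.ne']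
  · rw [hdiag]; exact Finset.sum_nonneg fun _ _ => by positivity
  · rw [hdiag]
    calc ∑ m ∈ Finset.Icc 1 R, (Nat.totient m : ℝ) * y m ^ 2 ≤ ∑ m ∈ Finset.Icc 1 R, mu m ^ 2 / (m : ℝ) / L ^ 2 := by
          refine Finset.sum_le_sum fun m hm => ?_
          have hm0 : (0 : ℝ) < m := by exact_mod_cast (Finset.mem_Icc.mp hm).1
          have ht : (Nat.totient m : ℝ) ≤ m := by exact_mod_cast Nat.totient_le m
          calc (Nat.totient m : ℝ) * y m ^ 2 ≤ m * y m ^ 2 := by gcongr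
            _ = _ := by simp only [y]; field_simp
      _ = 1 / L := by rw [← Finset.sum_div, hLmu]; field_simp
      _ ≤ 2 / Real.log R := by
          rw [div_le_div_iff₀ hL0 hlogR]; linarith

lemma int_cis_diff (a b a' b' s : ℝ) :
    ‖(∫ u in a..b, cis (u * s)) - ∫ u in a'..b', cis (u * s)‖ ≤ |a - a'| + |b - b'| := by
  have hc : Continuous fun u : ℝ => cis (u * s) := continuous_cis.comp (by fun_prop)
  have hi : ∀ x y, IntervalIntegrable (fun u : ℝ => cis (u * s)) volume x y := fun x y => hc.intervalIntegrable _ _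
  rw [intervalIntegral.integral_interval_sub_interval_comm (hi _ _) (hi _ _) (hi _ _)]
  have hb : ∀ x y, ‖∫ u in x..y, cis (u * s)‖ ≤ |y - x| := fun x y => by
    have := intervalIntegral.norm_integral_le_of_norm_le_const (a := x) (b := y)
      (f := fun u => cis (u * s)) (C := 1) (fun u _ => by rw [norm_cis])
    simpa using this
  refine (norm_sub_le _ _).trans ?_
  have h1 := hb a a'
  have h2 := hb b b'
  rw [abs_sub_comm a a', abs_sub_comm b b']
  linarith

/-- sums over multiples -/
lemma ES_mult (A : ℕ) (hA : 1 ≤ A) : ∃ c : ℝ, 0 < c ∧ c ≤ 1 ∧ ∃ C : ℝ, 0 ≤ C ∧ ∃ Y0 : ℕ, 1 ≤ Y0 ∧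
    ∀ Y : ℕ, Y0 ≤ Y → ∀ D : ℕ, 1 ≤ D → D ^ 2 ≤ Y → ∀ s : ℝ, |s| ≤ (Y : ℝ) ^ A →
    ‖∑ n ∈ (Finset.Icc Y (8 * Y)).filter (D ∣ ·), (1 / n : ℂ) * cis (s * Real.log n) -
      (1 / D : ℂ) * ∫ u in (Real.log Y)..(Real.log (8 * Y : ℕ)), cis (u * s)‖ ≤ C * (Y : ℝ) ^ (-c) := by
  obtain ⟨c, hc, C, hC, a0, ha0, h⟩ := ES (2 * A) 8 (by omega) (by norm_num)
  refine ⟨min (c / 2) (1 / 2), by positivity, by linarith [min_le_right (c/2) (1/2 : ℝ)], C + 2, by positivity,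
    a0 ^ 2, Nat.one_le_pow _ _ ha0, ?_⟩
  intro Y hY D hD1 hDY s hs
  have hY1 : 1 ≤ Y := (Nat.one_le_pow _ _ ha0).trans hY
  set a := (Y + D - 1) / D with ha
  set b := 8 * Y / D with hb
  have haD : Y ≤ a * D ∧ a * D ≤ Y + D - 1 := by
    have h1 := Nat.div_add_mod (Y + D - 1) D
    have h2 := Nat.mod_lt (Y + D - 1) (show 0 < D by omega)
    rw [← ha, mul_comm] at h1
    omega
  have hbD : b * D ≤ 8 * Y ∧ 8 * Y < b * D + D := by
    have h1 := Nat.div_add_mod (8 * Y) D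
    have h2 := Nat.mod_lt (8 * Y) (show 0 < D by omega)
    rw [← hb, mul_comm] at h1
    omega
  have hDY' : D ≤ Y := by nlinarith
  have haY : Y ≤ a ^ 2 := by
    have : Y ^ 2 ≤ a ^ 2 * Y := by
      calc Y ^ 2 ≤ (a * D) ^ 2 := Nat.pow_le_pow_left haD.1 2
        _ = a ^ 2 * D ^ 2 := by ring
        _ ≤ _ := Nat.mul_le_mul_left _ hDY
    nlinarith
  have haa : a0 ≤ a := by
    by_contra hcon
    push Not at hcon
    have : a ^ 2 < a0 ^ 2 := Nat.pow_lt_pow_left hcon (by norm_num)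
    omega
  have ha1 : 1 ≤ a := ha0.trans haa
  have hab : a ≤ b := by
    by_contra hcon
    push Not at hcon
    have : (b + 1) * D ≤ a * D := Nat.mul_le_mul_right _ hcon
    have : b * D + D ≤ a * D := by linarith
    omega
  have hb8 : b ≤ 8 * a := by
    have : b * D ≤ (8 * a) * D := by nlinarith [hbD.1, haD.1]
    exact Nat.le_of_mul_le_mul_right this (by omega)
  have hY0 : (0 : ℝ) < Y := by exact_mod_cast hY1
  have hY1' : (1 : ℝ) ≤ Y := by exact_mod_cast hY1
  have hD0 : (0 : ℝ) < D := by exact_mod_cast hD1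
  have ha0' : (0 : ℝ) < a := by exact_mod_cast ha1
  have hb0' : (0 : ℝ) < b := by exact_mod_cast ha1.trans hab
  have haYr : (Y : ℝ) ≤ (a : ℝ) ^ 2 := by exact_mod_cast haY
  have hs' : |s| ≤ (a : ℝ) ^ (2 * A) := by
    rw [pow_mul]; exact hs.trans (by gcongr)
  have hE := h a haa b hab hb8 s hs'
  set c' := min (c / 2) (1 / 2) with hc'
  have hsqrt : (Y : ℝ) ^ (1 / 2 : ℝ) ≤ a := by
    rw [← Real.sqrt_eq_rpow]
    exact Real.sqrt_le_iff.mpr ⟨ha0'.le, haYr⟩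
  have he1 : (a : ℝ) ^ (-c) ≤ (Y : ℝ) ^ (-c') := by
    calc (a : ℝ) ^ (-c) ≤ ((Y : ℝ) ^ (1 / 2 : ℝ)) ^ (-c) :=
          Real.rpow_le_rpow_of_nonpos (by positivity) hsqrt (by linarith)
      _ = (Y : ℝ) ^ (-(c / 2)) := by rw [← Real.rpow_mul hY0.le]; congr 1; ring
      _ ≤ _ := Real.rpow_le_rpow_of_exponent_le hY1' (neg_le_neg (min_le_left _ _))
  have he2 : (D : ℝ) / Y ≤ (Y : ℝ) ^ (-c') := by
    calc (D : ℝ) / Y ≤ (Y : ℝ) ^ (1 / 2 : ℝ) / (Y : ℝ) ^ (1 : ℝ) := by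
          rw [Real.rpow_one]; gcongr
          rw [← Real.sqrt_eq_rpow]
          exact Real.le_sqrt_of_sq_le (by exact_mod_cast hDY)
      _ = (Y : ℝ) ^ (-(1 / 2) : ℝ) := by rw [← Real.rpow_sub hY0]; norm_num
      _ ≤ _ := Real.rpow_le_rpow_of_exponent_le hY1' (neg_le_neg (min_le_right _ _))
  -- rewrite the sum
  have e1 : ∑ n ∈ (Finset.Icc Y (8 * Y)).filter (D ∣ ·), (1 / n : ℂ) * cis (s * Real.log n) =
      (1 / D : ℂ) * cis (s * Real.log D) * ∑ m ∈ Finset.Icc a b, (1 / m : ℂ) * cis (s * Real.log m) := by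
    rw [Finset.mul_sum]
    symm
    refine Finset.sum_bij (fun m _ => D * m) ?_ ?_ ?_ ?_
    · intro m hm
      rw [Finset.mem_Icc] at hm
      rw [Finset.mem_filter, Finset.mem_Icc]
      refine ⟨⟨?_, ?_⟩, dvd_mul_right _ _⟩
      · calc Y ≤ a * D := haD.1
          _ ≤ D * m := by rw [mul_comm]; exact Nat.mul_le_mul_left _ hm.1
      · calc D * m ≤ b * D := by rw [mul_comm b]; exact Nat.mul_le_mul_left _ hm.2
          _ ≤ _ := hbD.1
    · intro x _ y _ hxy
      exact Nat.eq_of_mul_eq_mul_left (by omega) hxy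
    · intro n hn
      rw [Finset.mem_filter, Finset.mem_Icc] at hn
      obtain ⟨⟨h1, h2⟩, m, rfl⟩ := hn
      refine ⟨m, ?_, rfl⟩
      rw [Finset.mem_Icc]
      constructor
      · by_contra hcon
        push Not at hcon
        have h3 : (m + 1) * D ≤ a * D := Nat.mul_le_mul_right _ hcon
        have h4 : (m + 1) * D = D * m + D := by ring
        omega
      · by_contra hcon
        push Not at hcon
        have h3 : (b + 1) * D ≤ m * D := Nat.mul_le_mul_right _ hcon
        have h4 : m * D = D * m := by ring
        have h5 : (b + 1) * D = b * D + D := by ring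
        omega
    · intro m hm
      have hm0 : (m : ℝ) ≠ 0 := by
        have := (Finset.mem_Icc.mp hm).1
        exact_mod_cast (by omega : m ≠ 0)
      rw [Nat.cast_mul, Nat.cast_mul, Real.log_mul hD0.ne' hm0, mul_add, cis_add]
      simp only [one_mul, one_div, mul_inv]
      ring
  have e2 : cis (s * Real.log D) * ∫ u in (Real.log a)..(Real.log b), cis (u * s) =
      ∫ u in (Real.log a + Real.log D)..(Real.log b + Real.log D), cis (u * s) := by
    rw [← intervalIntegral.integral_comp_add_right (fun u => cis (u * s)), ← intervalIntegral.integral_const_mul]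
    refine intervalIntegral.integral_congr fun u _ => ?_
    rw [add_mul, cis_add, mul_comm, mul_comm s]
  have hd1 : |Real.log a + Real.log D - Real.log Y| ≤ D / Y := by
    rw [← Real.log_mul ha0'.ne' hD0.ne']
    have h1 : (Y : ℝ) ≤ a * D := by exact_mod_cast haD.1
    have h2 : (a : ℝ) * D ≤ Y + D := by exact_mod_cast haD.2.trans (by omega)
    rw [abs_of_nonneg (sub_nonneg.mpr (Real.log_le_log hY0 h1)), ← Real.log_div (by positivity) hY0.ne']
    refine (Real.log_le_sub_one_of_pos (by positivity)).trans ?_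
    rw [sub_le_iff_le_add, div_le_iff₀ hY0, add_mul, div_mul_cancel₀ _ hY0.ne']
    linarith
  have hd2 : |Real.log b + Real.log D - Real.log (8 * Y : ℕ)| ≤ D / Y := by
    rw [← Real.log_mul hb0'.ne' hD0.ne', abs_sub_comm]
    have h1 : (b : ℝ) * D ≤ (8 * Y : ℕ) := by exact_mod_cast hbD.1
    have h2 : ((8 * Y : ℕ) : ℝ) ≤ b * D + D := by exact_mod_cast hbD.2.le
    have h3 : (Y : ℝ) ≤ b * D := by
      have : Y ≤ b * D := by omega
      exact_mod_cast this
    have h80 : (0 : ℝ) < (8 * Y : ℕ) := by push_cast; positivity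
    rw [abs_of_nonneg (sub_nonneg.mpr (Real.log_le_log (by positivity) h1)), ← Real.log_div h80.ne' (by positivity)]
    refine (Real.log_le_sub_one_of_pos (by positivity)).trans ?_
    calc ((8 * Y : ℕ) : ℝ) / (b * D) - 1 ≤ D / (b * D) := by
          rw [sub_le_iff_le_add, div_add_one (by positivity)]
          gcongr; linarith
      _ ≤ D / Y := by gcongr
  have hdd := int_cis_diff (Real.log a + Real.log D) (Real.log b + Real.log D) (Real.log Y) (Real.log (8 * Y : ℕ)) s
  rw [e1]
  have hDinv : ‖(1 / D : ℂ)‖ ≤ 1 := by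
    rw [norm_div, norm_one, Complex.norm_natCast]
    rw [div_le_one hD0]; exact_mod_cast hD1
  calc _ = ‖(1 / D : ℂ) * (cis (s * Real.log D) * (∑ m ∈ Finset.Icc a b, (1 / m : ℂ) * cis (s * Real.log m) -
          ∫ u in (Real.log a)..(Real.log b), cis (u * s)) +
          ((∫ u in (Real.log a + Real.log D)..(Real.log b + Real.log D), cis (u * s)) -
            ∫ u in (Real.log Y)..(Real.log (8 * Y : ℕ)), cis (u * s)))‖ := by
        rw [← e2]; congr 1; ring
    _ ≤ 1 * (C * (a : ℝ) ^ (-c) + (D / Y + D / Y)) := by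
        rw [norm_mul]
        gcongr
        refine (norm_add_le _ _).trans ?_
        gcongr
        · rw [norm_mul, norm_cis, one_mul]; exact hE
        · linarith
    _ ≤ _ := by
        have := mul_le_mul_of_nonneg_left he1 hC
        linarith

noncomputable def prm (Y : ℕ) : Finset ℕ := (Finset.Ico Y (8 * Y)).filter Nat.Prime

lemma prm_lower : ∃ Y0 : ℕ, 2 ≤ Y0 ∧ ∀ Y : ℕ, Y0 ≤ Y → 1 / (4 * Real.log Y) ≤ ∑ p ∈ prm Y, 1 / (p : ℝ) := by
  refine ⟨200 ^ 4, by norm_num, fun Y hY => ?_⟩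
  have hYr : (200 : ℝ) ^ 4 ≤ Y := by exact_mod_cast hY
  have hY0 : (0 : ℝ) < Y := by linarith
  set x : ℝ := 8 * Y with hx
  have hx0 : 0 < x := by positivity
  have hY1 : 1 ≤ 8 * Y := by omega
  set t : ℝ := x ^ (1 / 4 : ℝ) with ht
  have ht4 : t ^ 4 = x := by
    rw [ht, ← Real.rpow_natCast, ← Real.rpow_mul hx0.le]; norm_num
  have ht0 : 0 < t := by positivity
  have ht200 : 200 ≤ t := by
    refine le_of_pow_le_pow_left₀ (n := 4) (by norm_num) ht0.le ?_
    rw [ht4]; linarith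
  have hlogx : Real.log x ≤ 4 * t := by
    rw [← ht4, Real.log_pow]
    have := Real.log_le_self ht0.le
    push_cast; linarith
  have hlogx0 : 0 < Real.log x := Real.log_pos (by linarith)
  have hlogY0 : 0 < Real.log Y := Real.log_pos (by linarith)
  have hsq : Real.sqrt x = t ^ 2 := by
    rw [← ht4, show t ^ 4 = (t ^ 2) ^ 2 by ring, Real.sqrt_sq (by positivity)]
  have hl2 := Real.log_two_gt_d9
  have hn : (((8 * Y - 1 : ℕ)) : ℝ) = x - 1 := by rw [Nat.cast_sub hY1]; push_cast; ring
  have h1 := Chebyshev.theta_ge (8 * Y - 1)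
  have h2 := Chebyshev.theta_le_log4_mul_x (x := (Y : ℝ)) hY0.le
  rw [hn] at h1
  have hl4 : Real.log 4 = 2 * Real.log 2 := by
    rw [show (4 : ℝ) = 2 ^ 2 by norm_num, Real.log_pow]; norm_num
  rw [hl4] at h2
  have h3 : Real.sqrt (x - 1) * Real.log (x - 1) ≤ t ^ 2 * (4 * t) := by
    have : Real.sqrt (x - 1) ≤ t ^ 2 := by rw [← hsq]; exact Real.sqrt_le_sqrt (by linarith)
    have h4 : Real.log (x - 1) ≤ 4 * t := (Real.log_le_log (by linarith) (by linarith)).trans hlogx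
    have h5 : 0 ≤ Real.log (x - 1) := Real.log_nonneg (by linarith)
    gcongr
  rw [sub_add_cancel] at h1
  have hθ : 5 * Y * Real.log 2 ≤ Chebyshev.theta (x - 1) - Chebyshev.theta Y := by
    have h6 : 4 * t + 8 * t ^ 3 ≤ (x / 8 - 1) * (1 / 2) := by
      rw [← ht4]
      nlinarith [mul_nonneg (pow_nonneg ht0.le 3) (sub_nonneg.mpr ht200), mul_nonneg (pow_nonneg ht0.le 2) (sub_nonneg.mpr ht200), mul_nonneg ht0.le (sub_nonneg.mpr ht200)]
    have h7 : (x / 8 - 1) * (1 / 2) ≤ (x / 8 - 1) * Real.log 2 := by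
      apply mul_le_mul_of_nonneg_left (by linarith); linarith
    have : x / 8 = Y := by rw [hx]; ring
    nlinarith
  have hsum : Chebyshev.theta (x - 1) - Chebyshev.theta Y ≤ ∑ p ∈ prm Y, Real.log p := by
    have e1 : Chebyshev.theta (x - 1) = ∑ p ∈ (Finset.Ioc 0 (8 * Y - 1)).filter Nat.Prime, Real.log p := by
      rw [← hn]; unfold Chebyshev.theta; rw [Nat.floor_natCast]
    have e2 : Chebyshev.theta Y = ∑ p ∈ (Finset.Ioc 0 Y).filter Nat.Prime, Real.log p := by
      unfold Chebyshev.theta; rw [Nat.floor_natCast]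
    rw [e1, e2, sub_le_iff_le_add, ← Finset.sum_union_inter]
    have hnn : ∀ p : ℕ, 0 ≤ Real.log (p : ℝ) := fun p => Real.log_natCast_nonneg p
    refine le_add_of_le_of_nonneg ?_ (Finset.sum_nonneg fun p _ => hnn p)
    refine Finset.sum_le_sum_of_subset_of_nonneg ?_ fun p _ _ => hnn p
    intro p hp
    simp only [prm, Finset.mem_union, Finset.mem_filter, Finset.mem_Ioc, Finset.mem_Ico] at hp ⊢
    rcases le_total p Y with h | h
    · exact Or.inr ⟨⟨hp.1.1, h⟩, hp.2⟩
    · exact Or.inl ⟨⟨h, by omega⟩, hp.2⟩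
  have hlow : ∑ p ∈ prm Y, Real.log p ≤ (x * Real.log x) * ∑ p ∈ prm Y, 1 / (p : ℝ) := by
    rw [Finset.mul_sum]
    refine Finset.sum_le_sum fun p hp => ?_
    simp only [prm, Finset.mem_filter, Finset.mem_Ico] at hp
    have hp0 : (0 : ℝ) < p := by exact_mod_cast hp.2.pos
    have hp0' : (1 : ℝ) ≤ p := by exact_mod_cast hp.2.pos
    have hpx : (p : ℝ) ≤ x := by rw [hx]; exact_mod_cast hp.1.2.le
    rw [mul_one_div, le_div_iff₀ hp0]
    have := Real.log_le_log hp0 hpx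
    have h0 := Real.log_nonneg hp0'
    nlinarith
  have hlogxY : Real.log x ≤ 1.5 * Real.log Y := by
    have h8 : Real.log 8 = 3 * Real.log 2 := by
      rw [show (8 : ℝ) = 2 ^ 3 by norm_num, Real.log_pow]; norm_num
    have h9 : Real.log ((2 : ℝ) ^ 6) ≤ Real.log Y := Real.log_le_log (by norm_num) (by norm_num; linarith)
    rw [Real.log_pow] at h9
    rw [hx, Real.log_mul (by norm_num) hY0.ne', h8]
    push_cast at h9
    linarith
  have hfin : 5 * Y * Real.log 2 ≤ (x * Real.log x) * ∑ p ∈ prm Y, 1 / (p : ℝ) := by linarith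
  have hS0 : 0 ≤ ∑ p ∈ prm Y, 1 / (p : ℝ) := Finset.sum_nonneg fun _ _ => by positivity
  rw [div_le_iff₀ (by positivity)]
  set S := ∑ p ∈ prm Y, 1 / (p : ℝ)
  have h10 : x * Real.log x * S ≤ x * (1.5 * Real.log Y) * S := by gcongr
  have h11 : 5 * (Y : ℝ) * Real.log 2 ≤ Y * (12 * (Real.log Y * S)) := by
    calc _ ≤ _ := hfin
      _ ≤ _ := h10
      _ = _ := by rw [hx]; ring
  have h12 : 5 * Real.log 2 ≤ 12 * (Real.log Y * S) := by
    refine le_of_mul_le_mul_left ?_ hY0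
    linarith
  nlinarith

lemma abs_sin_nat_mul (k : ℕ) (t : ℝ) : |Real.sin (k * t)| ≤ k * |Real.sin t| := by
  induction k with
  | zero => simp
  | succ k ih =>
    push_cast
    rw [add_mul, one_mul, Real.sin_add, add_mul, one_mul]
    refine (abs_add_le _ _).trans ?_
    rw [abs_mul, abs_mul]
    have h1 := Real.abs_cos_le_one t
    have h2 := Real.abs_cos_le_one (k * t)
    nlinarith [abs_nonneg (Real.sin (k * t)), abs_nonneg (Real.sin t), abs_nonneg (Real.cos t)]

lemma one_sub_cos_nat_mul (k : ℕ) (x : ℝ) : 1 - Real.cos (k * x) ≤ k ^ 2 * (1 - Real.cos x) := by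
  have e : ∀ y : ℝ, 1 - Real.cos y = 2 * Real.sin (y / 2) ^ 2 := fun y => by
    have h2 := Real.cos_two_mul' (y / 2)
    have h1 := Real.sin_sq_add_cos_sq (y / 2)
    rw [mul_div_cancel₀ y (by norm_num)] at h2
    linarith
  rw [e, e]
  have := abs_sin_nat_mul k (x / 2)
  rw [← mul_div_assoc] at this
  have h2 := pow_le_pow_left₀ (abs_nonneg _) this 2
  rw [sq_abs, mul_pow, sq_abs] at h2
  linarith

lemma cis_re (x : ℝ) : (cis x).re = Real.cos x := by
  unfold cis; rw [Complex.exp_re]; simp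

lemma geom_lower (K : ℕ) (x : ℝ) :
    (K : ℝ) ^ 2 - 2 * K ^ 4 * (1 - Real.cos x) ≤ ‖∑ k ∈ Finset.range K, cis (k * x)‖ ^ 2 := by
  have hc : 0 ≤ 1 - Real.cos x := by linarith [Real.cos_le_one x]
  have h1 : (K : ℝ) - K ^ 3 * (1 - Real.cos x) ≤ ‖∑ k ∈ Finset.range K, cis (k * x)‖ := by
    refine le_trans ?_ (Complex.re_le_norm _)
    rw [Complex.re_sum]
    simp_rw [cis_re]
    have : ∀ k ∈ Finset.range K, 1 - (K : ℝ) ^ 2 * (1 - Real.cos x) ≤ Real.cos (k * x) := by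
      intro k hk
      have h2 := one_sub_cos_nat_mul k x
      have hkK : (k : ℝ) ≤ K := by exact_mod_cast (Finset.mem_range.mp hk).le
      have : (k : ℝ) ^ 2 * (1 - Real.cos x) ≤ (K : ℝ) ^ 2 * (1 - Real.cos x) := by gcongr
      linarith
    have h3 := Finset.sum_le_sum this
    rw [Finset.sum_const, Finset.card_range, nsmul_eq_mul] at h3
    nlinarith
  set v := ‖∑ k ∈ Finset.range K, cis (k * x)‖
  nlinarith [sq_nonneg (v - K), (Nat.cast_nonneg K : (0 : ℝ) ≤ K)]

lemma geom_normSq (K : ℕ) (x : ℝ) : ((‖∑ k ∈ Finset.range K, cis (k * x)‖ ^ 2 : ℝ) : ℂ) =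
    ∑ k ∈ Finset.range K, ∑ j ∈ Finset.range K, cis (((k : ℝ) - j) * x) := by
  rw [← Complex.normSq_eq_norm_sq, ← Complex.mul_conj, map_sum, Finset.sum_mul_sum]
  refine Finset.sum_congr rfl fun k _ => Finset.sum_congr rfl fun j _ => ?_
  rw [conj_cis, ← cis_add]; congr 1; ring

lemma sieveU (A : ℕ) (hA : 1 ≤ A) : ∃ c : ℝ, 0 < c ∧ c ≤ 1 ∧ ∃ C : ℝ, 0 ≤ C ∧ ∃ Y0 : ℕ, 1 ≤ Y0 ∧
    ∀ Y : ℕ, Y0 ≤ Y → ∀ R : ℕ, R ^ 4 ≤ Y → ∀ ρ : ℕ → ℝ, (∀ d, |ρ d| ≤ d) → ∀ s : ℝ, |s| ≤ (Y : ℝ) ^ A →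
    ‖∑ n ∈ Finset.Icc Y (8 * Y), (((∑ d ∈ (Finset.Icc 1 R).filter (· ∣ n), ρ d) ^ 2 : ℝ) : ℂ) *
        ((1 / n : ℂ) * cis (s * Real.log n)) -
      ((∑ d ∈ Finset.Icc 1 R, ∑ e ∈ Finset.Icc 1 R, ρ d * ρ e / (Nat.lcm d e : ℝ) : ℝ) : ℂ) *
        ∫ u in (Real.log Y)..(Real.log (8 * Y : ℕ)), cis (u * s)‖ ≤ (R : ℝ) ^ 4 * (C * (Y : ℝ) ^ (-c)) := by
  obtain ⟨c, hc, hc1, C, hC, Y0, hY0, h⟩ := ES_mult A hA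
  refine ⟨c, hc, hc1, C, hC, Y0, hY0, ?_⟩
  intro Y hY R hR ρ hρ s hs
  set I := ∫ u in (Real.log Y)..(Real.log (8 * Y : ℕ)), cis (u * s)
  have e1 : ∀ n ∈ Finset.Icc Y (8 * Y), (((∑ d ∈ (Finset.Icc 1 R).filter (· ∣ n), ρ d) ^ 2 : ℝ) : ℂ) *
        ((1 / n : ℂ) * cis (s * Real.log n)) = ∑ d ∈ Finset.Icc 1 R, ∑ e ∈ Finset.Icc 1 R,
        ((ρ d * ρ e : ℝ) : ℂ) * (if Nat.lcm d e ∣ n then (1 / n : ℂ) * cis (s * Real.log n) else 0) := by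
    intro n _
    rw [sq, Finset.sum_filter, Finset.sum_mul_sum]
    push_cast
    rw [Finset.sum_mul]
    refine Finset.sum_congr rfl fun d _ => ?_
    rw [Finset.sum_mul]
    refine Finset.sum_congr rfl fun e _ => ?_
    have : Nat.lcm d e ∣ n ↔ d ∣ n ∧ e ∣ n := Nat.lcm_dvd_iff
    by_cases h1 : d ∣ n <;> by_cases h2 : e ∣ n <;> simp [this, h1, h2]
  rw [Finset.sum_congr rfl e1, Finset.sum_comm]
  have e2 : ∑ d ∈ Finset.Icc 1 R, ∑ n ∈ Finset.Icc Y (8 * Y), ∑ e ∈ Finset.Icc 1 R,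
        ((ρ d * ρ e : ℝ) : ℂ) * (if Nat.lcm d e ∣ n then (1 / n : ℂ) * cis (s * Real.log n) else 0) =
      ∑ d ∈ Finset.Icc 1 R, ∑ e ∈ Finset.Icc 1 R, ((ρ d * ρ e : ℝ) : ℂ) *
        ∑ n ∈ (Finset.Icc Y (8 * Y)).filter (Nat.lcm d e ∣ ·), (1 / n : ℂ) * cis (s * Real.log n) := by
    refine Finset.sum_congr rfl fun d _ => ?_
    rw [Finset.sum_comm]
    refine Finset.sum_congr rfl fun e _ => ?_
    rw [← Finset.mul_sum, Finset.sum_filter]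
  have e3 : ((∑ d ∈ Finset.Icc 1 R, ∑ e ∈ Finset.Icc 1 R, ρ d * ρ e / (Nat.lcm d e : ℝ) : ℝ) : ℂ) * I =
      ∑ d ∈ Finset.Icc 1 R, ∑ e ∈ Finset.Icc 1 R, ((ρ d * ρ e : ℝ) : ℂ) * ((1 / (Nat.lcm d e : ℕ) : ℂ) * I) := by
    push_cast
    rw [Finset.sum_mul]
    refine Finset.sum_congr rfl fun d _ => ?_
    rw [Finset.sum_mul]
    refine Finset.sum_congr rfl fun e _ => ?_
    ring
  rw [e2, e3, ← Finset.sum_sub_distrib]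
  have hbd : ∀ d ∈ Finset.Icc 1 R, ∀ e ∈ Finset.Icc 1 R, ‖((ρ d * ρ e : ℝ) : ℂ) *
        (∑ n ∈ (Finset.Icc Y (8 * Y)).filter (Nat.lcm d e ∣ ·), (1 / n : ℂ) * cis (s * Real.log n)) -
        ((ρ d * ρ e : ℝ) : ℂ) * ((1 / (Nat.lcm d e : ℕ) : ℂ) * I)‖ ≤ (R : ℝ) ^ 2 * (C * (Y : ℝ) ^ (-c)) := by
    intro d hd e he
    rw [Finset.mem_Icc] at hd he
    rw [← mul_sub, norm_mul, Complex.norm_real, Real.norm_eq_abs, abs_mul]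
    have hdR : (d : ℝ) ≤ R := by exact_mod_cast hd.2
    have heR : (e : ℝ) ≤ R := by exact_mod_cast he.2
    have h1 : |ρ d| * |ρ e| ≤ (R : ℝ) ^ 2 := by
      rw [sq]
      exact mul_le_mul ((hρ d).trans hdR) ((hρ e).trans heR) (abs_nonneg _) (Nat.cast_nonneg _)
    have hl1 : 1 ≤ Nat.lcm d e := Nat.lcm_pos (by omega) (by omega)
    have hl2 : Nat.lcm d e ≤ R * R := (Nat.le_of_dvd (Nat.mul_pos (by omega) (by omega)) (Nat.lcm_dvd_mul d e)).trans
      (Nat.mul_le_mul hd.2 he.2)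
    have hl3 : (Nat.lcm d e) ^ 2 ≤ Y := by
      calc _ ≤ (R * R) ^ 2 := Nat.pow_le_pow_left hl2 2
        _ = R ^ 4 := by ring
        _ ≤ Y := hR
    have := h Y hY (Nat.lcm d e) hl1 hl3 s hs
    gcongr
  calc _ ≤ ∑ d ∈ Finset.Icc 1 R, ∑ e ∈ Finset.Icc 1 R, (R : ℝ) ^ 2 * (C * (Y : ℝ) ^ (-c)) := by
        refine (norm_sum_le _ _).trans (Finset.sum_le_sum fun d hd => ?_)
        rw [← Finset.sum_sub_distrib]
        exact (norm_sum_le _ _).trans (Finset.sum_le_sum fun e he => hbd d hd e he)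
    _ = _ := by
        simp only [Finset.sum_const, Nat.card_Icc, nsmul_eq_mul, Nat.add_sub_cancel]
        ring

set_option maxHeartbeats 1000000 in
theorem PL (A : ℕ) (hA : 1 ≤ A) : ∃ c0 : ℝ, 0 < c0 ∧ c0 < 1 ∧ ∃ T0 : ℝ, 1 ≤ T0 ∧ ∃ Y0 : ℕ, 2 ≤ Y0 ∧
    ∀ Y : ℕ, Y0 ≤ Y → ∀ ξ : ℝ, T0 ≤ |ξ| → |ξ| ≤ (Y : ℝ) ^ A →
    ‖∑ p ∈ prm Y, (1 / p : ℂ) * cis (ξ * Real.log p)‖ ≤ (1 - c0) * ∑ p ∈ prm Y, 1 / (p : ℝ) := by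
  obtain ⟨c, hc, hc1, C, hC, Y1, hY1, hU⟩ := sieveU (A + 1) (by omega)
  obtain ⟨Y2, hY2, hW⟩ := prm_lower
  obtain ⟨K, hK⟩ := exists_nat_ge (5120 / c + 1)
  have hKc : 5120 / c ≤ K := by linarith
  have hK1 : (1 : ℝ) ≤ K := by
    have : 0 ≤ 5120 / c := by positivity
    linarith
  have hK0 : (0 : ℝ) < K := by linarith
  -- largeness
  have hlarge : ∀ᶠ Y : ℕ in atTop, C * ((Y : ℝ) ^ (-(c / 2))) ≤ 1 / (33 * Real.log Y) ∧
      4 ≤ (Y : ℝ) ^ (c / 16) := by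
    have h1 : Tendsto (fun x : ℝ => C * (33 * (Real.log x / x ^ (c / 2)))) atTop (nhds (C * (33 * 0))) := by
      have := (isLittleO_log_rpow_atTop (show 0 < c / 2 by positivity)).tendsto_div_nhds_zero
      exact (this.const_mul 33).const_mul C
    rw [mul_zero, mul_zero] at h1
    have h2 : ∀ᶠ x : ℝ in atTop, C * (33 * (Real.log x / x ^ (c / 2))) ≤ 1 := h1.eventually (eventually_le_nhds (by norm_num))
    have h3 : ∀ᶠ x : ℝ in atTop, 4 ≤ x ^ (c / 16) := (tendsto_rpow_atTop (by positivity)).eventually_ge_atTop 4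
    have h4 := (h2.and (h3.and (eventually_ge_atTop (2 : ℝ))))
    refine (tendsto_natCast_atTop_atTop.eventually h4).mono ?_
    rintro Y ⟨h5, h6, h7⟩
    refine ⟨?_, h6⟩
    have hl : 0 < Real.log Y := Real.log_pos (by linarith)
    have hY : (0 : ℝ) < (Y : ℝ) ^ (c / 2) := by positivity
    rw [Real.rpow_neg (by linarith), le_div_iff₀ (by positivity)]
    calc _ = C * (33 * (Real.log Y / (Y : ℝ) ^ (c / 2))) := by field_simp
      _ ≤ 1 := h5
  obtain ⟨Y3, hY3⟩ := eventually_atTop.mp hlarge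
  refine ⟨1 / (4 * K ^ 2), by positivity, ?_, K, hK1, Y1 + Y2 + Y3 + K, by omega, ?_⟩
  · rw [div_lt_one (by positivity)]; nlinarith
  intro Y hY ξ hξ1 hξ2
  obtain ⟨hY3a, hY3b⟩ := hY3 Y (by omega)
  have hYK : (K : ℝ) ≤ Y := by exact_mod_cast (by omega : K ≤ Y)
  have hY2r : (2 : ℝ) ≤ Y := by exact_mod_cast (by omega : 2 ≤ Y)
  have hY0 : (0 : ℝ) < Y := by linarith
  have hlogY : 0 < Real.log Y := Real.log_pos (by linarith)
  have hWl := hW Y (by omega)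
  set W := ∑ p ∈ prm Y, 1 / (p : ℝ) with hWdef
  have hW0 : 0 < W := lt_of_lt_of_le (by positivity) hWl
  by_contra hcon
  push Not at hcon
  set P := ∑ p ∈ prm Y, (1 / p : ℂ) * cis (ξ * Real.log p) with hP
  set φ := Complex.arg P with hφ
  -- real part
  have hre : ∑ p ∈ prm Y, 1 / (p : ℝ) * (1 - Real.cos (ξ * Real.log p - φ)) = W - ‖P‖ := by
    have h1 : ((‖P‖ : ℝ) : ℂ) = cis (-φ) * P := by
      have := Complex.norm_mul_exp_arg_mul_I P
      nth_rewrite 2 [← this]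
      change _ = cis (-φ) * (((‖P‖ : ℝ) : ℂ) * cis φ)
      rw [mul_left_comm, ← cis_add, neg_add_cancel, cis_zero, mul_one]
    have h2 : ‖P‖ = ∑ p ∈ prm Y, 1 / (p : ℝ) * Real.cos (ξ * Real.log p - φ) := by
      have h3 := congrArg Complex.re h1
      rw [Complex.ofReal_re, hP, Finset.mul_sum, Complex.re_sum] at h3
      rw [hP, h3]
      refine Finset.sum_congr rfl fun p _ => ?_
      have : cis (-φ) * ((1 / p : ℂ) * cis (ξ * Real.log p)) = ((1 / p : ℝ) : ℂ) * cis (ξ * Real.log p - φ) := by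
        rw [sub_eq_add_neg, cis_add]; push_cast; ring
      rw [this, Complex.re_ofReal_mul, cis_re]
    rw [h2, hWdef, ← Finset.sum_sub_distrib]
    refine Finset.sum_congr rfl fun p _ => by ring
  set R := ⌊(Y : ℝ) ^ (c / 8)⌋₊ with hR
  have hRle : (R : ℝ) ≤ (Y : ℝ) ^ (c / 8) := Nat.floor_le (by positivity)
  have hRge : (Y : ℝ) ^ (c / 16) ≤ R := by
    have h1 := Nat.lt_floor_add_one ((Y : ℝ) ^ (c / 8))
    have h2 : (Y : ℝ) ^ (c / 8) = (Y : ℝ) ^ (c / 16) * (Y : ℝ) ^ (c / 16) := by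
      rw [← Real.rpow_add hY0]; congr 1; ring
    rw [← hR] at h1
    nlinarith
  have hR4 : (R : ℝ) ^ 4 ≤ (Y : ℝ) ^ (c / 2) := by
    calc (R : ℝ) ^ 4 ≤ ((Y : ℝ) ^ (c / 8)) ^ 4 := by gcongr
      _ = (Y : ℝ) ^ (c / 2) := by rw [← Real.rpow_natCast, ← Real.rpow_mul hY0.le]; congr 1; push_cast; ring
  have hR4' : R ^ 4 ≤ Y := by
    have : (R : ℝ) ^ 4 ≤ Y := by
      refine hR4.trans ?_
      calc (Y : ℝ) ^ (c / 2) ≤ (Y : ℝ) ^ (1 : ℝ) := Real.rpow_le_rpow_of_exponent_le (by linarith) (by linarith)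
        _ = Y := Real.rpow_one _
    exact_mod_cast this
  have hR2 : 2 ≤ R := by
    have : (4 : ℝ) ≤ R := hY3b.trans hRge
    have : 4 ≤ R := by exact_mod_cast this
    omega
  have hRY : R < Y := by
    have : R * 2 ≤ R ^ 4 := by nlinarith [Nat.pow_le_pow_left hR2 3, Nat.zero_le R]
    omega
  have hlogR : c / 16 * Real.log Y ≤ Real.log R := by
    rw [← Real.log_rpow hY0]; exact Real.log_le_log (by positivity) hRge
  obtain ⟨ρ, hρ1, hρ, hQ0, hQ⟩ := selberg_weights R hR2
  set Q := ∑ d ∈ Finset.Icc 1 R, ∑ e ∈ Finset.Icc 1 R, ρ d * ρ e / (Nat.lcm d e : ℝ) with hQdef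
  have hQ2 : Q ≤ 32 / (c * Real.log Y) := by
    refine hQ.trans ?_
    calc 2 / Real.log R ≤ 2 / (c / 16 * Real.log Y) := by gcongr
      _ = _ := by field_simp; norm_num
  set w : ℕ → ℝ := fun n => (∑ d ∈ (Finset.Icc 1 R).filter (· ∣ n), ρ d) ^ 2 with hw
  set E : ℝ := C * (Y : ℝ) ^ (-(c / 2)) with hE
  have hU' : ∀ s : ℝ, |s| ≤ (Y : ℝ) ^ (A + 1) → ‖∑ n ∈ Finset.Icc Y (8 * Y), (w n : ℂ) *
        ((1 / n : ℂ) * cis (s * Real.log n))‖ ≤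
        Q * ‖∫ u in (Real.log Y)..(Real.log (8 * Y : ℕ)), cis (u * s)‖ + E := by
    intro s hs
    have h1 := hU Y (by omega) R hR4' ρ hρ s hs
    have h2 : (R : ℝ) ^ 4 * (C * (Y : ℝ) ^ (-c)) ≤ E := by
      calc _ ≤ (Y : ℝ) ^ (c / 2) * (C * (Y : ℝ) ^ (-c)) := by gcongr
        _ = C * ((Y : ℝ) ^ (c / 2) * (Y : ℝ) ^ (-c)) := by ring
        _ = E := by rw [← Real.rpow_add hY0, hE]; congr 2; ring
    have h3 := norm_sub_norm_le (∑ n ∈ Finset.Icc Y (8 * Y), (w n : ℂ) *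
        ((1 / n : ℂ) * cis (s * Real.log n))) ((Q : ℂ) * ∫ u in (Real.log Y)..(Real.log (8 * Y : ℕ)), cis (u * s))
    rw [norm_mul, Complex.norm_real, Real.norm_of_nonneg hQ0] at h3
    linarith
  -- lower bound
  set V : ℕ → ℝ := fun n => ‖∑ k ∈ Finset.range K, cis (k * (ξ * Real.log n - φ))‖ ^ 2 with hV
  have hlow : (K : ℝ) ^ 2 * W / 2 ≤ ∑ n ∈ Finset.Icc Y (8 * Y), w n * (1 / (n : ℝ) * V n) := by
    calc (K : ℝ) ^ 2 * W / 2 ≤ (K : ℝ) ^ 2 * W - 2 * K ^ 4 * (W - ‖P‖) := by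
          have h1 : W - ‖P‖ ≤ 1 / (4 * K ^ 2) * W := by linarith
          have h2 : 2 * (K : ℝ) ^ 4 * (W - ‖P‖) ≤ 2 * (K : ℝ) ^ 4 * (1 / (4 * K ^ 2) * W) := by gcongr
          have h3 : 2 * (K : ℝ) ^ 4 * (1 / (4 * K ^ 2) * W) = (K : ℝ) ^ 2 * W / 2 := by field_simp; norm_num
          linarith
      _ = ∑ p ∈ prm Y, 1 / (p : ℝ) * ((K : ℝ) ^ 2 - 2 * K ^ 4 * (1 - Real.cos (ξ * Real.log p - φ))) := by
          rw [← hre, hWdef, Finset.mul_sum, Finset.mul_sum, ← Finset.sum_sub_distrib]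
          refine Finset.sum_congr rfl fun p _ => by ring
      _ ≤ ∑ p ∈ prm Y, w p * (1 / (p : ℝ) * V p) := by
          refine Finset.sum_le_sum fun p hp => ?_
          have hp' := Finset.mem_filter.mp hp
          have hpY := (Finset.mem_Ico.mp hp'.1).1
          have hw1 : w p = 1 := by
            have : (Finset.Icc 1 R).filter (· ∣ p) = {1} := by
              ext d
              rw [Finset.mem_filter, Finset.mem_Icc, Finset.mem_singleton, Nat.dvd_prime hp'.2]
              constructor
              · rintro ⟨⟨h1, h2⟩, h3 | h3⟩ <;> omega
              · rintro rfl; exact ⟨⟨le_rfl, by omega⟩, Or.inl rfl⟩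
            simp only [hw]
            rw [this, Finset.sum_singleton, hρ1, one_pow]
          rw [hw1, one_mul]
          have := geom_lower K (ξ * Real.log p - φ)
          gcongr
      _ ≤ _ := by
          refine Finset.sum_le_sum_of_subset_of_nonneg ?_ fun n _ _ => by positivity
          intro p hp
          have hp' := Finset.mem_Ico.mp (Finset.mem_filter.mp hp).1
          exact Finset.mem_Icc.mpr ⟨hp'.1, hp'.2.le⟩
  -- upper bound
  have hid : ((∑ n ∈ Finset.Icc Y (8 * Y), w n * (1 / (n : ℝ) * V n) : ℝ) : ℂ) =
      ∑ k ∈ Finset.range K, ∑ j ∈ Finset.range K, cis (-(((k : ℝ) - j) * φ)) *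
        ∑ n ∈ Finset.Icc Y (8 * Y), (w n : ℂ) * ((1 / n : ℂ) * cis ((((k : ℝ) - j) * ξ) * Real.log n)) := by
    rw [Complex.ofReal_sum]
    have h1 : ∀ n ∈ Finset.Icc Y (8 * Y), ((w n * (1 / (n : ℝ) * V n) : ℝ) : ℂ) =
        ∑ k ∈ Finset.range K, ∑ j ∈ Finset.range K, cis (-(((k : ℝ) - j) * φ)) *
        ((w n : ℂ) * ((1 / n : ℂ) * cis ((((k : ℝ) - j) * ξ) * Real.log n))) := by
      intro n _
      rw [Complex.ofReal_mul, Complex.ofReal_mul, hV, geom_normSq, Finset.mul_sum, Finset.mul_sum]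
      refine Finset.sum_congr rfl fun k _ => ?_
      rw [Finset.mul_sum, Finset.mul_sum]
      refine Finset.sum_congr rfl fun j _ => ?_
      rw [show ((k : ℝ) - j) * (ξ * Real.log n - φ) = -(((k : ℝ) - j) * φ) + ((k : ℝ) - j) * ξ * Real.log n by ring,
        cis_add]
      push_cast; ring
    rw [Finset.sum_congr rfl h1, Finset.sum_comm]
    refine Finset.sum_congr rfl fun k _ => ?_
    rw [Finset.sum_comm]
    refine Finset.sum_congr rfl fun j _ => ?_
    rw [Finset.mul_sum]
  have hE0 : 0 ≤ E := by positivity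
  have hlog8 : Real.log (8 * Y : ℕ) - Real.log Y ≤ 3 := by
    have h8 : Real.log 8 = 3 * Real.log 2 := by
      rw [show (8 : ℝ) = 2 ^ 3 by norm_num, Real.log_pow]; norm_num
    push_cast
    rw [Real.log_mul (by norm_num) hY0.ne', h8]
    have := Real.log_two_lt_d9
    linarith
  have hlog8' : 0 ≤ Real.log (8 * Y : ℕ) - Real.log Y := by
    have := log_nat_mono (a := Y) (b := 8 * Y) (by omega) (by omega)
    linarith
  have hterm : ∀ k ∈ Finset.range K, ∀ j ∈ Finset.range K, ‖cis (-(((k : ℝ) - j) * φ)) *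
        ∑ n ∈ Finset.Icc Y (8 * Y), (w n : ℂ) * ((1 / n : ℂ) * cis ((((k : ℝ) - j) * ξ) * Real.log n))‖ ≤
        Q * ((if k = j then 3 else 0) + 2 / K) + E := by
    intro k hk j hj
    rw [Finset.mem_range] at hk hj
    rw [norm_mul, norm_cis, one_mul]
    have hkj : |(k : ℝ) - j| ≤ K := by
      have h1 : (k : ℝ) ≤ K := by exact_mod_cast hk.le
      have h2 : (j : ℝ) ≤ K := by exact_mod_cast hj.le
      have h3 : (0 : ℝ) ≤ k := Nat.cast_nonneg k
      have h4 : (0 : ℝ) ≤ j := Nat.cast_nonneg j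
      rw [abs_le]; constructor <;> linarith
    have h1 := hU' (((k : ℝ) - j) * ξ) (by
      rw [abs_mul, pow_succ, mul_comm]
      gcongr
      exact hkj.trans hYK)
    refine h1.trans ?_
    gcongr
    by_cases hkj : k = j
    · subst hkj
      rw [sub_self, zero_mul, if_pos rfl]
      simp only [mul_zero, cis_zero, intervalIntegral.integral_const]
      rw [norm_smul, norm_one, mul_one, Real.norm_of_nonneg hlog8']
      have : 0 ≤ 2 / (K : ℝ) := by positivity
      linarith
    · rw [if_neg hkj, zero_add]
      have h2 : (1 : ℝ) ≤ |(k : ℝ) - j| := by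
        have : (1 : ℤ) ≤ |(k : ℤ) - j| := Int.one_le_abs (by omega)
        exact_mod_cast this
      have h3 : (K : ℝ) ≤ |((k : ℝ) - j) * ξ| := by
        rw [abs_mul]; nlinarith
      refine (int_cis_bound _ _ _ (abs_pos.mp (by linarith))).trans ?_
      gcongr
  have hup : ∑ n ∈ Finset.Icc Y (8 * Y), w n * (1 / (n : ℝ) * V n) ≤ K * (5 * Q) + K ^ 2 * E := by
    have h0 : ∑ n ∈ Finset.Icc Y (8 * Y), w n * (1 / (n : ℝ) * V n) ≤
        ‖((∑ n ∈ Finset.Icc Y (8 * Y), w n * (1 / (n : ℝ) * V n) : ℝ) : ℂ)‖ := by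
      rw [Complex.norm_real]; exact Real.le_norm_self _
    refine h0.trans ?_
    rw [hid]
    calc _ ≤ ∑ k ∈ Finset.range K, ∑ j ∈ Finset.range K, (Q * ((if k = j then 3 else 0) + 2 / K) + E) := by
          refine (norm_sum_le _ _).trans (Finset.sum_le_sum fun k hk => ?_)
          exact (norm_sum_le _ _).trans (Finset.sum_le_sum fun j hj => hterm k hk j hj)
      _ = ∑ k ∈ Finset.range K, (Q * 5 + K * E) := by
          refine Finset.sum_congr rfl fun k hk => ?_
          rw [Finset.sum_add_distrib, ← Finset.mul_sum, Finset.sum_add_distrib, Finset.sum_ite_eq, if_pos hk]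
          simp only [Finset.sum_const, Finset.card_range, nsmul_eq_mul]
          rw [mul_div_cancel₀ _ hK0.ne']; ring
      _ = _ := by
          simp only [Finset.sum_const, Finset.card_range, nsmul_eq_mul]; ring
  -- contradiction
  set l := Real.log Y
  have f1 : (K : ℝ) ^ 2 * (1 / (4 * l)) / 2 ≤ (K : ℝ) ^ 2 * W / 2 := by gcongr
  have f2 : (K : ℝ) ^ 2 * E ≤ (K : ℝ) ^ 2 * (1 / (33 * l)) := by gcongr
  have f3 : K * (5 * Q) ≤ K * (5 * (32 / (c * l))) := by gcongr
  have f4 : K * (5 * (32 / (c * l))) = K * (5120 / c) / (32 * l) := by field_simp; norm_num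
  have f5 : K * (5120 / c) / (32 * l) ≤ K * K / (32 * l) := by gcongr
  have f6 : (K : ℝ) ^ 2 * (1 / (4 * l)) / 2 ≤ K * K / (32 * l) + (K : ℝ) ^ 2 * (1 / (33 * l)) := by linarith
  have f7 : (K : ℝ) ^ 2 * (1 / (4 * l)) / 2 = (K ^ 2 / l) * (1 / 8) := by field_simp; norm_num
  have f8 : K * K / (32 * l) + (K : ℝ) ^ 2 * (1 / (33 * l)) = (K ^ 2 / l) * (1 / 32 + 1 / 33) := by field_simp
  rw [f7, f8] at f6
  have : 0 < (K : ℝ) ^ 2 / l := by positivity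
  nlinarith

noncomputable def RI (a b : ℝ) : Finset ℕ := Finset.Icc ⌈a⌉₊ ⌊b⌋₊

lemma mem_RI {a b : ℝ} (hb : 0 ≤ b) {n : ℕ} : n ∈ RI a b ↔ a ≤ n ∧ (n : ℝ) ≤ b := by
  unfold RI
  rw [Finset.mem_Icc, Nat.ceil_le, Nat.le_floor_iff hb]

lemma harm_RI {a b : ℝ} (ha : 0 < a) (hab : a ≤ b) : ∑ n ∈ RI a b, 1 / (n : ℝ) ≤ 1 / a + Real.log (b / a) := by
  unfold RI
  have hl : 0 ≤ Real.log (b / a) := Real.log_nonneg (by rw [le_div_iff₀ ha]; linarith)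
  rcases le_or_gt ⌈a⌉₊ ⌊b⌋₊ with h | h
  · have hc : 1 ≤ ⌈a⌉₊ := Nat.one_le_iff_ne_zero.mpr (Nat.ceil_pos.mpr ha).ne'
    have h1 := harm_upper hc h
    have h2 : 1 / (⌈a⌉₊ : ℝ) ≤ 1 / a := one_div_le_one_div_of_le ha (Nat.le_ceil a)
    have h3 : Real.log ⌊b⌋₊ ≤ Real.log b :=
      Real.log_le_log (by exact_mod_cast hc.trans h) (Nat.floor_le (by linarith))
    have h4 : Real.log a ≤ Real.log ⌈a⌉₊ := Real.log_le_log ha (Nat.le_ceil a)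
    rw [Real.log_div (by linarith) ha.ne']
    linarith
  · rw [Finset.Icc_eq_empty_of_lt h, Finset.sum_empty]; positivity

lemma harm_RI_one {a b : ℝ} (ha : 0 < a) (hab : a ≤ b) : ∑ n ∈ RI a b, 1 / (n : ℝ) ≤ 1 + Real.log (b / a) := by
  unfold RI
  have hl : 0 ≤ Real.log (b / a) := Real.log_nonneg (by rw [le_div_iff₀ ha]; linarith)
  rcases le_or_gt ⌈a⌉₊ ⌊b⌋₊ with h | h
  · have hc : 1 ≤ ⌈a⌉₊ := Nat.one_le_iff_ne_zero.mpr (Nat.ceil_pos.mpr ha).ne'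
    have h1 := harm_upper hc h
    have h2 : 1 / (⌈a⌉₊ : ℝ) ≤ 1 := by
      rw [div_le_one (by exact_mod_cast hc)]; exact_mod_cast hc
    have h3 : Real.log ⌊b⌋₊ ≤ Real.log b :=
      Real.log_le_log (by exact_mod_cast hc.trans h) (Nat.floor_le (by linarith))
    have h4 : Real.log a ≤ Real.log ⌈a⌉₊ := Real.log_le_log ha (Nat.le_ceil a)
    rw [Real.log_div (by linarith) ha.ne']
    linarith
  · rw [Finset.Icc_eq_empty_of_lt h, Finset.sum_empty]; positivity

/-- the sum over multiples -/
lemma sum_mult_RI {a b : ℝ} (hb : 0 ≤ b) (d : ℕ) (hd : 1 ≤ d) :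
    ∑ n ∈ (RI a b).filter (d ∣ ·), 1 / (n : ℝ) = 1 / (d : ℝ) * ∑ m ∈ RI (a / d) (b / d), 1 / (m : ℝ) := by
  have hd0 : (0 : ℝ) < d := by exact_mod_cast hd
  rw [Finset.mul_sum]
  symm
  refine Finset.sum_bij (fun m _ => d * m) ?_ ?_ ?_ ?_
  · intro m hm
    rw [mem_RI (by positivity), div_le_iff₀ hd0, le_div_iff₀ hd0] at hm
    rw [Finset.mem_filter, mem_RI hb]
    push_cast
    exact ⟨⟨by linarith, by linarith⟩, dvd_mul_right _ _⟩
  · intro x _ y _ hxy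
    exact Nat.eq_of_mul_eq_mul_left (by omega) hxy
  · intro n hn
    rw [Finset.mem_filter, mem_RI hb] at hn
    obtain ⟨⟨h1, h2⟩, m, rfl⟩ := hn
    push_cast at h1 h2
    refine ⟨m, ?_, rfl⟩
    rw [mem_RI (by positivity), div_le_iff₀ hd0, le_div_iff₀ hd0]
    exact ⟨by linarith, by linarith⟩
  · intro m _
    push_cast
    rw [div_mul_div_comm, one_mul]

noncomputable def om (s : Finset ℕ) (n : ℕ) : ℕ := (s.filter (· ∣ n)).card

/-- product coefficient -/
noncomputable def pc (s S : Finset ℕ) (a : ℕ → ℂ) (n : ℕ) : ℂ :=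
  ∑ p ∈ s, if p ∣ n ∧ n / p ∈ S then a (n / p) else 0

lemma dp_mul_prime (s S S' : Finset ℕ) (a : ℕ → ℂ) (hs : ∀ p ∈ s, 1 ≤ p) (hS : ∀ m ∈ S, 1 ≤ m)
    (hS' : ∀ p ∈ s, ∀ m ∈ S, p * m ∈ S') (ξ : ℝ) :
    dp s (fun _ => 1) ξ * dp S a ξ = dp S' (pc s S a) ξ := by
  unfold dp pc
  rw [Finset.sum_mul]
  simp_rw [Finset.sum_div, Finset.sum_mul]
  rw [Finset.sum_comm]
  refine Finset.sum_congr rfl fun p hp => ?_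
  have hp1 := hs p hp
  have h1 : ∀ n, (if p ∣ n ∧ n / p ∈ S then a (n / p) else 0) / (n : ℂ) * cis (-(ξ * Real.log n)) =
      if p ∣ n ∧ n / p ∈ S then a (n / p) / (n : ℂ) * cis (-(ξ * Real.log n)) else 0 := by
    intro n; split_ifs <;> simp
  simp_rw [h1]
  rw [← Finset.sum_filter, Finset.mul_sum]
  refine Finset.sum_bij (fun m _ => p * m) ?_ ?_ ?_ ?_
  · intro m hm
    rw [Finset.mem_filter, Nat.mul_div_cancel_left _ (by omega)]
    exact ⟨hS' p hp m hm, dvd_mul_right _ _, hm⟩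
  · intro x _ y _ hxy
    exact Nat.eq_of_mul_eq_mul_left (by omega) hxy
  · intro n hn
    rw [Finset.mem_filter] at hn
    exact ⟨n / p, hn.2.2, Nat.mul_div_cancel' hn.2.1⟩
  · intro m hm
    have hm1 := hS m hm
    rw [Nat.mul_div_cancel_left _ (by omega)]
    have hp0 : (p : ℝ) ≠ 0 := by exact_mod_cast (by omega : p ≠ 0)
    have hm0 : (m : ℝ) ≠ 0 := by exact_mod_cast (by omega : m ≠ 0)
    push_cast
    rw [Real.log_mul hp0 hm0, mul_add, neg_add, cis_add, div_eq_mul_inv, div_eq_mul_inv, div_eq_mul_inv, mul_inv]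
    ring

lemma om_mono_dvd (s : Finset ℕ) {m n : ℕ} (h : m ∣ n) : om s m ≤ om s n :=
  Finset.card_le_card (Finset.monotone_filter_right _ fun _ _ hp => hp.trans h)

lemma pc_bound (s S : Finset ℕ) (a : ℕ → ℂ) (k : ℕ) (ha : ∀ n, ‖a n‖ ≤ (om s n : ℝ) ^ k) (n : ℕ) :
    ‖pc s S a n‖ ≤ (om s n : ℝ) ^ (k + 1) := by
  unfold pc
  calc _ ≤ ∑ p ∈ s, ‖if p ∣ n ∧ n / p ∈ S then a (n / p) else 0‖ := norm_sum_le _ _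
    _ ≤ ∑ p ∈ s, if p ∣ n then (om s n : ℝ) ^ k else 0 := by
        refine Finset.sum_le_sum fun p _ => ?_
        by_cases h1 : p ∣ n
        · rw [if_pos h1]
          split_ifs
          · refine (ha _).trans ?_
            have := om_mono_dvd s (Nat.div_dvd_of_dvd h1)
            gcongr
          · rw [norm_zero]; positivity
        · rw [if_neg (fun h => h1 h.1), if_neg h1, norm_zero]
    _ = _ := by
        rw [← Finset.sum_filter, Finset.sum_const, nsmul_eq_mul, pow_succ, mul_comm]; rfl

lemma dp_pow_mul (s : Finset ℕ) (p1 p2 m1 m2 : ℝ) (hp1 : 1 ≤ p1) (hp12 : p1 ≤ p2) (hm1 : 0 < m1) (hm12 : m1 ≤ m2)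
    (hs : ∀ p ∈ s, p1 ≤ p ∧ (p : ℝ) ≤ p2) (a : ℕ → ℂ) (ha : ∀ n, ‖a n‖ ≤ 1) (l : ℕ) :
    ∃ b : ℕ → ℂ, (∀ n, ‖b n‖ ≤ (om s n : ℝ) ^ l) ∧
      ∀ ξ, dp s (fun _ => 1) ξ ^ l * dp (RI m1 m2) a ξ = dp (RI (m1 * p1 ^ l) (m2 * p2 ^ l)) b ξ := by
  induction l with
  | zero => exact ⟨a, by simpa using ha, fun ξ => by simp⟩
  | succ l ih =>
    obtain ⟨b, hb, h⟩ := ih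
    have hm2 : 0 < m2 := by linarith
    have hp2 : 0 < p2 := by linarith
    refine ⟨pc s (RI (m1 * p1 ^ l) (m2 * p2 ^ l)) b, pc_bound s _ b l hb, fun ξ => ?_⟩
    rw [pow_succ', mul_assoc, h]
    apply dp_mul_prime
    · intro p hp
      have := (hs p hp).1
      exact_mod_cast hp1.trans this
    · intro m hm
      rw [mem_RI (by positivity)] at hm
      have : (0 : ℝ) < m := lt_of_lt_of_le (by positivity) hm.1
      exact_mod_cast this
    · intro p hp m hm
      rw [mem_RI (by positivity)] at hm ⊢
      obtain ⟨h1, h2⟩ := hs p hp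
      push_cast
      constructor
      · calc m1 * p1 ^ (l + 1) = p1 * (m1 * p1 ^ l) := by ring
          _ ≤ p * m := by gcongr; exact hm.1
      · calc (p : ℝ) * m ≤ p2 * (m2 * p2 ^ l) := by gcongr; exact hm.2
          _ = _ := by ring

lemma om_pow_le (w k : ℕ) : (w : ℝ) ^ k ≤ 2 ^ k * (Nat.factorial k) * 2 ^ w := by
  have h1 := Real.pow_div_factorial_le_exp ((w : ℝ) / 2) (by positivity) k
  have hf : (0 : ℝ) < Nat.factorial k := by exact_mod_cast Nat.factorial_pos k
  rw [div_le_iff₀ hf, div_pow, div_le_iff₀ (by positivity)] at h1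
  have h2 : Real.exp ((w : ℝ) / 2) ≤ 2 ^ w := by
    have : Real.exp ((w : ℝ) / 2) = (Real.exp (1 / 2)) ^ w := by
      rw [← Real.exp_nat_mul]; congr 1; ring
    rw [this]
    have h3 : Real.exp (1 / 2) ≤ 2 := by
      have h4 : Real.exp (1 / 2) * Real.exp (1 / 2) = Real.exp 1 := by rw [← Real.exp_add]; norm_num
      have := Real.exp_one_lt_d9
      by_contra hcon
      push Not at hcon
      nlinarith
    gcongr
  calc (w : ℝ) ^ k ≤ Real.exp ((w : ℝ) / 2) * Nat.factorial k * 2 ^ k := h1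
    _ ≤ 2 ^ w * Nat.factorial k * 2 ^ k := by gcongr
    _ = _ := by ring

lemma sum_two_pow_om (s : Finset ℕ) (hs : ∀ p ∈ s, p.Prime) (hs2 : ∑ p ∈ s, 1 / (p : ℝ) ≤ 2) {a b : ℝ} (ha : 0 < a)
    (hab : a ≤ b) : ∑ n ∈ RI a b, (2 : ℝ) ^ (om s n) / n ≤ Real.exp 2 * (1 + Real.log (b / a)) := by
  have hb : 0 ≤ b := by linarith
  have h1 : ∀ n ∈ RI a b, (2 : ℝ) ^ (om s n) / n = ∑ D ∈ s.powerset, if (∏ p ∈ D, p) ∣ n then 1 / (n : ℝ) else 0 := by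
    intro n hn
    have : (2 : ℝ) ^ (om s n) = ∑ D ∈ s.powerset, if (∏ p ∈ D, p) ∣ n then (1 : ℝ) else 0 := by
      have e : s.powerset.filter (fun D => (∏ p ∈ D, p) ∣ n) = (s.filter (· ∣ n)).powerset := by
        ext D
        rw [Finset.mem_filter, Finset.mem_powerset, Finset.mem_powerset]
        constructor
        · rintro ⟨h1, h2⟩ p hp
          exact Finset.mem_filter.mpr ⟨h1 hp, (Finset.dvd_prod_of_mem _ hp).trans h2⟩
        · intro h
          refine ⟨fun p hp => (Finset.mem_filter.mp (h hp)).1, ?_⟩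
          exact Finset.prod_primes_dvd n (fun p hp => (hs p (Finset.mem_filter.mp (h hp)).1).prime)
            (fun p hp => (Finset.mem_filter.mp (h hp)).2)
      rw [← Finset.sum_filter, e, Finset.sum_const, Finset.card_powerset, nsmul_eq_mul, mul_one]
      push_cast; rfl
    rw [this, Finset.sum_div]
    refine Finset.sum_congr rfl fun D _ => ?_
    split_ifs <;> simp
  rw [Finset.sum_congr rfl h1, Finset.sum_comm]
  have hl : 0 ≤ Real.log (b / a) := Real.log_nonneg (by rw [le_div_iff₀ ha]; linarith)
  calc _ ≤ ∑ D ∈ s.powerset, (∏ p ∈ D, 1 / (p : ℝ)) * (1 + Real.log (b / a)) := by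
        refine Finset.sum_le_sum fun D hD => ?_
        rw [← Finset.sum_filter]
        have hd : 1 ≤ ∏ p ∈ D, p := Nat.one_le_iff_ne_zero.mpr
          (Finset.prod_ne_zero_iff.mpr fun p hp => (hs p (Finset.mem_powerset.mp hD hp)).ne_zero)
        have hd0 : (0 : ℝ) < ((∏ p ∈ D, p : ℕ) : ℝ) := by exact_mod_cast hd
        rw [sum_mult_RI hb _ hd]
        have h2 := harm_RI_one (a := a / ((∏ p ∈ D, p : ℕ) : ℝ)) (b := b / ((∏ p ∈ D, p : ℕ) : ℝ)) (by positivity)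
          (by gcongr)
        rw [div_div_div_cancel_right₀ hd0.ne'] at h2
        have e : (∏ p ∈ D, 1 / (p : ℝ)) = 1 / ((∏ p ∈ D, p : ℕ) : ℝ) := by
          push_cast; rw [Finset.prod_div_distrib]; simp
        rw [e]
        gcongr
    _ = (∏ p ∈ s, (1 + 1 / (p : ℝ))) * (1 + Real.log (b / a)) := by
        rw [← Finset.sum_mul, Finset.prod_one_add]
    _ ≤ _ := by
        gcongr
        calc ∏ p ∈ s, (1 + 1 / (p : ℝ)) ≤ ∏ p ∈ s, Real.exp (1 / (p : ℝ)) := by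
              refine Finset.prod_le_prod (fun p _ => by positivity) fun p _ => ?_
              rw [add_comm]; exact Real.add_one_le_exp _
          _ = Real.exp (∑ p ∈ s, 1 / (p : ℝ)) := (Real.exp_sum _ _).symm
          _ ≤ _ := Real.exp_le_exp.mpr hs2

theorem moment_bound (T : ℝ) (hT : 0 < T) (s : Finset ℕ) (hs0 : ∀ p ∈ s, p.Prime) (hs2 : ∑ p ∈ s, 1 / (p : ℝ) ≤ 2)
    (p1 p2 m1 m2 : ℝ) (hp1 : 1 ≤ p1) (hp12 : p1 ≤ p2) (hm1 : 0 < m1) (hm12 : m1 ≤ m2)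
    (hs : ∀ p ∈ s, p1 ≤ p ∧ (p : ℝ) ≤ p2) (a : ℕ → ℂ) (ha : ∀ n, ‖a n‖ ≤ 1) (l : ℕ) (hTl : T ≤ m1 * p1 ^ l) :
    ∫ ξ, ‖dp s (fun _ => 1) ξ‖ ^ (2 * l) * ‖dp (RI m1 m2) a ξ‖ ^ 2 ∂muT T ≤
      3 * Real.exp 2 * 4 ^ l * (Nat.factorial (2 * l)) * (1 + Real.log (m2 / m1) + l * Real.log (p2 / p1)) := by
  obtain ⟨b, hb, h⟩ := dp_pow_mul s p1 p2 m1 m2 hp1 hp12 hm1 hm12 hs a ha l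
  have hm2 : 0 < m2 := by linarith
  have hp10 : 0 < p1 := by linarith
  have hp2 : 0 < p2 := by linarith
  set A := m1 * p1 ^ l with hA
  set B := m2 * p2 ^ l with hB
  have hA0 : 0 < A := by positivity
  have hAB : A ≤ B := by rw [hA, hB]; gcongr
  have hB0 : 0 < B := by positivity
  have e1 : ∀ ξ, ‖dp s (fun _ => 1) ξ‖ ^ (2 * l) * ‖dp (RI m1 m2) a ξ‖ ^ 2 = ‖dp (RI A B) b ξ‖ ^ 2 := by
    intro ξ
    rw [← h, norm_mul, norm_pow, mul_pow, ← pow_mul, mul_comm 2 l]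
  simp_rw [e1]
  have h2 := dp_mv hT (RI A B) b (fun n hn => by
      rw [mem_RI hB0.le] at hn
      have : (0 : ℝ) < n := by linarith [hn.1]
      exact_mod_cast this) (fun n hn => by rw [mem_RI hB0.le] at hn; linarith [hn.1])
  refine h2.trans ?_
  have h3 : ∑ n ∈ RI A B, ‖b n‖ ^ 2 / (n : ℝ) ≤
      ∑ n ∈ RI A B, 2 ^ (2 * l) * (Nat.factorial (2 * l)) * ((2 : ℝ) ^ (om s n) / n) := by
    refine Finset.sum_le_sum fun n _ => ?_
    have h4 := pow_le_pow_left₀ (norm_nonneg _) (hb n) 2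
    rw [← pow_mul, mul_comm l 2] at h4
    have h5 := h4.trans (om_pow_le (om s n) (2 * l))
    rw [← mul_div_assoc]
    gcongr
  rw [← Finset.mul_sum] at h3
  have h6 := sum_two_pow_om s hs0 hs2 hA0 hAB
  have e2 : Real.log (B / A) = Real.log (m2 / m1) + l * Real.log (p2 / p1) := by
    rw [hA, hB, mul_div_mul_comm, ← div_pow, Real.log_mul (by positivity) (by positivity), Real.log_pow]
  rw [e2, ← add_assoc] at h6
  have e3 : (2 : ℝ) ^ (2 * l) = 4 ^ l := by rw [pow_mul]; norm_num
  rw [e3] at h3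
  calc 3 * ∑ n ∈ RI A B, ‖b n‖ ^ 2 / (n : ℝ) ≤ 3 * (4 ^ l * (Nat.factorial (2 * l)) * ∑ n ∈ RI A B, (2 : ℝ) ^ (om s n) / n) := by
        gcongr
    _ ≤ 3 * (4 ^ l * (Nat.factorial (2 * l)) * (Real.exp 2 * (1 + Real.log (m2 / m1) + l * Real.log (p2 / p1)))) := by
        gcongr
    _ = _ := by ring

lemma harm_RI_lower {a b : ℝ} (ha : 0 < a) (hab : a ≤ b) : Real.log (b / a) - 1 / a ≤ ∑ n ∈ RI a b, 1 / (n : ℝ) := by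
  unfold RI
  have hb : 0 < b := by linarith
  rcases le_or_gt ⌈a⌉₊ ⌊b⌋₊ with h | h
  · have hc : 1 ≤ ⌈a⌉₊ := Nat.one_le_iff_ne_zero.mpr (Nat.ceil_pos.mpr ha).ne'
    have h1 := harm_lower hc h
    have h3 : Real.log b ≤ Real.log ((⌊b⌋₊ + 1 : ℕ) : ℝ) :=
      Real.log_le_log hb (by push_cast; exact (Nat.lt_floor_add_one b).le)
    have h4 : Real.log ⌈a⌉₊ ≤ Real.log (a + 1) :=
      Real.log_le_log (by exact_mod_cast hc) (Nat.ceil_lt_add_one ha.le).le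
    have h5 : Real.log (a + 1) - Real.log a ≤ 1 / a := by
      rw [← Real.log_div (by linarith) ha.ne']
      have := Real.log_le_sub_one_of_pos (show 0 < (a + 1) / a by positivity)
      have h6 : (a + 1) / a - 1 = 1 / a := by field_simp; ring
      linarith
    rw [Real.log_div hb.ne' ha.ne']
    linarith
  · rw [Finset.Icc_eq_empty_of_lt h, Finset.sum_empty]
    have h1 : b < a + 1 := by
      have h2 := Nat.lt_floor_add_one b
      have h3 := Nat.ceil_lt_add_one ha.le
      have h4 : ((⌊b⌋₊ + 1 : ℕ) : ℝ) ≤ ⌈a⌉₊ := by exact_mod_cast h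
      push_cast at h4
      linarith
    have := Real.log_le_sub_one_of_pos (show 0 < b / a by positivity)
    have h6 : b / a - 1 ≤ 1 / a := by
      rw [div_sub_one ha.ne']
      gcongr; linarith
    linarith

lemma mult_RI_bd {a b : ℝ} (ha : 0 < a) (hab : a ≤ b) (d : ℕ) (hd : 1 ≤ d) :
    Real.log (b / a) / d - 1 / a ≤ ∑ n ∈ (RI a b).filter (d ∣ ·), 1 / (n : ℝ) ∧
    ∑ n ∈ (RI a b).filter (d ∣ ·), 1 / (n : ℝ) ≤ Real.log (b / a) / d + 1 / a := by
  have hd0 : (0 : ℝ) < d := by exact_mod_cast hd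
  rw [sum_mult_RI (by linarith) d hd]
  have e : b / d / (a / d) = b / a := by field_simp
  have h1 := harm_RI (show 0 < a / d by positivity) (show a / d ≤ b / d by gcongr)
  have h2 := harm_RI_lower (show 0 < a / d by positivity) (show a / d ≤ b / d by gcongr)
  rw [e] at h1 h2
  constructor
  · calc _ = 1 / (d : ℝ) * (Real.log (b / a) - 1 / (a / d)) := by field_simp
      _ ≤ _ := by gcongr
  · calc _ ≤ 1 / (d : ℝ) * (1 / (a / d) + Real.log (b / a)) := by gcongr
      _ = _ := by field_simp; ring

lemma om_eq_sum (s : Finset ℕ) (n : ℕ) : (om s n : ℝ) = ∑ p ∈ s, if p ∣ n then (1 : ℝ) else 0 := by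
  unfold om; rw [Finset.sum_boole]

lemma om_avg (s : Finset ℕ) (S : Finset ℕ) :
    ∑ n ∈ S, (om s n : ℝ) / n = ∑ p ∈ s, ∑ n ∈ S.filter (p ∣ ·), 1 / (n : ℝ) := by
  simp_rw [om_eq_sum, Finset.sum_div]
  rw [Finset.sum_comm]
  refine Finset.sum_congr rfl fun p _ => ?_
  rw [Finset.sum_filter]
  refine Finset.sum_congr rfl fun n _ => ?_
  split_ifs <;> simp

/-- Turan-Kubilius -/
theorem turan_kubilius (s : Finset ℕ) (hs : ∀ p ∈ s, p.Prime) (a b : ℝ) (ha : 0 < a) (hab : a ≤ b) :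
    ∑ n ∈ RI a b, ((om s n : ℝ) - ∑ p ∈ s, 1 / (p : ℝ)) ^ 2 / n ≤
      (∑ p ∈ s, 1 / (p : ℝ)) * Real.log (b / a) + 5 * (s.card : ℝ) ^ 2 / a := by
  set W := ∑ p ∈ s, 1 / (p : ℝ) with hW
  set L := Real.log (b / a) with hL
  set k : ℝ := (s.card : ℝ) with hk
  have hL0 : 0 ≤ L := Real.log_nonneg (by rw [le_div_iff₀ ha]; linarith)
  have hW0 : 0 ≤ W := Finset.sum_nonneg fun p _ => by positivity
  have hWk : W ≤ k := by
    calc W ≤ ∑ p ∈ s, (1 : ℝ) := Finset.sum_le_sum fun p hp => by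
          have : 1 ≤ p := (hs p hp).one_lt.le
          rw [div_le_one (by exact_mod_cast this)]; exact_mod_cast this
      _ = k := by simp [hk]
  have hk2 : k ≤ k ^ 2 := by rw [hk]; exact_mod_cast Nat.le_self_pow (by norm_num) _
  have hp1 : ∀ p ∈ s, 1 ≤ p := fun p hp => (hs p hp).one_lt.le
  have E1 : ∑ n ∈ RI a b, ((om s n : ℝ) - W) ^ 2 / n =
      ∑ n ∈ RI a b, (om s n : ℝ) ^ 2 / n - 2 * W * ∑ n ∈ RI a b, (om s n : ℝ) / n + W ^ 2 * ∑ n ∈ RI a b, 1 / (n : ℝ) := by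
    clear_value W
    rw [Finset.mul_sum, Finset.mul_sum, ← Finset.sum_sub_distrib, ← Finset.sum_add_distrib]
    refine Finset.sum_congr rfl fun n _ => by ring
  have B0 : ∑ n ∈ RI a b, 1 / (n : ℝ) ≤ L + 1 / a := by have := harm_RI ha hab; linarith
  have B1 : W * L - k / a ≤ ∑ n ∈ RI a b, (om s n : ℝ) / n := by
    rw [om_avg]
    calc W * L - k / a = ∑ p ∈ s, (L / p - 1 / a) := by
          rw [Finset.sum_sub_distrib, hW, Finset.sum_mul, Finset.sum_const, nsmul_eq_mul, hk]
          congr 1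
          · refine Finset.sum_congr rfl fun p _ => by ring
          · ring
      _ ≤ _ := Finset.sum_le_sum fun p hp => (mult_RI_bd ha hab p (hp1 p hp)).1
  have B2 : ∑ n ∈ RI a b, (om s n : ℝ) ^ 2 / n ≤ W ^ 2 * L + W * L + (k ^ 2 + k) / a := by
    have e : ∑ n ∈ RI a b, (om s n : ℝ) ^ 2 / n = ∑ p ∈ s, ∑ q ∈ s,
        ∑ n ∈ (RI a b).filter (fun n => p ∣ n ∧ q ∣ n), 1 / (n : ℝ) := by
      simp_rw [om_eq_sum, sq, Finset.sum_mul_sum, Finset.sum_div]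
      rw [Finset.sum_comm]
      refine Finset.sum_congr rfl fun p _ => ?_
      rw [Finset.sum_comm]
      refine Finset.sum_congr rfl fun q _ => ?_
      rw [Finset.sum_filter]
      refine Finset.sum_congr rfl fun n _ => ?_
      by_cases h1 : p ∣ n <;> by_cases h2 : q ∣ n <;> simp [h1, h2]
    rw [e]
    calc _ ≤ ∑ p ∈ s, ∑ q ∈ s, ((L / (p * q) + 1 / a) + if p = q then (L / p + 1 / a) else 0) := by
          refine Finset.sum_le_sum fun p hp => Finset.sum_le_sum fun q hq => ?_
          have hp0 := hp1 p hp
          have hq0 := hp1 q hq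
          by_cases hpq : p = q
          · subst hpq
            rw [if_pos rfl]
            simp only [and_self]
            have := (mult_RI_bd ha hab p hp0).2
            have h3 : 0 ≤ L / (p * p) + 1 / a := by positivity
            linarith
          · rw [if_neg hpq, add_zero]
            have hc := (Nat.coprime_primes (hs p hp) (hs q hq)).mpr hpq
            have e2 : (RI a b).filter (fun n => p ∣ n ∧ q ∣ n) = (RI a b).filter (p * q ∣ ·) := by
              refine Finset.filter_congr fun n _ => ?_
              exact ⟨fun h => hc.mul_dvd_of_dvd_of_dvd h.1 h.2,
                fun h => ⟨(dvd_mul_right _ _).trans h, (dvd_mul_left _ _).trans h⟩⟩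
            rw [e2]
            have := (mult_RI_bd ha hab (p * q) (Nat.one_le_iff_ne_zero.mpr (by positivity))).2
            push_cast at this
            exact this
      _ = _ := by
          simp_rw [Finset.sum_add_distrib]
          have t1 : ∑ p ∈ s, ∑ q ∈ s, L / ((p : ℝ) * q) = W ^ 2 * L := by
            rw [sq, hW, Finset.sum_mul_sum, Finset.sum_mul]
            refine Finset.sum_congr rfl fun p _ => ?_
            rw [Finset.sum_mul]
            refine Finset.sum_congr rfl fun q _ => ?_
            rw [div_mul_div_comm]; ring
          have t2 : ∑ p ∈ s, ∑ q ∈ s, (if p = q then (L / (p : ℝ) + 1 / a) else 0) = W * L + k / a := by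
            calc _ = ∑ p ∈ s, (L / (p : ℝ) + 1 / a) := by
                  refine Finset.sum_congr rfl fun p hp => ?_
                  rw [Finset.sum_ite_eq, if_pos hp]
              _ = _ := by
                  rw [Finset.sum_add_distrib, hW, Finset.sum_mul, Finset.sum_const, nsmul_eq_mul, hk]
                  congr 1
                  · refine Finset.sum_congr rfl fun p _ => by ring
                  · ring
          rw [t1, t2]
          simp only [Finset.sum_const, nsmul_eq_mul]
          rw [← hk]; ring
  rw [E1]
  have h1 : W * (W * L - k / a) ≤ W * ∑ n ∈ RI a b, (om s n : ℝ) / n := by gcongr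
  have h2 : W ^ 2 * ∑ n ∈ RI a b, 1 / (n : ℝ) ≤ W ^ 2 * (L + 1 / a) := by gcongr
  have h3 : (k ^ 2 + k + 2 * W * k + W ^ 2) / a ≤ 5 * k ^ 2 / a := by
    gcongr
    have : W * k ≤ k * k := by gcongr
    have : W ^ 2 ≤ k ^ 2 := by gcongr
    nlinarith
  have e3 : W ^ 2 * L + W * L + (k ^ 2 + k) / a - 2 * (W * (W * L - k / a)) + W ^ 2 * (L + 1 / a) =
    W * L + (k ^ 2 + k + 2 * W * k + W ^ 2) / a := by ring
  linarith

noncomputable def PP (x : ℝ) : Finset ℕ := (RI (Real.exp (Real.exp x)) (Real.exp (Real.exp (2 * x)))).filter Nat.Prime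
noncomputable def blk (x : ℝ) (v : ℕ) : Finset ℕ := (PP x).filter (fun p => ⌊x * Real.log p⌋₊ = v)
noncomputable def II (x : ℝ) : Finset ℕ := Finset.Icc ⌊x * Real.exp x⌋₊ ⌊x * Real.exp (2 * x)⌋₊
noncomputable def Pv (x : ℝ) (v : ℕ) (ξ : ℝ) : ℂ := dp (blk x v) (fun _ => 1) ξ
noncomputable def WW (x : ℝ) : ℝ := ∑ p ∈ PP x, 1 / (p : ℝ)
noncomputable def lamC (n : ℕ) : ℂ := (lam n : ℂ)
noncomputable def GG (B M : ℝ) (ξ : ℝ) : ℂ := dp (RI M (B * M)) lamC ξ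

lemma norm_lamC (n : ℕ) : ‖lamC n‖ = 1 := by
  unfold lamC; rw [Complex.norm_real, Real.norm_eq_abs, abs_lam]

lemma mem_PP {x : ℝ} {p : ℕ} : p ∈ PP x ↔ (Real.exp (Real.exp x) ≤ p ∧ (p : ℝ) ≤ Real.exp (Real.exp (2 * x))) ∧ p.Prime := by
  unfold PP; rw [Finset.mem_filter, mem_RI (Real.exp_pos _).le]

lemma blk_bd {x : ℝ} (hx : 0 < x) {v p : ℕ} (hp : p ∈ blk x v) :
    p.Prime ∧ Real.exp (v / x) ≤ p ∧ (p : ℝ) ≤ Real.exp ((v + 1) / x) := by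
  unfold blk at hp
  rw [Finset.mem_filter, mem_PP] at hp
  obtain ⟨⟨_, hpp⟩, h2⟩ := hp
  have hp1 : (1 : ℝ) ≤ p := by exact_mod_cast hpp.one_lt.le
  have hp0 : (0 : ℝ) < p := by linarith
  have hl : 0 ≤ x * Real.log p := mul_nonneg hx.le (Real.log_nonneg hp1)
  rw [Nat.floor_eq_iff hl] at h2
  refine ⟨hpp, ?_, ?_⟩
  · rw [← Real.le_log_iff_exp_le hp0, div_le_iff₀ hx]; linarith
  · rw [← Real.log_le_iff_le_exp hp0, le_div_iff₀ hx]; linarith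

lemma PP_maps {x : ℝ} (hx : 0 < x) {p : ℕ} (hp : p ∈ PP x) : ⌊x * Real.log p⌋₊ ∈ II x := by
  rw [mem_PP] at hp
  obtain ⟨⟨h1, h2⟩, hpp⟩ := hp
  have hp0 : (0 : ℝ) < p := by exact_mod_cast hpp.pos
  unfold II
  rw [Finset.mem_Icc]
  constructor
  · apply Nat.floor_le_floor
    gcongr
    rwa [Real.le_log_iff_exp_le hp0]
  · apply Nat.floor_le_floor
    gcongr
    rwa [Real.log_le_iff_le_exp hp0]

lemma II_bd {x : ℝ} (hx : 0 < x) {v : ℕ} (hv : v ∈ II x) :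
    Real.exp x - 1 / x ≤ v / x ∧ (v : ℝ) / x ≤ Real.exp (2 * x) := by
  unfold II at hv
  rw [Finset.mem_Icc] at hv
  constructor
  · have h1 : x * Real.exp x < (v : ℝ) + 1 := by
      have h2 := Nat.lt_floor_add_one (x * Real.exp x)
      have h3 : (⌊x * Real.exp x⌋₊ : ℝ) ≤ v := by exact_mod_cast hv.1
      linarith
    rw [le_div_iff₀ hx, sub_mul, one_div, inv_mul_cancel₀ hx.ne']; linarith
  · have h1 : (v : ℝ) ≤ x * Real.exp (2 * x) := (Nat.le_floor_iff (by positivity)).mp hv.2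
    rw [div_le_iff₀ hx]; linarith

lemma II_card {x : ℝ} (hx : 1 ≤ x) : ((II x).card : ℝ) ≤ 2 * x * Real.exp (2 * x) := by
  have h0 : (II x).card ≤ ⌊x * Real.exp (2 * x)⌋₊ + 1 := by
    unfold II; rw [Nat.card_Icc]; omega
  have h1 : (⌊x * Real.exp (2 * x)⌋₊ : ℝ) ≤ x * Real.exp (2 * x) := Nat.floor_le (by positivity)
  have h2 : (1 : ℝ) ≤ Real.exp (2 * x) := Real.one_le_exp (by linarith)
  have h3 : ((II x).card : ℝ) ≤ ⌊x * Real.exp (2 * x)⌋₊ + 1 := by exact_mod_cast h0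
  nlinarith

lemma blk_sum {x : ℝ} (hx : 1 ≤ x) (v : ℕ) : ∑ p ∈ blk x v, 1 / (p : ℝ) ≤ 2 := by
  have hx0 : 0 < x := by linarith
  have hle : Real.exp (v / x) ≤ Real.exp ((v + 1) / x) := Real.exp_le_exp.mpr (by gcongr; linarith)
  calc _ ≤ ∑ p ∈ RI (Real.exp (v / x)) (Real.exp ((v + 1) / x)), 1 / (p : ℝ) := by
        refine Finset.sum_le_sum_of_subset_of_nonneg (fun p hp => ?_) fun _ _ _ => by positivity
        rw [mem_RI (Real.exp_pos _).le]; exact (blk_bd hx0 hp).2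
    _ ≤ _ := harm_RI_one (Real.exp_pos _) hle
    _ ≤ 2 := by
        rw [← Real.exp_sub, Real.log_exp, ← sub_div]
        have : ((v : ℝ) + 1 - v) / x ≤ 1 := by rw [div_le_one hx0]; linarith
        linarith

lemma PP_card (x : ℝ) : ((PP x).card : ℝ) ≤ Real.exp (Real.exp (2 * x)) := by
  have h1 : (PP x).card ≤ ⌊Real.exp (Real.exp (2 * x))⌋₊ := by
    have : PP x ⊆ Finset.Icc 1 ⌊Real.exp (Real.exp (2 * x))⌋₊ := by
      intro p hp
      rw [mem_PP] at hp
      rw [Finset.mem_Icc, Nat.le_floor_iff (Real.exp_pos _).le]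
      exact ⟨hp.2.one_lt.le, hp.1.2⟩
    simpa using Finset.card_le_card this
  calc ((PP x).card : ℝ) ≤ ⌊Real.exp (Real.exp (2 * x))⌋₊ := by exact_mod_cast h1
    _ ≤ _ := Nat.floor_le (Real.exp_pos _).le

lemma WW_lower : ∃ x0 : ℝ, 20 ≤ x0 ∧ ∀ x ≥ x0, x / 20 ≤ WW x := by
  obtain ⟨Y0, hY0, hY⟩ := prm_lower
  refine ⟨max 20 Y0, le_max_left _ _, fun x hx => ?_⟩
  have hx20 : 20 ≤ x := (le_max_left _ _).trans hx
  have hxY : (Y0 : ℝ) ≤ x := (le_max_right _ _).trans hx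
  have hl8 : Real.log 8 = 3 * Real.log 2 := by
    rw [show (8 : ℝ) = 2 ^ 3 by norm_num, Real.log_pow]; norm_num
  have hl2 := Real.log_two_gt_d9
  have hl2' := Real.log_two_lt_d9
  have hl8p : 0 < Real.log 8 := by rw [hl8]; linarith
  have hex : x + 1 ≤ Real.exp x := Real.add_one_le_exp x
  have he2 : Real.exp (2 * x) = Real.exp x * Real.exp x := by rw [← Real.exp_add]; ring_nf
  set a := Real.exp x / Real.log 8 with ha
  set b := Real.exp (2 * x) / Real.log 8 - 1 with hb
  have ha0 : 0 < a := by positivity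
  have ha1 : 10 ≤ a := by rw [ha, le_div_iff₀ hl8p, hl8]; linarith
  have hba : Real.exp x / 2 * a ≤ b := by
    have : b = Real.exp x * a - 1 := by rw [hb, ha, he2]; ring
    rw [this]; nlinarith
  have hab : a ≤ b := by nlinarith
  have hlog : x - Real.log 2 ≤ Real.log (b / a) := by
    rw [← Real.log_exp x, ← Real.log_div (Real.exp_pos _).ne' (by norm_num)]
    apply Real.log_le_log (by positivity)
    rw [le_div_iff₀ ha0]; exact hba
  have hsum := harm_RI_lower ha0 hab
  have h1a : 1 / a ≤ 1 := by rw [div_le_one ha0]; linarith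
  have hmem : ∀ i ∈ RI a b, (Real.exp x ≤ i * Real.log 8) ∧ ((i + 1) * Real.log 8 ≤ Real.exp (2 * x)) ∧ (10 : ℝ) ≤ i := by
    intro i hi
    rw [mem_RI (by linarith)] at hi
    refine ⟨?_, ?_, by linarith⟩
    · have := hi.1; rwa [ha, div_le_iff₀ hl8p] at this
    · have h := hi.2
      have : (i : ℝ) + 1 ≤ Real.exp (2 * x) / Real.log 8 := by linarith
      rwa [le_div_iff₀ hl8p] at this
  have hpow : ∀ i : ℕ, ((8 ^ i : ℕ) : ℝ) = Real.exp (i * Real.log 8) := by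
    intro i; rw [mul_comm, Real.exp_mul, Real.exp_log (by norm_num)]; push_cast; rw [Real.rpow_natCast]
  have hdisj : (RI a b : Set ℕ).PairwiseDisjoint (fun i => prm (8 ^ i)) := by
    intro i _ j _ hij
    rw [Function.onFun, Finset.disjoint_left]
    intro p hp hq
    unfold prm at hp hq
    rw [Finset.mem_filter, Finset.mem_Ico, ← pow_succ'] at hp hq
    rcases lt_or_gt_of_ne hij with h | h
    · have := Nat.pow_le_pow_right (n := 8) (by norm_num) (Nat.succ_le_of_lt h)
      simp only [Nat.succ_eq_add_one] at this
      omega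
    · have := Nat.pow_le_pow_right (n := 8) (by norm_num) (Nat.succ_le_of_lt h)
      simp only [Nat.succ_eq_add_one] at this
      omega
  have hsub : (RI a b).biUnion (fun i => prm (8 ^ i)) ⊆ PP x := by
    intro p hp
    rw [Finset.mem_biUnion] at hp
    obtain ⟨i, hi, hp⟩ := hp
    obtain ⟨h1, h2, _⟩ := hmem i hi
    unfold prm at hp
    rw [Finset.mem_filter, Finset.mem_Ico] at hp
    rw [mem_PP]
    refine ⟨⟨?_, ?_⟩, hp.2⟩
    · calc Real.exp (Real.exp x) ≤ Real.exp (i * Real.log 8) := Real.exp_le_exp.mpr h1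
        _ = ((8 ^ i : ℕ) : ℝ) := (hpow i).symm
        _ ≤ p := by exact_mod_cast hp.1.1
    · calc (p : ℝ) ≤ ((8 ^ (i + 1) : ℕ) : ℝ) := by rw [pow_succ']; exact_mod_cast hp.1.2.le
        _ = Real.exp ((i + 1) * Real.log 8) := by rw [hpow]; push_cast; rfl
        _ ≤ _ := Real.exp_le_exp.mpr h2
  unfold WW
  calc x / 20 ≤ 1 / (4 * Real.log 8) * (x - Real.log 2 - 1) := by
        rw [one_div_mul_eq_div, div_le_div_iff₀ (by norm_num) (by positivity), hl8]
        nlinarith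
    _ ≤ 1 / (4 * Real.log 8) * ∑ i ∈ RI a b, 1 / (i : ℝ) := by gcongr; linarith
    _ = ∑ i ∈ RI a b, 1 / (4 * Real.log ((8 ^ i : ℕ) : ℝ)) := by
        rw [Finset.mul_sum]
        refine Finset.sum_congr rfl fun i _ => ?_
        rw [hpow, Real.log_exp, div_mul_div_comm]; ring_nf
    _ ≤ ∑ i ∈ RI a b, ∑ p ∈ prm (8 ^ i), 1 / (p : ℝ) := by
        refine Finset.sum_le_sum fun i hi => ?_
        apply hY
        obtain ⟨h1, h2, _⟩ := hmem i hi
        have : (Y0 : ℝ) ≤ ((8 ^ i : ℕ) : ℝ) := by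
          rw [hpow]
          have h3 := Real.add_one_le_exp (i * Real.log 8)
          linarith
        exact_mod_cast this
    _ = ∑ p ∈ (RI a b).biUnion (fun i => prm (8 ^ i)), 1 / (p : ℝ) := (Finset.sum_biUnion hdisj).symm
    _ ≤ _ := Finset.sum_le_sum_of_subset_of_nonneg hsub fun _ _ _ => by positivity

noncomputable def RIv (B N x : ℝ) (v : ℕ) : Finset ℕ := RI (N * Real.exp (-(v / x))) (B * (N * Real.exp (-(v / x))))

/-- the multiplicity -/
noncomputable def cc (B N x : ℝ) (n : ℕ) : ℝ :=
  ∑ v ∈ II x, ∑ p ∈ blk x v, if p ∣ n ∧ n / p ∈ RIv B N x v then (1 : ℝ) else 0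

lemma lamC_div {p n : ℕ} (hp : p.Prime) (hn : n ≠ 0) (h : p ∣ n) : lamC (n / p) = - lamC n := by
  obtain ⟨m, rfl⟩ := h
  rw [Nat.mul_div_cancel_left _ hp.pos]
  unfold lamC
  rw [lam_prime_mul hp (by rintro rfl; simp at hn)]
  push_cast; ring

lemma pc_sum_eq {B N x : ℝ} (hx : 0 < x) {n : ℕ} (hn : n ≠ 0) :
    ∑ v ∈ II x, pc (blk x v) (RIv B N x v) lamC n = - (lamC n * (cc B N x n : ℝ)) := by
  unfold pc cc
  push_cast
  rw [Finset.mul_sum, ← Finset.sum_neg_distrib]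
  refine Finset.sum_congr rfl fun v _ => ?_
  rw [Finset.mul_sum, ← Finset.sum_neg_distrib]
  refine Finset.sum_congr rfl fun p hp => ?_
  split_ifs with h
  · rw [lamC_div (blk_bd hx hp).1 hn h.1]; simp
  · simp

lemma om_fiber {x : ℝ} (hx : 0 < x) (n : ℕ) :
    (om (PP x) n : ℝ) = ∑ v ∈ II x, ∑ p ∈ blk x v, if p ∣ n then (1 : ℝ) else 0 := by
  rw [om_eq_sum]
  exact (Finset.sum_fiberwise_of_maps_to (fun p hp => PP_maps hx hp) _).symm

lemma cc_nonneg (B N x : ℝ) (n : ℕ) : 0 ≤ cc B N x n :=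
  Finset.sum_nonneg fun v _ => Finset.sum_nonneg fun p _ => by split_ifs <;> norm_num

lemma cc_le {B N x : ℝ} (hx : 0 < x) (n : ℕ) : cc B N x n ≤ om (PP x) n := by
  rw [om_fiber hx]
  refine Finset.sum_le_sum fun v _ => Finset.sum_le_sum fun p _ => ?_
  by_cases h : p ∣ n
  · simp only [h, true_and, if_true]; split_ifs <;> norm_num
  · simp [h]

lemma cc_eq {B N x : ℝ} (hx : 0 < x) (hN : 0 < N) (hB : 0 < B) (n : ℕ) (h1 : N * Real.exp (1 / x) ≤ n) (h2 : (n : ℝ) ≤ B * N) :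
    cc B N x n = om (PP x) n := by
  rw [om_fiber hx]
  refine Finset.sum_congr rfl fun v _ => Finset.sum_congr rfl fun p hp => ?_
  by_cases h : p ∣ n
  · obtain ⟨hpp, hp1, hp2⟩ := blk_bd hx hp
    have hp0 : (0 : ℝ) < p := by exact_mod_cast hpp.pos
    have : n / p ∈ RIv B N x v := by
      unfold RIv
      rw [mem_RI (by positivity), Nat.cast_div h hp0.ne']
      rw [le_div_iff₀ hp0, div_le_iff₀ hp0]
      constructor
      · calc N * Real.exp (-(v / x)) * p ≤ N * Real.exp (-(v / x)) * Real.exp ((v + 1) / x) := by gcongr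
          _ = N * Real.exp (1 / x) := by rw [mul_assoc, ← Real.exp_add]; ring_nf
          _ ≤ n := h1
      · calc (n : ℝ) ≤ B * N := h2
          _ = B * (N * Real.exp (-(v / x))) * Real.exp (v / x) := by
              rw [Real.exp_neg]; field_simp
          _ ≤ _ := by gcongr
    simp [h, this]
  · simp [h]

noncomputable def ee (B N x : ℝ) (n : ℕ) : ℂ :=
  (if (n : ℝ) ≤ B * N then lamC n else 0) + ((1 / WW x : ℝ) : ℂ) * ∑ v ∈ II x, pc (blk x v) (RIv B N x v) lamC n

lemma dp_add' (S : Finset ℕ) (a b : ℕ → ℂ) (ξ : ℝ) : dp S (fun n => a n + b n) ξ = dp S a ξ + dp S b ξ := by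
  unfold dp; rw [← Finset.sum_add_distrib]; refine Finset.sum_congr rfl fun n _ => by ring

lemma dp_smul' (S : Finset ℕ) (c : ℂ) (a : ℕ → ℂ) (ξ : ℝ) : dp S (fun n => c * a n) ξ = c * dp S a ξ := by
  unfold dp; rw [Finset.mul_sum]; refine Finset.sum_congr rfl fun n _ => by ring

lemma dp_sum' {ι : Type*} (I : Finset ι) (S : Finset ℕ) (a : ι → ℕ → ℂ) (ξ : ℝ) :
    dp S (fun n => ∑ i ∈ I, a i n) ξ = ∑ i ∈ I, dp S (a i) ξ := by
  unfold dp; rw [Finset.sum_comm]; refine Finset.sum_congr rfl fun n _ => by rw [Finset.sum_div, Finset.sum_mul]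

lemma RI_mem_pos {a b : ℝ} (ha : 0 < a) {m : ℕ} (h : m ∈ RI a b) : 1 ≤ m := by
  unfold RI at h
  rw [Finset.mem_Icc] at h
  have := Nat.ceil_pos.mpr ha
  omega

lemma RB_identity {B N x : ℝ} (hx : 0 < x) (hN : 0 < N) (hB : 1 ≤ B) (ξ : ℝ) :
    GG B N ξ + ((1 / WW x : ℝ) : ℂ) * ∑ v ∈ II x, Pv x v ξ * GG B (N * Real.exp (-(v / x))) ξ =
      dp (RI N (B * N * Real.exp (1 / x))) (ee B N x) ξ := by
  have he1 : 1 ≤ Real.exp (1 / x) := Real.one_le_exp (by positivity)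
  have hBN : 0 < B * N := by positivity
  unfold ee
  rw [dp_add', dp_smul', dp_sum']
  congr 1
  · unfold GG dp
    have : RI N (B * N) = (RI N (B * N * Real.exp (1 / x))).filter (fun n : ℕ => (n : ℝ) ≤ B * N) := by
      ext n
      rw [Finset.mem_filter, mem_RI hBN.le, mem_RI (by positivity)]
      constructor
      · rintro ⟨h1, h2⟩; exact ⟨⟨h1, by nlinarith⟩, h2⟩
      · rintro ⟨⟨h1, _⟩, h2⟩; exact ⟨h1, h2⟩
    rw [this, Finset.sum_filter]
    refine Finset.sum_congr rfl fun n _ => ?_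
    by_cases h : (n : ℝ) ≤ B * N <;> simp only [h, if_true, if_false, zero_div, zero_mul]
  · congr 1
    refine Finset.sum_congr rfl fun v _ => ?_
    unfold Pv GG
    apply dp_mul_prime
    · intro p hp; exact (blk_bd hx hp).1.one_lt.le
    · intro m hm; exact RI_mem_pos (by positivity) hm
    · intro p hp m hm
      obtain ⟨hpp, hp1, hp2⟩ := blk_bd hx hp
      rw [mem_RI (by positivity)] at hm ⊢
      push_cast
      constructor
      · calc N = Real.exp (v / x) * (N * Real.exp (-(v / x))) := by rw [Real.exp_neg]; field_simp
          _ ≤ _ := by gcongr; exact hm.1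
      · calc (p : ℝ) * m ≤ Real.exp ((v + 1) / x) * (B * (N * Real.exp (-(v / x)))) := by gcongr; exact hm.2
          _ = B * N * (Real.exp ((v + 1) / x) * Real.exp (-(v / x))) := by ring
          _ = _ := by rw [← Real.exp_add]; ring_nf

lemma ee_bound {B N x : ℝ} (hx : 0 < x) (hN : 0 < N) (hB : 1 ≤ B) (hW : 0 < WW x) (n : ℕ)
    (hn : n ∈ RI N (B * N * Real.exp (1 / x))) :
    ‖ee B N x n‖ ^ 2 ≤ 8 * ((if n ∈ RI N (N * Real.exp (1 / x)) then 1 else 0) +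
      (if n ∈ RI (B * N) (B * N * Real.exp (1 / x)) then 1 else 0)) + 2 / WW x ^ 2 * ((om (PP x) n : ℝ) - WW x) ^ 2 := by
  have hn1 := RI_mem_pos hN hn
  rw [mem_RI (by positivity)] at hn
  unfold ee
  rw [pc_sum_eq hx (by omega)]
  set c := cc B N x n with hc
  set o : ℝ := (om (PP x) n : ℝ) with ho
  set W := WW x with hWd
  have e1 : (if (n : ℝ) ≤ B * N then lamC n else 0) + ((1 / W : ℝ) : ℂ) * -(lamC n * (c : ℝ)) =
      lamC n * (((if (n : ℝ) ≤ B * N then 1 else 0) - c / W : ℝ) : ℂ) := by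
    split_ifs <;> push_cast <;> ring
  rw [e1, norm_mul, norm_lamC, one_mul, Complex.norm_real, Real.norm_eq_abs, sq_abs]
  have e2 : 2 / W ^ 2 * (o - W) ^ 2 = 2 * (o / W - 1) ^ 2 := by field_simp
  rw [e2]
  have hc0 : 0 ≤ c / W := div_nonneg (cc_nonneg _ _ _ _) hW.le
  have hco : c / W ≤ o / W := by gcongr; exact cc_le hx n
  by_cases hmid : N * Real.exp (1 / x) ≤ n ∧ (n : ℝ) ≤ B * N
  · have : c = o := cc_eq hx hN (by linarith) n hmid.1 hmid.2
    rw [if_pos hmid.2, this]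
    have h1 : (0 : ℝ) ≤ (if n ∈ RI N (N * Real.exp (1 / x)) then 1 else 0) := by split_ifs <;> norm_num
    have h2 : (0 : ℝ) ≤ (if n ∈ RI (B * N) (B * N * Real.exp (1 / x)) then 1 else 0) := by split_ifs <;> norm_num
    nlinarith [sq_nonneg (o / W - 1)]
  · have hs : (1 : ℝ) ≤ (if n ∈ RI N (N * Real.exp (1 / x)) then 1 else 0) +
      (if n ∈ RI (B * N) (B * N * Real.exp (1 / x)) then 1 else 0) := by
      rw [not_and_or] at hmid
      rcases hmid with h | h
      · have : n ∈ RI N (N * Real.exp (1 / x)) := by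
          rw [mem_RI (by positivity)]; exact ⟨hn.1, (not_le.mp h).le⟩
        rw [if_pos this]
        split_ifs <;> norm_num
      · have : n ∈ RI (B * N) (B * N * Real.exp (1 / x)) := by
          rw [mem_RI (by positivity)]; exact ⟨(not_le.mp h).le, hn.2⟩
        rw [if_pos this]
        split_ifs <;> norm_num
    have h3 : ((if (n : ℝ) ≤ B * N then 1 else 0) - c / W) ^ 2 ≤ 8 + 2 * (o / W - 1) ^ 2 := by
      set t := c / W
      set y := o / W
      have h4 : ((if (n : ℝ) ≤ B * N then 1 else 0) - t) ^ 2 ≤ 1 + t ^ 2 := by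
        split_ifs <;> nlinarith
      have h5 : t ^ 2 ≤ y ^ 2 := by gcongr
      nlinarith [sq_nonneg (y - 2)]
    linarith

lemma ee_sum {B N x : ℝ} (hx : 20 ≤ x) (hB : 1 ≤ B) (hW : x / 20 ≤ WW x) (hN : Real.exp (3 * Real.exp (2 * x)) ≤ N) :
    ∑ n ∈ RI N (B * N * Real.exp (1 / x)), ‖ee B N x n‖ ^ 2 / n ≤ 100 * (Real.log B + 1) / x := by
  have hx0 : 0 < x := by linarith
  have hN0 : 0 < N := (Real.exp_pos _).trans_le hN
  have hW1 : 1 ≤ WW x := by linarith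
  have hW0 : 0 < WW x := by linarith
  have hL0 : 0 ≤ Real.log B := Real.log_nonneg hB
  have he1 : 1 ≤ Real.exp (1 / x) := Real.one_le_exp (by positivity)
  have hBN : 0 < B * N := by positivity
  set S := RI N (B * N * Real.exp (1 / x)) with hS
  set S1 := RI N (N * Real.exp (1 / x)) with hS1
  set S2 := RI (B * N) (B * N * Real.exp (1 / x)) with hS2
  set Q := Real.exp (Real.exp (2 * x)) with hQ
  have hQN : Q ^ 3 ≤ N := by rw [hQ, ← Real.exp_nat_mul]; exact_mod_cast hN
  have hQx : x ≤ Q := by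
    have h1 := Real.add_one_le_exp (Real.exp (2 * x))
    have h2 := Real.add_one_le_exp (2 * x)
    linarith
  have hxN : x ≤ N := by
    calc x ≤ Q := hQx
      _ ≤ Q ^ 3 := le_self_pow₀ (by linarith) (by norm_num)
      _ ≤ N := hQN
  have hsub1 : S1 ⊆ S := by
    intro n; rw [hS1, hS, mem_RI (by positivity), mem_RI (by positivity)]
    rintro ⟨h1, h2⟩
    refine ⟨h1, h2.trans ?_⟩
    gcongr
    nlinarith
  have hsub2 : S2 ⊆ S := by
    intro n; rw [hS2, hS, mem_RI (by positivity), mem_RI (by positivity)]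
    rintro ⟨h1, h2⟩
    exact ⟨by nlinarith, h2⟩
  have hs1 : ∑ n ∈ S1, 1 / (n : ℝ) ≤ 2 / x := by
    have := harm_RI hN0 (show N ≤ N * Real.exp (1 / x) by nlinarith)
    rw [mul_div_cancel_left₀ _ hN0.ne', Real.log_exp] at this
    have h2 : 1 / N ≤ 1 / x := one_div_le_one_div_of_le hx0 hxN
    have h3 : 2 / x = 1 / x + 1 / x := by ring
    linarith
  have hs2 : ∑ n ∈ S2, 1 / (n : ℝ) ≤ 2 / x := by
    have := harm_RI hBN (show B * N ≤ B * N * Real.exp (1 / x) by nlinarith)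
    rw [mul_div_cancel_left₀ _ hBN.ne', Real.log_exp] at this
    have h2 : 1 / (B * N) ≤ 1 / x := one_div_le_one_div_of_le hx0 (by nlinarith)
    have h3 : 2 / x = 1 / x + 1 / x := by ring
    linarith
  have hTK := turan_kubilius (PP x) (fun p hp => (mem_PP.mp hp).2) N (B * N * Real.exp (1 / x)) hN0 (by nlinarith)
  have hlog : Real.log (B * N * Real.exp (1 / x) / N) = Real.log B + 1 / x := by
    rw [show B * N * Real.exp (1 / x) / N = B * Real.exp (1 / x) by field_simp, Real.log_mul (by linarith) (by positivity), Real.log_exp]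
  rw [hlog] at hTK
  change ∑ n ∈ S, ((om (PP x) n : ℝ) - WW x) ^ 2 / n ≤ WW x * _ + _ at hTK
  have hx1 : 1 / x ≤ 1 := by rw [div_le_one hx0]; linarith
  have hcard : 5 * ((PP x).card : ℝ) ^ 2 / N ≤ 5 / x := by
    have h1 := PP_card x
    rw [← hQ] at h1
    have hQ0 : 0 < Q := Real.exp_pos _
    calc 5 * ((PP x).card : ℝ) ^ 2 / N ≤ 5 * Q ^ 2 / Q ^ 3 := by gcongr
      _ = 5 / Q := by field_simp
      _ ≤ 5 / x := by gcongr
  calc ∑ n ∈ S, ‖ee B N x n‖ ^ 2 / n ≤ ∑ n ∈ S, (8 * ((if n ∈ S1 then 1 / (n : ℝ) else 0) + (if n ∈ S2 then 1 / (n : ℝ) else 0)) +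
        2 / WW x ^ 2 * (((om (PP x) n : ℝ) - WW x) ^ 2 / n)) := by
        refine Finset.sum_le_sum fun n hn => ?_
        have := ee_bound hx0 hN0 hB hW0 n hn
        calc _ ≤ (8 * ((if n ∈ S1 then 1 else 0) + (if n ∈ S2 then 1 else 0)) + 2 / WW x ^ 2 * ((om (PP x) n : ℝ) - WW x) ^ 2) / n := by
              gcongr
          _ = _ := by split_ifs <;> ring
    _ = 8 * (∑ n ∈ S1, 1 / (n : ℝ) + ∑ n ∈ S2, 1 / (n : ℝ)) + 2 / WW x ^ 2 * ∑ n ∈ S, ((om (PP x) n : ℝ) - WW x) ^ 2 / n := by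
        rw [Finset.sum_add_distrib, ← Finset.mul_sum, ← Finset.mul_sum, Finset.sum_add_distrib, Finset.sum_ite_mem, Finset.sum_ite_mem,
          Finset.inter_eq_right.mpr hsub1, Finset.inter_eq_right.mpr hsub2]
    _ ≤ 8 * (2 / x + 2 / x) + 2 / WW x ^ 2 * (WW x * (Real.log B + 1 / x) + 5 / x) := by
        gcongr
        linarith
    _ = 32 / x + 2 * (Real.log B + 1 / x) * (1 / WW x) + 10 / x * (1 / WW x) ^ 2 := by field_simp; ring
    _ ≤ 32 / x + 2 * (Real.log B + 1) * (20 / x) + 10 / x * 1 ^ 2 := by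
        have h1 : 1 / WW x ≤ 20 / x := by
          rw [div_le_div_iff₀ hW0 hx0]; linarith
        have h2 : 1 / WW x ≤ 1 := by rw [div_le_one hW0]; exact hW1
        gcongr
    _ ≤ _ := by
        rw [show 32 / x + 2 * (Real.log B + 1) * (20 / x) + 10 / x * 1 ^ 2 = (42 + 40 * (Real.log B + 1)) / x by ring]
        gcongr
        linarith

lemma continuous_GG (B M : ℝ) : Continuous (GG B M) := continuous_dp _ _
lemma continuous_Pv (x : ℝ) (v : ℕ) : Continuous (Pv x v) := continuous_dp _ _

/-- continuous and bounded -/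
def CB {F : Type*} [NormedRing F] (f : ℝ → F) : Prop := Continuous f ∧ ∃ C, ∀ x, ‖f x‖ ≤ C

lemma CB.mul {F : Type*} [NormedRing F] {f g : ℝ → F} (hf : CB f) (hg : CB g) : CB (fun x => f x * g x) := by
  obtain ⟨hf, C, hC⟩ := hf
  obtain ⟨hg, D, hD⟩ := hg
  refine ⟨hf.mul hg, C * D, fun x => (norm_mul_le _ _).trans ?_⟩
  have := (norm_nonneg _).trans (hC x)
  exact mul_le_mul (hC x) (hD x) (norm_nonneg _) this

lemma CB.add {F : Type*} [NormedRing F] {f g : ℝ → F} (hf : CB f) (hg : CB g) : CB (fun x => f x + g x) := by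
  obtain ⟨hf, C, hC⟩ := hf
  obtain ⟨hg, D, hD⟩ := hg
  exact ⟨hf.add hg, C + D, fun x => (norm_add_le _ _).trans (add_le_add (hC x) (hD x))⟩

lemma CB.const {F : Type*} [NormedRing F] (c : F) : CB (fun _ => c) := ⟨continuous_const, ‖c‖, fun _ => le_rfl⟩

lemma CB.sub {F : Type*} [NormedRing F] {f g : ℝ → F} (hf : CB f) (hg : CB g) : CB (fun x => f x - g x) := by
  obtain ⟨hf, C, hC⟩ := hf
  obtain ⟨hg, D, hD⟩ := hg
  exact ⟨hf.sub hg, C + D, fun x => (norm_sub_le _ _).trans (add_le_add (hC x) (hD x))⟩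

lemma CB.pow {F : Type*} [NormedRing F] {f : ℝ → F} (hf : CB f) (n : ℕ) : CB (fun x => f x ^ n) := by
  induction n with
  | zero => simpa using CB.const (1 : F)
  | succ n ih => simpa only [pow_succ] using ih.mul hf

lemma CB.sum {F : Type*} [NormedRing F] {ι : Type*} (I : Finset ι) {f : ι → ℝ → F} (hf : ∀ i ∈ I, CB (f i)) :
    CB (fun x => ∑ i ∈ I, f i x) := by
  induction I using Finset.induction_on with
  | empty => simpa using CB.const (0 : F)
  | insert a s ha ih =>
    simp_rw [Finset.sum_insert ha]
    exact (hf a (Finset.mem_insert_self _ _)).add (ih fun i hi => hf i (Finset.mem_insert_of_mem hi))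

lemma CB.norm {f : ℝ → ℂ} (hf : CB f) : CB (fun x => ‖f x‖) := by
  obtain ⟨hf, C, hC⟩ := hf
  exact ⟨hf.norm, C, fun x => by simpa using hC x⟩

lemma CB_dp (S : Finset ℕ) (a : ℕ → ℂ) : CB (dp S a) := ⟨continuous_dp _ _, _, norm_dp_le S a⟩
lemma CB_GG (B M : ℝ) : CB (GG B M) := CB_dp _ _
lemma CB_Pv (x : ℝ) (v : ℕ) : CB (Pv x v) := CB_dp _ _

lemma CB.int {F : Type*} [NormedRing F] [SecondCountableTopology F] {f : ℝ → F} (hf : CB f) (μ : Measure ℝ) [IsFiniteMeasure μ] : Integrable f μ := by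
  obtain ⟨hf, C, hC⟩ := hf
  exact integrable_of_cont_bdd hf hC

lemma RB_bound {B N x T K : ℝ} (hx : 20 ≤ x) (hB : 1 ≤ B) (hW : x / 20 ≤ WW x) (hN : Real.exp (3 * Real.exp (2 * x)) ≤ N)
    (hT : 0 < T) (hTN : T ≤ N) (E : Set ℝ)
    (hK : ∀ v ∈ II x, ∫ ξ in E, ‖Pv x v ξ‖ ^ 2 * ‖GG B (N * Real.exp (-(v / x))) ξ‖ ^ 2 ∂muT T ≤ K) :
    ∫ ξ in E, ‖GG B N ξ‖ ^ 2 ∂muT T ≤ 600 * (Real.log B + 1) / x + 2 * ((II x).card : ℝ) ^ 2 * K := by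
  have := muT_finite hT
  have hx0 : 0 < x := by linarith
  have hN0 : 0 < N := (Real.exp_pos _).trans_le hN
  have hW1 : 1 ≤ WW x := by linarith
  set D := dp (RI N (B * N * Real.exp (1 / x))) (ee B N x) with hD
  set F : ℕ → ℝ → ℂ := fun v => GG B (N * Real.exp (-(v / x))) with hF
  have hpt : ∀ ξ, ‖GG B N ξ‖ ^ 2 ≤ 2 * ‖D ξ‖ ^ 2 + 2 * (II x).card * ∑ v ∈ II x, ‖Pv x v ξ‖ ^ 2 * ‖F v ξ‖ ^ 2 := by
    intro ξ
    have h := RB_identity hx0 hN0 hB ξ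
    set Z := ∑ v ∈ II x, Pv x v ξ * GG B (N * Real.exp (-(v / x))) ξ with hZ
    have hG : GG B N ξ = D ξ - ((1 / WW x : ℝ) : ℂ) * Z := by rw [hD, ← h]; ring
    have h1 : ‖((1 / WW x : ℝ) : ℂ) * Z‖ ≤ ‖Z‖ := by
      rw [norm_mul, Complex.norm_real, Real.norm_eq_abs, abs_of_nonneg (by positivity)]
      have : 1 / WW x ≤ 1 := by rw [div_le_one (by linarith)]; exact hW1
      have := mul_le_mul_of_nonneg_right this (norm_nonneg Z)
      linarith
    have h2 : ‖GG B N ξ‖ ≤ ‖D ξ‖ + ‖Z‖ := by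
      rw [hG]; exact (norm_sub_le _ _).trans (by linarith)
    have h3 : ‖Z‖ ^ 2 ≤ (II x).card * ∑ v ∈ II x, ‖Pv x v ξ‖ ^ 2 * ‖F v ξ‖ ^ 2 := by
      calc ‖Z‖ ^ 2 ≤ (∑ v ∈ II x, ‖Pv x v ξ * F v ξ‖) ^ 2 := by gcongr; exact norm_sum_le _ _
        _ ≤ (II x).card * ∑ v ∈ II x, ‖Pv x v ξ * F v ξ‖ ^ 2 := sq_sum_le_card_mul_sum_sq
        _ = _ := by simp_rw [norm_mul, mul_pow]
    have h4 : ‖GG B N ξ‖ ^ 2 ≤ (‖D ξ‖ + ‖Z‖) ^ 2 := by gcongr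
    nlinarith [sq_nonneg (‖D ξ‖ - ‖Z‖)]
  have cbD : CB (fun ξ => ‖D ξ‖ ^ 2) := (CB_dp _ _).norm.pow 2
  have cbv : ∀ v, CB (fun ξ => ‖Pv x v ξ‖ ^ 2 * ‖F v ξ‖ ^ 2) := fun v => ((CB_Pv x v).norm.pow 2).mul ((CB_GG _ _).norm.pow 2)
  have cbs : CB (fun ξ => ∑ v ∈ II x, ‖Pv x v ξ‖ ^ 2 * ‖F v ξ‖ ^ 2) := CB.sum _ fun v _ => cbv v
  have hDint : ∫ ξ in E, ‖D ξ‖ ^ 2 ∂muT T ≤ 300 * (Real.log B + 1) / x := by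
    calc _ ≤ ∫ ξ, ‖D ξ‖ ^ 2 ∂muT T := setIntegral_le_integral (cbD.int _) (Eventually.of_forall fun ξ => by positivity)
      _ ≤ 3 * ∑ n ∈ RI N (B * N * Real.exp (1 / x)), ‖ee B N x n‖ ^ 2 / n := by
          apply dp_mv hT
          · intro n hn; exact RI_mem_pos hN0 hn
          · intro n hn; rw [mem_RI (by positivity)] at hn; linarith [hn.1]
      _ ≤ 3 * (100 * (Real.log B + 1) / x) := by gcongr; exact ee_sum hx hB hW hN
      _ = _ := by ring
  calc ∫ ξ in E, ‖GG B N ξ‖ ^ 2 ∂muT T ≤ ∫ ξ in E, (2 * ‖D ξ‖ ^ 2 + 2 * (II x).card * ∑ v ∈ II x, ‖Pv x v ξ‖ ^ 2 * ‖F v ξ‖ ^ 2) ∂muT T := by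
        refine integral_mono ?_ ?_ hpt
        · exact ((CB_GG _ _).norm.pow 2).int _
        · exact (((CB.const (2 : ℝ)).mul cbD).add ((CB.const (2 * ((II x).card : ℝ))).mul cbs)).int _
    _ = 2 * ∫ ξ in E, ‖D ξ‖ ^ 2 ∂muT T + 2 * (II x).card * ∑ v ∈ II x, ∫ ξ in E, ‖Pv x v ξ‖ ^ 2 * ‖F v ξ‖ ^ 2 ∂muT T := by
        rw [integral_add, integral_const_mul, integral_const_mul, integral_finsetSum]
        · intro v _; exact (cbv v).int _
        · exact ((CB.const (2 : ℝ)).mul cbD).int _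
        · exact ((CB.const (2 * ((II x).card : ℝ))).mul cbs).int _
    _ ≤ 2 * (300 * (Real.log B + 1) / x) + 2 * (II x).card * ∑ v ∈ II x, K := by
        gcongr with v hv
        exact hK v hv
    _ = _ := by rw [Finset.sum_const, nsmul_eq_mul]; ring

def SS (x α : ℝ) : Set ℝ := {ξ | ∃ v ∈ II x, Real.exp (-(α * (v / x))) < ‖Pv x v ξ‖}

lemma SS_meas (x α : ℝ) : MeasurableSet (SS x α) := by
  have : SS x α = ⋃ v ∈ II x, {ξ | Real.exp (-(α * (v / x))) < ‖Pv x v ξ‖} := by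
    ext ξ; simp [SS]
  rw [this]
  refine Finset.measurableSet_biUnion _ fun v _ => ?_
  exact measurableSet_lt measurable_const (continuous_Pv x v).norm.measurable

lemma not_SS {x α ξ : ℝ} (h : ξ ∉ SS x α) {v : ℕ} (hv : v ∈ II x) : ‖Pv x v ξ‖ ≤ Real.exp (-(α * (v / x))) := by
  by_contra h2
  exact h ⟨v, hv, not_le.mp h2⟩

lemma exp_quad {y : ℝ} (hy : 0 ≤ y) : y ^ 2 / 2 ≤ Real.exp y := by
  have := Real.quadratic_le_exp_of_nonneg hy; linarith

lemma GG_mv {B M T : ℝ} (hB : 1 ≤ B) (hM : 0 < M) (hT : 0 < T) (hTM : T ≤ M) :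
    ∫ ξ, ‖GG B M ξ‖ ^ 2 ∂muT T ≤ 3 * (1 + Real.log B) := by
  have hBM : M ≤ B * M := by nlinarith
  calc _ ≤ 3 * ∑ n ∈ RI M (B * M), ‖lamC n‖ ^ 2 / n := by
        apply dp_mv hT
        · intro n hn; exact RI_mem_pos hM hn
        · intro n hn; rw [mem_RI (by linarith)] at hn; linarith [hn.1]
    _ = 3 * ∑ n ∈ RI M (B * M), 1 / (n : ℝ) := by simp_rw [norm_lamC, one_pow]
    _ ≤ _ := by
        have := harm_RI_one hM hBM
        rw [mul_div_cancel_right₀ _ hM.ne'] at this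
        gcongr

lemma step1 {x α B T N : ℝ} (hx : 100 ≤ x) (hW : x / 20 ≤ WW x) (hα : Real.exp (-(x / 2)) ≤ α) (hB : 1 ≤ B) (hT : 0 < T)
    (hTN : T * Real.exp (Real.exp (2 * x)) ≤ N) (hN : Real.exp (3 * Real.exp (2 * x)) ≤ N) :
    ∫ ξ in (SS x α)ᶜ, ‖GG B N ξ‖ ^ 2 ∂muT T ≤ 700 * (Real.log B + 1) / x := by
  have := muT_finite hT
  have hx0 : 0 < x := by linarith
  have hN0 : 0 < N := (Real.exp_pos _).trans_le hN
  have hα0 : 0 < α := (Real.exp_pos _).trans_le hα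
  have hL0 : 0 ≤ Real.log B := Real.log_nonneg hB
  have hq1 : 1 ≤ Real.exp (Real.exp (2 * x)) := Real.one_le_exp (Real.exp_pos _).le
  have hTN' : T ≤ N := by nlinarith
  set y := Real.exp (x / 2) with hy
  have hy0 : 0 < y := Real.exp_pos _
  have hyx : x ^ 2 / 8 ≤ y := by have := exp_quad (show 0 ≤ x / 2 by linarith); linarith
  have hex : Real.exp x = y ^ 2 := by rw [hy, ← Real.exp_nat_mul]; ring_nf
  have h := RB_bound (K := Real.exp (-y) * (3 * (1 + Real.log B))) (by linarith) hB hW hN hT hTN' (SS x α)ᶜ ?_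
  · refine h.trans ?_
    have hc := II_card (show 1 ≤ x by linarith)
    have h1 : x ^ 3 * Real.exp (4 * x) * Real.exp (-y) ≤ 1 := by
      have h2 : x ^ 3 ≤ Real.exp (3 * x) := by
        have := Real.add_one_le_exp x
        calc x ^ 3 ≤ Real.exp x ^ 3 := by gcongr; linarith
          _ = _ := by rw [← Real.exp_nat_mul]; norm_num
      calc _ ≤ Real.exp (3 * x) * Real.exp (4 * x) * Real.exp (-y) := by gcongr
        _ = Real.exp (7 * x - y) := by rw [← Real.exp_add, ← Real.exp_add]; ring_nf
        _ ≤ 1 := Real.exp_le_one_iff.mpr (by nlinarith)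
    have h3 : 2 * ((II x).card : ℝ) ^ 2 * (Real.exp (-y) * (3 * (1 + Real.log B))) ≤ 100 * (Real.log B + 1) / x := by
      calc _ ≤ 2 * (2 * x * Real.exp (2 * x)) ^ 2 * (Real.exp (-y) * (3 * (1 + Real.log B))) := by gcongr
        _ = 24 * (x ^ 3 * (Real.exp (2 * x)) ^ 2 * Real.exp (-y)) * (1 + Real.log B) / x := by field_simp; ring
        _ = 24 * (x ^ 3 * Real.exp (4 * x) * Real.exp (-y)) * (1 + Real.log B) / x := by
            rw [← Real.exp_nat_mul]; ring_nf
        _ ≤ 24 * 1 * (1 + Real.log B) / x := by gcongr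
        _ ≤ _ := div_le_div_of_nonneg_right (by linarith) hx0.le
    calc _ ≤ 600 * (Real.log B + 1) / x + 100 * (Real.log B + 1) / x := by gcongr
      _ = _ := by ring
  · intro v hv
    obtain ⟨hv1, hv2⟩ := II_bd hx0 hv
    have hM0 : 0 < N * Real.exp (-(v / x)) := by positivity
    have hTM : T ≤ N * Real.exp (-(v / x)) := by
      rw [Real.exp_neg, ← div_eq_mul_inv, le_div_iff₀ (Real.exp_pos _)]
      refine le_trans ?_ hTN
      gcongr
    have hmv := GG_mv hB hM0 hT hTM
    have cb := ((CB_GG B (N * Real.exp (-(v / x)))).norm.pow 2)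
    have cbP := ((CB_Pv x v).norm.pow 2)
    have hexp : 2 * (α * (v / x)) ≥ y := by
      have h1x : 1 / x ≤ 1 := by rw [div_le_one hx0]; linarith
      have hvx : y ^ 2 / 2 ≤ v / x := by rw [← hex]; nlinarith [Real.add_one_le_exp x]
      have hαy : 1 ≤ α * y := by
        calc (1 : ℝ) = Real.exp (-(x / 2)) * y := by rw [hy, ← Real.exp_add]; simp
          _ ≤ _ := by gcongr
      have : α * (y ^ 2 / 2) ≤ α * (v / x) := by gcongr
      nlinarith
    calc _ ≤ ∫ ξ in (SS x α)ᶜ, Real.exp (-y) * ‖GG B (N * Real.exp (-(v / x))) ξ‖ ^ 2 ∂muT T := by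
          refine setIntegral_mono_on ((cbP.mul cb).int _) (((CB.const _).mul cb).int _) (SS_meas x α).compl fun ξ hξ => ?_
          gcongr
          calc ‖Pv x v ξ‖ ^ 2 ≤ Real.exp (-(α * (v / x))) ^ 2 := by gcongr; exact not_SS hξ hv
            _ = Real.exp (-(2 * (α * (v / x)))) := by rw [← Real.exp_nat_mul]; push_cast; ring_nf
            _ ≤ _ := Real.exp_le_exp.mpr (by linarith)
      _ ≤ ∫ ξ, Real.exp (-y) * ‖GG B (N * Real.exp (-(v / x))) ξ‖ ^ 2 ∂muT T :=
          setIntegral_le_integral (((CB.const _).mul cb).int _) (Eventually.of_forall fun ξ => by positivity)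
      _ ≤ _ := by rw [integral_const_mul]; gcongr

/-- factorial growth -/
lemma four_fact (l : ℕ) (hl : 1 ≤ l) : (4 : ℝ) ^ l * (Nat.factorial (2 * l)) ≤ Real.exp (2 * l * Real.log (4 * l)) := by
  have hl0 : (0 : ℝ) < l := by exact_mod_cast hl
  have h1 : ((Nat.factorial (2 * l) : ℕ) : ℝ) ≤ (2 * l : ℝ) ^ (2 * l) := by exact_mod_cast Nat.factorial_le_pow (2 * l)
  calc (4 : ℝ) ^ l * (Nat.factorial (2 * l)) ≤ 4 ^ l * (2 * l : ℝ) ^ (2 * l) := by gcongr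
    _ = (4 * l : ℝ) ^ (2 * l) := by
        rw [show (4 : ℝ) ^ l = 2 ^ (2 * l) by rw [pow_mul]; norm_num, ← mul_pow]; ring_nf
    _ = _ := by
        rw [mul_comm (2 * (l : ℝ)), Real.exp_mul, Real.exp_log (by positivity)]
        rw [← Real.rpow_natCast]; push_cast; rfl

set_option maxHeartbeats 1000000 in
lemma step_num {x α α' V U L : ℝ} (hx : 20000 ≤ x) (hα0 : 0 ≤ α) (hα1 : α ≤ 1) (hgap : α + Real.exp (-(x / 2)) ≤ α') (hL : 0 ≤ L)
    (hU1 : Real.exp x - 1 / x ≤ U) (hU2 : U ≤ Real.exp (2 * x)) (hV1 : Real.exp (4 * x) - 1 ≤ V) (hV2 : V ≤ Real.exp (8 * x))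
    (l : ℕ) (hl : l = ⌈V / U⌉₊) :
    Real.exp (-(2 * (α' * V))) * Real.exp (2 * l * (α * U)) * (3 * Real.exp 2 * 4 ^ l * (Nat.factorial (2 * l)) * (1 + L + l * (1 / x))) ≤
      (1 + L) * Real.exp (-Real.exp (2 * x)) := by
  have hx0 : 0 < x := by linarith
  set y := Real.exp (x / 2) with hy
  have hy0 : 0 < y := Real.exp_pos _
  have hyx : x ^ 2 / 8 ≤ y := by have := exp_quad (show 0 ≤ x / 2 by linarith); linarith
  have hyx2 : 1000 * x ≤ y := by nlinarith
  have hy1 : 1000 ≤ y := by nlinarith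
  have hex : Real.exp x = y ^ 2 := by rw [hy, ← Real.exp_nat_mul]; ring_nf
  have he2 : Real.exp (2 * x) = y ^ 4 := by rw [hy, ← Real.exp_nat_mul]; ring_nf
  have he4 : Real.exp (4 * x) = y ^ 8 := by rw [hy, ← Real.exp_nat_mul]; ring_nf
  have he8 : Real.exp (8 * x) = y ^ 16 := by rw [hy, ← Real.exp_nat_mul]; ring_nf
  have hem : Real.exp (-(x / 2)) = 1 / y := by rw [Real.exp_neg, hy]; ring
  have hlogy : Real.log y = x / 2 := Real.log_exp _
  rw [hex] at hU1; rw [he2] at hU2 ⊢; rw [he4] at hV1; rw [he8] at hV2; rw [hem] at hgap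
  clear_value y
  have h1x : 1 / x ≤ 1 := by rw [div_le_one hx0]; linarith
  have hy2 : 1000 ≤ y ^ 2 := by nlinarith
  have hUlow : y ^ 2 / 2 ≤ U := by linarith
  have hU0 : 0 < U := by linarith
  have hy7 : 1 ≤ y ^ 7 := one_le_pow₀ (by linarith)
  have hy8 : y ^ 8 = y * y ^ 7 := by ring
  have hVlow : y ^ 8 / 2 ≤ V := by nlinarith
  have hV0 : 0 < V := by nlinarith
  have hl1 : 1 ≤ l := by rw [hl]; exact Nat.one_le_iff_ne_zero.mpr (Nat.ceil_pos.mpr (by positivity)).ne'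
  have hl1' : (1 : ℝ) ≤ l := by exact_mod_cast hl1
  have hlle : (l : ℝ) ≤ V / U + 1 := by rw [hl]; exact (Nat.ceil_lt_add_one (by positivity)).le
  have hlU : l * U ≤ V + U := by
    calc l * U ≤ (V / U + 1) * U := by gcongr
      _ = _ := by field_simp
  have hVU : V / U ≤ 2 * V / y ^ 2 := by
    rw [div_le_div_iff₀ hU0 (by positivity)]; nlinarith
  have hVy2 : 1 ≤ V / y ^ 2 := by
    rw [le_div_iff₀ (by positivity), one_mul]
    have : y ^ 8 = y ^ 2 * y ^ 6 := by ring
    have h6 : 2 ≤ y ^ 6 := by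
      calc (2 : ℝ) ≤ y := by linarith
        _ ≤ y ^ 6 := le_self_pow₀ (by linarith) (by norm_num)
    rw [this] at hVlow
    have : y ^ 2 * 2 ≤ y ^ 2 * y ^ 6 := by gcongr
    linarith
  have hl3 : (l : ℝ) ≤ 3 * (V / y ^ 2) := by
    have : 2 * V / y ^ 2 = 2 * (V / y ^ 2) := by ring
    linarith
  have hlog : Real.log (4 * l) ≤ 8 * x := by
    have h1 : (4 * l : ℝ) ≤ y ^ 16 := by
      have : V / y ^ 2 ≤ y ^ 14 := by
        rw [div_le_iff₀ (by positivity)]; calc V ≤ y ^ 16 := hV2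
          _ = _ := by ring
      have h14 : y ^ 16 = y ^ 2 * y ^ 14 := by ring
      have : 0 < y ^ 14 := by positivity
      nlinarith
    calc Real.log (4 * l) ≤ Real.log (y ^ 16) := Real.log_le_log (by positivity) h1
      _ = 8 * x := by rw [Real.log_pow, hlogy]; push_cast; ring
  have hexp : -(2 * (α' * V)) + 2 * l * (α * U) + 4 + 2 * l * Real.log (4 * l) + l ≤ -y ^ 4 := by
    have a1 : l * (α * U) ≤ α * V + U := by
      calc l * (α * U) = α * (l * U) := by ring
        _ ≤ α * (V + U) := by gcongr
        _ ≤ α * V + U := by nlinarith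
    have a2 : (α + 1 / y) * V ≤ α' * V := by gcongr
    have a3 : 2 * l * Real.log (4 * l) + l ≤ 17 * x * l := by
      have : l * Real.log (4 * l) ≤ l * (8 * x) := by gcongr
      nlinarith
    have a4 : 17 * x * l ≤ V / (2 * y) := by
      calc 17 * x * l ≤ 17 * x * (3 * (V / y ^ 2)) := by gcongr
        _ = (51 * x) * (V / y ^ 2) := by ring
        _ ≤ (y / 2) * (V / y ^ 2) := by gcongr; linarith
        _ = _ := by field_simp
    have a5 : y ^ 7 / 2 ≤ V / y := by
      rw [le_div_iff₀ hy0]; calc y ^ 7 / 2 * y = y ^ 8 / 2 := by ring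
        _ ≤ V := hVlow
    have a6 : V / (2 * y) = (V / y) / 2 := by ring
    have a7 : (α + 1 / y) * V = α * V + V / y := by ring
    have a8 : y ^ 7 = y ^ 3 * y ^ 4 := by ring
    have a9 : 1000 ≤ y ^ 3 := by
      calc (1000 : ℝ) ≤ y := hy1
        _ ≤ y ^ 3 := le_self_pow₀ (by linarith) (by norm_num)
    have a10 : 1 ≤ y ^ 4 := one_le_pow₀ (by linarith)
    have a11 : 1000 * y ^ 4 ≤ y ^ 7 := by rw [a8]; gcongr
    linarith
  have hfac := four_fact l hl1
  have h3e : 3 * Real.exp 2 ≤ Real.exp 4 := by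
    rw [show (4 : ℝ) = 2 + 2 by norm_num, Real.exp_add]
    have := Real.add_one_le_exp 2
    nlinarith [Real.exp_pos 2]
  have hlin : 1 + L + l * (1 / x) ≤ (1 + L) * Real.exp l := by
    have := Real.add_one_le_exp (l : ℝ)
    have : l * (1 / x) ≤ l * 1 := by gcongr
    nlinarith
  calc _ = Real.exp (-(2 * (α' * V))) * Real.exp (2 * l * (α * U)) * ((3 * Real.exp 2) * (4 ^ l * (Nat.factorial (2 * l))) * (1 + L + l * (1 / x))) := by ring
    _ ≤ Real.exp (-(2 * (α' * V))) * Real.exp (2 * l * (α * U)) * (Real.exp 4 * Real.exp (2 * l * Real.log (4 * l)) * ((1 + L) * Real.exp l)) := by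
        gcongr
    _ = (1 + L) * Real.exp (-(2 * (α' * V)) + 2 * l * (α * U) + 4 + 2 * l * Real.log (4 * l) + l) := by
        simp only [Real.exp_add]; ring
    _ ≤ _ := by gcongr

lemma step_term {x α α' B T N : ℝ} (hx : 20000 ≤ x) (hα0 : 0 ≤ α) (hα1 : α ≤ 1) (hgap : α + Real.exp (-(x / 2)) ≤ α')
    (hB : 1 ≤ B) (hT : 0 < T) (hTN : T ≤ N) (v u : ℕ) (hv : v ∈ II (4 * x)) (hu : u ∈ II x) (l : ℕ)
    (hl : l = ⌈(v / (4 * x) : ℝ) / (u / x)⌉₊) :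
    ∫ ξ, (Real.exp (-(2 * (α' * (v / (4 * x))))) * Real.exp (2 * l * (α * (u / x)))) * (‖Pv x u ξ‖ ^ (2 * l) * ‖GG B (N * Real.exp (-(v / (4 * x)))) ξ‖ ^ 2) ∂muT T ≤
      (1 + Real.log B) * Real.exp (-Real.exp (2 * x)) := by
  have hx0 : 0 < x := by linarith
  have hN0 : 0 < N := by linarith
  obtain ⟨hu1, hu2⟩ := II_bd hx0 hu
  obtain ⟨hv1, hv2⟩ := II_bd (show 0 < 4 * x by linarith) hv
  rw [show 2 * (4 * x) = 8 * x by ring] at hv2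
  have h1x : 1 / x ≤ 1 := by rw [div_le_one hx0]; linarith
  have h4x : 1 / (4 * x) ≤ 1 := by rw [div_le_one (by linarith)]; linarith
  set U : ℝ := u / x with hU
  set V : ℝ := v / (4 * x) with hV
  have hex := Real.add_one_le_exp x
  have hU0 : 0 < U := by linarith
  have hL0 : 0 ≤ Real.log B := Real.log_nonneg hB
  have hM0 : 0 < N * Real.exp (-V) := by positivity
  have hVl : V ≤ l * U := by
    have : V / U ≤ l := by rw [hl]; exact Nat.le_ceil _
    rwa [div_le_iff₀ hU0] at this
  have hU' : ((u : ℝ) + 1) / x = U + 1 / x := by rw [hU]; ring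
  have hm := moment_bound T hT (blk x u) (fun p hp => (blk_bd hx0 hp).1) (blk_sum (by linarith) u)
    (Real.exp U) (Real.exp (U + 1 / x)) (N * Real.exp (-V)) (B * (N * Real.exp (-V)))
    (Real.one_le_exp hU0.le) (Real.exp_le_exp.mpr (by have : 0 < 1 / x := by positivity
                                                      linarith)) hM0 (by nlinarith)
    (fun p hp => by rw [← hU']; exact (blk_bd hx0 hp).2) lamC (fun n => (norm_lamC n).le) l
    (by
      rw [← Real.exp_nat_mul, mul_assoc, ← Real.exp_add]
      calc T ≤ N * 1 := by linarith
        _ ≤ _ := by gcongr; exact Real.one_le_exp (by linarith))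
  rw [integral_const_mul]
  have hlb : Real.log (B * (N * Real.exp (-V)) / (N * Real.exp (-V))) = Real.log B := by
    rw [mul_div_cancel_right₀ _ hM0.ne']
  have hle : Real.log (Real.exp (U + 1 / x) / Real.exp U) = 1 / x := by
    rw [← Real.exp_sub, Real.log_exp]; ring
  rw [hlb, hle] at hm
  refine le_trans ?_ (step_num hx hα0 hα1 hgap hL0 hu1 hu2 (by linarith) hv2 l hl)
  gcongr
  exact hm

lemma step {x α α' B T N : ℝ} (hx : 20000 ≤ x) (hW : (4 * x) / 20 ≤ WW (4 * x)) (hα0 : 0 ≤ α) (hα1 : α ≤ 1)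
    (hgap : α + Real.exp (-(x / 2)) ≤ α')
    (hB : 1 ≤ B) (hT : 0 < T) (hTN : T ≤ N) (hN : Real.exp (3 * Real.exp (2 * (4 * x))) ≤ N) :
    ∫ ξ in SS x α ∩ (SS (4 * x) α')ᶜ, ‖GG B N ξ‖ ^ 2 ∂muT T ≤ 700 * (Real.log B + 1) / (4 * x) := by
  have := muT_finite hT
  have hx0 : 0 < x := by linarith
  have hN0 : 0 < N := (Real.exp_pos _).trans_le hN
  have hL0 : 0 ≤ Real.log B := Real.log_nonneg hB
  have hmeas : MeasurableSet (SS x α ∩ (SS (4 * x) α')ᶜ) := (SS_meas _ _).inter (SS_meas _ _).compl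
  have h := RB_bound (K := (II x).card * ((1 + Real.log B) * Real.exp (-Real.exp (2 * x)))) (by linarith) hB hW hN hT hTN (SS x α ∩ (SS (4 * x) α')ᶜ) ?_
  · refine h.trans ?_
    have hc := II_card (show 1 ≤ x by linarith)
    have hc' := II_card (show 1 ≤ 4 * x by linarith)
    rw [show 2 * (4 * x) = 8 * x by ring] at hc'
    have h1 : 11 * x ^ 4 * Real.exp (18 * x) * Real.exp (-Real.exp (2 * x)) ≤ 1 := by
      have h2 : x ^ 4 ≤ Real.exp (4 * x) := by
        have := Real.add_one_le_exp x
        calc x ^ 4 ≤ Real.exp x ^ 4 := by gcongr; linarith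
          _ = _ := by rw [← Real.exp_nat_mul]; norm_num
      have h11 : (11 : ℝ) ≤ Real.exp 10 := by have := Real.add_one_le_exp 10; linarith
      calc _ ≤ Real.exp 10 * Real.exp (4 * x) * Real.exp (18 * x) * Real.exp (-Real.exp (2 * x)) := by gcongr
        _ = Real.exp (10 + 22 * x - Real.exp (2 * x)) := by simp only [← Real.exp_add]; ring_nf
        _ ≤ 1 := Real.exp_le_one_iff.mpr (by
            have := exp_quad (show 0 ≤ 2 * x by linarith); nlinarith)
    have h3 : 2 * ((II (4 * x)).card : ℝ) ^ 2 * ((II x).card * ((1 + Real.log B) * Real.exp (-Real.exp (2 * x)))) ≤ 100 * (Real.log B + 1) / (4 * x) := by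
      calc _ ≤ 2 * (8 * x * Real.exp (8 * x)) ^ 2 * ((2 * x * Real.exp (2 * x)) * ((1 + Real.log B) * Real.exp (-Real.exp (2 * x)))) := by gcongr
        _ = 1024 * (x ^ 4 * (Real.exp (8 * x) ^ 2 * Real.exp (2 * x)) * Real.exp (-Real.exp (2 * x))) * (1 + Real.log B) / (4 * x) := by field_simp; ring
        _ = 1024 / 11 * (11 * x ^ 4 * Real.exp (18 * x) * Real.exp (-Real.exp (2 * x))) * (1 + Real.log B) / (4 * x) := by
            rw [← Real.exp_nat_mul, ← Real.exp_add]; ring_nf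
        _ ≤ 1024 / 11 * 1 * (1 + Real.log B) / (4 * x) := by gcongr
        _ ≤ _ := div_le_div_of_nonneg_right (by linarith) (by linarith)
    calc _ ≤ 600 * (Real.log B + 1) / (4 * x) + 100 * (Real.log B + 1) / (4 * x) := by gcongr
      _ = _ := by ring
  · intro v hv
    set M := N * Real.exp (-(v / (4 * x))) with hM
    set lu : ℕ → ℕ := fun u => ⌈(v / (4 * x) : ℝ) / (u / x)⌉₊ with hlu
    set F : ℕ → ℝ → ℝ := fun u ξ => (Real.exp (-(2 * (α' * (v / (4 * x))))) * Real.exp (2 * lu u * (α * (u / x)))) * (‖Pv x u ξ‖ ^ (2 * lu u) * ‖GG B M ξ‖ ^ 2) with hF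
    have cbF : ∀ u, CB (F u) := fun u => (CB.const _).mul (((CB_Pv x u).norm.pow _).mul ((CB_GG B M).norm.pow 2))
    have cbP : CB (fun ξ => ‖Pv (4 * x) v ξ‖ ^ 2 * ‖GG B M ξ‖ ^ 2) := ((CB_Pv _ v).norm.pow 2).mul ((CB_GG B M).norm.pow 2)
    have hF0 : ∀ u ξ, 0 ≤ F u ξ := fun u ξ => by rw [hF]; positivity
    calc _ ≤ ∫ ξ in SS x α ∩ (SS (4 * x) α')ᶜ, ∑ u ∈ II x, F u ξ ∂muT T := by
          refine setIntegral_mono_on (cbP.int _) ((CB.sum _ fun u _ => cbF u).int _) hmeas fun ξ hξ => ?_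
          obtain ⟨⟨u, hu, hu2⟩, h2⟩ := hξ
          refine le_trans ?_ (Finset.single_le_sum (fun u _ => hF0 u ξ) hu)
          rw [hF]
          have h3 := not_SS h2 hv
          have h4 : 1 ≤ Real.exp (2 * lu u * (α * (u / x))) * ‖Pv x u ξ‖ ^ (2 * lu u) := by
            have : Real.exp (2 * lu u * (α * (u / x))) = Real.exp (α * (u / x)) ^ (2 * lu u) := by
              rw [← Real.exp_nat_mul]; push_cast; ring_nf
            rw [this, ← mul_pow]
            apply one_le_pow₀
            calc (1 : ℝ) = Real.exp (α * (u / x)) * Real.exp (-(α * (u / x))) := by rw [← Real.exp_add]; simp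
              _ ≤ _ := by gcongr
          have h5 : ‖Pv (4 * x) v ξ‖ ^ 2 ≤ Real.exp (-(2 * (α' * (v / (4 * x))))) := by
            calc _ ≤ Real.exp (-(α' * (v / (4 * x)))) ^ 2 := by gcongr
              _ = _ := by rw [← Real.exp_nat_mul]; push_cast; ring_nf
          calc ‖Pv (4 * x) v ξ‖ ^ 2 * ‖GG B M ξ‖ ^ 2 ≤ Real.exp (-(2 * (α' * (v / (4 * x))))) * ‖GG B M ξ‖ ^ 2 * 1 := by
                rw [mul_one]; gcongr
            _ ≤ Real.exp (-(2 * (α' * (v / (4 * x))))) * ‖GG B M ξ‖ ^ 2 * (Real.exp (2 * lu u * (α * (u / x))) * ‖Pv x u ξ‖ ^ (2 * lu u)) := by gcongr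
            _ = _ := by ring
      _ ≤ ∫ ξ, ∑ u ∈ II x, F u ξ ∂muT T :=
          setIntegral_le_integral ((CB.sum _ fun u _ => cbF u).int _) (Eventually.of_forall fun ξ => Finset.sum_nonneg fun u _ => hF0 u ξ)
      _ = ∑ u ∈ II x, ∫ ξ, F u ξ ∂muT T := integral_finsetSum _ fun u _ => (cbF u).int _
      _ ≤ ∑ u ∈ II x, (1 + Real.log B) * Real.exp (-Real.exp (2 * x)) :=
          Finset.sum_le_sum fun u hu => step_term hx hα0 hα1 hgap hB hT hTN v u hv hu (lu u) rfl
      _ = _ := by rw [Finset.sum_const, nsmul_eq_mul]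

lemma dp_one (ξ : ℝ) : dp (RI 1 1) (fun _ => 1) ξ = 1 := by
  have : RI 1 1 = {1} := by unfold RI; simp
  rw [this]; unfold dp; simp [cis_zero]

lemma wt_low {X ξ : ℝ} (hX : 0 < X) (h : |ξ| ≤ X) : Real.exp (-1) / (2 * Real.pi) ≤ wt X ξ := by
  unfold wt
  have : |ξ| / X ≤ 1 := by rw [div_le_one hX]; exact h
  gcongr

lemma muT_low {X : ℝ} (hX : 0 < X) (A : Set ℝ) (hA : MeasurableSet A) (h : A ⊆ Set.Icc (-X) X) :
    volume A ≤ ENNReal.ofReal 20 * muT X A := by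
  unfold muT
  rw [withDensity_apply _ hA]
  calc volume A = ∫⁻ ξ in A, 1 := by simp
    _ ≤ ∫⁻ ξ in A, ENNReal.ofReal 20 * ENNReal.ofReal (wt X ξ) := by
        refine setLIntegral_mono' hA fun ξ hξ => ?_
        rw [← ENNReal.ofReal_mul (by norm_num), ← ENNReal.ofReal_one]
        apply ENNReal.ofReal_le_ofReal
        have h1 := wt_low hX (abs_le.mpr (h hξ))
        have h2 : (1 : ℝ) / 20 ≤ Real.exp (-1) / (2 * Real.pi) := by
          rw [div_le_div_iff₀ (by norm_num) (by positivity), Real.exp_neg]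
          have h3 := Real.exp_one_lt_d9
          have h4 := Real.pi_lt_d2
          have h5 : (1 : ℝ) / 2.72 ≤ (Real.exp 1)⁻¹ := by
            rw [one_div]; gcongr; linarith
          nlinarith
        linarith
    _ = _ := by rw [lintegral_const_mul' _ _ (by simp)]

set_option maxHeartbeats 1000000 in
lemma vol_num {x α β M U : ℝ} (hx : 20000 ≤ x) (hα0 : 0 ≤ α) (hα1 : α ≤ 1) (hβ0 : 0 < β) (hβ1 : β ≤ 1)
    (h1 : Real.exp (2 * x) ≤ β * M) (h2 : Real.log M ≤ β * Real.exp x)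
    (hU1 : Real.exp x - 1 / x ≤ U) (hU2 : U ≤ Real.exp (2 * x)) (l : ℕ) (hl : l = ⌈M / U⌉₊) :
    Real.exp (2 * l * (α * U)) * (3 * Real.exp 2 * 4 ^ l * (Nat.factorial (2 * l)) * (1 + 0 + l * (1 / x))) ≤
      Real.exp (4 + 2 * α * M + 11 * β * M) := by
  have hx0 : 0 < x := by linarith
  have h1x : 1 / x ≤ 1 := by rw [div_le_one hx0]; linarith
  set y := Real.exp x with hy
  have hy0 : 0 < y := Real.exp_pos _
  have hyx : x + 1 ≤ y := Real.add_one_le_exp x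
  have he2 : Real.exp (2 * x) = y ^ 2 := by rw [hy, ← Real.exp_nat_mul]; norm_num
  rw [he2] at h1 hU2
  have e2 : (Real.exp 20) ≤ y := Real.exp_le_exp.mpr (by linarith)
  clear_value y
  have hM0 : 0 < M := by
    by_contra h; push Not at h; nlinarith [pow_pos hy0 2]
  have hMy : y ^ 2 ≤ M := by nlinarith
  have hyM : y ≤ M := by nlinarith
  have hlM : 20 ≤ Real.log M := by
    rw [Real.le_log_iff_exp_le hM0]
    linarith
  have hUlow : y / 2 ≤ U := by linarith
  have hU0 : 0 < U := by linarith
  have hl1 : 1 ≤ l := by rw [hl]; exact Nat.one_le_iff_ne_zero.mpr (Nat.ceil_pos.mpr (by positivity)).ne'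
  have hl1' : (1 : ℝ) ≤ l := by exact_mod_cast hl1
  have hlle : (l : ℝ) ≤ M / U + 1 := by rw [hl]; exact (Nat.ceil_lt_add_one (by positivity)).le
  have hlU : l * U ≤ M + U := by
    calc l * U ≤ (M / U + 1) * U := by gcongr
      _ = _ := by field_simp
  have hMU : M / U ≤ 2 * (M / y) := by
    rw [mul_div_assoc', div_le_div_iff₀ hU0 (by positivity)]; nlinarith
  have hMy1 : 1 ≤ M / y := by rw [le_div_iff₀ hy0]; linarith
  have hl3 : (l : ℝ) ≤ 3 * (M / y) := by linarith
  have hlog : Real.log (4 * l) ≤ Real.log M := by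
    apply Real.log_le_log (by positivity)
    have : M / y ≤ M / 12 := by gcongr; linarith
    linarith
  have hMyl : (M / y) * Real.log M ≤ β * M := by
    calc (M / y) * Real.log M ≤ (M / y) * (β * y) := by gcongr
      _ = _ := by field_simp
  have hexp : 2 * l * (α * U) + 4 + 2 * l * Real.log (4 * l) + l ≤ 4 + 2 * α * M + 11 * β * M := by
    have a1 : l * (α * U) ≤ α * M + U := by
      calc l * (α * U) = α * (l * U) := by ring
        _ ≤ α * (M + U) := by gcongr
        _ ≤ α * M + U := by nlinarith
    have a3 : 2 * l * Real.log (4 * l) + l ≤ 3 * l * Real.log M := by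
      have : l * Real.log (4 * l) ≤ l * Real.log M := by gcongr
      nlinarith
    have a4 : l * Real.log M ≤ 3 * (M / y) * Real.log M := by gcongr
    linarith
  have hfac := four_fact l hl1
  have h3e : 3 * Real.exp 2 ≤ Real.exp 4 := by
    rw [show (4 : ℝ) = 2 + 2 by norm_num, Real.exp_add]
    have := Real.add_one_le_exp 2
    nlinarith [Real.exp_pos 2]
  have hlin : 1 + 0 + l * (1 / x) ≤ Real.exp l := by
    have := Real.add_one_le_exp (l : ℝ)
    have : l * (1 / x) ≤ l * 1 := by gcongr
    linarith
  calc _ = Real.exp (2 * l * (α * U)) * ((3 * Real.exp 2) * (4 ^ l * (Nat.factorial (2 * l))) * (1 + 0 + l * (1 / x))) := by ring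
    _ ≤ Real.exp (2 * l * (α * U)) * (Real.exp 4 * Real.exp (2 * l * Real.log (4 * l)) * Real.exp l) := by
        gcongr
    _ = Real.exp (2 * l * (α * U) + 4 + 2 * l * Real.log (4 * l) + l) := by
        simp only [Real.exp_add]; ring
    _ ≤ _ := Real.exp_le_exp.mpr hexp

lemma vol_term {x α β X : ℝ} (hx : 20000 ≤ x) (hα0 : 0 ≤ α) (hα1 : α ≤ 1) (hβ0 : 0 < β) (hβ1 : β ≤ 1) (hX : 0 < X)
    (h1 : Real.exp (2 * x) ≤ β * Real.log X) (h2 : Real.log (Real.log X) ≤ β * Real.exp x) (u : ℕ) (hu : u ∈ II x) :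
    volume ({ξ | Real.exp (-(α * (u / x))) < ‖Pv x u ξ‖} ∩ Set.Icc (-X) X) ≤
      ENNReal.ofReal (20 * Real.exp (4 + 2 * α * Real.log X + 11 * β * Real.log X)) := by
  have := muT_finite hX
  have hx0 : 0 < x := by linarith
  obtain ⟨hu1, hu2⟩ := II_bd hx0 hu
  have h1x : 1 / x ≤ 1 := by rw [div_le_one hx0]; linarith
  have hU' : ((u : ℝ) + 1) / x = u / x + 1 / x := by ring
  set A := {ξ | Real.exp (-(α * (u / x))) < ‖Pv x u ξ‖} ∩ Set.Icc (-X) X with hA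
  set U : ℝ := u / x with hU
  have hex := Real.add_one_le_exp x
  have hU0 : 0 < U := by linarith
  set l := ⌈Real.log X / U⌉₊ with hl
  have hVl : Real.log X ≤ l * U := by
    have : Real.log X / U ≤ l := by rw [hl]; exact Nat.le_ceil _
    rwa [div_le_iff₀ hU0] at this
  have hAm : MeasurableSet A := (measurableSet_lt measurable_const (continuous_Pv x u).norm.measurable).inter measurableSet_Icc
  have hm := moment_bound X hX (blk x u) (fun p hp => (blk_bd hx0 hp).1) (blk_sum (by linarith) u)
    (Real.exp U) (Real.exp (U + 1 / x)) 1 1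
    (Real.one_le_exp hU0.le) (Real.exp_le_exp.mpr (by have : 0 < 1 / x := by positivity
                                                      linarith)) one_pos le_rfl
    (fun p hp => by rw [← hU']; exact (blk_bd hx0 hp).2) (fun _ => 1) (fun n => by simp) l
    (by
      rw [← Real.exp_nat_mul, one_mul, ← Real.log_le_iff_le_exp hX]; exact hVl)
  simp_rw [dp_one] at hm
  have hle : Real.log (Real.exp (U + 1 / x) / Real.exp U) = 1 / x := by
    rw [← Real.exp_sub, Real.log_exp]; ring
  rw [hle, div_one, Real.log_one] at hm
  simp only [norm_one, one_pow, mul_one] at hm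
  have hnum := vol_num hx hα0 hα1 hβ0 hβ1 h1 h2 hu1 hu2 l hl
  have cb : CB (fun ξ => Real.exp (2 * l * (α * U)) * ‖Pv x u ξ‖ ^ (2 * l)) := (CB.const _).mul ((CB_Pv x u).norm.pow _)
  have hmark : (muT X).real A ≤ Real.exp (4 + 2 * α * Real.log X + 11 * β * Real.log X) := by
    calc (muT X).real A = ∫ ξ in A, 1 ∂muT X := by simp
      _ ≤ ∫ ξ in A, Real.exp (2 * l * (α * U)) * ‖Pv x u ξ‖ ^ (2 * l) ∂muT X := by
          refine setIntegral_mono_on ((CB.const (1 : ℝ)).int _) (cb.int _) hAm fun ξ hξ => ?_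
          have : Real.exp (2 * l * (α * U)) = Real.exp (α * U) ^ (2 * l) := by
            rw [← Real.exp_nat_mul]; push_cast; ring_nf
          rw [this, ← mul_pow]
          apply one_le_pow₀
          calc (1 : ℝ) = Real.exp (α * U) * Real.exp (-(α * U)) := by rw [← Real.exp_add]; simp
            _ ≤ _ := by gcongr; exact hξ.1.le
      _ ≤ ∫ ξ, Real.exp (2 * l * (α * U)) * ‖Pv x u ξ‖ ^ (2 * l) ∂muT X :=
          setIntegral_le_integral (cb.int _) (Eventually.of_forall fun ξ => by positivity)
      _ ≤ _ := by
          rw [integral_const_mul]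
          refine le_trans ?_ hnum
          gcongr
          exact hm
  calc volume A ≤ ENNReal.ofReal 20 * muT X A := muT_low hX A hAm Set.inter_subset_right
    _ = ENNReal.ofReal 20 * ENNReal.ofReal ((muT X).real A) := by rw [ofReal_measureReal]
    _ = ENNReal.ofReal (20 * (muT X).real A) := by rw [ENNReal.ofReal_mul (by norm_num)]
    _ ≤ _ := by apply ENNReal.ofReal_le_ofReal; gcongr

lemma vol_SS {x α β X : ℝ} (hx : 20000 ≤ x) (hα0 : 0 ≤ α) (hα1 : α ≤ 1) (hβ0 : 0 < β) (hβ1 : β ≤ 1) (hX : 0 < X)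
    (h1 : Real.exp (2 * x) ≤ β * Real.log X) (h2 : Real.log (Real.log X) ≤ β * Real.exp x) :
    volume (SS x α ∩ Set.Icc (-X) X) ≤ ENNReal.ofReal (Real.exp ((2 * α + 12 * β) * Real.log X)) := by
  have hx0 : 0 < x := by linarith
  have hsub : SS x α ∩ Set.Icc (-X) X ⊆ ⋃ u ∈ II x, ({ξ | Real.exp (-(α * (u / x))) < ‖Pv x u ξ‖} ∩ Set.Icc (-X) X) := by
    rintro ξ ⟨⟨u, hu, h⟩, hξ⟩
    simp only [Set.mem_iUnion]
    exact ⟨u, hu, h, hξ⟩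
  have hc := II_card (show 1 ≤ x by linarith)
  set Z := 20 * Real.exp (4 + 2 * α * Real.log X + 11 * β * Real.log X) with hZ
  calc _ ≤ volume (⋃ u ∈ II x, ({ξ | Real.exp (-(α * (u / x))) < ‖Pv x u ξ‖} ∩ Set.Icc (-X) X)) := measure_mono hsub
    _ ≤ ∑ u ∈ II x, volume ({ξ | Real.exp (-(α * (u / x))) < ‖Pv x u ξ‖} ∩ Set.Icc (-X) X) := measure_biUnion_finset_le _ _
    _ ≤ ∑ u ∈ II x, ENNReal.ofReal Z := Finset.sum_le_sum fun u hu => vol_term hx hα0 hα1 hβ0 hβ1 hX h1 h2 u hu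
    _ = ENNReal.ofReal ((II x).card * Z) := by
        rw [Finset.sum_const, nsmul_eq_mul, ENNReal.ofReal_mul (p := ((II x).card : ℝ)) (by positivity), ENNReal.ofReal_natCast]
    _ ≤ _ := by
        apply ENNReal.ofReal_le_ofReal
        have h20 : (20 : ℝ) ≤ Real.exp 19 := by have := Real.add_one_le_exp 19; linarith
        have hex := Real.add_one_le_exp x
        have h2x : 2 * x ≤ Real.exp x := by have := exp_quad hx0.le; nlinarith
        calc ((II x).card : ℝ) * Z ≤ (Real.exp x * Real.exp (2 * x)) * (Real.exp 19 * Real.exp (4 + 2 * α * Real.log X + 11 * β * Real.log X)) := by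
              rw [hZ]
              gcongr
              exact hc.trans (by gcongr)
          _ = Real.exp (x + 2 * x + (19 + (4 + 2 * α * Real.log X + 11 * β * Real.log X))) := by simp only [Real.exp_add]
          _ ≤ _ := by
              apply Real.exp_le_exp.mpr
              have h3 := exp_quad (show 0 ≤ 2 * x by linarith)
              nlinarith

lemma tail_bound {B N T : ℝ} (hB : 1 ≤ B) (hN : 1 ≤ N) (hT : 0 < T) (hTN : 2 * T ≤ N) :
    ∫ ξ in (Set.Icc (-(N ^ 2)) (N ^ 2))ᶜ, ‖GG B N ξ‖ ^ 2 ∂muT T ≤ Real.exp (-N) * (3 * (1 + Real.log B)) := by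
  have hN0 : 0 < N := by linarith
  have hmv := GG_mv hB hN0 (show 0 < 2 * T by linarith) hTN
  have cb := (CB_GG B N).norm.pow 2
  rw [← integral_indicator measurableSet_Icc.compl, muT_integral]
  obtain ⟨hc, C, hC⟩ := cb
  calc _ ≤ ∫ ξ, Real.exp (-N) * (wt (2 * T) ξ • ‖GG B N ξ‖ ^ 2) := by
        refine integral_mono_of_nonneg (Eventually.of_forall fun ξ => ?_) ?_ (Eventually.of_forall fun ξ => ?_)
        · exact smul_nonneg (wt_pos _ _).le (Set.indicator_nonneg (fun _ _ => by positivity) _)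
        · apply Integrable.const_mul
          simp only [smul_eq_mul]
          exact (wt_integrable (show 0 < 2 * T by linarith)).mul_bdd hc.aestronglyMeasurable (Eventually.of_forall hC)
        · simp only [smul_eq_mul]
          by_cases h : ξ ∈ (Set.Icc (-(N ^ 2)) (N ^ 2))ᶜ
          · rw [Set.indicator_of_mem h, ← mul_assoc]
            gcongr
            unfold wt
            rw [mul_div_assoc', ← Real.exp_add]
            gcongr
            have h1 : N ^ 2 ≤ |ξ| := by
              by_contra h2
              exact h (abs_le.mp (not_le.mp h2).le)
            have h2 : N ≤ |ξ| / (2 * T) := by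
              rw [le_div_iff₀ (by linarith)]; nlinarith
            have h3 : |ξ| / T = |ξ| / (2 * T) + |ξ| / (2 * T) := by field_simp; ring
            linarith
          · rw [Set.indicator_of_notMem h, mul_zero]
            have := (wt_pos (2 * T) ξ).le
            positivity
    _ = Real.exp (-N) * ∫ ξ, ‖GG B N ξ‖ ^ 2 ∂muT (2 * T) := by rw [integral_const_mul, muT_integral]
    _ ≤ _ := by gcongr

lemma setInt_union_le {f : ℝ → ℝ} (hf : ∀ x, 0 ≤ f x) {μ : Measure ℝ} (hi : Integrable f μ) {A B E : Set ℝ}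
    (hB : MeasurableSet B) (h : E ⊆ A ∪ B) : ∫ x in E, f x ∂μ ≤ ∫ x in A, f x ∂μ + ∫ x in B, f x ∂μ := by
  calc _ ≤ ∫ x in A ∪ B, f x ∂μ :=
        setIntegral_mono_set hi.integrableOn (Eventually.of_forall hf) (Eventually.of_forall h)
    _ ≤ ∫ x, f x ∂(μ.restrict A + μ.restrict B) := by
        refine integral_mono_measure (Measure.restrict_union_le A B) (Eventually.of_forall hf) ?_
        exact integrable_add_measure.mpr ⟨hi.integrableOn, hi.integrableOn⟩
    _ = _ := integral_add_measure hi.integrableOn hi.integrableOn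

noncomputable def alj (α : ℝ) (j : ℕ) : ℝ := α * (1 - 1 / 2 ^ (j + 1))

lemma MR_iter {D α B T N : ℝ} (hD : 20000 ≤ D) (hW : ∀ x ≥ D, x / 20 ≤ WW x) (hα0 : 0 < α) (hα1 : α ≤ 1) (hDα : 8 / α ≤ D)
    (hB : 1 ≤ B) (hT : 0 < T) (hTN : T * Real.exp (Real.exp (2 * D)) ≤ N) (J : ℕ) :
    Real.exp (3 * Real.exp (2 * (D * 4 ^ J))) ≤ N →
    ∫ ξ in (SS (D * 4 ^ J) (alj α J))ᶜ, ‖GG B N ξ‖ ^ 2 ∂muT T ≤ 700 * (Real.log B + 1) / D * (2 - 1 / 4 ^ J) := by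
  have := muT_finite hT
  have hD0 : 0 < D := by linarith
  have hq1 : 1 ≤ Real.exp (Real.exp (2 * D)) := Real.one_le_exp (Real.exp_pos _).le
  have hTN' : T ≤ N := by nlinarith
  rw [div_le_iff₀ hα0] at hDα
  have hL0 : 0 ≤ Real.log B := Real.log_nonneg hB
  induction J with
  | zero =>
    intro hN
    simp only [pow_zero, mul_one] at hN ⊢
    have h := step1 (α := alj α 0) (by linarith) (hW D le_rfl) ?_ hB hT hTN hN
    · refine h.trans ?_
      norm_num
    · unfold alj
      rw [Real.exp_neg]
      have h1 := Real.add_one_le_exp (D / 2)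
      calc (Real.exp (D / 2))⁻¹ ≤ (D / 2)⁻¹ := by gcongr; linarith
        _ ≤ _ := by
          rw [inv_le_iff_one_le_mul₀ (by linarith)]; norm_num; nlinarith
  | succ j ih =>
    intro hN
    have hp : (1 : ℝ) ≤ 4 ^ j := one_le_pow₀ (by norm_num)
    have hx : 20000 ≤ D * 4 ^ j := by nlinarith
    have h4 : D * 4 ^ (j + 1) = 4 * (D * 4 ^ j) := by rw [pow_succ]; ring
    have hN' : Real.exp (3 * Real.exp (2 * (D * 4 ^ j))) ≤ N := by
      refine le_trans ?_ hN
      rw [h4]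
      have : Real.exp (2 * (D * 4 ^ j)) ≤ Real.exp (2 * (4 * (D * 4 ^ j))) := Real.exp_le_exp.mpr (by linarith)
      exact Real.exp_le_exp.mpr (by linarith)
    have ih := ih hN'
    have h2j : (2 : ℝ) ^ j ≤ 4 ^ j := by gcongr; norm_num
    have h2p : (0 : ℝ) < 2 ^ j := by positivity
    have hα0' : 0 ≤ alj α j := by
      unfold alj
      apply mul_nonneg hα0.le
      rw [sub_nonneg, div_le_one (by positivity)]
      exact one_le_pow₀ (by norm_num)
    have hα1' : alj α j ≤ 1 := by
      unfold alj
      have : (0 : ℝ) ≤ 1 / 2 ^ (j + 1) := by positivity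
      nlinarith
    have hgap : alj α j + Real.exp (-((D * 4 ^ j) / 2)) ≤ alj α (j + 1) := by
      have e : alj α (j + 1) - alj α j = α / (4 * 2 ^ j) := by
        unfold alj; field_simp; ring
      have h1 := Real.add_one_le_exp ((D * 4 ^ j) / 2)
      have : Real.exp (-((D * 4 ^ j) / 2)) ≤ α / (4 * 2 ^ j) := by
        rw [Real.exp_neg, inv_le_iff_one_le_mul₀ (Real.exp_pos _)]
        rw [div_mul_eq_mul_div, le_div_iff₀ (by positivity), one_mul]
        have h5 : 4 * 2 ^ j ≤ α * ((D * 4 ^ j) / 2) := by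
          have : 8 * 4 ^ j ≤ D * α * 4 ^ j := by gcongr
          nlinarith
        have h6 : α * ((D * 4 ^ j) / 2) ≤ α * Real.exp ((D * 4 ^ j) / 2) := by gcongr; linarith
        linarith
      linarith
    rw [h4] at hN ⊢
    have hs := step (α := alj α j) (α' := alj α (j + 1)) (B := B) (T := T) (N := N) hx (hW _ (by nlinarith)) hα0' hα1' hgap hB hT hTN' hN
    have hu := setInt_union_le (f := fun ξ => ‖GG B N ξ‖ ^ 2) (μ := muT T) (fun ξ => by positivity) (((CB_GG B N).norm.pow 2).int _)
      (A := (SS (D * 4 ^ j) (alj α j))ᶜ) (B := SS (D * 4 ^ j) (alj α j) ∩ (SS (4 * (D * 4 ^ j)) (alj α (j + 1)))ᶜ)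
      (E := (SS (4 * (D * 4 ^ j)) (alj α (j + 1)))ᶜ) ((SS_meas _ _).inter (SS_meas _ _).compl)
      (by
        intro ξ hξ
        by_cases h : ξ ∈ SS (D * 4 ^ j) (alj α j)
        · exact Or.inr ⟨h, hξ⟩
        · exact Or.inl h)
    refine hu.trans ((add_le_add ih hs).trans ?_)
    have e1 : 700 * (Real.log B + 1) / (4 * (D * 4 ^ j)) = 700 * (Real.log B + 1) / D * (1 / 4 ^ (j + 1)) := by
      rw [pow_succ]; field_simp
    have e2 : (1 : ℝ) / 4 ^ j = 4 * (1 / 4 ^ (j + 1)) := by rw [pow_succ]; field_simp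
    rw [e1, e2, ← mul_add]
    gcongr
    have : (0 : ℝ) < 1 / 4 ^ (j + 1) := by positivity
    linarith

theorem MR (B ε γ : ℝ) (hB : 1 ≤ B) (hε : 0 < ε) (hγ : 0 < γ) :
    ∃ H0 : ℝ, 2 ≤ H0 ∧ ∀ H ≥ H0, ∀ᶠ N : ℝ in atTop, ∃ U : Set ℝ, MeasurableSet U ∧ U ⊆ Set.Icc (-(N ^ 2)) (N ^ 2) ∧
      volume U ≤ ENNReal.ofReal (N ^ γ) ∧ ∫ ξ in Uᶜ, ‖GG B N ξ‖ ^ 2 ∂muT (N / H) ≤ ε := by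
  obtain ⟨x0, hx0, hW⟩ := WW_lower
  have hL0 : 0 ≤ Real.log B := Real.log_nonneg hB
  obtain ⟨α, hα0, hα1, hαγ⟩ : ∃ α : ℝ, 0 < α ∧ α ≤ 1 ∧ α ≤ γ / 8 :=
    ⟨min 1 (γ / 8), lt_min one_pos (by linarith), min_le_left _ _, min_le_right _ _⟩
  obtain ⟨β, hβ0, hβ1, hβγ⟩ : ∃ β : ℝ, 0 < β ∧ β ≤ 1 / 6 ∧ β ≤ γ / 48 :=
    ⟨min (1 / 6) (γ / 48), lt_min (by norm_num) (by linarith), min_le_left _ _, min_le_right _ _⟩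
  obtain ⟨D, hD, hDx, hDα, hDε⟩ : ∃ D : ℝ, 20000 ≤ D ∧ x0 ≤ D ∧ 8 / α ≤ D ∧ 2800 * (Real.log B + 1) / ε ≤ D :=
    ⟨max (max 20000 x0) (max (8 / α) (2800 * (Real.log B + 1) / ε)), by simp, by simp, by simp, by simp⟩
  have hD0 : 0 < D := by linarith
  refine ⟨max 2 (Real.exp (Real.exp (2 * D))), le_max_left _ _, fun H hH => ?_⟩
  have hH2 : 2 ≤ H := (le_max_left _ _).trans hH
  have hHD : Real.exp (Real.exp (2 * D)) ≤ H := (le_max_right _ _).trans hH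
  have hlogt : Tendsto (fun N : ℝ => 2 * Real.log N) atTop atTop := Real.tendsto_log_atTop.const_mul_atTop (by norm_num)
  have ev1 : ∀ᶠ M : ℝ in atTop, (Real.log M / β) ^ 8 ≤ β * M := by
    have h := Real.isLittleO_pow_log_id_atTop (n := 8)
    have h2 := h.bound (show 0 < β ^ 9 by positivity)
    filter_upwards [h2, eventually_ge_atTop 1] with M hM hM1
    simp only [id, Real.norm_eq_abs] at hM
    rw [abs_of_nonneg (by positivity), abs_of_nonneg (by linarith)] at hM
    rw [div_pow, div_le_iff₀ (by positivity)]
    calc _ ≤ _ := hM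
      _ = _ := by ring
  have ev2 : ∀ᶠ M : ℝ in atTop, Real.exp (2 * D) ≤ β * M := (tendsto_id.const_mul_atTop hβ0).eventually_ge_atTop _
  have ev3 : ∀ᶠ N : ℝ in atTop, Real.exp (-N) * (3 * (1 + Real.log B)) ≤ ε / 2 := by
    have h : Tendsto (fun N : ℝ => Real.exp (-N) * (3 * (1 + Real.log B))) atTop (nhds (0 * (3 * (1 + Real.log B)))) :=
      (Real.tendsto_exp_neg_atTop_nhds_zero).mul_const _
    rw [zero_mul] at h
    exact h.eventually_le_const (by linarith)
  filter_upwards [hlogt.eventually ev1, hlogt.eventually ev2, ev3, eventually_ge_atTop 1, hlogt.eventually_ge_atTop 1] with N h1 h2 h3 hN1 hM1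
  set M := 2 * Real.log N with hM
  have hN0 : 0 < N := by linarith
  have hJ : ∃ J : ℕ, Real.log M ≤ β * Real.exp (D * 4 ^ J) := by
    refine ⟨⌈Real.log M / β⌉₊, ?_⟩
    set J := ⌈Real.log M / β⌉₊
    have h4 : Real.log M / β ≤ J := Nat.le_ceil _
    rw [div_le_iff₀ hβ0] at h4
    have h5 : (J : ℝ) ≤ 4 ^ J := by exact_mod_cast (Nat.lt_pow_self (by norm_num)).le
    have h6 := Real.add_one_le_exp (D * 4 ^ J)
    have h7 : (J : ℝ) ≤ Real.exp (D * 4 ^ J) := by nlinarith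
    nlinarith
  obtain ⟨J, hJ1, hJ2⟩ : ∃ J : ℕ, Real.log M ≤ β * Real.exp (D * 4 ^ J) ∧ Real.exp (2 * (D * 4 ^ J)) ≤ β * M := by
    refine ⟨Nat.find hJ, Nat.find_spec hJ, ?_⟩
    rcases Nat.eq_zero_or_pos (Nat.find hJ) with h0 | hpos
    · rw [h0]; simpa using h2
    · obtain ⟨j, hj⟩ : ∃ j, Nat.find hJ = j + 1 := ⟨Nat.find hJ - 1, by omega⟩
      have hlt := Nat.find_min hJ (show j < Nat.find hJ by omega)
      push Not at hlt
      rw [hj]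
      refine le_trans ?_ h1
      calc Real.exp (2 * (D * 4 ^ (j + 1))) = Real.exp (D * 4 ^ j) ^ 8 := by
            rw [← Real.exp_nat_mul, pow_succ]; push_cast; ring_nf
        _ ≤ _ := by
            gcongr
            rw [le_div_iff₀ hβ0]; linarith
  set x := D * 4 ^ J with hx
  have hpJ : (1 : ℝ) ≤ 4 ^ J := one_le_pow₀ (by norm_num)
  have hxD : D ≤ x := by rw [hx]; nlinarith
  have hT : 0 < N / H := by positivity
  have hNx : Real.exp (3 * Real.exp (2 * x)) ≤ N := by
    rw [← Real.le_log_iff_exp_le hN0]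
    nlinarith
  have hit := MR_iter (T := N / H) (N := N) hD (fun y hy => hW y (by linarith)) hα0 hα1 hDα hB hT
    (by rw [div_mul_eq_mul_div, div_le_iff₀ (by linarith)]; gcongr) J hNx
  have haj0 : 0 ≤ alj α J := by
    unfold alj
    apply mul_nonneg hα0.le
    rw [sub_nonneg, div_le_one (by positivity)]
    exact one_le_pow₀ (by norm_num)
  have hajα : alj α J ≤ α := by
    unfold alj
    have : (0 : ℝ) ≤ 1 / 2 ^ (J + 1) := by positivity
    nlinarith
  have hlogX : Real.log (N ^ 2) = M := by rw [Real.log_pow, hM]; norm_num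
  have hv := vol_SS (x := x) (α := alj α J) (β := β) (X := N ^ 2) (by linarith) haj0 (by linarith) hβ0 (by linarith) (by positivity)
    (by rw [hlogX]; exact hJ2) (by rw [hlogX]; exact hJ1)
  have htail := tail_bound (T := N / H) hB hN1 hT (by rw [mul_div_assoc', div_le_iff₀ (by linarith)]; nlinarith)
  have := muT_finite hT
  refine ⟨SS x (alj α J) ∩ Set.Icc (-(N ^ 2)) (N ^ 2), (SS_meas _ _).inter measurableSet_Icc, Set.inter_subset_right, ?_, ?_⟩
  · refine hv.trans (ENNReal.ofReal_le_ofReal ?_)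
    rw [hlogX, Real.rpow_def_of_pos hN0]
    apply Real.exp_le_exp.mpr
    have hl : 0 ≤ Real.log N := Real.log_nonneg hN1
    have : (2 * alj α J + 12 * β) * 2 ≤ γ := by linarith
    calc _ = ((2 * alj α J + 12 * β) * 2) * Real.log N := by rw [hM]; ring
      _ ≤ γ * Real.log N := by gcongr
      _ = _ := by ring
  · have hu := setInt_union_le (f := fun ξ => ‖GG B N ξ‖ ^ 2) (μ := muT (N / H)) (fun ξ => by positivity) (((CB_GG B N).norm.pow 2).int _)
      (A := (SS x (alj α J))ᶜ) (B := (Set.Icc (-(N ^ 2)) (N ^ 2))ᶜ)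
      (E := (SS x (alj α J) ∩ Set.Icc (-(N ^ 2)) (N ^ 2))ᶜ) measurableSet_Icc.compl (by rw [Set.compl_inter])
    refine hu.trans ((add_le_add hit htail).trans ?_)
    have h5 : 700 * (Real.log B + 1) / D * (2 - 1 / 4 ^ J) ≤ ε / 2 := by
      have h6 : (2 - 1 / 4 ^ J : ℝ) ≤ 2 := by
        have : (0 : ℝ) ≤ 1 / 4 ^ J := by positivity
        linarith
      calc _ ≤ 700 * (Real.log B + 1) / D * 2 := by gcongr
        _ ≤ ε / 2 := by
          rw [div_le_iff₀ hε] at hDε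
          rw [div_mul_eq_mul_div, div_le_iff₀ hD0]; linarith
    linarith

/-- large sieve type inequalities for a measure, at all scales above the square root -/
def BSL (ν : Measure ℝ) (κ N : ℝ) (B : ℕ) : Prop := ∀ a b : ℕ, N ≤ (a : ℝ) ^ 2 → a ≤ b → b ≤ B * a →
  (∀ φ : ℝ → ℂ, CB φ → ∑ m ∈ Finset.Icc a b, ‖hat ν φ (Real.log m)‖ ^ 2 / m ≤ (1 + κ) * ∫ ξ, ‖φ ξ‖ ^ 2 ∂ν) ∧
  (∀ c : ℕ → ℂ, ∫ ξ, ‖dp (Finset.Icc a b) c ξ‖ ^ 2 ∂ν ≤ (1 + κ) * ∑ m ∈ Finset.Icc a b, ‖c m‖ ^ 2 / m)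

lemma besselU (B : ℕ) (hB : 1 ≤ B) : ∃ γ : ℝ, 0 < γ ∧ ∀ κ > 0, ∀ᶠ N : ℝ in atTop, ∀ ν : Measure ℝ, IsFiniteMeasure ν →
    ν ≤ ENNReal.ofReal (1 / (2 * Real.pi)) • volume → ν.real Set.univ ≤ N ^ γ → (∀ᵐ ξ ∂ν, |ξ| ≤ N ^ 2) →
    BSL ν κ N B := by
  obtain ⟨c, hc, C, hC, a0, ha0, h⟩ := ES 5 B (by norm_num) hB
  refine ⟨c / 4, by positivity, fun κ hκ => ?_⟩
  have ev : ∀ᶠ N : ℝ in atTop, C * N ^ (-(c / 4)) ≤ κ := by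
    have h := (tendsto_rpow_neg_atTop (show 0 < c / 4 by positivity)).const_mul C
    rw [mul_zero] at h
    exact h.eventually_le_const hκ
  filter_upwards [ev, eventually_ge_atTop (max 4 ((a0 : ℝ) ^ 2))] with N hN hN2 ν hfin hν hreal hsupp a b ha hab hbB
  have hN4 : 4 ≤ N := (le_max_left _ _).trans hN2
  have haa : a0 ≤ a := by
    have h1 : (a0 : ℝ) ^ 2 ≤ (a : ℝ) ^ 2 := ((le_max_right _ _).trans hN2).trans ha
    exact_mod_cast (pow_le_pow_iff_left₀ (by positivity) (by positivity) (by norm_num)).mp h1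
  have ha2 : (2 : ℝ) ≤ a := by
    have h1 : (2 : ℝ) ^ 2 ≤ (a : ℝ) ^ 2 := by linarith
    exact (pow_le_pow_iff_left₀ (by positivity) (by positivity) (by norm_num)).mp h1
  set ρ := C * (a : ℝ) ^ (-c) with hρ
  have hρ0 : 0 ≤ ρ := by positivity
  have hES : ∀ s : ℝ, |s| ≤ 2 * N ^ 2 → ‖∑ m ∈ Finset.Icc a b, (1 / m : ℂ) * cis (s * Real.log m) -
      ∫ u in (Real.log a)..(Real.log b), cis (u * s)‖ ≤ ρ := by
    intro s hs
    refine h a haa b hab hbB s (hs.trans ?_)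
    have h4 : N ^ 2 ≤ (a : ℝ) ^ 4 := by
      calc N ^ 2 ≤ ((a : ℝ) ^ 2) ^ 2 := by gcongr
        _ = _ := by ring
    calc 2 * N ^ 2 ≤ a * (a : ℝ) ^ 4 := by gcongr
      _ = _ := by ring
  have hlog : Real.log a ≤ Real.log b := Real.log_le_log (by linarith) (by exact_mod_cast hab)
  have hk : ρ * ν.real Set.univ ≤ κ := by
    have h1 : (a : ℝ) ^ (-c) ≤ N ^ (-(c / 2)) := by
      have e : (a : ℝ) ^ (-c) = ((a : ℝ) ^ 2) ^ (-(c / 2)) := by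
        rw [← Real.rpow_natCast, ← Real.rpow_mul (by linarith)]
        congr 1; push_cast; ring
      rw [e]
      exact Real.rpow_le_rpow_of_nonpos (by linarith) ha (by linarith)
    calc ρ * ν.real Set.univ ≤ (C * N ^ (-(c / 2))) * N ^ (c / 4) := by rw [hρ]; gcongr
      _ = C * N ^ (-(c / 4)) := by
        rw [mul_assoc, ← Real.rpow_add (by linarith)]; congr 2; ring
      _ ≤ κ := hN
  constructor
  · rintro φ ⟨hφ, D, hD⟩
    refine (bessel ν hν hφ hD _ _ hlog _ (N ^ 2) ρ hsupp hES).trans ?_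
    have : 0 ≤ ∫ ξ, ‖φ ξ‖ ^ 2 ∂ν := integral_nonneg fun _ => by positivity
    gcongr
  · intro c
    refine (bessel_dual ν hν _ _ hlog _ (N ^ 2) ρ hρ0 hsupp hES c).trans ?_
    have : 0 ≤ ∑ m ∈ Finset.Icc a b, ‖c m‖ ^ 2 / m := Finset.sum_nonneg fun _ _ => by positivity
    gcongr

lemma GG_dual {ν : Measure ℝ} {κ N : ℝ} {B B' : ℕ} (hB : 1 ≤ B) (hBB : B ≤ B') (hκ : 0 ≤ κ) (h : BSL ν κ N B') {M : ℝ}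
    (hM0 : 0 < M) (hM : N ≤ M ^ 2) : ∫ ξ, ‖GG B M ξ‖ ^ 2 ∂ν ≤ (1 + κ) * (1 / M + Real.log B) := by
  have hBr : (1 : ℝ) ≤ B := by exact_mod_cast hB
  have hh := harm_RI hM0 (show M ≤ B * M by nlinarith)
  rw [mul_div_cancel_right₀ _ hM0.ne'] at hh
  by_cases hab : ⌈M⌉₊ ≤ ⌊B * M⌋₊
  · have h1 := (h ⌈M⌉₊ ⌊B * M⌋₊ (hM.trans (by gcongr; exact Nat.le_ceil M)) hab (by
      have h2 : (⌊B * M⌋₊ : ℝ) ≤ B' * ⌈M⌉₊ := (Nat.floor_le (by positivity)).trans (by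
        gcongr
        exact Nat.le_ceil M)
      exact_mod_cast h2)).2 lamC
    unfold GG
    refine h1.trans ?_
    gcongr
    refine le_trans (le_of_eq ?_) hh
    refine Finset.sum_congr rfl fun n _ => by rw [norm_lamC, one_pow]
  · have : ∀ ξ, GG B M ξ = 0 := by
      intro ξ; unfold GG dp RI; rw [Finset.Icc_eq_empty hab, Finset.sum_empty]
    simp only [this]
    simp
    have : 0 ≤ Real.log B := Real.log_nonneg hBr
    positivity

/-- shifting the scale -/
lemma RI_symm {B a' a : ℝ} (hB : 1 ≤ B) (ha' : 0 < a') (haa : a' ≤ a) (S : Finset ℕ) :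
    ∑ m ∈ S, ‖(if m ∈ RI a' (B * a') then lamC m else 0) - (if m ∈ RI a (B * a) then lamC m else 0)‖ ^ 2 / m ≤
      2 / a' + 2 * Real.log (a / a') := by
  have ha : 0 < a := by linarith
  have h1 := harm_RI ha' haa
  have h2 := harm_RI (show 0 < B * a' by positivity) (show B * a' ≤ B * a by gcongr)
  rw [mul_div_mul_left _ _ (by linarith : B ≠ 0)] at h2
  have h3 : 1 / (B * a') ≤ 1 / a' := one_div_le_one_div_of_le ha' (by nlinarith)
  have key : ∀ m ∈ S, ‖(if m ∈ RI a' (B * a') then lamC m else 0) - (if m ∈ RI a (B * a) then lamC m else 0)‖ ^ 2 / m ≤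
      (if m ∈ RI a' a then 1 / (m : ℝ) else 0) + (if m ∈ RI (B * a') (B * a) then 1 / (m : ℝ) else 0) := by
    intro m _
    simp only [mem_RI (show 0 ≤ B * a' by positivity), mem_RI (show 0 ≤ B * a by positivity), mem_RI ha.le]
    have hm : (0 : ℝ) ≤ 1 / m := by positivity
    have hq1 : B * a' ≤ B * a := by gcongr
    have hq2 : a ≤ B * a := by nlinarith
    split_ifs with c1 c2 c3 c4 <;> simp only [sub_self, norm_zero, sub_zero, zero_sub, norm_neg, norm_lamC, one_pow] <;> 
      first | (simp; done) | (simp; positivity) | skip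
    all_goals (exfalso; clear h1 h2 h3 hm; grind)
  refine (Finset.sum_le_sum key).trans ?_
  rw [Finset.sum_add_distrib, ← Finset.sum_filter, ← Finset.sum_filter]
  have s1 : ∀ R : Finset ℕ, ∑ m ∈ S.filter (· ∈ R), 1 / (m : ℝ) ≤ ∑ m ∈ R, 1 / (m : ℝ) := fun R =>
    Finset.sum_le_sum_of_subset_of_nonneg (fun m hm => (Finset.mem_filter.mp hm).2) fun _ _ _ => by positivity
  have := s1 (RI a' a)
  have := s1 (RI (B * a') (B * a))
  have e : 2 / a' = 1 / a' + 1 / a' := by ring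
  linarith

lemma GG_eq_dp {B M : ℝ} {S : Finset ℕ} (hS : RI M (B * M) ⊆ S) (ξ : ℝ) :
    GG B M ξ = dp S (fun m => if m ∈ RI M (B * M) then lamC m else 0) ξ := by
  unfold GG dp
  rw [← Finset.sum_subset hS]
  · refine Finset.sum_congr rfl fun m hm => by simp only [if_pos hm]
  · intro m _ hm; simp [if_neg hm]

lemma dp_sub' (S : Finset ℕ) (a b : ℕ → ℂ) (ξ : ℝ) : dp S (fun n => a n - b n) ξ = dp S a ξ - dp S b ξ := by
  unfold dp; rw [← Finset.sum_sub_distrib]; refine Finset.sum_congr rfl fun n _ => by ring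

lemma GG_shift {ν : Measure ℝ} {κ N : ℝ} {B B' : ℕ} (hB : 1 ≤ B) (hBB : 8 * B ≤ B') (hκ : 0 ≤ κ) (h : BSL ν κ N B') {a' a : ℝ}
    (ha' : 0 < a') (haa : a' ≤ a) (ha8 : a ≤ 8 * a') (hN : N ≤ a' ^ 2) :
    ∫ ξ, ‖GG B a' ξ - GG B a ξ‖ ^ 2 ∂ν ≤ (1 + κ) * (2 / a' + 2 * Real.log 8) := by
  have hBr : (1 : ℝ) ≤ B := by exact_mod_cast hB
  have ha : 0 < a := by linarith
  have hlog : 2 / a' + 2 * Real.log (a / a') ≤ 2 / a' + 2 * Real.log 8 := by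
    have : Real.log (a / a') ≤ Real.log 8 := Real.log_le_log (by positivity) (by rwa [div_le_iff₀ ha'])
    linarith
  set S := Finset.Icc ⌈a'⌉₊ ⌊B * a⌋₊ with hS
  have hs1 : RI a' (B * a') ⊆ S := by
    unfold RI
    exact Finset.Icc_subset_Icc le_rfl (Nat.floor_mono (by gcongr))
  have hs2 : RI a (B * a) ⊆ S := by
    unfold RI
    exact Finset.Icc_subset_Icc (Nat.ceil_mono haa) le_rfl
  have e : ∀ ξ, GG B a' ξ - GG B a ξ = dp S (fun m => (if m ∈ RI a' (B * a') then lamC m else 0) - (if m ∈ RI a (B * a) then lamC m else 0)) ξ := by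
    intro ξ
    rw [dp_sub', ← GG_eq_dp hs1, ← GG_eq_dp hs2]
  simp only [e]
  have hl8 : 0 ≤ Real.log 8 := Real.log_nonneg (by norm_num)
  by_cases hab : ⌈a'⌉₊ ≤ ⌊B * a⌋₊
  · have h1 := (h ⌈a'⌉₊ ⌊B * a⌋₊ (hN.trans (by gcongr; exact Nat.le_ceil _)) hab (by
      have h2 : (⌊B * a⌋₊ : ℝ) ≤ B' * ⌈a'⌉₊ := (Nat.floor_le (by positivity)).trans (by
        have h3 := Nat.le_ceil a'
        have h4 : (8 * B : ℝ) ≤ B' := by exact_mod_cast hBB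
        calc (B : ℝ) * a ≤ B * (8 * a') := by gcongr
          _ = (8 * B) * a' := by ring
          _ ≤ _ := by gcongr)
      exact_mod_cast h2)).2 (fun m => (if m ∈ RI a' (B * a') then lamC m else 0) - (if m ∈ RI a (B * a) then lamC m else 0))
    refine h1.trans ?_
    gcongr
    exact (RI_symm hBr ha' haa _).trans hlog
  · rw [hS, Finset.Icc_eq_empty hab]
    simp [dp]
    positivity

lemma cross_hat (ν : Measure ℝ) [IsFiniteMeasure ν] {φ : ℝ → ℂ} (hφ : CB φ) (S : Finset ℕ) :
    ∫ ξ, φ ξ * starRingEnd ℂ (dp S lamC ξ) ∂ν = ∑ m ∈ S, lamC m / m * hat ν φ (Real.log m) := by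
  have e : ∀ ξ, φ ξ * starRingEnd ℂ (dp S lamC ξ) = ∑ m ∈ S, lamC m / m * (φ ξ * cis (Real.log m * ξ)) := by
    intro ξ
    unfold dp
    rw [map_sum, Finset.mul_sum]
    refine Finset.sum_congr rfl fun m _ => ?_
    rw [map_mul, map_div₀, conj_cis]
    have : starRingEnd ℂ (lamC m) = lamC m := by unfold lamC; exact Complex.conj_ofReal _
    rw [this, Complex.conj_natCast, neg_neg, mul_comm ξ]; ring
  simp only [e]
  obtain ⟨hc, C, hC⟩ := hφ
  have hi : ∀ m ∈ S, Integrable (fun ξ => lamC m / m * (φ ξ * cis (Real.log m * ξ))) ν := by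
    intro m _
    refine Integrable.const_mul ?_ _
    refine integrable_of_cont_bdd (hc.mul (continuous_cis.comp (by fun_prop))) (C := C) fun x => ?_
    rw [norm_mul, norm_cis, mul_one]; exact hC x
  rw [integral_finsetSum _ hi]
  refine Finset.sum_congr rfl fun m _ => ?_
  rw [integral_const_mul]; rfl

lemma sum_mult_gen {a b : ℝ} (hb : 0 ≤ b) (d : ℕ) (hd : 1 ≤ d) (f : ℕ → ℝ) :
    ∑ n ∈ (RI a b).filter (d ∣ ·), f n = ∑ m ∈ RI (a / d) (b / d), f (d * m) := by
  have hd0 : (0 : ℝ) < d := by exact_mod_cast hd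
  symm
  refine Finset.sum_bij (fun m _ => d * m) ?_ ?_ ?_ ?_
  · intro m hm
    rw [mem_RI (by positivity), div_le_iff₀ hd0, le_div_iff₀ hd0] at hm
    rw [Finset.mem_filter, mem_RI hb]
    refine ⟨?_, dvd_mul_right _ _⟩
    push_cast
    constructor <;> linarith
  · intro m1 _ m2 _ h
    exact Nat.eq_of_mul_eq_mul_left hd h
  · intro n hn
    rw [Finset.mem_filter, mem_RI hb] at hn
    obtain ⟨⟨h1, h2⟩, m, rfl⟩ := hn
    push_cast at h1 h2
    refine ⟨m, ?_, rfl⟩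
    rw [mem_RI (by positivity), div_le_iff₀ hd0, le_div_iff₀ hd0]
    constructor <;> linarith
  · intro m _; rfl

noncomputable def gg (ν : Measure ℝ) (B : ℕ) (N : ℝ) (n : ℕ) : ℂ := hat ν (GG B N) (Real.log n)

lemma re_lam_mul (n : ℕ) (z : ℂ) : (lamC n * z).re = lam n * z.re := by
  unfold lamC; rw [Complex.re_ofReal_mul]

lemma lam_sub_sq (n : ℕ) (z : ℂ) : ‖lamC n - z‖ ^ 2 = 1 + ‖z‖ ^ 2 - 2 * (lam n * z.re) := by
  rw [← Complex.normSq_eq_norm_sq, ← Complex.normSq_eq_norm_sq, Complex.normSq_apply, Complex.normSq_apply]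
  unfold lamC
  simp only [Complex.sub_re, Complex.sub_im, Complex.ofReal_re, Complex.ofReal_im]
  rcases lam_eq n with h | h <;> rw [h] <;> ring

lemma Q_eq (ν : Measure ℝ) [IsFiniteMeasure ν] (B : ℕ) (N : ℝ) :
    ∫ ξ, ‖GG B N ξ‖ ^ 2 ∂ν = ∑ n ∈ RI N (B * N), lam n * (gg ν B N n).re / n := by
  have h := cross_hat ν (CB_GG B N) (RI N (B * N))
  have e : ∀ ξ, GG B N ξ * starRingEnd ℂ (dp (RI N (B * N)) lamC ξ) = ((‖GG B N ξ‖ ^ 2 : ℝ) : ℂ) := by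
    intro ξ
    have : dp (RI N (B * N)) lamC ξ = GG B N ξ := rfl
    rw [this, Complex.mul_conj, Complex.normSq_eq_norm_sq]
  simp only [e] at h
  rw [integral_complex_ofReal] at h
  have h2 := congrArg Complex.re h
  rw [Complex.ofReal_re, Complex.re_sum] at h2
  rw [h2]
  refine Finset.sum_congr rfl fun n _ => ?_
  rw [div_mul_eq_mul_div, Complex.div_natCast_re, re_lam_mul]; rfl

lemma delta_bound {ν : Measure ℝ} [IsFiniteMeasure ν] {κ N : ℝ} {B B' : ℕ} (hB : 2 ≤ B) (hBB : B ≤ B') (h : BSL ν κ N B')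
    (hN : 1 ≤ N) :
    ∑ n ∈ RI N (B * N), ‖lamC n - gg ν B N n‖ ^ 2 / n ≤ 1 / N + Real.log B - (1 - κ) * ∫ ξ, ‖GG B N ξ‖ ^ 2 ∂ν := by
  have hBr : (2 : ℝ) ≤ B := by exact_mod_cast hB
  have hN0 : 0 < N := by linarith
  have hab : ⌈N⌉₊ ≤ ⌊B * N⌋₊ := by
    rw [Nat.ceil_le]
    have := Nat.lt_floor_add_one ((B : ℝ) * N)
    nlinarith
  have h1 := (h ⌈N⌉₊ ⌊B * N⌋₊ (by
      have : N ≤ N ^ 2 := by nlinarith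
      exact this.trans (by gcongr; exact Nat.le_ceil _)) hab (by
      have h2 : (⌊B * N⌋₊ : ℝ) ≤ B' * ⌈N⌉₊ := (Nat.floor_le (by positivity)).trans (by
        gcongr
        exact Nat.le_ceil N)
      exact_mod_cast h2)).1 (GG B N) (CB_GG B N)
  have hh := harm_RI hN0 (show N ≤ B * N by nlinarith)
  rw [mul_div_cancel_right₀ _ hN0.ne'] at hh
  have hQ := Q_eq ν B N
  have e : ∑ n ∈ RI N (B * N), ‖lamC n - gg ν B N n‖ ^ 2 / n = ∑ n ∈ RI N (B * N), 1 / (n : ℝ) + ∑ n ∈ RI N (B * N), ‖gg ν B N n‖ ^ 2 / n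
      - 2 * ∑ n ∈ RI N (B * N), lam n * (gg ν B N n).re / n := by
    rw [Finset.mul_sum, ← Finset.sum_add_distrib, ← Finset.sum_sub_distrib]
    refine Finset.sum_congr rfl fun n _ => ?_
    rw [lam_sub_sq]; ring
  have h1' : ∑ n ∈ RI N (B * N), ‖gg ν B N n‖ ^ 2 / n ≤ (1 + κ) * ∫ ξ, ‖GG B N ξ‖ ^ 2 ∂ν := h1
  rw [e, ← hQ]
  linarith

/-- correlation of `G_N` with the rescaled `G_{N/p}` -/
noncomputable def EE (ν : Measure ℝ) (B : ℕ) (N : ℝ) (p : ℕ) : ℝ := ∫ ξ, ‖cis (ξ * Real.log p) * GG B N ξ + GG B (N / p) ξ‖ ^ 2 ∂ν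

lemma CB_cis (u : ℝ) : CB (fun ξ => cis (ξ * u)) :=
  ⟨continuous_cis.comp (by fun_prop), 1, fun x => (norm_cis _).le⟩

lemma EE_eq (ν : Measure ℝ) [IsFiniteMeasure ν] {B : ℕ} {N : ℝ} (hN : 0 < N) {p : ℕ} (hp : p.Prime) :
    EE ν B N p = ∫ ξ, ‖GG B N ξ‖ ^ 2 ∂ν + ∫ ξ, ‖GG B (N / p) ξ‖ ^ 2 ∂ν
      - 2 * (p * ∑ n ∈ (RI N (B * N)).filter (p ∣ ·), lam n * (gg ν B N n).re / n) := by
  have hp0 : (0 : ℝ) < p := by exact_mod_cast hp.pos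
  have hφ : CB (fun ξ => cis (ξ * Real.log p) * GG B N ξ) := (CB_cis _).mul (CB_GG B N)
  have h := cross_hat ν hφ (RI (N / p) (B * (N / p)))
  have hcb : CB (fun ξ => cis (ξ * Real.log p) * GG B N ξ * starRingEnd ℂ (GG B (N / p) ξ)) := by
    refine hφ.mul ?_
    obtain ⟨h1, C, h2⟩ := CB_GG B (N / p)
    exact ⟨Complex.continuous_conj.comp h1, C, fun x => by rw [RCLike.norm_conj]; exact h2 x⟩
  have h2 : ∫ ξ, (cis (ξ * Real.log p) * GG B N ξ * starRingEnd ℂ (GG B (N / p) ξ)).re ∂ν =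
      - (p * ∑ n ∈ (RI N (B * N)).filter (p ∣ ·), lam n * (gg ν B N n).re / n) := by
    have h3 : ∫ ξ, (cis (ξ * Real.log p) * GG B N ξ * starRingEnd ℂ (GG B (N / p) ξ)).re ∂ν =
        (∫ ξ, (cis (ξ * Real.log p) * GG B N ξ * starRingEnd ℂ (GG B (N / p) ξ)) ∂ν).re :=
      integral_re (hcb.int ν)
    have h4 : (∫ ξ, (cis (ξ * Real.log p) * GG B N ξ * starRingEnd ℂ (GG B (N / p) ξ)) ∂ν) =
      ∑ m ∈ RI (N / p) (B * (N / p)), lamC m / m * hat ν (fun ξ => cis (ξ * Real.log p) * GG B N ξ) (Real.log m) := h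
    rw [h3, h4, sum_mult_gen (by positivity) p hp.one_lt.le, Complex.re_sum, Finset.mul_sum, ← Finset.sum_neg_distrib,
      ← mul_div_assoc]
    refine Finset.sum_congr rfl fun m hm => ?_
    have hm1 : 1 ≤ m := RI_mem_pos (by positivity) hm
    have hm0 : (0 : ℝ) < m := by exact_mod_cast hm1
    rw [div_mul_eq_mul_div, Complex.div_natCast_re, re_lam_mul, lam_prime_mul hp (by omega)]
    have e : hat ν (fun ξ => cis (ξ * Real.log p) * GG B N ξ) (Real.log m) = gg ν B N (p * m) := by
      unfold gg hat
      refine integral_congr_ae (Eventually.of_forall fun ξ => ?_)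
      show cis (ξ * Real.log p) * GG B N ξ * cis (Real.log m * ξ) = GG B N ξ * cis (Real.log ((p * m : ℕ) : ℝ) * ξ)
      push_cast
      rw [Real.log_mul hp0.ne' hm0.ne', add_mul, cis_add, mul_comm ξ (Real.log p)]; ring
    rw [e]; push_cast; field_simp
  unfold EE
  have e : ∀ ξ, ‖cis (ξ * Real.log p) * GG B N ξ + GG B (N / p) ξ‖ ^ 2 = (‖GG B N ξ‖ ^ 2 + ‖GG B (N / p) ξ‖ ^ 2) +
      2 * (cis (ξ * Real.log p) * GG B N ξ * starRingEnd ℂ (GG B (N / p) ξ)).re := by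
    intro ξ
    rw [← Complex.normSq_eq_norm_sq, Complex.normSq_add, Complex.normSq_eq_norm_sq, Complex.normSq_eq_norm_sq, norm_mul, norm_cis, one_mul]
  simp only [e]
  have i1 := ((CB_GG B N).norm.pow 2).int ν
  have i2 := ((CB_GG B (N / p)).norm.pow 2).int ν
  have i3 : Integrable (fun ξ => 2 * (cis (ξ * Real.log p) * GG B N ξ * starRingEnd ℂ (GG B (N / p) ξ)).re) ν :=
    ((hcb.int ν).re).const_mul 2
  have i12 : Integrable (fun x => ‖GG B N x‖ ^ 2 + ‖GG B (N / p) x‖ ^ 2) ν := i1.add i2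
  rw [integral_add i12 i3, integral_add i1 i2, integral_const_mul, h2]
  ring

lemma EE_sum {ν : Measure ℝ} [IsFiniteMeasure ν] {κ N τ σ Δ : ℝ} {B B' : ℕ} (hB : 2 ≤ B) (hBB : B ≤ B') (hκ : 0 ≤ κ) (h : BSL ν κ N B')
    (hN : 1 ≤ N) (P : Finset ℕ) (hP : ∀ p ∈ P, p.Prime) (hPN : ∀ p ∈ P, N ≤ (N / p) ^ 2) (hPτ : ∀ p ∈ P, p / N ≤ τ)
    (hcard : P.card / N ≤ τ) (hNτ : 1 / N ≤ τ) (hom : ∀ n ∈ RI N (B * N), om P n ≤ 4) (hσ : 0 < σ)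
    (hΔ : ∑ n ∈ RI N (B * N), ‖lamC n - gg ν B N n‖ ^ 2 / n ≤ Δ) :
    (∑ p ∈ P, 1 / (p : ℝ)) * Real.log B ≤ 4 * Real.log B + 5 * τ ∧
    ∑ p ∈ P, 1 / (p : ℝ) * EE ν B N p ≤ (∑ p ∈ P, 1 / (p : ℝ)) * (2 * (1 + κ) * (Real.log B + τ) - 2 * Real.log B) + 2 * τ +
      8 * (σ * (Real.log B + τ) + Δ / σ) := by
  have hBr : (2 : ℝ) ≤ B := by exact_mod_cast hB
  have hN0 : 0 < N := by linarith
  set L := Real.log B with hL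
  set W := ∑ p ∈ P, 1 / (p : ℝ) with hW
  set R := RI N (B * N) with hR
  have hab : N ≤ B * N := by nlinarith
  have hh := harm_RI hN0 hab
  have hm := fun d hd => (mult_RI_bd hN0 hab d hd).1
  rw [mul_div_cancel_right₀ _ hN0.ne'] at hh
  simp only [mul_div_cancel_right₀ _ hN0.ne'] at hm
  -- lower bound for the average of `om`
  have hav : W * L - τ ≤ ∑ n ∈ R, (om P n : ℝ) / n := by
    rw [om_avg]
    calc W * L - τ ≤ W * L - P.card / N := by linarith
      _ = ∑ p ∈ P, (L / p - 1 / N) := by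
        rw [Finset.sum_sub_distrib, hW, Finset.sum_mul, Finset.sum_const, nsmul_eq_mul]
        congr 1
        · refine Finset.sum_congr rfl fun p _ => by ring
        · ring
      _ ≤ _ := Finset.sum_le_sum fun p hp => hm p (hP p hp).one_lt.le
  have hav2 : ∑ n ∈ R, (om P n : ℝ) / n ≤ 4 * (L + τ) := by
    calc _ ≤ ∑ n ∈ R, 4 * (1 / (n : ℝ)) := Finset.sum_le_sum fun n hn => by
          have : (om P n : ℝ) ≤ 4 := by exact_mod_cast hom n hn
          rw [mul_one_div]; gcongr
      _ = 4 * ∑ n ∈ R, 1 / (n : ℝ) := by rw [Finset.mul_sum]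
      _ ≤ _ := by linarith
  refine ⟨by linarith, ?_⟩
  have hQ : ∫ ξ, ‖GG B N ξ‖ ^ 2 ∂ν ≤ (1 + κ) * (L + τ) := by
    refine (GG_dual (by omega) hBB hκ h hN0 (by nlinarith)).trans ?_
    exact mul_le_mul_of_nonneg_left (by linarith) (by linarith)
  have hQp : ∀ p ∈ P, ∫ ξ, ‖GG B (N / p) ξ‖ ^ 2 ∂ν ≤ (1 + κ) * (L + τ) := by
    intro p hp
    have hp0 : (0 : ℝ) < p := by exact_mod_cast (hP p hp).pos
    refine (GG_dual (by omega) hBB hκ h (by positivity) (hPN p hp)).trans ?_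
    rw [one_div_div]
    exact mul_le_mul_of_nonneg_left (by linarith [hPτ p hp]) (by linarith)
  set D := ∑ n ∈ R, (om P n : ℝ) * (lam n * (gg ν B N n).re) / n with hD
  have e1 : ∑ p ∈ P, ∑ n ∈ R.filter (p ∣ ·), lam n * (gg ν B N n).re / n = D := by
    simp_rw [hD, om_eq_sum, Finset.sum_mul, Finset.sum_div]
    rw [Finset.sum_comm]
    refine Finset.sum_congr rfl fun p _ => ?_
    rw [Finset.sum_filter]
    refine Finset.sum_congr rfl fun n _ => ?_
    split_ifs <;> simp
  have h1 : ∑ p ∈ P, 1 / (p : ℝ) * EE ν B N p ≤ W * (2 * (1 + κ) * (L + τ)) - 2 * D := by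
    rw [← e1, hW, Finset.sum_mul, Finset.mul_sum, ← Finset.sum_sub_distrib]
    refine Finset.sum_le_sum fun p hp => ?_
    have hp0 : (0 : ℝ) < p := by exact_mod_cast (hP p hp).pos
    rw [EE_eq ν hN0 (hP p hp)]
    set Z := ∑ n ∈ R.filter (p ∣ ·), lam n * (gg ν B N n).re / n with hZ
    have := hQp p hp
    calc 1 / (p : ℝ) * (∫ ξ, ‖GG B N ξ‖ ^ 2 ∂ν + ∫ ξ, ‖GG B (N / p) ξ‖ ^ 2 ∂ν - 2 * (p * Z))
        ≤ 1 / (p : ℝ) * (2 * (1 + κ) * (L + τ) - 2 * (p * Z)) := by gcongr; linarith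
      _ = _ := by field_simp
  have h2 : ∑ n ∈ R, (om P n : ℝ) / n - D ≤ 4 * (σ * (L + τ) + Δ / σ) := by
    rw [hD, ← Finset.sum_sub_distrib]
    calc _ ≤ ∑ n ∈ R, 4 * (σ * (1 / (n : ℝ)) + (‖lamC n - gg ν B N n‖ ^ 2 / n) / σ) := by
          refine Finset.sum_le_sum fun n hn => ?_
          have ho : (om P n : ℝ) ≤ 4 := by exact_mod_cast hom n hn
          set d := ‖lamC n - gg ν B N n‖ with hd
          have hd0 : 0 ≤ d := norm_nonneg _
          have hr : 1 - lam n * (gg ν B N n).re ≤ d := by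
            have h3 : (lamC n * (lamC n - gg ν B N n)).re ≤ d := by
              refine (Complex.re_le_norm _).trans ?_
              rw [norm_mul, norm_lamC, one_mul]
            rw [re_lam_mul] at h3
            unfold lamC at h3
            rw [Complex.sub_re, Complex.ofReal_re, mul_sub] at h3
            have := lam_sq n
            nlinarith
          have hdσ : d ≤ σ + d ^ 2 / σ := by
            rw [← sub_le_iff_le_add', le_div_iff₀ hσ]
            nlinarith [sq_nonneg (d - σ), mul_nonneg hd0 hσ.le]
          have h5 : (om P n : ℝ) * (1 - lam n * (gg ν B N n).re) ≤ 4 * (σ + d ^ 2 / σ) := by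
            calc _ ≤ (om P n : ℝ) * (σ + d ^ 2 / σ) := by gcongr; linarith
              _ ≤ _ := by gcongr
          calc (om P n : ℝ) / n - (om P n : ℝ) * (lam n * (gg ν B N n).re) / n
              = ((om P n : ℝ) * (1 - lam n * (gg ν B N n).re)) / n := by ring
            _ ≤ (4 * (σ + d ^ 2 / σ)) / n := by gcongr
            _ = _ := by ring
      _ = 4 * (σ * ∑ n ∈ R, 1 / (n : ℝ) + (∑ n ∈ R, ‖lamC n - gg ν B N n‖ ^ 2 / n) / σ) := by
          rw [← Finset.mul_sum, Finset.sum_add_distrib, ← Finset.mul_sum, Finset.sum_div]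
      _ ≤ _ := by
          gcongr
          linarith
  linarith

lemma EE_small {ν : Measure ℝ} [IsFiniteMeasure ν] {N θ : ℝ} {B B' : ℕ} (hB : 3 ≤ B) (hBB : B ≤ B')
    (hθ : θ = 1 / (10 ^ 7 * (Real.log B + 1) ^ 2)) (h : BSL ν θ N B')
    (hN : 1 ≤ N) (P : Finset ℕ) (hP : ∀ p ∈ P, p.Prime) (hPN : ∀ p ∈ P, N ≤ (N / p) ^ 2) (hPτ : ∀ p ∈ P, p / N ≤ θ)
    (hcard : P.card / N ≤ θ) (hNτ : 1 / N ≤ θ) (hom : ∀ n ∈ RI N (B * N), om P n ≤ 4)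
    (hQ : Real.log B - θ ≤ ∫ ξ, ‖GG B N ξ‖ ^ 2 ∂ν) :
    ∑ p ∈ P, 1 / (p : ℝ) * EE ν B N p ≤ 1 / 40 := by
  have hBr : (3 : ℝ) ≤ B := by exact_mod_cast hB
  have hL1 : 1 ≤ Real.log B := by
    rw [Real.le_log_iff_exp_le (by linarith)]
    linarith [Real.exp_one_lt_d9]
  set L := Real.log B with hL
  have hθ0 : 0 < θ := by rw [hθ]; positivity
  have hθ2 : θ * (10 ^ 7 * (L + 1) ^ 2) = 1 := by rw [hθ]; field_simp
  have hA : θ * (L + 1) ^ 2 = 1 / 10 ^ 7 := by linarith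
  have hA1 : θ * (L + 1) ≤ 1 / 10 ^ 7 := by nlinarith [mul_nonneg hθ0.le (by linarith : 0 ≤ L)]
  have hθ1 : θ ≤ 1 / 10 ^ 7 := by nlinarith [mul_nonneg hθ0.le (by linarith : 0 ≤ L)]
  have hd := delta_bound (by omega) hBB h hN
  have hd2 : ∑ n ∈ RI N (B * N), ‖lamC n - gg ν B N n‖ ^ 2 / n ≤ 2 * ((L + 1) * θ) := by
    refine hd.trans ?_
    have : (1 - θ) * (L - θ) ≤ (1 - θ) * ∫ ξ, ‖GG B N ξ‖ ^ 2 ∂ν := by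
      apply mul_le_mul_of_nonneg_left hQ; linarith
    nlinarith
  obtain ⟨h1, h2⟩ := EE_sum (σ := 1 / (1000 * (L + 1))) (by omega) hBB hθ0.le h hN P hP hPN hPτ hcard hNτ hom (by positivity) hd2
  set W := ∑ p ∈ P, 1 / (p : ℝ) with hW
  have hW0 : 0 ≤ W := Finset.sum_nonneg fun _ _ => by positivity
  have hW9 : W ≤ 9 := by
    have : W * L ≤ 9 * L := by linarith
    exact le_of_mul_le_mul_right this (by linarith)
  refine h2.trans ?_
  have t1 : 2 * (1 + θ) * (L + θ) - 2 * L ≤ 4 * (θ * (L + 1)) := by nlinarith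
  have t2 : W * (2 * (1 + θ) * (L + θ) - 2 * L) ≤ 9 * (4 * (θ * (L + 1))) := by
    calc _ ≤ W * (4 * (θ * (L + 1))) := by gcongr
      _ ≤ _ := by gcongr
  have t3 : 1 / (1000 * (L + 1)) * (L + θ) ≤ 1 / 1000 := by
    rw [div_mul_eq_mul_div, div_le_div_iff₀ (by positivity) (by norm_num)]
    linarith
  have t4 : 2 * ((L + 1) * θ) / (1 / (1000 * (L + 1))) = 2000 * (θ * (L + 1) ^ 2) := by field_simp; ring
  rw [hA] at t4
  rw [t4]
  rw [← hL]
  linarith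

lemma mem_prm8 {j p : ℕ} : p ∈ prm (8 ^ j) ↔ (8 ^ j ≤ p ∧ p < 8 ^ (j + 1)) ∧ p.Prime := by
  unfold prm
  rw [Finset.mem_filter, Finset.mem_Ico, pow_succ, mul_comm 8]

lemma prm8_disj (J : Finset ℕ) : Set.PairwiseDisjoint (J : Set ℕ) (fun j => prm (8 ^ j)) := by
  intro i _ j _ hij
  rw [Function.onFun, Finset.disjoint_left]
  intro p hp hp'
  rw [mem_prm8] at hp hp'
  have h1 := (Nat.pow_lt_pow_iff_right (by norm_num : 1 < 8)).mp (hp.1.1.trans_lt hp'.1.2)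
  have h2 := (Nat.pow_lt_pow_iff_right (by norm_num : 1 < 8)).mp (hp'.1.1.trans_lt hp.1.2)
  omega

lemma om_le_four {P : Finset ℕ} {z N B n : ℕ} (hP : ∀ p ∈ P, p.Prime ∧ z ≤ p) (hz : N < z ^ 4) (hzB : B ≤ z) (hn : 1 ≤ n)
    (hnB : n ≤ B * N) : om P n ≤ 4 := by
  by_contra hc
  push Not at hc
  unfold om at hc
  have hd : ∏ p ∈ P.filter (· ∣ n), p ∣ n := Finset.prod_primes_dvd n (fun p hp => (hP p (Finset.mem_filter.mp hp).1).1.prime)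
    (fun p hp => (Finset.mem_filter.mp hp).2)
  have h1 : z ^ (P.filter (· ∣ n)).card ≤ ∏ p ∈ P.filter (· ∣ n), p := by
    rw [← Finset.prod_const]
    exact Finset.prod_le_prod (fun _ _ => Nat.zero_le _) fun p hp => (hP p (Finset.mem_filter.mp hp).1).2
  have hz1 : 1 ≤ z := by
    rcases Nat.eq_zero_or_pos z with h | h
    · subst h; simp at hz
    · exact h
  have h2 : z ^ 5 ≤ n := ((Nat.pow_le_pow_right hz1 hc).trans h1).trans (Nat.le_of_dvd hn hd)
  have h3 : B * N < z ^ 5 := by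
    calc B * N ≤ z * N := by gcongr
      _ < z * z ^ 4 := by gcongr
      _ = z ^ 5 := by ring
  omega

lemma blocks (B Y1 : ℕ) : ∀ᶠ N : ℕ in atTop, ∃ J : Finset ℕ,
    (∀ j ∈ J, Y1 ≤ 8 ^ j ∧ N ^ 2 ≤ (8 ^ j) ^ 8 ∧ (8 * 8 ^ j) ^ 2 ≤ N) ∧
    (∀ p ∈ J.biUnion (fun j => prm (8 ^ j)), p.Prime ∧ p ^ 2 ≤ N) ∧
    (J.biUnion (fun j => prm (8 ^ j))).card ^ 2 ≤ N ∧
    (∀ n, 1 ≤ n → n ≤ B * N → om (J.biUnion (fun j => prm (8 ^ j))) n ≤ 4) ∧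
    1 / 40 ≤ ∑ j ∈ J, ∑ p ∈ prm (8 ^ j), 1 / (p : ℝ) := by
  obtain ⟨Y0, hY0, hprm⟩ := prm_lower
  set K := B + Y1 + Y0 + 2 with hK
  filter_upwards [eventually_ge_atTop (8 ^ (4 * K))] with N hN
  set q := Nat.log 8 N / 4 with hq
  have hN0 : N ≠ 0 := by
    have : 0 < 8 ^ (4 * K) := by positivity
    omega
  have hqK : K ≤ q := by
    have := Nat.le_log_of_pow_le (by norm_num : 1 < 8) hN
    omega
  have hlo : 8 ^ (4 * q) ≤ N := (Nat.pow_le_pow_right (by norm_num) (by omega)).trans (Nat.pow_log_le_self 8 hN0)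
  have hhi : N < 8 ^ (4 * (q + 1)) :=
    (Nat.lt_pow_succ_log_self (by norm_num : 1 < 8) N).trans_le (Nat.pow_le_pow_right (by norm_num) (by omega))
  have hbig : ∀ j, q ≤ j → K ≤ 8 ^ j := fun j hj => by
    have := (Nat.lt_pow_self (n := j) (by norm_num : 1 < 8)); omega
  have hs : (8 ^ (2 * q)) ^ 2 ≤ N := by rw [← pow_mul]; rw [show 2 * q * 2 = 4 * q by ring]; exact hlo
  have hmem : ∀ p ∈ (Finset.Ico (q + 1) (2 * q)).biUnion (fun j => prm (8 ^ j)), p.Prime ∧ 8 ^ (q + 1) ≤ p ∧ p < 8 ^ (2 * q) := by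
    intro p hp
    rw [Finset.mem_biUnion] at hp
    obtain ⟨j, hj, hp⟩ := hp
    rw [Finset.mem_Ico] at hj
    rw [mem_prm8] at hp
    exact ⟨hp.2, (Nat.pow_le_pow_right (by norm_num) hj.1).trans hp.1.1, hp.1.2.trans_le (Nat.pow_le_pow_right (by norm_num) (by omega))⟩
  refine ⟨Finset.Ico (q + 1) (2 * q), ?_, ?_, ?_, ?_, ?_⟩
  · intro j hj
    rw [Finset.mem_Ico] at hj
    refine ⟨by have := hbig j (by omega); omega, ?_, ?_⟩
    · calc N ^ 2 ≤ (8 ^ (4 * (q + 1))) ^ 2 := by gcongr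
        _ = (8 ^ (q + 1)) ^ 8 := by rw [← pow_mul, ← pow_mul]; congr 1; ring
        _ ≤ (8 ^ j) ^ 8 := by gcongr; norm_num; exact hj.1
    · refine le_trans ?_ hs
      gcongr
      rw [mul_comm, ← pow_succ]
      exact Nat.pow_le_pow_right (by norm_num) (by omega)
  · intro p hp
    obtain ⟨h1, h2, h3⟩ := hmem p hp
    exact ⟨h1, le_trans (by gcongr) hs⟩
  · refine le_trans ?_ hs
    gcongr
    calc _ ≤ (Finset.range (8 ^ (2 * q))).card := Finset.card_le_card fun p hp => Finset.mem_range.mpr (hmem p hp).2.2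
      _ = _ := Finset.card_range _
  · intro n hn hnB
    refine om_le_four (z := 8 ^ (q + 1)) (fun p hp => ⟨(hmem p hp).1, (hmem p hp).2.1⟩) ?_ (by have := hbig (q + 1) (by omega); omega) hn hnB
    rw [← pow_mul, mul_comm (q + 1)]; exact hhi
  · have hl8 : 0 < Real.log 8 := Real.log_pos (by norm_num)
    have hl8' : Real.log 8 ≤ 21 / 10 := by
      have : Real.log 8 = 3 * Real.log 2 := by
        rw [show (8 : ℝ) = 2 ^ 3 by norm_num, Real.log_pow]; norm_num
      rw [this]; linarith [Real.log_two_lt_d9]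
    have hq2 : (2 : ℝ) ≤ q := by
      have : 2 ≤ q := by omega
      exact_mod_cast this
    have hterm : ∀ j ∈ Finset.Ico (q + 1) (2 * q), 1 / (8 * q * Real.log 8) ≤ ∑ p ∈ prm (8 ^ j), 1 / (p : ℝ) := by
      intro j hj
      rw [Finset.mem_Ico] at hj
      refine le_trans ?_ (hprm (8 ^ j) (by have := hbig j (by omega); omega))
      push_cast
      rw [Real.log_pow]
      have hj1 : (j : ℝ) ≤ 2 * q := by exact_mod_cast hj.2.le
      have hj0 : (0 : ℝ) < j := by exact_mod_cast (show 0 < j by omega)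
      apply one_div_le_one_div_of_le (by positivity)
      nlinarith
    have hsum := Finset.card_nsmul_le_sum _ _ _ hterm
    rw [Nat.card_Ico, nsmul_eq_mul] at hsum
    refine le_trans ?_ hsum
    have hc : ((2 * q - (q + 1) : ℕ) : ℝ) = q - 1 := by
      rw [show 2 * q - (q + 1) = q - 1 by omega, Nat.cast_sub (by omega)]; norm_num
    rw [hc, mul_one_div, div_le_div_iff₀ (by norm_num) (by positivity)]
    nlinarith

lemma sq_norm_add_le (z w : ℂ) : ‖z + w‖ ^ 2 ≤ 2 * ‖z‖ ^ 2 + 2 * ‖w‖ ^ 2 := by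
  have h := norm_add_le z w
  have h0 := norm_nonneg (z + w)
  nlinarith [sq_nonneg (‖z‖ - ‖w‖)]

lemma var_point (P : Finset ℕ) (c0 : ℝ) (hc0 : 0 < c0) (hc1 : c0 < 1) (ξ : ℝ) (z w : ℂ)
    (hF : ‖∑ p ∈ P, (1 / p : ℂ) * cis (ξ * Real.log p)‖ ≤ (1 - c0) * ∑ p ∈ P, 1 / (p : ℝ)) :
    (∑ p ∈ P, 1 / (p : ℝ)) * c0 * ‖z‖ ^ 2 ≤ ∑ p ∈ P, 1 / (p : ℝ) * ‖cis (ξ * Real.log p) * z + w‖ ^ 2 := by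
  set W := ∑ p ∈ P, 1 / (p : ℝ) with hW
  have hW0 : 0 ≤ W := Finset.sum_nonneg fun _ _ => by positivity
  have e : ∀ p ∈ P, 1 / (p : ℝ) * ‖cis (ξ * Real.log p) * z + w‖ ^ 2 =
      1 / (p : ℝ) * (‖z‖ ^ 2 + ‖w‖ ^ 2) + 2 * (((1 / p : ℂ) * cis (ξ * Real.log p)) * (z * starRingEnd ℂ w)).re := by
    intro p _
    rw [← Complex.normSq_eq_norm_sq (cis _ * z + w), Complex.normSq_add, Complex.normSq_eq_norm_sq, Complex.normSq_eq_norm_sq, norm_mul, norm_cis, one_mul]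
    have : ((1 / p : ℂ) * cis (ξ * Real.log p)) * (z * starRingEnd ℂ w) = ((1 / p : ℝ) : ℂ) * (cis (ξ * Real.log p) * z * starRingEnd ℂ w) := by
      push_cast; ring
    rw [this, Complex.re_ofReal_mul]; ring
  rw [Finset.sum_congr rfl e, Finset.sum_add_distrib, ← Finset.sum_mul, ← hW, ← Finset.mul_sum, ← Complex.re_sum, ← Finset.sum_mul]
  set F := ∑ p ∈ P, (1 / p : ℂ) * cis (ξ * Real.log p) with hFd
  have h1 : -((1 - c0) * W * (‖z‖ * ‖w‖)) ≤ (F * (z * starRingEnd ℂ w)).re := by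
    have h2 := Complex.abs_re_le_norm (F * (z * starRingEnd ℂ w))
    rw [norm_mul, norm_mul, RCLike.norm_conj] at h2
    have h3 : ‖F‖ * (‖z‖ * ‖w‖) ≤ (1 - c0) * W * (‖z‖ * ‖w‖) := by gcongr
    linarith [neg_abs_le (F * (z * starRingEnd ℂ w)).re]
  have h4 : 0 ≤ (1 - c0) * W := mul_nonneg (by linarith) hW0
  have h5 : (1 - c0) * W * (2 * (‖z‖ * ‖w‖)) ≤ (1 - c0) * W * (‖z‖ ^ 2 + ‖w‖ ^ 2) := by
    gcongr; nlinarith [sq_nonneg (‖z‖ - ‖w‖)]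
  have h6 : 0 ≤ W * c0 * ‖w‖ ^ 2 := by positivity
  nlinarith

lemma var_step {ν : Measure ℝ} [IsFiniteMeasure ν] {N θ c0 T0 : ℝ} {B B' Y : ℕ} (hB : 1 ≤ B) (hBB : 8 * B ≤ B') (hθ0 : 0 ≤ θ)
    (hθ1 : θ ≤ 1 / 100) (h : BSL ν θ N B') (hN : 1 ≤ N) (hY : 1 ≤ Y) (hYN : (8 * Y : ℝ) ^ 2 ≤ N) (hYθ : 8 * Y / N ≤ θ)
    (hc0 : 0 < c0) (hc1 : c0 < 1) (hsupp : ∀ᵐ ξ ∂ν, |ξ| ≤ N ^ 2) (hY8 : N ^ 2 ≤ (Y : ℝ) ^ 8)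
    (hPL : ∀ ξ : ℝ, T0 ≤ |ξ| → |ξ| ≤ (Y : ℝ) ^ 8 →
      ‖∑ p ∈ prm Y, (1 / p : ℂ) * cis (ξ * Real.log p)‖ ≤ (1 - c0) * ∑ p ∈ prm Y, 1 / (p : ℝ))
    (hW : 0 < ∑ p ∈ prm Y, 1 / (p : ℝ))
    (hE : ∑ p ∈ prm Y, 1 / (p : ℝ) * EE ν B N p ≤ ∑ p ∈ prm Y, 1 / (p : ℝ)) :
    ∫ ξ in {ξ : ℝ | T0 ≤ |ξ|}, ‖GG B N ξ‖ ^ 2 ∂ν ≤ 12 / c0 := by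
  have hN0 : 0 < N := by linarith
  have hY0 : (0 : ℝ) < Y := by exact_mod_cast hY
  set W := ∑ p ∈ prm Y, 1 / (p : ℝ) with hWd
  set G := fun ξ => GG B N ξ with hG
  set Gs := fun ξ => GG B (N / Y) ξ with hGs
  have hcb : ∀ p : ℕ, CB (fun ξ => cis (ξ * Real.log p) * G ξ + Gs ξ) := fun p =>
    ((CB_cis _).mul (CB_GG B N)).add (CB_GG B _)
  have hp1 : ∀ p ∈ prm Y, ∫ ξ, ‖cis (ξ * Real.log p) * G ξ + Gs ξ‖ ^ 2 ∂ν ≤ 2 * EE ν B N p + 10 := by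
    intro p hp
    unfold prm at hp
    rw [Finset.mem_filter, Finset.mem_Ico] at hp
    obtain ⟨⟨hp1, hp2⟩, hpp⟩ := hp
    have hp0 : (0 : ℝ) < p := by exact_mod_cast hpp.pos
    have hp1' : (Y : ℝ) ≤ p := by exact_mod_cast hp1
    have hp2' : (p : ℝ) ≤ 8 * Y := by exact_mod_cast hp2.le
    have hsh := GG_shift (a' := N / p) (a := N / Y) hB hBB hθ0 h (by positivity) (by gcongr)
      (by rw [mul_div_assoc', div_le_div_iff₀ hY0 hp0]; nlinarith) (by
        rw [div_pow, le_div_iff₀ (by positivity)]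
        have : (p : ℝ) ^ 2 ≤ N := le_trans (by gcongr) hYN
        nlinarith)
    have hnum : (1 + θ) * (2 / (N / p) + 2 * Real.log 8) ≤ 5 := by
      have hl8' : Real.log 8 ≤ 21 / 10 := by
        have : Real.log 8 = 3 * Real.log 2 := by
          rw [show (8 : ℝ) = 2 ^ 3 by norm_num, Real.log_pow]; norm_num
        rw [this]; linarith [Real.log_two_lt_d9]
      have h2 : 2 / (N / p) = 2 * (p / N) := by field_simp
      have h3 : p / N ≤ θ := le_trans (by gcongr) hYθ
      rw [h2]
      have h4 : 2 * (p / N) + 2 * Real.log 8 ≤ 43 / 10 := by linarith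
      calc _ ≤ (1 + θ) * (43 / 10) := by gcongr
        _ ≤ _ := by linarith
    have i1 : Integrable (fun ξ => 2 * ‖cis (ξ * Real.log p) * G ξ + GG B (N / p) ξ‖ ^ 2) ν :=
      (((((CB_cis _).mul (CB_GG B N)).add (CB_GG B _)).norm.pow 2).int ν).const_mul 2
    have i2 : Integrable (fun ξ => 2 * ‖GG B (N / p) ξ - Gs ξ‖ ^ 2) ν :=
      ((((CB_GG B _).sub (CB_GG B _)).norm.pow 2).int ν).const_mul 2
    calc ∫ ξ, ‖cis (ξ * Real.log p) * G ξ + Gs ξ‖ ^ 2 ∂ν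
        ≤ ∫ ξ, (2 * ‖cis (ξ * Real.log p) * G ξ + GG B (N / p) ξ‖ ^ 2 + 2 * ‖GG B (N / p) ξ - Gs ξ‖ ^ 2) ∂ν := by
          refine integral_mono (((hcb p).norm.pow 2).int ν) (i1.add i2) fun ξ => ?_
          have h5 := sq_norm_add_le (cis (ξ * Real.log p) * G ξ + GG B (N / p) ξ) (-(GG B (N / p) ξ - Gs ξ))
          rw [norm_neg] at h5
          have e : cis (ξ * Real.log p) * G ξ + GG B (N / p) ξ + -(GG B (N / p) ξ - Gs ξ) = cis (ξ * Real.log p) * G ξ + Gs ξ := by ring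
          rw [e] at h5
          exact h5
      _ = 2 * EE ν B N p + 2 * ∫ ξ, ‖GG B (N / p) ξ - Gs ξ‖ ^ 2 ∂ν := by
          rw [integral_add i1 i2, integral_const_mul, integral_const_mul]; rfl
      _ ≤ _ := by linarith
  set Φ := fun ξ => ∑ p ∈ prm Y, 1 / (p : ℝ) * ‖cis (ξ * Real.log p) * G ξ + Gs ξ‖ ^ 2 with hΦ
  have iΦp : ∀ p ∈ prm Y, Integrable (fun ξ => 1 / (p : ℝ) * ‖cis (ξ * Real.log p) * G ξ + Gs ξ‖ ^ 2) ν := fun p _ =>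
    (((hcb p).norm.pow 2).int ν).const_mul _
  have iΦ : Integrable Φ ν := integrable_finsetSum _ iΦp
  have hΦ0 : ∀ ξ, 0 ≤ Φ ξ := fun ξ => Finset.sum_nonneg fun _ _ => by positivity
  have hΦi : ∫ ξ, Φ ξ ∂ν ≤ 12 * W := by
    rw [hΦ, integral_finsetSum _ iΦp]
    calc _ ≤ ∑ p ∈ prm Y, (2 * (1 / (p : ℝ) * EE ν B N p) + 10 * (1 / (p : ℝ))) := by
          refine Finset.sum_le_sum fun p hp => ?_
          rw [integral_const_mul]
          have := hp1 p hp
          calc _ ≤ 1 / (p : ℝ) * (2 * EE ν B N p + 10) := by gcongr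
            _ = _ := by ring
      _ = 2 * ∑ p ∈ prm Y, 1 / (p : ℝ) * EE ν B N p + 10 * W := by rw [Finset.sum_add_distrib, ← Finset.mul_sum, ← Finset.mul_sum]
      _ ≤ _ := by linarith
  have hV : MeasurableSet {ξ : ℝ | T0 ≤ |ξ|} := measurableSet_le measurable_const continuous_abs.measurable
  have hmain : ∫ ξ in {ξ : ℝ | T0 ≤ |ξ|}, W * c0 * ‖GG B N ξ‖ ^ 2 ∂ν ≤ ∫ ξ in {ξ : ℝ | T0 ≤ |ξ|}, Φ ξ ∂ν := by
    refine setIntegral_mono_on_ae ((((CB_GG B N).norm.pow 2).int ν).const_mul _).integrableOn iΦ.integrableOn hV ?_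
    filter_upwards [hsupp] with ξ hξ hT
    exact var_point (prm Y) c0 hc0 hc1 ξ (G ξ) (Gs ξ) (hPL ξ hT (hξ.trans hY8))
  have hle : ∫ ξ in {ξ : ℝ | T0 ≤ |ξ|}, Φ ξ ∂ν ≤ ∫ ξ, Φ ξ ∂ν := setIntegral_le_integral iΦ (Eventually.of_forall hΦ0)
  rw [integral_const_mul] at hmain
  rw [le_div_iff₀ hc0]
  have key : W * ((∫ ξ in {ξ : ℝ | T0 ≤ |ξ|}, ‖GG B N ξ‖ ^ 2 ∂ν) * c0) ≤ W * 12 := by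
    calc _ = W * c0 * (∫ ξ in {ξ : ℝ | T0 ≤ |ξ|}, ‖GG B N ξ‖ ^ 2 ∂ν) := by ring
      _ ≤ 12 * W := hmain.trans (hle.trans hΦi)
      _ = _ := by ring
  exact le_of_mul_le_mul_left key hW

theorem highfreq : ∃ c0 : ℝ, 0 < c0 ∧ ∃ T0 : ℝ, 1 ≤ T0 ∧ ∀ B : ℕ, 3 ≤ B → ∃ θ : ℝ, 0 < θ ∧ ∃ γ : ℝ, 0 < γ ∧ ∀ᶠ N : ℕ in atTop,
    ∀ ν : Measure ℝ, IsFiniteMeasure ν → ν ≤ ENNReal.ofReal (1 / (2 * Real.pi)) • volume → ν.real Set.univ ≤ (N : ℝ) ^ γ →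
    (∀ᵐ ξ ∂ν, |ξ| ≤ (N : ℝ) ^ 2) → Real.log B - θ ≤ ∫ ξ, ‖GG B N ξ‖ ^ 2 ∂ν →
    ∫ ξ in {ξ : ℝ | T0 ≤ |ξ|}, ‖GG B N ξ‖ ^ 2 ∂ν ≤ 12 / c0 := by
  obtain ⟨c0, hc0, hc1, T0, hT0, Y0, hY0, hPL⟩ := PL 8 (by norm_num)
  refine ⟨c0, hc0, T0, hT0, fun B hB => ?_⟩
  have hBr : (3 : ℝ) ≤ B := by exact_mod_cast hB
  have hL0 : 0 ≤ Real.log B := Real.log_nonneg (by linarith)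
  obtain ⟨θ, hθ⟩ : ∃ θ : ℝ, θ = 1 / (10 ^ 7 * (Real.log B + 1) ^ 2) := ⟨_, rfl⟩
  have hθ0 : 0 < θ := by rw [hθ]; positivity
  have hθ1 : θ ≤ 1 / 100 := by
    rw [hθ]
    apply one_div_le_one_div_of_le (by norm_num)
    nlinarith [sq_nonneg (Real.log B)]
  obtain ⟨γ, hγ, hbes⟩ := besselU (8 * B) (by omega)
  obtain ⟨Y1, hY1, hprm⟩ := prm_lower
  refine ⟨θ, hθ0, γ, hγ, ?_⟩
  have ev1 := tendsto_natCast_atTop_atTop.eventually (hbes θ hθ0)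
  have ev2 : ∀ᶠ N : ℕ in atTop, 1 / θ ^ 2 ≤ (N : ℝ) := tendsto_natCast_atTop_atTop.eventually_ge_atTop _
  filter_upwards [ev1, ev2, blocks B (Y0 + Y1), eventually_ge_atTop 1] with N hb hNθ ⟨J, hJ1, hJ2, hJ3, hJ4, hJ5⟩ hN1 ν hfin hν hreal hsupp hQ
  have hbsl := hb ν hfin hν hreal hsupp
  have hN1' : (1 : ℝ) ≤ N := by exact_mod_cast hN1
  have hN0 : (0 : ℝ) < N := by linarith
  rw [div_le_iff₀ (by positivity)] at hNθ
  have hsq : ∀ x : ℝ, 0 ≤ x → x ^ 2 ≤ N → x / N ≤ θ := by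
    intro x hx hxN
    rw [div_le_iff₀ hN0]
    refine (pow_le_pow_iff_left₀ hx (by positivity) (two_ne_zero)).mp ?_
    nlinarith
  set P := J.biUnion (fun j => prm (8 ^ j)) with hP
  have hES := EE_small (N := N) hB (by omega) hθ hbsl hN1' P (fun p hp => (hJ2 p hp).1)
    (fun p hp => by
      have h1 : (p : ℝ) ^ 2 ≤ N := by exact_mod_cast (hJ2 p hp).2
      have h2 : (0 : ℝ) < p := by exact_mod_cast (hJ2 p hp).1.pos
      rw [div_pow, le_div_iff₀ (by positivity)]
      nlinarith)
    (fun p hp => hsq p (by positivity) (by exact_mod_cast (hJ2 p hp).2))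
    (hsq _ (by positivity) (by exact_mod_cast hJ3)) (hsq 1 (by norm_num) (by linarith))
    (fun n hn => hJ4 n (RI_mem_pos hN0 hn) (by
      rw [mem_RI (by positivity)] at hn
      exact_mod_cast hn.2)) hQ
  rw [hP, Finset.sum_biUnion (prm8_disj J)] at hES
  obtain ⟨j, hj, hjE⟩ : ∃ j ∈ J, ∑ p ∈ prm (8 ^ j), 1 / (p : ℝ) * EE ν B N p ≤ ∑ p ∈ prm (8 ^ j), 1 / (p : ℝ) := by
    refine Finset.exists_le_of_sum_le ?_ (hES.trans hJ5)
    by_contra hne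
    rw [Finset.not_nonempty_iff_eq_empty] at hne
    rw [hne] at hJ5
    norm_num at hJ5
  obtain ⟨k1, k2, k3⟩ := hJ1 j hj
  have k3' : (8 * (8 ^ j : ℕ) : ℝ) ^ 2 ≤ N := by exact_mod_cast k3
  have hWp : 0 < ∑ p ∈ prm (8 ^ j), 1 / (p : ℝ) := by
    refine lt_of_lt_of_le ?_ (hprm (8 ^ j) (by omega))
    have : (1 : ℝ) < (8 ^ j : ℕ) := by exact_mod_cast (show 1 < 8 ^ j by omega)
    have := Real.log_pos this
    positivity
  exact var_step (Y := 8 ^ j) (by omega) le_rfl hθ0.le hθ1 hbsl hN1' (by omega) k3' (hsq _ (by positivity) k3') hc0 hc1 hsupp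
    (by exact_mod_cast k2) (fun ξ h1 h2 => hPL (8 ^ j) (by omega) ξ h1 h2) hWp hjE

lemma lf_block (F : ℕ → ℂ) (k n : ℕ) :
    ‖∑ i ∈ Finset.range k, F (n + i) - k * F n‖ ≤ k * ∑ i ∈ Finset.range k, ‖F (n + i + 1) - F (n + i)‖ := by
  have e : ∑ i ∈ Finset.range k, F (n + i) - k * F n = ∑ i ∈ Finset.range k, (F (n + i) - F n) := by
    rw [Finset.sum_sub_distrib]; simp
  rw [e]
  refine (norm_sum_le _ _).trans ?_
  calc _ ≤ ∑ i ∈ Finset.range k, ∑ j ∈ Finset.range k, ‖F (n + j + 1) - F (n + j)‖ := by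
        refine Finset.sum_le_sum fun i hi => ?_
        have h := Finset.sum_range_sub (fun j => F (n + j)) i
        simp only [add_zero] at h
        rw [← h]
        refine (norm_sum_le _ _).trans ?_
        refine Finset.sum_le_sum_of_subset_of_nonneg ?_ fun _ _ _ => norm_nonneg _
        exact Finset.range_subset_range.mpr (Finset.mem_range.mp hi).le
    _ = _ := by rw [Finset.sum_const, Finset.card_range, nsmul_eq_mul]

lemma lf_blocks (F : ℕ → ℂ) (k M : ℕ) :
    ‖∑ n ∈ Finset.range (k * M), F n - k * ∑ m ∈ Finset.range M, F (k * m)‖ ≤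
      k * ∑ n ∈ Finset.range (k * M), ‖F (n + 1) - F n‖ := by
  induction M with
  | zero => simp
  | succ M ih =>
    rw [Nat.mul_succ, Finset.sum_range_add, Finset.sum_range_succ, Finset.sum_range_add]
    have h := lf_block F k (k * M)
    calc _ = ‖(∑ n ∈ Finset.range (k * M), F n - k * ∑ m ∈ Finset.range M, F (k * m)) +
          (∑ i ∈ Finset.range k, F (k * M + i) - k * F (k * M))‖ := by congr 1; ring
      _ ≤ _ := (norm_add_le _ _).trans (add_le_add ih h)
      _ = _ := by ring

noncomputable def FF (B N : ℕ) (ξ : ℝ) (n : ℕ) : ℂ :=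
  if n ∈ Finset.Icc N (B * N) then lamC n / n * cis (-(ξ * Real.log n)) else 0

lemma sum_ite_le (R : ℕ) (S : Finset ℕ) (c : ℝ) (hc : 0 ≤ c) :
    ∑ n ∈ Finset.range R, (if n ∈ S then c else 0) ≤ S.card * c := by
  rw [← Finset.sum_filter, Finset.sum_const, nsmul_eq_mul]
  gcongr
  intro n hn
  exact (Finset.mem_filter.mp hn).2

lemma log_succ_le (n : ℕ) (hn : 1 ≤ n) : |Real.log (n + 1 : ℕ) - Real.log n| ≤ 1 / n := by
  have hn0 : (0 : ℝ) < n := by exact_mod_cast hn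
  rw [← Real.log_div (by positivity) (by positivity), abs_of_nonneg]
  · have := Real.log_le_sub_one_of_pos (show (0 : ℝ) < ((n + 1 : ℕ) : ℝ) / n by positivity)
    refine this.trans (le_of_eq ?_)
    push_cast; field_simp; ring
  · apply Real.log_nonneg
    rw [le_div_iff₀ hn0]; push_cast; linarith

lemma hh_diff (ξ T0 : ℝ) (hξ : |ξ| ≤ T0) (n : ℕ) (hn : 1 ≤ n) :
    ‖cis (-(ξ * Real.log (n + 1 : ℕ))) / (n + 1 : ℕ) - cis (-(ξ * Real.log n)) / n‖ ≤ (1 + T0) / (n : ℝ) ^ 2 := by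
  have hn0 : (0 : ℝ) < n := by exact_mod_cast hn
  have hnc : (n : ℂ) ≠ 0 := by exact_mod_cast hn0.ne'
  have hnc1 : ((n + 1 : ℕ) : ℂ) ≠ 0 := by exact_mod_cast (Nat.succ_ne_zero n)
  have e : cis (-(ξ * Real.log (n + 1 : ℕ))) / (n + 1 : ℕ) - cis (-(ξ * Real.log n)) / n =
      (cis (-(ξ * Real.log (n + 1 : ℕ))) - cis (-(ξ * Real.log n))) / n - cis (-(ξ * Real.log (n + 1 : ℕ))) / (n * (n + 1 : ℕ)) := by
    field_simp; push_cast; ring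
  rw [e]
  refine (norm_sub_le _ _).trans ?_
  rw [norm_div, norm_div, norm_cis, norm_mul, Complex.norm_natCast, Complex.norm_natCast]
  have h1 : ‖cis (-(ξ * Real.log (n + 1 : ℕ))) - cis (-(ξ * Real.log n))‖ ≤ T0 * (1 / n) := by
    refine (cis_sub_le _ _).trans ?_
    have : -(ξ * Real.log (n + 1 : ℕ)) - -(ξ * Real.log n) = -(ξ * (Real.log (n + 1 : ℕ) - Real.log n)) := by ring
    rw [this, abs_neg, abs_mul]
    exact mul_le_mul hξ (log_succ_le n hn) (abs_nonneg _) ((abs_nonneg _).trans hξ)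
  have h2 : 1 / ((n : ℝ) * (n + 1 : ℕ)) ≤ 1 / (n : ℝ) ^ 2 := by
    apply one_div_le_one_div_of_le (by positivity)
    push_cast; nlinarith
  calc _ ≤ T0 * (1 / n) / n + 1 / (n : ℝ) ^ 2 := by gcongr
    _ = _ := by field_simp; ring

lemma FF_step (B N : ℕ) (hB : 1 ≤ B) (hN : 1 ≤ N) (ξ T0 : ℝ) (hT0 : 0 ≤ T0) (hξ : |ξ| ≤ T0) (n : ℕ) :
    ‖FF B N ξ (n + 1) - FF B N ξ n‖ ≤ (if n ∈ ({N - 1} : Finset ℕ) then 1 / (N : ℝ) else 0) +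
      (if n ∈ ({B * N} : Finset ℕ) then 1 / (N : ℝ) else 0) +
      (if n ∈ Finset.Icc N (B * N) then (1 + T0) / (N : ℝ) ^ 2 else 0) +
      (if n ∈ (Finset.Icc N (B * N)).filter (fun n => lam n ≠ lam (n + 1)) then 2 / (N : ℝ) else 0) := by
  have hN0 : (0 : ℝ) < N := by exact_mod_cast hN
  have p1 : 0 ≤ (if n ∈ ({N - 1} : Finset ℕ) then 1 / (N : ℝ) else 0) := by split_ifs <;> positivity
  have p2 : 0 ≤ (if n ∈ ({B * N} : Finset ℕ) then 1 / (N : ℝ) else 0) := by split_ifs <;> positivity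
  have p3 : 0 ≤ (if n ∈ Finset.Icc N (B * N) then (1 + T0) / (N : ℝ) ^ 2 else 0) := by split_ifs <;> positivity
  have p4 : 0 ≤ (if n ∈ (Finset.Icc N (B * N)).filter (fun n => lam n ≠ lam (n + 1)) then 2 / (N : ℝ) else 0) := by
    split_ifs <;> positivity
  have hBN : N ≤ B * N := Nat.le_mul_of_pos_left N hB
  have hnorm : ∀ m, N ≤ m → ‖lamC m / m * cis (-(ξ * Real.log m))‖ ≤ 1 / N := by
    intro m hm
    rw [norm_mul, norm_cis, norm_div, norm_lamC, Complex.norm_natCast, mul_one]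
    gcongr
  by_cases h1 : n + 1 ∈ Finset.Icc N (B * N)
  · by_cases h2 : n ∈ Finset.Icc N (B * N)
    · have hnN : N ≤ n := (Finset.mem_Icc.mp h2).1
      have hn1 : 1 ≤ n := hN.trans hnN
      have hn0 : (0 : ℝ) < n := by exact_mod_cast hn1
      have hd := hh_diff ξ T0 hξ n hn1
      have hd' : (1 + T0) / (n : ℝ) ^ 2 ≤ (1 + T0) / (N : ℝ) ^ 2 := by gcongr
      unfold FF
      rw [if_pos h1, if_pos h2]
      rw [if_pos h2] at p3 ⊢
      by_cases h3 : lam n = lam (n + 1)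
      · have e : lamC (n + 1) / (n + 1 : ℕ) * cis (-(ξ * Real.log (n + 1 : ℕ))) - lamC n / n * cis (-(ξ * Real.log n)) =
            lamC n * (cis (-(ξ * Real.log (n + 1 : ℕ))) / (n + 1 : ℕ) - cis (-(ξ * Real.log n)) / n) := by
          have : lamC (n + 1) = lamC n := by unfold lamC; rw [h3]
          rw [this]; ring
        rw [e, norm_mul, norm_lamC, one_mul]
        linarith
      · rw [if_pos (Finset.mem_filter.mpr ⟨h2, h3⟩)]
        have a := hnorm n hnN
        have b := hnorm (n + 1) (by omega)
        have c := norm_sub_le (lamC (n + 1) / (n + 1 : ℕ) * cis (-(ξ * Real.log (n + 1 : ℕ)))) (lamC n / n * cis (-(ξ * Real.log n)))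
        have d : 2 / (N : ℝ) = 1 / N + 1 / N := by ring
        linarith
    · unfold FF
      rw [if_pos h1, if_neg h2, sub_zero]
      have : n ∈ ({N - 1} : Finset ℕ) := by
        rw [Finset.mem_Icc] at h1 h2; rw [Finset.mem_singleton]; omega
      rw [if_pos this]
      have b := hnorm (n + 1) (Finset.mem_Icc.mp h1).1
      linarith
  · by_cases h2 : n ∈ Finset.Icc N (B * N)
    · unfold FF
      rw [if_neg h1, if_pos h2, zero_sub, norm_neg]
      have : n ∈ ({B * N} : Finset ℕ) := by
        rw [Finset.mem_Icc] at h1 h2; rw [Finset.mem_singleton]; omega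
      rw [if_pos this]
      have b := hnorm n (Finset.mem_Icc.mp h2).1
      linarith
    · have : FF B N ξ (n + 1) - FF B N ξ n = 0 := by
        unfold FF; rw [if_neg h1, if_neg h2, sub_zero]
      rw [this, norm_zero]
      linarith

lemma FF_var (B N R : ℕ) (hB : 1 ≤ B) (hN : 1 ≤ N) (ξ T0 : ℝ) (hT0 : 0 ≤ T0) (hξ : |ξ| ≤ T0) (δ : ℝ)
    (hc : (((Finset.Icc N (B * N)).filter (fun n => lam n ≠ lam (n + 1))).card : ℝ) ≤ δ * N) :
    ∑ n ∈ Finset.range R, ‖FF B N ξ (n + 1) - FF B N ξ n‖ ≤ (2 + 2 * B * (1 + T0)) / N + 2 * δ := by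
  have hN0 : (0 : ℝ) < N := by exact_mod_cast hN
  refine (Finset.sum_le_sum fun n _ => FF_step B N hB hN ξ T0 hT0 hξ n).trans ?_
  rw [Finset.sum_add_distrib, Finset.sum_add_distrib, Finset.sum_add_distrib]
  have h1 := sum_ite_le R {N - 1} (1 / (N : ℝ)) (by positivity)
  have h2 := sum_ite_le R {B * N} (1 / (N : ℝ)) (by positivity)
  have h3 := sum_ite_le R (Finset.Icc N (B * N)) ((1 + T0) / (N : ℝ) ^ 2) (by positivity)
  have h4 := sum_ite_le R ((Finset.Icc N (B * N)).filter (fun n => lam n ≠ lam (n + 1))) (2 / (N : ℝ)) (by positivity)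
  rw [Finset.card_singleton] at h1 h2
  have h5 : ((Finset.Icc N (B * N)).card : ℝ) ≤ 2 * B * N := by
    rw [Nat.card_Icc]
    have : B * N + 1 - N ≤ 2 * B * N := by
      have : 1 ≤ B * N := Nat.mul_pos hB hN
      have : 2 * B * N = 2 * (B * N) := by ring
      omega
    exact_mod_cast this
  have h6 : ((Finset.Icc N (B * N)).card : ℝ) * ((1 + T0) / (N : ℝ) ^ 2) ≤ 2 * B * (1 + T0) / N := by
    calc _ ≤ 2 * B * N * ((1 + T0) / (N : ℝ) ^ 2) := by gcongr
      _ = _ := by field_simp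
  have h7 : (((Finset.Icc N (B * N)).filter (fun n => lam n ≠ lam (n + 1))).card : ℝ) * (2 / N) ≤ 2 * δ := by
    calc _ ≤ δ * N * (2 / N) := by gcongr
      _ = _ := by field_simp
  have e : (2 + 2 * B * (1 + T0)) / N = 1 / (N : ℝ) + 1 / N + 2 * B * (1 + T0) / N := by ring
  rw [e]
  push_cast at h1 h2
  linarith

lemma RI_nat (B N : ℕ) : RI (N : ℝ) ((B : ℝ) * N) = Finset.Icc N (B * N) := by
  unfold RI
  rw [Nat.ceil_natCast, ← Nat.cast_mul, Nat.floor_natCast]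

lemma lf_comp (B N k : ℕ) (hB : 1 ≤ B) (hN : 1 ≤ N) (hk : 1 ≤ k) (ξ T0 : ℝ) (hT0 : 0 ≤ T0) (hξ : |ξ| ≤ T0) (δ : ℝ)
    (hc : (((Finset.Icc N (B * N)).filter (fun n => lam n ≠ lam (n + 1))).card : ℝ) ≤ δ * N) :
    ‖GG B N ξ - lamC k * cis (-(ξ * Real.log k)) * GG B (N / k) ξ‖ ≤ k * ((2 + 2 * B * (1 + T0)) / N + 2 * δ) := by
  have hk0 : (0 : ℝ) < k := by exact_mod_cast hk
  have hkc : (k : ℂ) ≠ 0 := by exact_mod_cast hk0.ne'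
  have h := lf_blocks (FF B N ξ) k (B * N + 1)
  have e1 : ∑ n ∈ Finset.range (k * (B * N + 1)), FF B N ξ n = GG B N ξ := by
    unfold FF GG dp
    rw [RI_nat, Finset.sum_ite_mem, Finset.inter_eq_right.mpr]
    intro n hn
    rw [Finset.mem_Icc] at hn
    rw [Finset.mem_range]
    nlinarith
  have e2 : (k : ℂ) * ∑ m ∈ Finset.range (B * N + 1), FF B N ξ (k * m) =
      lamC k * cis (-(ξ * Real.log k)) * GG B (N / k) ξ := by
    have hmem : ∀ m : ℕ, m ∈ RI ((N : ℝ) / k) (B * (N / k)) ↔ k * m ∈ Finset.Icc N (B * N) := by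
      intro m
      rw [mem_RI (by positivity), Finset.mem_Icc, div_le_iff₀ hk0, ← mul_div_assoc, le_div_iff₀ hk0, mul_comm (m : ℝ)]
      norm_cast
    have hsub : RI ((N : ℝ) / k) (B * (N / k)) ⊆ Finset.range (B * N + 1) := by
      intro m hm
      have := (Finset.mem_Icc.mp ((hmem m).mp hm)).2
      rw [Finset.mem_range]
      nlinarith
    rw [GG_eq_dp hsub]
    unfold dp FF
    rw [Finset.mul_sum, Finset.mul_sum]
    refine Finset.sum_congr rfl fun m _ => ?_
    beta_reduce
    by_cases hm : k * m ∈ Finset.Icc N (B * N)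
    · rw [if_pos hm, if_pos ((hmem m).mpr hm)]
      have hm0 : m ≠ 0 := by
        rintro rfl
        rw [Finset.mem_Icc] at hm; omega
      have hmc : (m : ℂ) ≠ 0 := by exact_mod_cast hm0
      have e3 : lamC (k * m) = lamC k * lamC m := by
        unfold lamC; rw [lam_mul (by omega) hm0]; push_cast; rfl
      have e4 : cis (-(ξ * Real.log ((k * m : ℕ) : ℝ))) = cis (-(ξ * Real.log k)) * cis (-(ξ * Real.log m)) := by
        rw [← cis_add, Nat.cast_mul, Real.log_mul hk0.ne' (by exact_mod_cast hm0)]; ring_nf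
      rw [e3, e4]
      push_cast
      field_simp
    · rw [if_neg hm, if_neg (fun h => hm ((hmem m).mp h))]; simp
  rw [e1, e2] at h
  refine h.trans ?_
  gcongr
  exact FF_var B N _ hB hN ξ T0 hT0 hξ δ hc

lemma exists_sign_change (K : ℕ) : ∃ k, K ≤ k ∧ 1 ≤ k ∧ lam k ≠ lam (k + 1) := by
  by_contra hcon
  push Not at hcon
  have hconst : ∀ j, lam (K + 1 + j) = lam (K + 1) := by
    intro j
    induction j with
    | zero => rfl
    | succ j ih => rw [← ih]; exact (hcon (K + 1 + j) (by omega) (by omega)).symm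
  have h2 := lam_prime_mul Nat.prime_two (m := K + 1) (by omega)
  have h3 := hconst (K + 1)
  rw [show K + 1 + (K + 1) = 2 * (K + 1) by ring, h2] at h3
  rcases lam_eq (K + 1) with h | h <;> rw [h] at h3 <;> norm_num at h3

lemma norm_GG_le (B : ℕ) (hB : 1 ≤ B) (M : ℝ) (hM : 0 < M) (ξ : ℝ) : ‖GG B M ξ‖ ≤ 1 + Real.log B := by
  have hBr : (1 : ℝ) ≤ B := by exact_mod_cast hB
  unfold GG
  refine (norm_dp_le _ _ _).trans ?_
  simp only [norm_lamC]
  refine (harm_RI_one hM (by nlinarith)).trans (le_of_eq ?_)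
  rw [mul_div_assoc, div_self hM.ne', mul_one]

lemma GG_diff (B : ℕ) (hB : 1 ≤ B) (a' a : ℝ) (ha' : 0 < a') (haa : a' ≤ a) (ξ : ℝ) :
    ‖GG B a' ξ - GG B a ξ‖ ≤ 2 / a' + 2 * Real.log (a / a') := by
  have hBr : (1 : ℝ) ≤ B := by exact_mod_cast hB
  have h := RI_symm hBr ha' haa (RI a' (B * a') ∪ RI a (B * a))
  rw [GG_eq_dp (S := RI a' (B * a') ∪ RI a (B * a)) Finset.subset_union_left,
    GG_eq_dp (S := RI a' (B * a') ∪ RI a (B * a)) (M := a) Finset.subset_union_right, ← dp_sub']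
  refine (norm_dp_le _ _ _).trans (le_trans (le_of_eq ?_) h)
  refine Finset.sum_congr rfl fun m _ => ?_
  congr 1
  split_ifs <;> simp [norm_lamC]

lemma lf_bound (B N k : ℕ) (hB : 1 ≤ B) (hN : 1 ≤ N) (hk : 1 ≤ k) (hl : lam k ≠ lam (k + 1)) (ξ T0 : ℝ)
    (hT0 : 0 ≤ T0) (hξ : |ξ| ≤ T0) (δ : ℝ)
    (hc : (((Finset.Icc N (B * N)).filter (fun n => lam n ≠ lam (n + 1))).card : ℝ) ≤ δ * N) :
    ‖GG B N ξ‖ ≤ (2 * k + 1) * ((2 + 2 * B * (1 + T0)) / N + 2 * δ) + (T0 * (1 + Real.log B) + 2) / k + 2 * (k + 1) / N := by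
  have hk0 : (0 : ℝ) < k := by exact_mod_cast hk
  have hN0 : (0 : ℝ) < N := by exact_mod_cast hN
  have h1 := lf_comp B N k hB hN hk ξ T0 hT0 hξ δ hc
  have h2 := lf_comp B N (k + 1) hB hN (by omega) ξ T0 hT0 hξ δ hc
  have hlam : lamC (k + 1) = -lamC k := by
    unfold lamC
    rcases lam_eq k with h | h <;> rcases lam_eq (k + 1) with h' | h' <;> rw [h, h'] at hl ⊢ <;> simp_all
  obtain ⟨τ, hτ⟩ : ∃ τ, τ = (2 + 2 * B * (1 + T0)) / N + 2 * δ := ⟨_, rfl⟩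
  rw [← hτ] at h1 h2 ⊢
  obtain ⟨u, hu⟩ : ∃ u, u = lamC k * cis (-(ξ * Real.log k)) := ⟨_, rfl⟩
  obtain ⟨v, hv⟩ : ∃ v, v = lamC (k + 1) * cis (-(ξ * Real.log (k + 1 : ℕ))) := ⟨_, rfl⟩
  obtain ⟨A, hA⟩ : ∃ A, A = GG B (N / k) ξ := ⟨_, rfl⟩
  obtain ⟨A', hA'⟩ : ∃ A', A' = GG B (N / (k + 1 : ℕ)) ξ := ⟨_, rfl⟩
  have hL : 0 ≤ 1 + Real.log B := by
    have := Real.log_nonneg (show (1 : ℝ) ≤ B by exact_mod_cast hB); linarith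
  have nu : ‖u‖ = 1 := by rw [hu, norm_mul, norm_lamC, norm_cis, one_mul]
  have nv : ‖v‖ = 1 := by rw [hv, norm_mul, norm_lamC, norm_cis, one_mul]
  have nA : ‖A‖ ≤ 1 + Real.log B := by rw [hA]; exact norm_GG_le B hB _ (by positivity) ξ
  have hlog := log_succ_le k hk
  have nuv : ‖u + v‖ ≤ T0 * (1 / k) := by
    have e : u + v = lamC k * (cis (-(ξ * Real.log k)) - cis (-(ξ * Real.log (k + 1 : ℕ)))) := by
      rw [hu, hv, hlam]; ring
    rw [e, norm_mul, norm_lamC, one_mul]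
    refine (cis_sub_le _ _).trans ?_
    have : -(ξ * Real.log k) - -(ξ * Real.log (k + 1 : ℕ)) = ξ * (Real.log (k + 1 : ℕ) - Real.log k) := by ring
    rw [this, abs_mul]
    exact mul_le_mul hξ hlog (abs_nonneg _) hT0
  have nd : ‖A' - A‖ ≤ 2 * (k + 1) / N + 2 * (1 / k) := by
    rw [hA, hA']
    have h := GG_diff B hB ((N : ℝ) / (k + 1 : ℕ)) (N / k) (by positivity) (by
      apply div_le_div_of_nonneg_left hN0.le hk0; push_cast; linarith) ξ
    have e1 : 2 / ((N : ℝ) / (k + 1 : ℕ)) = 2 * (k + 1) / N := by push_cast; field_simp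
    have e2 : (N : ℝ) / k / (N / (k + 1 : ℕ)) = (k + 1 : ℕ) / k := by field_simp
    rw [e1, e2, Real.log_div (by positivity) (by positivity)] at h
    have := (le_abs_self _).trans hlog
    linarith
  rw [← hu, ← hA] at h1
  rw [← hv, ← hA'] at h2
  push_cast at h2
  have e : 2 * (u * A) = -(GG B N ξ - u * A) + (GG B N ξ - v * A') + v * (A' - A) + (u + v) * A := by ring
  have h3 : 2 * ‖A‖ ≤ k * τ + (k + 1) * τ + (2 * (k + 1) / N + 2 * (1 / k)) + T0 * (1 / k) * (1 + Real.log B) := by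
    calc 2 * ‖A‖ = ‖2 * (u * A)‖ := by rw [norm_mul, norm_mul, nu]; simp
      _ ≤ ‖-(GG B N ξ - u * A)‖ + ‖GG B N ξ - v * A'‖ + ‖v * (A' - A)‖ + ‖(u + v) * A‖ := by
        rw [e]
        exact (norm_add_le _ _).trans (add_le_add ((norm_add_le _ _).trans (add_le_add (norm_add_le _ _) le_rfl)) le_rfl)
      _ ≤ _ := by
        rw [norm_neg, norm_mul v, nv, one_mul, norm_mul]
        have := mul_le_mul nuv nA (norm_nonneg _) (by positivity)
        linarith
  have h4 : ‖GG B N ξ‖ ≤ ‖A‖ + k * τ := by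
    have : GG B N ξ = u * A + (GG B N ξ - u * A) := by ring
    rw [this]
    refine (norm_add_le _ _).trans ?_
    rw [norm_mul, nu, one_mul]
    linarith
  have hkτ : 0 ≤ (k : ℝ) * τ := (norm_nonneg _).trans h1
  have hτ0 : 0 ≤ τ := nonneg_of_mul_nonneg_right hkτ hk0
  have e5 : (T0 * (1 + Real.log B) + 2) / k = T0 * (1 / k) * (1 + Real.log B) + 2 * (1 / k) := by ring
  have h6 : 0 ≤ T0 * (1 / k) * (1 + Real.log B) + 2 * (1 / (k : ℝ)) := by positivity
  have h7 : 0 ≤ 2 * (k + 1) / (N : ℝ) := by positivity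
  rw [e5]
  nlinarith

theorem lowfreq (B : ℕ) (hB : 1 ≤ B) (T0 s : ℝ) (hT0 : 0 ≤ T0) (hs : 0 < s) :
    ∃ δ > (0 : ℝ), ∀ᶠ N : ℕ in atTop,
      (((Finset.Icc N (B * N)).filter (fun n => lam n ≠ lam (n + 1))).card : ℝ) ≤ δ * N →
      ∀ ξ : ℝ, |ξ| ≤ T0 → ‖GG B N ξ‖ ≤ s := by
  have hL : 0 ≤ 1 + Real.log B := by
    have := Real.log_nonneg (show (1 : ℝ) ≤ B by exact_mod_cast hB); linarith
  obtain ⟨K, hK⟩ := exists_nat_ge ((T0 * (1 + Real.log B) + 2) / (s / 2))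
  obtain ⟨k, hkK, hk, hl⟩ := exists_sign_change K
  have hk0 : (0 : ℝ) < k := by exact_mod_cast hk
  have hks : (T0 * (1 + Real.log B) + 2) / k ≤ s / 2 := by
    have : (K : ℝ) ≤ k := by exact_mod_cast hkK
    rw [div_le_iff₀ (by positivity)] at hK ⊢
    nlinarith
  refine ⟨s / (8 * (2 * k + 1)), by positivity, ?_⟩
  obtain ⟨C, hC⟩ : ∃ C : ℝ, C = (2 * k + 1) * (2 + 2 * B * (1 + T0)) + 2 * (k + 1) := ⟨_, rfl⟩
  filter_upwards [eventually_ge_atTop 1, tendsto_natCast_atTop_atTop.eventually_ge_atTop (C / (s / 4))] with N hN hNC hc ξ hξ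
  have hN0 : (0 : ℝ) < N := by exact_mod_cast hN
  have h := lf_bound B N k hB hN hk hl ξ T0 hT0 hξ _ hc
  have hCN : C / N ≤ s / 4 := by
    rw [div_le_iff₀ (by positivity)] at hNC ⊢
    linarith
  have e : (2 * k + 1) * ((2 + 2 * B * (1 + T0)) / N + 2 * (s / (8 * (2 * k + 1)))) = (2 * k + 1) * (2 + 2 * B * (1 + T0)) / N + s / 4 := by
    field_simp; ring
  have e2 : C / N = (2 * k + 1) * (2 + 2 * B * (1 + T0)) / N + 2 * (k + 1) / N := by rw [hC]; ring
  rw [e] at h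
  linarith

theorem core_thm : CoreStmt := by
  obtain ⟨c0, hc0, T0, hT0, hHF⟩ := highfreq
  obtain ⟨B, hB⟩ := exists_nat_ge (Real.exp (12 / c0 + 4) + 3)
  have hB3r : (3 : ℝ) ≤ B := by linarith [Real.exp_pos (12 / c0 + 4)]
  have hB3 : 3 ≤ B := by exact_mod_cast hB3r
  have hlB : 12 / c0 + 4 ≤ Real.log B := by
    rw [Real.le_log_iff_exp_le (by linarith)]; linarith
  have hc12 : 0 < 12 / c0 := by positivity
  obtain ⟨θ, hθ, γ, hγ, hev⟩ := hHF B hB3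
  obtain ⟨ε, hε, hεθ, hε1⟩ : ∃ ε : ℝ, 0 < ε ∧ 3 * ε ≤ θ ∧ 3 * ε ≤ 1 :=
    ⟨min (θ / 3) (1 / 3), by positivity, by linarith [min_le_left (θ / 3) (1 / 3)], by linarith [min_le_right (θ / 3) (1 / 3)]⟩
  obtain ⟨H0, hH0, hMR⟩ := MR B ε γ (by linarith) hε hγ
  obtain ⟨H, hH1, hH2⟩ : ∃ H : ℝ, H0 ≤ H ∧ (Real.log B + 1) / ε ≤ H := ⟨max H0 ((Real.log B + 1) / ε), le_max_left _ _, le_max_right _ _⟩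
  have hHpos : 0 < H := by linarith
  have hHε : (Real.log B + 1) / H ≤ ε := by
    rw [div_le_iff₀ hε] at hH2; rw [div_le_iff₀ hHpos]; linarith
  obtain ⟨δ1, hδ1, N1, hms⟩ := meanSq_lower B (by omega) H (by linarith) ε hε
  obtain ⟨δ2, hδ2, hlow⟩ := lowfreq B (by omega) T0 (1 / T0) (by linarith) (by positivity)
  refine ⟨min δ1 δ2, lt_min hδ1 hδ2, B, by omega, ?_⟩
  have evMR := tendsto_natCast_atTop_atTop.eventually (hMR H hH1)
  obtain ⟨N0, hN0⟩ := eventually_atTop.mp ((evMR.and (hev.and hlow)).and ((eventually_ge_atTop N1).and (eventually_ge_atTop 1)))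
  refine ⟨N0, fun N hN => ?_⟩
  obtain ⟨⟨⟨U, hUm, hUs, hUv, hUi⟩, hhigh, hl⟩, hNN1, hN1⟩ := hN0 N hN
  by_contra hcon
  push Not at hcon
  have hNr : (1 : ℝ) ≤ N := by exact_mod_cast hN1
  have hcon1 := hcon.le.trans (mul_le_mul_of_nonneg_right (min_le_left δ1 δ2) (by linarith : (0 : ℝ) ≤ N))
  have hcon2 := hcon.le.trans (mul_le_mul_of_nonneg_right (min_le_right δ1 δ2) (by linarith : (0 : ℝ) ≤ N))
  have hT : 0 < (N : ℝ) / H := by positivity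
  have hfin := muT_finite hT
  have hle := muT_le hT
  have hpi : 1 / (2 * Real.pi) ≤ 1 := by
    rw [div_le_one (by positivity)]; linarith [Real.pi_gt_three]
  have hpi0 : 0 ≤ 1 / (2 * Real.pi) := by positivity
  have htot := hms N hNN1 hcon1
  have hGe : ∀ ξ, dp (Finset.Icc N (B * N)) (fun n => (lam n : ℂ)) ξ = GG B N ξ := by
    intro ξ; unfold GG; rw [RI_nat]; rfl
  simp only [hGe] at htot
  have hIntg : Integrable (fun ξ => ‖GG B N ξ‖ ^ 2) (muT (N / H)) := ((CB_GG B N).norm.pow 2).int _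
  have hsplit := integral_add_compl hUm hIntg
  obtain ⟨ν, hν⟩ : ∃ ν, ν = (muT (N / H)).restrict U := ⟨_, rfl⟩
  have hνfin : IsFiniteMeasure ν := by rw [hν]; infer_instance
  have hνle : ν ≤ ENNReal.ofReal (1 / (2 * Real.pi)) • volume := by rw [hν]; exact Measure.restrict_le_self.trans hle
  have hνreal : ν.real Set.univ ≤ (N : ℝ) ^ γ := by
    have : ν Set.univ ≤ ENNReal.ofReal ((N : ℝ) ^ γ) := by
      rw [hν, Measure.restrict_apply_univ]
      refine (hle U).trans ?_
      rw [Measure.smul_apply, smul_eq_mul]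
      calc _ ≤ 1 * volume U := by
            gcongr
            exact ENNReal.ofReal_le_one.mpr hpi
        _ ≤ _ := by rw [one_mul]; exact hUv
    exact ENNReal.toReal_le_of_le_ofReal (by positivity) this
  have hνae : ∀ᵐ ξ ∂ν, |ξ| ≤ (N : ℝ) ^ 2 := by
    rw [hν, ae_restrict_iff' hUm]
    refine Eventually.of_forall fun ξ hξ => abs_le.mpr (hUs hξ)
  have hνint : Real.log B - 3 * ε ≤ ∫ ξ, ‖GG B N ξ‖ ^ 2 ∂ν := by rw [hν]; linarith
  have hh := hhigh ν hνfin hνle hνreal hνae (by linarith)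
  have hV : MeasurableSet {ξ : ℝ | T0 ≤ |ξ|} := measurableSet_le measurable_const continuous_abs.measurable
  have hIntg' : Integrable (fun ξ => ‖GG B N ξ‖ ^ 2) ν := ((CB_GG B N).norm.pow 2).int _
  have hsplit' := integral_add_compl hV hIntg'
  have hlowi : ∫ ξ in {ξ : ℝ | T0 ≤ |ξ|}ᶜ, ‖GG B N ξ‖ ^ 2 ∂ν ≤ 2 := by
    have hmeas : ν.real {ξ : ℝ | T0 ≤ |ξ|}ᶜ ≤ 2 * T0 := by
      refine ENNReal.toReal_le_of_le_ofReal (by linarith) ?_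
      refine (hνle _).trans ?_
      rw [Measure.smul_apply, smul_eq_mul]
      calc _ ≤ 1 * volume (Set.Icc (-T0) T0) := by
            gcongr
            · exact ENNReal.ofReal_le_one.mpr hpi
            · intro ξ hξ
              simp only [Set.mem_compl_iff, Set.mem_setOf_eq, not_le] at hξ
              exact abs_le.mp hξ.le
        _ = _ := by rw [one_mul, Real.volume_Icc]; congr 1; ring
    calc _ ≤ ∫ ξ in {ξ : ℝ | T0 ≤ |ξ|}ᶜ, (1 / T0) ^ 2 ∂ν := by
          refine setIntegral_mono_on hIntg'.integrableOn (integrable_const _).integrableOn hV.compl fun ξ hξ => ?_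
          simp only [Set.mem_compl_iff, Set.mem_setOf_eq, not_le] at hξ
          have := hl hcon2 ξ hξ.le
          gcongr
      _ = ν.real {ξ : ℝ | T0 ≤ |ξ|}ᶜ * (1 / T0) ^ 2 := by rw [setIntegral_const, smul_eq_mul]
      _ ≤ 2 * T0 * (1 / T0) ^ 2 := by gcongr
      _ = 2 * (1 / T0) := by field_simp
      _ ≤ 2 := by
          have : 1 / T0 ≤ 1 := by rw [div_le_one (by linarith)]; exact hT0
          linarith
  linarith

theorem stmt_19 (ω : ℝ → ℝ)
    (hω : ∀ X : ℝ, 1 ≤ X → 1 ≤ ω X ∧ ω X ≤ X)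
    (hωtop : Filter.Tendsto ω Filter.atTop Filter.atTop) :
    Filter.limsup (fun x : ℝ =>
      |logAvg (Finset.Icc ⌈x / ω x⌉₊ ⌊x⌋₊)
        (fun n => ((liouville (n + 1) : ℝ) * (liouville (n + 2) : ℝ)) *
          ((liouville (n + 4) : ℝ) * (liouville (n + 5) : ℝ)))|)
      Filter.atTop < 1 := by
  exact final_of_core core_thm ω hω hωtop
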